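/- Let Ω be an open set in ℝ⁴ with an almost complex structure J, let r be a C² strictly J-plurisubharmonic function on Ω, and let G = {x ∈ Ω : r(x) < 0} be relatively compact in Ω with dr ≠ 0 on ∂G. Let D be a bounded domain in ℂ² for which there is no bijective holomorphic map from D onto the unit ball 𝔹₂ with holomorphic inverse. Let (f^ν) be a sequence of C^∞ diffeomorphisms from D onto G, each defined and a diffeomorphism on a neighborhood of the closure of D, and set J_ν := Df^ν ∘ J_st ∘ (Df^ν)⁻¹ on G. If ‖J_ν − J‖_{C²(Ḡ)} → 0, then the sequence (f^ν) is relatively compact: every subsequence admits a further subsequence converging uniformly on compact subsets of D, and every such limit is a (J_st,J)-holomorphic diffeomorphism from D onto G. -/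

import Mathlib

open Metric Set Filter Topology Asymptotics

noncomputable section

/-- The standard complex structure `J_st` (multiplication by `i`) on a complex
normed space, viewed as a real-linear endomorphism. -/
def Jst (E : Type*) [NormedAddCommGroup E] [NormedSpace ℂ E] : E →L[ℝ] E :=
  ContinuousLinearMap.restrictScalars ℝ (Complex.I • ContinuousLinearMap.id ℂ E)

variable {E F : Type*} [NormedAddCommGroup E] [NormedSpace ℂ E]
  [NormedAddCommGroup F] [NormedSpace ℂ F]

/-- `J` is an almost complex structure on the set `Ω`: a smooth field of real-linear
endomorphisms with `J x ∘ J x = -id`. -/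
structure IsACS (Ω : Set E) (J : E → E →L[ℝ] E) : Prop where
  smooth : ContDiffOn ℝ (⊤ : ℕ∞) J Ω
  sq : ∀ x ∈ Ω, (J x).comp (J x) = -(ContinuousLinearMap.id ℝ E)

/-- `f` is `(J', J)`-holomorphic on `s`: `Df(x) ∘ J'(x) = J(f x) ∘ Df(x)`. -/
def IsHolomorphicMapOn (J' : E → E →L[ℝ] E) (J : F → F →L[ℝ] F) (f : E → F)
    (s : Set E) : Prop :=
  ∀ x ∈ s, DifferentiableAt ℝ f x ∧
    (fderiv ℝ f x).comp (J' x) = (J (f x)).comp (fderiv ℝ f x)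

/-- The Levi form `L^J(r)(x)(X) = -d(J⋆dr)(x)(X, J x X)` where `J⋆dr` is the 1-form
`X ↦ dr(x)(J x X)` and `dω(x)(X,Y) = (Dω(x)X)(Y) - (Dω(x)Y)(X)`. -/
def leviForm (J : E → E →L[ℝ] E) (r : E → ℝ) (x : E) (X : E) : ℝ :=
  -((fderiv ℝ (fun y => (fderiv ℝ r y).comp (J y)) x X) (J x X)
    - (fderiv ℝ (fun y => (fderiv ℝ r y).comp (J y)) x (J x X)) X)

/-- `r` is strictly `J`-plurisubharmonic on `s`. -/
def StrictPSHOn (J : E → E →L[ℝ] E) (r : E → ℝ) (s : Set E) : Prop :=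
  ∀ x ∈ s, ∀ X : E, X ≠ 0 → 0 < leviForm J r x X

/-- `r` is `J`-plurisubharmonic on `s` (nonnegative Levi form). -/
def PSHOn (J : E → E →L[ℝ] E) (r : E → ℝ) (s : Set E) : Prop :=
  ∀ x ∈ s, ∀ X : E, 0 ≤ leviForm J r x X

/-- `C⁰` norm of `g` on `K`. -/
def c0Norm {G : Type*} [NormedAddCommGroup G] (g : E → G) (K : Set E) : ℝ :=
  ⨆ x : K, ‖g (x : E)‖

/-- `C¹` norm of `g` on `K`. -/
def c1Norm {G : Type*} [NormedAddCommGroup G] [NormedSpace ℝ G] (g : E → G) (K : Set E) : ℝ :=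
  ⨆ x : K, max ‖g (x : E)‖ ‖fderiv ℝ g (x : E)‖

/-- `C¹` distance between `g` and `h` on `K`. -/
def c1Dist {G : Type*} [NormedAddCommGroup G] [NormedSpace ℝ G] (g h : E → G) (K : Set E) : ℝ :=
  ⨆ x : K, max ‖g (x : E) - h (x : E)‖ ‖fderiv ℝ g (x : E) - fderiv ℝ h (x : E)‖

/-- `C²` distance between `g` and `h` on `K`. -/
def c2Dist {G : Type*} [NormedAddCommGroup G] [NormedSpace ℝ G] (g h : E → G) (K : Set E) : ℝ :=
  ⨆ x : K, max ‖g (x : E) - h (x : E)‖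
    (max ‖fderiv ℝ g (x : E) - fderiv ℝ h (x : E)‖
      ‖fderiv ℝ (fderiv ℝ g) (x : E) - fderiv ℝ (fderiv ℝ h) (x : E)‖)

/-- A `J`-holomorphic disc in `D`: a map from the unit disc `Δ ⊂ ℂ` to `D` satisfying
`Df(ζ) ∘ J_st = J(f ζ) ∘ Df(ζ)`. -/
def IsJDisc (J : F → F →L[ℝ] F) (D : Set F) (f : ℂ → F) : Prop :=
  MapsTo f (ball (0 : ℂ) 1) D ∧
  ∀ ζ ∈ ball (0 : ℂ) 1, DifferentiableAt ℝ f ζ ∧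
    (fderiv ℝ f ζ).comp (Jst ℂ) = (J (f ζ)).comp (fderiv ℝ f ζ)

/-- The Kobayashi–Royden infinitesimal pseudometric of `(D, J)`. -/
def kobayashiMetric (J : F → F →L[ℝ] F) (D : Set F) (p : F) (v : F) : ℝ :=
  sInf {α : ℝ | 0 < α ∧ ∃ f : ℂ → F, IsJDisc J D f ∧ f 0 = p ∧
    fderiv ℝ f 0 1 = α⁻¹ • v}

/-- The integrated Kobayashi pseudodistance of `(D, J)`. -/
def kobayashiDist (J : F → F →L[ℝ] F) (D : Set F) (p q : F) : ℝ :=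
  sInf {d : ℝ | ∃ γ : ℝ → F, ContDiffOn ℝ 1 γ (Icc 0 1) ∧ MapsTo γ (Icc 0 1) D ∧
    γ 0 = p ∧ γ 1 = q ∧ d = ∫ t in (0:ℝ)..1, kobayashiMetric J D (γ t) (deriv γ t)}

/-- `f` is a smooth diffeomorphism from `s` onto `t` with inverse `g`. -/
def IsDiffeoOn (f : E → F) (g : F → E) (s : Set E) (t : Set F) : Prop :=
  ContDiffOn ℝ (⊤ : ℕ∞) f s ∧ ContDiffOn ℝ (⊤ : ℕ∞) g t ∧ MapsTo f s t ∧ MapsTo g t s ∧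
  (∀ x ∈ s, g (f x) = x) ∧ (∀ y ∈ t, f (g y) = y)

/-- The Laplacian of a real function on `ℂ ≅ ℝ²`. -/
def lapR (g : ℂ → ℝ) (ζ : ℂ) : ℝ :=
  fderiv ℝ (fun w => fderiv ℝ g w 1) ζ 1
    + fderiv ℝ (fun w => fderiv ℝ g w Complex.I) ζ Complex.I

/-- The Wirtinger derivative `∂g/∂ζ`. -/
def wirtingerD (g : ℂ → ℂ) (ζ : ℂ) : ℂ :=
  (fderiv ℝ g ζ 1 - Complex.I * fderiv ℝ g ζ Complex.I) / 2

/-- The Wirtinger derivative `∂g/∂ζ̄`. -/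
def wirtingerDbar (g : ℂ → ℂ) (ζ : ℂ) : ℂ :=
  (fderiv ℝ g ζ 1 + Complex.I * fderiv ℝ g ζ Complex.I) / 2

/-- The coordinates of a point of `ℂ²`. -/
def coord2 (z : ℂ × ℂ) : Fin 2 → ℂ := ![z.1, z.2]

abbrev E2 := EuclideanSpace ℂ (Fin 2)

section

open Complex (I reCLM imCLM normSq normSq_apply norm_real real_smul mem_reProdIm coe_smul
  normSq_eq_norm_sq re_add_im ofRealCLM conjCLE)
open ContinuousLinearMap (comp_apply id_apply opNorm_le_bound compL opNorm_comp_le le_of_opNorm_le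
  le_opNorm le_of_opNorm_le_of_le opNorm_prod opNorm_le_of_unit_norm toSpanSingleton)

variable {U V W : Type*} [NormedAddCommGroup U] [NormedSpace ℝ U] [NormedAddCommGroup V]
  [NormedSpace ℝ V] [NormedAddCommGroup W] [NormedSpace ℝ W]

theorem ContDiffAt.differentiableAt_fderiv_two {f : V → W} {x : V}
    (hf : ContDiffAt ℝ 2 f x) : DifferentiableAt ℝ (fderiv ℝ f) x :=
  (hf.fderiv_right (m := 1) (by norm_num)).differentiableAt (by norm_num)

theorem ContDiffAt.eventually_differentiableAt_two {f : V → W} {x : V}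
    (hf : ContDiffAt ℝ 2 f x) : ∀ᶠ y in 𝓝 x, DifferentiableAt ℝ f y :=
  (hf.eventually (by simp)).mono fun _ hy => hy.differentiableAt (by norm_num)

/-- Second order chain rule. -/
theorem fderiv_fderiv_comp_apply
    {f : V → W} {g : U → V} {x : U} (hf : ContDiffAt ℝ 2 f (g x)) (hg : ContDiffAt ℝ 2 g x)
    (a b : U) :
    fderiv ℝ (fderiv ℝ (fun y => f (g y))) x a b =
      fderiv ℝ (fderiv ℝ f) (g x) (fderiv ℝ g x a) (fderiv ℝ g x b)
        + fderiv ℝ f (g x) (fderiv ℝ (fderiv ℝ g) x a b) := by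
  have h1 : fderiv ℝ (fun y => f (g y)) =ᶠ[𝓝 x]
      fun y => (fderiv ℝ f (g y)).comp (fderiv ℝ g y) := by
    filter_upwards [hg.continuousAt.eventually hf.eventually_differentiableAt_two,
      hg.eventually_differentiableAt_two] with y h1 h2
    exact fderiv_comp y h1 h2
  rw [h1.fderiv_eq]
  have hgd : DifferentiableAt ℝ g x := hg.differentiableAt (by norm_num)
  have h2 := hf.differentiableAt_fderiv_two.hasFDerivAt.comp x hgd.hasFDerivAt
  have h3 := h2.clm_comp hg.differentiableAt_fderiv_two.hasFDerivAt
  have h4 := h3.fderiv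
  simp only [Function.comp_def] at h4
  rw [h4]
  simp [add_comm]

theorem fderiv_fderiv_comp_affine
    {f : V → W} (A : U →L[ℝ] V) (c : V) {x : U} (hf : ContDiffAt ℝ 2 f (c + A x)) (a b : U) :
    fderiv ℝ (fderiv ℝ (fun y => f (c + A y))) x a b =
      fderiv ℝ (fderiv ℝ f) (c + A x) (A a) (A b) := by
  have hd : ∀ y, fderiv ℝ (fun y => c + A y) y = A := fun y => by
    simp
  have h := fderiv_fderiv_comp_apply (f := f) (g := fun y => c + A y) (x := x) hf
    (contDiff_const.add A.contDiff).contDiffAt a b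
  rw [h, hd]
  have : fderiv ℝ (fun y => c + A y) = fun _ => A := funext hd
  simp [this]

theorem fderiv_comp_affine
    {f : V → W} (A : U →L[ℝ] V) (c : V) {x : U} (hf : DifferentiableAt ℝ f (c + A x)) :
    fderiv ℝ (fun y => f (c + A y)) x = (fderiv ℝ f (c + A x)).comp A := by
  have h := hf.hasFDerivAt.comp x ((A.hasFDerivAt (x := x)).const_add c)
  exact h.fderiv

theorem fderiv_fderiv_clm_comp
    (L : V →L[ℝ] W) {g : U → V} {x : U} (hg : ContDiffAt ℝ 2 g x) (a b : U) :
    fderiv ℝ (fderiv ℝ (fun y => L (g y))) x a b = L (fderiv ℝ (fderiv ℝ g) x a b) := by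
  have h := fderiv_fderiv_comp_apply (f := L) (g := g) (x := x) L.contDiff.contDiffAt hg a b
  rw [h]
  have : fderiv ℝ L = fun _ => L := funext fun y => L.fderiv
  simp [this]

theorem fderiv_fderiv_add {f g : U → W} {x : U}
    (hf : ContDiffAt ℝ 2 f x) (hg : ContDiffAt ℝ 2 g x) :
    fderiv ℝ (fderiv ℝ (fun y => f y + g y)) x =
      fderiv ℝ (fderiv ℝ f) x + fderiv ℝ (fderiv ℝ g) x := by
  have h1 : fderiv ℝ (fun y => f y + g y) =ᶠ[𝓝 x] fun y => fderiv ℝ f y + fderiv ℝ g y := by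
    filter_upwards [hf.eventually_differentiableAt_two, hg.eventually_differentiableAt_two]
      with y h1 h2 using fderiv_add h1 h2
  rw [h1.fderiv_eq]
  exact fderiv_add hf.differentiableAt_fderiv_two hg.differentiableAt_fderiv_two

theorem fderiv_fderiv_sub {f g : U → W} {x : U}
    (hf : ContDiffAt ℝ 2 f x) (hg : ContDiffAt ℝ 2 g x) :
    fderiv ℝ (fderiv ℝ (fun y => f y - g y)) x =
      fderiv ℝ (fderiv ℝ f) x - fderiv ℝ (fderiv ℝ g) x := by
  have h1 : fderiv ℝ (fun y => f y - g y) =ᶠ[𝓝 x] fun y => fderiv ℝ f y - fderiv ℝ g y := by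
    filter_upwards [hf.eventually_differentiableAt_two, hg.eventually_differentiableAt_two]
      with y h1 h2 using fderiv_sub h1 h2
  rw [h1.fderiv_eq]
  exact fderiv_sub hf.differentiableAt_fderiv_two hg.differentiableAt_fderiv_two

theorem fderiv_fderiv_symm {f : U → W} {x : U}
    (hf : ContDiffAt ℝ 2 f x) (a b : U) :
    fderiv ℝ (fderiv ℝ f) x a b = fderiv ℝ (fderiv ℝ f) x b a :=
  (hf.isSymmSndFDerivAt (by simp)) a b

theorem deriv_deriv_nonpos_of_isLocalMax {h : ℝ → ℝ} {a : ℝ} (hc : ContinuousAt h a)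
    (hm : IsLocalMax h a) : deriv (deriv h) a ≤ 0 := by
  by_contra hcon
  push Not at hcon
  have h1 := isLocalMin_of_deriv_deriv_pos hcon hm.deriv_eq_zero hc
  have h2 : h =ᶠ[𝓝 a] fun _ => h a := by
    filter_upwards [h1, hm] with y hy1 hy2 using le_antisymm hy2 hy1
  have h3 : deriv h =ᶠ[𝓝 a] fun _ => 0 := by
    have := h2.deriv
    refine this.trans (Eventually.of_forall fun y => by simp)
  rw [h3.deriv_eq] at hcon
  simp at hcon

/-- Second order necessary condition at a local maximum. -/
theorem fderiv_fderiv_nonpos_of_isLocalMax {f : U → ℝ} {x : U} (hf : ContDiffAt ℝ 2 f x)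
    (hm : IsLocalMax f x)
    (v : U) : fderiv ℝ (fderiv ℝ f) x v v ≤ 0 := by
  set A : ℝ →L[ℝ] U := toSpanSingleton ℝ v with hA
  have hx : x + A 0 = x := by simp
  have hf' : ContDiffAt ℝ 2 f (x + A 0) := by rwa [hx]
  have hcomp : ContDiffAt ℝ 2 (fun t => f (x + A t)) 0 :=
    ContDiffAt.comp (0 : ℝ) hf' (contDiff_const.add A.contDiff).contDiffAt
  have h2 := fderiv_fderiv_comp_affine A x hf' 1 1
  have hA1 : A 1 = v := by simp [hA]
  rw [hx, hA1] at h2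
  rw [← h2]
  have h3 : deriv (deriv (fun t => f (x + A t))) 0 =
      fderiv ℝ (fderiv ℝ (fun t => f (x + A t))) 0 1 1 := by
    have : deriv (fun t => f (x + A t)) = fun t => fderiv ℝ (fun t => f (x + A t)) t 1 := by
      ext t; simp
    rw [this, ← fderiv_apply_one_eq_deriv,
      fderiv_clm_apply hcomp.differentiableAt_fderiv_two (differentiableAt_const _)]
    simp
  rw [← h3]
  refine deriv_deriv_nonpos_of_isLocalMax hcomp.continuousAt ?_
  have hcont : ContinuousAt (fun t => x + A t) 0 := by fun_prop
  have h5 : ∀ᶠ y in 𝓝 (x + A 0), f y ≤ f x := by rw [hx]; exact hm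
  have := hcont.eventually h5
  filter_upwards [this] with t ht
  simpa using ht

/-- The second derivative of `f` traced over the complex line spanned by `v`. -/
def lap2 (f : E → W) (x v : E) : W :=
  fderiv ℝ (fderiv ℝ f) x v v
    + fderiv ℝ (fderiv ℝ f) x (I • v) (I • v)

/-- The real-linear parametrization `ζ ↦ ζ • v` of a complex line. -/
def lineMap (v : E) : ℂ →L[ℝ] E :=
  (toSpanSingleton ℂ v).restrictScalars ℝ

@[simp] theorem lineMap_apply (v : E) (ζ : ℂ) : lineMap v ζ = ζ • v := by
  simp [lineMap]

theorem lap2_comp_line {f : E → W}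
    {x v : E} {ζ : ℂ} (hf : ContDiffAt ℝ 2 f (x + ζ • v)) (c : ℂ) :
    lap2 (fun z : ℂ => f (x + z • v)) ζ c = lap2 f (x + ζ • v) (c • v) := by
  have h := fun a b => fderiv_fderiv_comp_affine (f := f) (lineMap v) x (x := ζ) (by simpa) a b
  simp only [lineMap_apply] at h
  simp [lap2, h, smul_smul]

theorem lap2_add {f g : E → W} {x : E}
    (hf : ContDiffAt ℝ 2 f x) (hg : ContDiffAt ℝ 2 g x) (v : E) :
    lap2 (fun y => f y + g y) x v = lap2 f x v + lap2 g x v := by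
  simp only [lap2, fderiv_fderiv_add hf hg, add_apply]
  abel

theorem lap2_sub {f g : E → W} {x : E}
    (hf : ContDiffAt ℝ 2 f x) (hg : ContDiffAt ℝ 2 g x) (v : E) :
    lap2 (fun y => f y - g y) x v = lap2 f x v - lap2 g x v := by
  simp only [lap2, fderiv_fderiv_sub hf hg, sub_apply]
  abel

theorem lap2_clm_comp (L : V →L[ℝ] W) {g : E → V} {x : E}
    (hg : ContDiffAt ℝ 2 g x) (v : E) :
    lap2 (fun y => L (g y)) x v = L (lap2 g x v) := by
  simp [lap2, fderiv_fderiv_clm_comp L hg]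

theorem lap2_comp_add_left (f : E → W)
    (x h v : E) : lap2 (fun y => f (y + h)) x v = lap2 f (x + h) v := by
  have h1 : fderiv ℝ (fun y => f (y + h)) = fun y => fderiv ℝ f (y + h) := by
    ext y; rw [fderiv_comp_add_right]
  simp only [lap2, h1]
  rw [fderiv_comp_add_right]

theorem lap2_re_sq (ζ : ℂ) : lap2 (fun z : ℂ => z.re ^ 2) ζ 1 = 2 := by
  have h1 : fderiv ℝ (fun z : ℂ => z.re ^ 2) = fun z => (2 * z.re) • reCLM := by
    ext1 z
    have h := ((Complex.reCLM.hasFDerivAt (x := z)).pow 2).fderiv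
    simpa using h
  have h2 : fderiv ℝ (fun z : ℂ => (2 * z.re) • reCLM) ζ
      = ((2 : ℝ) • reCLM).smulRight reCLM := by
    have h := (((Complex.reCLM.hasFDerivAt (x := ζ)).const_mul 2).smul_const reCLM).fderiv
    simpa using h
  simp [lap2, h1, h2]

theorem contDiff_re_sq : ContDiff ℝ 2 (fun z : ℂ => z.re ^ 2) :=
  Complex.reCLM.contDiff.pow 2

theorem lap2_one_nonpos_of_isLocalMax {u : ℂ → ℝ} {ζ : ℂ} (hu : ContDiffAt ℝ 2 u ζ)
    (hm : IsLocalMax u ζ) : lap2 u ζ 1 ≤ 0 :=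
  add_nonpos (fderiv_fderiv_nonpos_of_isLocalMax hu hm _)
    (fderiv_fderiv_nonpos_of_isLocalMax hu hm _)

/-- Maximum principle for planar subharmonic functions of class `C²`. -/
theorem planar_max_principle {K B : Set ℂ} (hK : IsCompact K) {u : ℂ → ℝ} {m : ℝ}
    (hcont : ContinuousOn u K) (hint : ∀ z ∈ K \ B, K ∈ 𝓝 z ∧ ContDiffAt ℝ 2 u z ∧ 0 ≤ lap2 u z 1)
    (hB : ∀ z ∈ B, u z ≤ m) : ∀ z ∈ K, u z ≤ m := by
  intro z hz
  obtain ⟨C, hC⟩ : ∃ C, ∀ w ∈ K, w.re ^ 2 ≤ C := by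
    obtain ⟨C, hC⟩ := hK.bddAbove_image (f := fun z : ℂ => z.re ^ 2) (by fun_prop)
    exact ⟨C, fun w hw => hC ⟨w, hw, rfl⟩⟩
  refine le_of_forall_pos_le_add fun ε hε => ?_
  have hC0 : 0 ≤ C := (sq_nonneg _).trans (hC z hz)
  set δ := ε / (C + 1) with hδ
  have hδ0 : 0 < δ := by positivity
  have hδC : δ * C ≤ ε := by
    rw [hδ, div_mul_eq_mul_div, div_le_iff₀ (by positivity)]; nlinarith
  obtain ⟨w, hw, hmax⟩ := hK.exists_isMaxOn ⟨z, hz⟩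
    (f := fun z => u z + δ * z.re ^ 2) (hcont.add (by fun_prop))
  have hwB : w ∈ B := by
    by_contra hwB
    obtain ⟨hn, hc, hl⟩ := hint w ⟨hw, hwB⟩
    have hq : ContDiffAt ℝ 2 (fun z : ℂ => δ * z.re ^ 2) w :=
      (contDiff_const.mul contDiff_re_sq).contDiffAt
    have hloc : IsLocalMax (fun z => u z + δ * z.re ^ 2) w := hmax.isLocalMax hn
    have h1 := lap2_one_nonpos_of_isLocalMax (hc.add hq) hloc
    rw [lap2_add hc hq] at h1
    have h2 : lap2 (fun z : ℂ => δ * z.re ^ 2) w 1 = δ * 2 := by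
      have := lap2_clm_comp (δ • ContinuousLinearMap.id ℝ ℝ) (contDiff_re_sq.contDiffAt (x := w)) 1
      simpa [lap2_re_sq] using this
    rw [h2] at h1
    linarith
  have h3 := hmax hz
  simp only [mem_ofPred_eq] at h3
  have := hB w hwB
  have := hC w hw
  nlinarith [sq_nonneg z.re]

theorem fderiv_quadratic_planar (α β γ : ℝ) (ζ : ℂ) :
    ContDiffAt ℝ 2 (fun z : ℂ => α * z.im ^ 2 + β * z.re ^ 2 + γ * z.re) ζ ∧
      lap2 (fun z : ℂ => α * z.im ^ 2 + β * z.re ^ 2 + γ * z.re) ζ 1 = 2 * α + 2 * β := by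
  have hre : ContDiff ℝ 2 (fun z : ℂ => z.re) := Complex.reCLM.contDiff
  have him : ContDiff ℝ 2 (fun z : ℂ => z.im) := Complex.imCLM.contDiff
  refine ⟨by fun_prop, ?_⟩
  have h1 : fderiv ℝ (fun z : ℂ => α * z.im ^ 2 + β * z.re ^ 2 + γ * z.re) =
      fun z => (2 * α * z.im) • imCLM + (2 * β * z.re) • reCLM
        + γ • reCLM := by
    ext1 z
    have h := ((((Complex.imCLM.hasFDerivAt (x := z)).pow 2).const_mul α).add
      (((Complex.reCLM.hasFDerivAt (x := z)).pow 2).const_mul β)).add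
      ((Complex.reCLM.hasFDerivAt (x := z)).const_mul γ)
    have h' := h.fderiv
    simp only [Complex.imCLM_apply, Complex.reCLM_apply] at h'
    refine Eq.trans ?_ (h'.trans ?_)
    · congr 1
    · ext w; simp; ring
  have h2 : fderiv ℝ (fun z : ℂ => (2 * α * z.im) • imCLM
      + (2 * β * z.re) • reCLM + γ • reCLM) ζ
      = ((2 * α) • imCLM).smulRight imCLM +
        ((2 * β) • reCLM).smulRight reCLM := by
    have h := (((((Complex.imCLM.hasFDerivAt (x := ζ)).const_mul (2 * α)).smul_const
      imCLM)).add (((Complex.reCLM.hasFDerivAt (x := ζ)).const_mul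
        (2 * β)).smul_const reCLM)).add_const (γ • reCLM)
    exact h.fderiv
  simp [lap2, h1, h2]
  ring

/-- Interior gradient estimate for the planar Poisson equation. -/
theorem fderiv_one_le_of_lap2_real {u : ℂ → ℝ} {ρ M N : ℝ} (hρ : 0 < ρ)
    (hc : ∀ y ∈ ball (0 : ℂ) ρ, ContDiffAt ℝ 2 u y) (hM : ∀ y ∈ ball (0 : ℂ) ρ, |u y| ≤ M)
    (hN : ∀ y ∈ ball (0 : ℂ) ρ, |lap2 u y 1| ≤ N) :
    fderiv ℝ u 0 1 ≤ 4 * M / ρ + ρ * N / 4 := by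
  set d := ρ / 2 with hd
  have hd0 : 0 < d := by positivity
  have hM0 : 0 ≤ M := (abs_nonneg _).trans (hM 0 (by simpa))
  have hN0 : 0 ≤ N := (abs_nonneg _).trans (hN 0 (by simpa))
  set A : ℂ →L[ℝ] ℂ := -(conjCLE : ℂ →L[ℝ] ℂ) with hA
  have hAre : ∀ z, (A z).re = -z.re := fun z => by simp [hA]
  have hAim : ∀ z, (A z).im = z.im := fun z => by simp [hA]
  have hsq : ∀ z : ℂ, |z.re| ≤ d → |z.im| ≤ d → z ∈ ball (0 : ℂ) ρ := by
    intro z h1 h2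
    rw [mem_ball_zero_iff, ← abs_of_pos hρ, ← abs_norm z, ← sq_lt_sq, Complex.sq_norm,
      normSq_apply]
    have := sq_le_sq' (abs_le.1 h1).1 (abs_le.1 h1).2
    have := sq_le_sq' (abs_le.1 h2).1 (abs_le.1 h2).2
    nlinarith
  set K : Set ℂ := Icc 0 d ×ℂ Icc (-d) d with hK
  have hmemK : ∀ z ∈ K, z ∈ ball (0 : ℂ) ρ ∧ A z ∈ ball (0 : ℂ) ρ := by
    intro z hz
    rw [hK, mem_reProdIm, mem_Icc, mem_Icc] at hz
    have h1 : |z.re| ≤ d := abs_le.2 ⟨by linarith, hz.1.2⟩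
    have h2 : |z.im| ≤ d := abs_le.2 hz.2
    exact ⟨hsq z h1 h2, hsq (A z) (by rwa [hAre, abs_neg]) (by rwa [hAim])⟩
  set α := M / d ^ 2 with hα
  set γ := 2 * M / d + N * d / 2 with hγ
  have hα0 : 0 ≤ α := by positivity
  have hαd : α * d ^ 2 = M := by rw [hα]; field_simp
  have hγd : γ = 2 * (α * d) + N * d / 2 := by rw [hγ, hα]; field_simp
  set b : ℂ → ℝ := fun z => α * z.im ^ 2 + (-α - N / 2) * z.re ^ 2 + γ * z.re with hb
  set w : ℂ → ℝ := fun z => (1 / 2 : ℝ) • u z - (1 / 2 : ℝ) • u (0 + A z) with hw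
  have hwc : ∀ z ∈ K, ContDiffAt ℝ 2 (fun z => (1 / 2 : ℝ) • u z) z ∧
      ContDiffAt ℝ 2 (fun z => (1 / 2 : ℝ) • u (0 + A z)) z := by
    intro z hz
    refine ⟨(hc z (hmemK z hz).1).const_smul _, ContDiffAt.const_smul _ ?_⟩
    have : ContDiffAt ℝ 2 u (0 + A z) := by rw [zero_add]; exact hc _ (hmemK z hz).2
    exact ContDiffAt.comp z this (contDiff_const.add A.contDiff).contDiffAt
  have hcompact : IsCompact K := isCompact_Icc.reProdIm isCompact_Icc
  have key : ∀ z ∈ K, w z - b z ≤ 0 := by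
    refine planar_max_principle hcompact (B := {z ∈ K | z.re = 0 ∨ z.re = d ∨ z.im = -d ∨ z.im = d})
      ?_ ?_ ?_
    · intro z hz
      exact ((((hwc z hz).1.sub (hwc z hz).2).sub
        (fderiv_quadratic_planar α (-α - N / 2) γ z).1).continuousAt).continuousWithinAt
    · rintro z ⟨hz, hzB⟩
      have hz' := hz
      rw [hK, mem_reProdIm, mem_Icc, mem_Icc] at hz'
      simp only [mem_ofPred_eq, hz, true_and, not_or] at hzB
      refine ⟨?_, ((hwc z hz).1.sub (hwc z hz).2).sub
        (fderiv_quadratic_planar α (-α - N / 2) γ z).1, ?_⟩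
      · have hop : IsOpen (Ioo 0 d ×ℂ Ioo (-d) d) := isOpen_Ioo.reProdIm isOpen_Ioo
        refine mem_of_superset (hop.mem_nhds ?_) ?_
        · rw [mem_reProdIm]
          exact ⟨⟨lt_of_le_of_ne hz'.1.1 (Ne.symm hzB.1), lt_of_le_of_ne hz'.1.2 hzB.2.1⟩,
            ⟨lt_of_le_of_ne hz'.2.1 (Ne.symm hzB.2.2.1), lt_of_le_of_ne hz'.2.2 hzB.2.2.2⟩⟩
        · intro y hy
          rw [hK, mem_reProdIm]
          exact ⟨Ioo_subset_Icc_self hy.1, Ioo_subset_Icc_self hy.2⟩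
      · have hAz : ContDiffAt ℝ 2 u (0 + A z) := by rw [zero_add]; exact hc _ (hmemK z hz).2
        have hAc : ContDiffAt ℝ 2 (fun z => u (0 + A z)) z :=
          ContDiffAt.comp z hAz (contDiff_const.add A.contDiff).contDiffAt
        rw [lap2_sub ((hwc z hz).1.sub (hwc z hz).2) (fderiv_quadratic_planar _ _ _ z).1,
          lap2_sub (hwc z hz).1 (hwc z hz).2, (fderiv_quadratic_planar _ _ _ z).2]
        have e1 : lap2 (fun z => (1 / 2 : ℝ) • u z) z 1 = (1 / 2) * lap2 u z 1 := by
          have := lap2_clm_comp ((1 / 2 : ℝ) • ContinuousLinearMap.id ℝ ℝ) (hc z (hmemK z hz).1) 1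
          simpa using this
        have e2 : lap2 (fun z => (1 / 2 : ℝ) • u (0 + A z)) z 1 = (1 / 2) * lap2 u (A z) 1 := by
          have := lap2_clm_comp ((1 / 2 : ℝ) • ContinuousLinearMap.id ℝ ℝ) hAc 1
          have h2 : lap2 (fun z => u (0 + A z)) z 1 = lap2 u (A z) 1 := by
            simp only [lap2]
            rw [fderiv_fderiv_comp_affine A 0 hAz, fderiv_fderiv_comp_affine A 0 hAz]
            simp [hA]
          rw [← h2]
          simpa using this
        rw [e1, e2]
        have h1 := abs_le.1 (hN z (hmemK z hz).1)
        have h2 := abs_le.1 (hN (A z) (hmemK z hz).2)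
        linarith
    · rintro z ⟨hz, hzB⟩
      have hz' := hz
      rw [hK, mem_reProdIm, mem_Icc, mem_Icc] at hz'
      have h1 := abs_le.1 (hM z (hmemK z hz).1)
      have h2 := abs_le.1 (hM (A z) (hmemK z hz).2)
      have hwM : w z ≤ M := by
        simp only [hw, smul_eq_mul, zero_add]; linarith
      have hb0 : b z = α * (z.im ^ 2 + z.re * (2 * d - z.re)) + N / 2 * (z.re * (d - z.re)) := by
        simp only [hb, hγd]; ring
      have hr : 0 ≤ z.re * (d - z.re) := mul_nonneg hz'.1.1 (by linarith)
      have hr' : 0 ≤ z.re * (2 * d - z.re) := mul_nonneg hz'.1.1 (by linarith)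
      have hN' : 0 ≤ N / 2 * (z.re * (d - z.re)) := by positivity
      rcases hzB with h | h | h | h
      · have : A z = z := by
          apply Complex.ext
          · rw [hAre, h, neg_zero]
          · rw [hAim]
        simp only [hw, zero_add, this, sub_self, hb0, h]
        have := mul_nonneg hα0 (sq_nonneg z.im)
        simp; linarith
      · have : M ≤ α * (z.im ^ 2 + z.re * (2 * d - z.re)) := by
          rw [← hαd, h]; gcongr; nlinarith [sq_nonneg z.im]
        linarith
      · have : M ≤ α * (z.im ^ 2 + z.re * (2 * d - z.re)) := by
          rw [← hαd]; gcongr; rw [h]; nlinarith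
        linarith
      · have : M ≤ α * (z.im ^ 2 + z.re * (2 * d - z.re)) := by
          rw [← hαd]; gcongr; rw [h]; nlinarith
        linarith
  have hgoal : 4 * M / ρ + ρ * N / 4 = γ := by
    rw [hγ, hd]; field_simp; ring
  rw [hgoal]
  have hu0 : HasFDerivAt u (fderiv ℝ u 0) 0 :=
    ((hc 0 (by simpa)).differentiableAt (by norm_num)).hasFDerivAt
  have hder : HasDerivAt (fun t : ℝ => w (t : ℂ)) (fderiv ℝ u 0 1) 0 := by
    have e1 : HasDerivAt (fun t : ℝ => (t : ℂ)) 1 0 := Complex.ofRealCLM.hasDerivAt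
    have e2 : HasDerivAt (fun t : ℝ => -(t : ℂ)) (-1) 0 := e1.neg
    have f1 : HasDerivAt (fun t : ℝ => u (t : ℂ)) (fderiv ℝ u 0 1) 0 :=
      HasFDerivAt.comp_hasDerivAt (0 : ℝ) (by simpa using hu0) e1
    have f2 : HasDerivAt (fun t : ℝ => u (-(t : ℂ))) (fderiv ℝ u 0 (-1)) 0 :=
      HasFDerivAt.comp_hasDerivAt (0 : ℝ) (by simpa using hu0) e2
    have f3 := (f1.const_smul (1 / 2 : ℝ)).sub (f2.const_smul (1 / 2 : ℝ))
    have hv : (1 / 2 : ℝ) • fderiv ℝ u 0 1 - (1 / 2 : ℝ) • fderiv ℝ u 0 (-1) = fderiv ℝ u 0 1 := by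
      rw [map_neg]; simp only [smul_eq_mul]; ring
    rw [hv] at f3
    refine f3.congr_of_eventuallyEq (Eventually.of_forall fun t => ?_)
    have : A (t : ℂ) = -(t : ℂ) := by simp [hA]
    simp [hw, this]
  have hslope := (hasDerivAt_iff_tendsto_slope.1 hder).mono_left
    (nhdsWithin_mono (0 : ℝ) (fun t (ht : t ∈ Ioi (0 : ℝ)) => ne_of_gt ht))
  refine le_of_tendsto hslope ?_
  filter_upwards [Ioo_mem_nhdsGT hd0] with t ht
  have htK : (t : ℂ) ∈ K := by
    rw [hK, mem_reProdIm]
    simp [ht.1.le, ht.2.le, hd0.le]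
  have h1 := key _ htK
  have hw0 : w ((0 : ℝ) : ℂ) = 0 := by simp [hw]
  rw [slope_def_field, hw0, sub_zero, sub_zero, div_le_iff₀ ht.1]
  simp only [hb, Complex.ofReal_re, Complex.ofReal_im] at h1
  nlinarith [sq_nonneg t, mul_nonneg hα0 (sq_nonneg t), mul_nonneg hN0 (sq_nonneg t)]

theorem norm_fderiv_one_le_of_lap2
    {u : ℂ → W} {ρ M N : ℝ} (hρ : 0 < ρ) (c : W)
    (hc : ∀ y ∈ ball (0 : ℂ) ρ, ContDiffAt ℝ 2 u y) (hM : ∀ y ∈ ball (0 : ℂ) ρ, ‖u y - c‖ ≤ M)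
    (hN : ∀ y ∈ ball (0 : ℂ) ρ, ‖lap2 u y 1‖ ≤ N) :
    ‖fderiv ℝ u 0 1‖ ≤ 4 * M / ρ + ρ * N / 4 := by
  obtain ⟨L, hL, hLv⟩ := exists_dual_vector'' ℝ (fderiv ℝ u 0 1)
  have hL' : ∀ y, |L y| ≤ ‖y‖ := fun y => by
    rw [← Real.norm_eq_abs]
    exact (L.le_opNorm y).trans (mul_le_of_le_one_left (norm_nonneg _) hL)
  have hcc : ∀ y ∈ ball (0 : ℂ) ρ, ContDiffAt ℝ 2 (fun y => u y - c) y :=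
    fun y hy => (hc y hy).sub contDiffAt_const
  have h := fderiv_one_le_of_lap2_real (u := fun y => L (u y - c)) (M := M) (N := N) hρ
    (fun y hy => L.contDiff.contDiffAt.comp y (hcc y hy))
    (fun y hy => (hL' _).trans (hM y hy)) (fun y hy => ?_)
  · have h0 : DifferentiableAt ℝ (fun y => u y - c) 0 :=
      (hcc 0 (by simpa)).differentiableAt (by norm_num)
    have h1 : fderiv ℝ (fun y => L (u y - c)) 0 = L.comp (fderiv ℝ u 0) := by
      have := (L.hasFDerivAt.comp (0 : ℂ) h0.hasFDerivAt).fderiv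
      rw [fderiv_sub_const] at this
      exact this
    rw [h1] at h
    simpa [hLv] using h
  · rw [lap2_clm_comp L (hcc y hy), lap2_sub (hc y hy) contDiffAt_const]
    have : lap2 (fun _ : ℂ => c) y 1 = 0 := by
      have h0 : fderiv ℝ (fun _ : ℂ => c) = fun _ => 0 := by ext1 y; simp
      simp [lap2, h0]
    rw [this, sub_zero]
    exact (hL' _).trans (hN y hy)

theorem norm_fderiv_apply_le_of_lap2
    {f : E → W} {x v : E} {ρ M N : ℝ} (hρ : 0 < ρ) (c : W)
    (hc : ∀ z ∈ ball (0 : ℂ) ρ, ContDiffAt ℝ 2 f (x + z • v))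
    (hM : ∀ z ∈ ball (0 : ℂ) ρ, ‖f (x + z • v) - c‖ ≤ M)
    (hN : ∀ z ∈ ball (0 : ℂ) ρ, ‖lap2 f (x + z • v) v‖ ≤ N) :
    ‖fderiv ℝ f x v‖ ≤ 4 * M / ρ + ρ * N / 4 := by
  have h := norm_fderiv_one_le_of_lap2 (u := fun z : ℂ => f (x + z • v)) (N := N) hρ c
    (fun z hz => ?_) hM (fun z hz => ?_)
  · have h1 := fderiv_comp_affine (f := f) (lineMap v) x (x := 0)
      (by simpa using (hc 0 (by simpa)).differentiableAt (by norm_num))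
    simp only [lineMap_apply, zero_smul, add_zero] at h1
    rw [h1] at h
    simpa using h
  · have : ContDiff ℝ 2 (fun z : ℂ => x + z • v) := by
      have := contDiff_const (c := x).add (lineMap v).contDiff (n := 2)
      simpa using this
    exact (hc z hz).comp z this.contDiffAt
  · rw [lap2_comp_line (hc z hz), one_smul]; exact hN z hz

/-- Interior gradient estimate: a map with bounded oscillation and bounded complex-line
Laplacians has bounded derivative. -/
theorem norm_fderiv_le_of_lap2
    {f : E → W} {x : E} {ρ M N : ℝ} (hρ : 0 < ρ) (c : W) (hN0 : 0 ≤ N)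
    (hc : ∀ y ∈ ball x ρ, ContDiffAt ℝ 2 f y) (hM : ∀ y ∈ ball x ρ, ‖f y - c‖ ≤ M)
    (hN : ∀ y ∈ ball x ρ, ∀ v, ‖v‖ = 1 → ‖lap2 f y v‖ ≤ N) :
    ‖fderiv ℝ f x‖ ≤ 4 * M / ρ + ρ * N / 4 := by
  have hM0 : 0 ≤ M := (norm_nonneg _).trans (hM x (mem_ball_self hρ))
  refine opNorm_le_of_unit_norm (by positivity) fun v hv => ?_
  have hmem : ∀ z ∈ ball (0 : ℂ) ρ, x + z • v ∈ ball x ρ := fun z hz => by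
    simpa [norm_smul, hv] using hz
  exact norm_fderiv_apply_le_of_lap2 hρ c (fun z hz => hc _ (hmem z hz))
    (fun z hz => hM _ (hmem z hz)) (fun z hz => hN _ (hmem z hz) v hv)

theorem ContDiffAt.comp_add_right_const {n : WithTop ℕ∞} {f : U → W} {x h : U}
    (hf : ContDiffAt ℝ n f (x + h)) : ContDiffAt ℝ n (fun y => f (y + h)) x :=
  ContDiffAt.comp x hf (contDiff_id.add contDiff_const).contDiffAt

/-- Interior `1/2`-Hölder estimate for the derivative. -/
theorem norm_fderiv_sub_le_sqrt
    {f : E → W} {x₀ : E} {ρ M A : ℝ} (hρ : 0 < ρ) (hA0 : 0 ≤ A)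
    (hc : ∀ y ∈ ball x₀ ρ, ContDiffAt ℝ 2 f y) (hM : ∀ y ∈ ball x₀ ρ, ‖fderiv ℝ f y‖ ≤ M)
    (hA : ∀ y ∈ ball x₀ ρ, ∀ v, ‖v‖ = 1 → ‖lap2 f y v‖ ≤ A) {x y : E}
    (hx : x ∈ ball x₀ (ρ / 8)) (hy : y ∈ ball x₀ (ρ / 8)) :
    ‖fderiv ℝ f y - fderiv ℝ f x‖ ≤ (16 * M / √ρ + A * √ρ) * √‖y - x‖ := by
  rcases eq_or_ne y x with rfl | hne
  · simp
  set h := y - x with hh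
  have hh0 : 0 < ‖h‖ := norm_pos_iff.2 (sub_ne_zero.2 hne)
  have hh1 : ‖h‖ < ρ / 4 := by
    rw [hh, ← dist_eq_norm]
    have := dist_triangle_right y x x₀
    rw [mem_ball] at hx hy
    linarith
  set a := √ρ with ha
  set b := √‖h‖ with hb
  have ha0 : 0 < a := Real.sqrt_pos.2 hρ
  have hb0 : 0 < b := Real.sqrt_pos.2 hh0
  have ha2 : a ^ 2 = ρ := Real.sq_sqrt hρ.le
  have hb2 : b ^ 2 = ‖h‖ := Real.sq_sqrt hh0.le
  have hba : b ≤ a / 2 := by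
    rw [← abs_of_pos hb0, ← abs_of_pos (half_pos ha0), ← sq_le_sq, div_pow, ha2, hb2]; linarith
  set R := a * b / 4 with hR
  have hR0 : 0 < R := by positivity
  have hRρ : R ≤ ρ / 8 := by rw [hR, ← ha2]; nlinarith
  have hmem : ∀ z ∈ ball x R, z ∈ ball x₀ (ρ / 2) ∧ z + h ∈ ball x₀ ρ := by
    intro z hz
    rw [mem_ball] at hz hx
    have h1 := dist_triangle z x x₀
    have h2 := dist_triangle (z + h) z x₀
    have h3 : dist (z + h) z = ‖h‖ := by simp [dist_eq_norm]
    constructor <;> rw [mem_ball] <;> linarith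
  have hmem' : ∀ z ∈ ball x R, z ∈ ball x₀ ρ := fun z hz =>
    ball_subset_ball (by linarith) (hmem z hz).1
  have hcd : ∀ z ∈ ball x R, ContDiffAt ℝ 2 (fun y => f (y + h)) z := fun z hz =>
    (hc _ (hmem z hz).2).comp_add_right_const
  have key := norm_fderiv_le_of_lap2 (f := fun y => f (y + h) - f y) (x := x) (M := M * ‖h‖)
    (N := 2 * A) hR0 0 (by positivity) (fun z hz => (hcd z hz).sub (hc z (hmem' z hz)))
    (fun z hz => ?_) (fun z hz v hv => ?_)
  · have e1 : fderiv ℝ (fun y => f (y + h) - f y) x = fderiv ℝ f y - fderiv ℝ f x := by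
      have := fderiv_sub ((hcd x (mem_ball_self hR0)).differentiableAt (by norm_num))
        ((hc x (hmem' x (mem_ball_self hR0))).differentiableAt (by norm_num))
      rw [fderiv_comp_add_right] at this
      have hxy : x + h = y := by rw [hh]; abel
      rw [hxy] at this
      exact this
    rw [e1] at key
    refine key.trans ?_
    have e2 : 4 * (M * ‖h‖) / R = 16 * M / a * b := by
      rw [hR, ← hb2]; field_simp; ring
    rw [e2, hR, add_mul]
    have : 0 ≤ A * a * b := by positivity
    linarith
  · rw [sub_zero]
    have := (convex_ball x₀ ρ).norm_image_sub_le_of_norm_fderiv_le (𝕜 := ℝ)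
      (fun w hw => (hc w hw).differentiableAt (by norm_num)) hM (hmem' z hz) (hmem z hz).2
    simpa using this
  · rw [lap2_sub (hcd z hz) (hc z (hmem' z hz)), lap2_comp_add_left]
    refine (norm_sub_le _ _).trans ?_
    have h1 := hA _ (hmem z hz).2 v hv
    have h2 := hA _ (hmem' z hz) v hv
    linarith

/-- Selection of a point where a function is comparable to its maximum on a nearby ball. -/
theorem exists_doubling_point {X : Type*} [PseudoMetricSpace X] [ProperSpace X] {m : X → ℝ}
    {p : X} {R : ℝ} (hR : 0 < R) (hm : ContinuousOn m (closedBall p R)) (hp : 0 < m p) :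
    ∃ x₀ d, 0 < d ∧ d ≤ R ∧ ball x₀ d ⊆ ball p R ∧ 0 < m x₀ ∧ R * m p ≤ d * m x₀ ∧
      ∀ y ∈ ball x₀ (d / 2), m y ≤ 2 * m x₀ := by
  obtain ⟨x₀, hx₀, hmax⟩ := (isCompact_closedBall p R).exists_isMaxOn
    ⟨p, mem_closedBall_self hR.le⟩ (f := fun x => (R - dist x p) * m x)
    (ContinuousOn.mul (by fun_prop) hm)
  have hmax' : ∀ y ∈ closedBall p R, (R - dist y p) * m y ≤ (R - dist x₀ p) * m x₀ :=
    fun y hy => hmax hy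
  set d := R - dist x₀ p with hd
  have h1 : R * m p ≤ d * m x₀ := by simpa using hmax' p (mem_closedBall_self hR.le)
  have hd0 : 0 ≤ d := by rw [mem_closedBall] at hx₀; linarith
  have h2 : 0 < d * m x₀ := lt_of_lt_of_le (by positivity) h1
  have hdpos : 0 < d := lt_of_le_of_ne hd0 fun h => by rw [← h] at h2; simp at h2
  have hmpos : 0 < m x₀ := pos_of_mul_pos_right h2 hd0
  refine ⟨x₀, d, hdpos, by linarith [dist_nonneg (x := x₀) (y := p)], ?_, hmpos, h1, ?_⟩
  · refine ball_subset_ball' ?_; linarith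
  · intro y hy
    rw [mem_ball] at hy
    have htri := dist_triangle y x₀ p
    have h3 := hmax' y (by rw [mem_closedBall]; linarith)
    have h4 : d / 2 ≤ R - dist y p := by linarith
    by_contra hcon
    push Not at hcon
    have : d / 2 * m y ≤ (R - dist y p) * m y :=
      mul_le_mul_of_nonneg_right h4 (by linarith)
    nlinarith

/-- Gradient estimate for maps of small oscillation with quadratically controlled Laplacian. -/
theorem norm_fderiv_le_of_small_oscillation [ProperSpace E] {f : E → W} {p : E} {c : W} {ρ μ K : ℝ}
    (hρ : 0 < ρ) (hμ : 0 < μ)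
    (hK : 0 ≤ K) (hKμ : K * μ ≤ 1 / 32) (hc : ∀ y ∈ ball p ρ, ContDiffAt ℝ 2 f y)
    (hf : ∀ y ∈ ball p ρ, ‖f y - c‖ ≤ μ)
    (hlap : ∀ y ∈ ball p ρ, ∀ v, ‖v‖ = 1 → ‖lap2 f y v‖ ≤ K * ‖fderiv ℝ f y‖ ^ 2) :
    ‖fderiv ℝ f p‖ ≤ 32 * μ / ρ := by
  rcases (norm_nonneg (fderiv ℝ f p)).eq_or_lt with h0 | h0
  · rw [← h0]; positivity
  have hsub : closedBall p (ρ / 2) ⊆ ball p ρ := closedBall_subset_ball (by linarith)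
  obtain ⟨x₀, d, hd, hdR, hball, hL, h1, h2⟩ := exists_doubling_point (m := fun x => ‖fderiv ℝ f x‖)
    (half_pos hρ) (fun y hy => ((hc y (hsub hy)).fderiv_right (m := 1)
      (by norm_num)).continuousAt.norm.continuousWithinAt) h0
  set L := ‖fderiv ℝ f x₀‖ with hLdef
  have hN : d * L < 16 * μ := by
    by_contra hcon
    push Not at hcon
    set s := 8 * μ / L with hs
    have hs0 : 0 < s := by positivity
    have hsd : s ≤ d / 2 := by
      rw [hs, div_le_iff₀ hL]; linarith
    have hmem : ∀ y ∈ ball x₀ s, y ∈ ball p ρ := fun y hy =>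
      ball_subset_ball (by linarith) (hball (ball_subset_ball (by linarith) hy))
    have h3 := norm_fderiv_le_of_lap2 (f := f) (x := x₀) (N := K * (2 * L) ^ 2) hs0 c
      (by positivity) (fun y hy => hc y (hmem y hy)) (fun y hy => hf y (hmem y hy))
      (fun y hy v hv => (hlap y (hmem y hy) v hv).trans (by
        have := h2 y (ball_subset_ball hsd hy)
        gcongr))
    have e1 : 4 * μ / s + s * (K * (2 * L) ^ 2) / 4 = L / 2 + 8 * (K * μ) * L := by
      rw [hs]; field_simp; ring
    rw [e1] at h3
    nlinarith
  rw [le_div_iff₀ hρ]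
  linarith

/-- Gradient estimate for maps with affinely controlled Laplacian. -/
theorem norm_fderiv_le_of_lap2_affine [ProperSpace E] {f : E → W} {p : E} {ρ M K s : ℝ}
    (hρ : 0 < ρ) (hM : 0 ≤ M)
    (hK : 0 < K) (hs : 0 ≤ s) (hc : ∀ y ∈ ball p ρ, ContDiffAt ℝ 2 f y)
    (hf : ∀ y ∈ ball p ρ, ‖f y‖ ≤ M * s)
    (hlap : ∀ y ∈ ball p ρ, ∀ v, ‖v‖ = 1 → ‖lap2 f y v‖ ≤ K * (s + ‖fderiv ℝ f y‖)) :
    ‖fderiv ℝ f p‖ ≤ (16 * M * (2 + K * ρ) / ρ + 1) * s := by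
  rcases (norm_nonneg (fderiv ℝ f p)).eq_or_lt with h0 | h0
  · rw [← h0]; positivity
  have hsub : closedBall p (ρ / 2) ⊆ ball p ρ := closedBall_subset_ball (by linarith)
  obtain ⟨x₀, d, hd, hdR, hball, hL, h1, h2⟩ := exists_doubling_point (m := fun x => ‖fderiv ℝ f x‖)
    (half_pos hρ) (fun y hy => ((hc y (hsub hy)).fderiv_right (m := 1)
      (by norm_num)).continuousAt.norm.continuousWithinAt) h0
  set L := ‖fderiv ℝ f x₀‖ with hLdef
  set R := min (d / 2) (1 / K) with hR
  have hR0 : 0 < R := lt_min (by positivity) (by positivity)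
  have hRd : R ≤ d / 2 := min_le_left _ _
  have hRK : R * K ≤ 1 := by
    have : R ≤ 1 / K := min_le_right _ _
    rwa [le_div_iff₀ hK] at this
  have hdR' : d ≤ (2 + K * ρ) * R := by
    rcases min_choice (d / 2) (1 / K) with h | h
    · rw [← hR] at h; rw [h]; nlinarith [mul_pos hK hρ]
    · rw [← hR] at h; rw [h]; field_simp; nlinarith [mul_pos hK hρ]
  have hmem : ∀ y ∈ ball x₀ R, y ∈ ball p ρ := fun y hy =>
    ball_subset_ball (by linarith) (hball (ball_subset_ball (by linarith) hy))
  have h3 := norm_fderiv_le_of_lap2 (f := f) (x := x₀) (M := M * s) (N := K * (s + 2 * L)) hR0 0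
    (by positivity) (fun y hy => hc y (hmem y hy))
    (fun y hy => by rw [sub_zero]; exact hf y (hmem y hy))
    (fun y hy v hv => (hlap y (hmem y hy) v hv).trans (by
      have := h2 y (ball_subset_ball hRd hy)
      gcongr))
  have h4 : R * (K * (s + 2 * L)) / 4 ≤ (s + 2 * L) / 4 := by
    have : R * K * (s + 2 * L) ≤ 1 * (s + 2 * L) := by gcongr
    linarith
  have h5 : L ≤ 8 * (M * s) / R + s / 2 := by
    have : 8 * (M * s) / R = 2 * (4 * (M * s) / R) := by ring
    linarith
  have h6 : d * L ≤ 8 * (M * s) * (2 + K * ρ) + ρ / 2 * (s / 2) := by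
    have e : d * (8 * (M * s) / R) ≤ 8 * (M * s) * (2 + K * ρ) := by
      rw [mul_div_assoc', div_le_iff₀ hR0]
      have : 0 ≤ 8 * (M * s) := by positivity
      nlinarith
    have e2 : d * (s / 2) ≤ ρ / 2 * (s / 2) := by gcongr
    calc d * L ≤ d * (8 * (M * s) / R + s / 2) := by gcongr
      _ ≤ _ := by rw [mul_add]; exact add_le_add e e2
  have h7 : ‖fderiv ℝ f p‖ * ρ ≤ 16 * M * (2 + K * ρ) * s + s * ρ := by
    have := mul_nonneg hρ.le hs
    nlinarith
  have e : (16 * M * (2 + K * ρ) / ρ + 1) * s = (16 * M * (2 + K * ρ) * s + s * ρ) / ρ := by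
    field_simp
  rw [e, le_div_iff₀ hρ]
  exact h7

/-- Complex-line Laplacians of a map with complex-linear derivative vanish. -/
theorem lap2_eq_zero_of_fderiv_smul_I {W : Type*} [NormedAddCommGroup W] [NormedSpace ℂ W]
    {h : E → W} {x : E} (hc : ContDiffAt ℝ 2 h x)
    (hI : ∀ᶠ y in 𝓝 x, ∀ u, fderiv ℝ h y (I • u) = I • fderiv ℝ h y u) (v : E) :
    lap2 h x v = 0 := by
  have hd := hc.differentiableAt_fderiv_two
  have key : ∀ a u, fderiv ℝ (fderiv ℝ h) x a (I • u)
      = I • fderiv ℝ (fderiv ℝ h) x a u := by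
    intro a u
    have e1 : fderiv ℝ (fun y => fderiv ℝ h y (I • u)) x
        = fderiv ℝ (fun y => Jst W (fderiv ℝ h y u)) x := by
      refine Filter.EventuallyEq.fderiv_eq ?_
      filter_upwards [hI] with y hy
      simpa [Jst] using hy u
    have e2 := fderiv_clm_apply hd (differentiableAt_const (I • u))
    have e3 := ((Jst W).hasFDerivAt.comp x
      ((hd.hasFDerivAt).clm_apply (hasFDerivAt_const u x))).fderiv
    simp only [Function.comp_def] at e3
    rw [e2, e3] at e1
    have := DFunLike.congr_fun e1 a
    simpa [Jst] using this
  have h1 := key (I • v) v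
  rw [fderiv_fderiv_symm hc, key] at h1
  rw [lap2, key, fderiv_fderiv_symm hc (I • v) v, key, smul_smul, Complex.I_mul_I]
  simp

theorem lap2_re_polynomial (P : Polynomial ℂ) (z : ℂ) :
    ContDiffAt ℝ 2 (fun z => (P.eval z).re) z ∧ lap2 (fun z => (P.eval z).re) z 1 = 0 := by
  have hd : Differentiable ℂ fun z => P.eval z := P.differentiable
  have hc : ContDiff ℝ 2 fun z => P.eval z := hd.contDiff.restrict_scalars ℝ
  refine ⟨(Complex.reCLM.contDiff.comp hc).contDiffAt, ?_⟩
  have h := lap2_clm_comp reCLM (hc.contDiffAt (x := z)) 1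
  simp only [Complex.reCLM_apply] at h
  rw [h, lap2_eq_zero_of_fderiv_smul_I hc.contDiffAt]
  · simp
  · refine Eventually.of_forall fun y u => ?_
    rw [(hd y).fderiv_restrictScalars ℝ]
    simp [mul_assoc]

/-- Continuous functions on the unit circle are uniform limits of real parts of polynomials. -/
theorem exists_polynomial_re_near {u : ℂ → ℝ} (hu : ContinuousOn u (sphere 0 1)) {ε : ℝ}
    (hε : 0 < ε) : ∃ P : Polynomial ℂ, ∀ z ∈ sphere (0 : ℂ) 1, |(P.eval z).re - u z| ≤ ε := by
  have : Fact (0 < 2 * Real.pi) := ⟨Real.two_pi_pos⟩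
  have hsph : ∀ t : AddCircle (2 * Real.pi), ((AddCircle.toCircle t : Circle) : ℂ) ∈
      sphere (0 : ℂ) 1 := fun t => by
    rw [mem_sphere_zero_iff_norm]; exact Circle.norm_coe _
  have hcont : Continuous fun t : AddCircle (2 * Real.pi) =>
      ((u ((AddCircle.toCircle t : Circle) : ℂ) : ℝ) : ℂ) := by
    refine Complex.continuous_ofReal.comp ?_
    refine hu.comp_continuous ?_ hsph
    exact continuous_subtype_val.comp AddCircle.continuous_toCircle
  set g : C(AddCircle (2 * Real.pi), ℂ) := ⟨_, hcont⟩ with hg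
  have hspan : ∀ h ∈ Submodule.span ℂ (range (@fourier (2 * Real.pi))), ∃ P : Polynomial ℂ,
      ∀ t, (P.eval ((AddCircle.toCircle t : Circle) : ℂ)).re = (h t).re := by
    suffices H : ∀ h ∈ Submodule.span ℂ (range (@fourier (2 * Real.pi))), ∀ c : ℂ,
        ∃ P : Polynomial ℂ, ∀ t, (P.eval ((AddCircle.toCircle t : Circle) : ℂ)).re
          = (c * h t).re by
      intro h hh
      simpa using H h hh 1
    intro h hh
    induction hh using Submodule.span_induction with
    | mem x hx =>
      obtain ⟨n, rfl⟩ := hx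
      intro c
      rcases le_total 0 n with hn | hn
      · lift n to ℕ using hn
        refine ⟨Polynomial.C c * Polynomial.X ^ n, fun t => ?_⟩
        simp [fourier_apply, AddCircle.toCircle_nsmul]
      · obtain ⟨m, rfl⟩ : ∃ m : ℕ, n = -(m : ℤ) := ⟨n.natAbs, by omega⟩
        refine ⟨Polynomial.C (starRingEnd ℂ c) * Polynomial.X ^ m, fun t => ?_⟩
        rw [← Complex.conj_re]
        congr 1
        simp only [fourier_apply, AddCircle.toCircle_zsmul, zpow_neg, zpow_natCast,
          Polynomial.eval_mul, Polynomial.eval_C, Polynomial.eval_pow, Polynomial.eval_X,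
          map_mul, map_pow, RingHomCompTriple.comp_apply, RingHom.id_apply,
          Circle.coe_inv_eq_conj, Circle.coe_pow]
    | zero => exact fun c => ⟨0, fun t => by simp⟩
    | add x y _ _ hx hy =>
      intro c
      obtain ⟨P, hP⟩ := hx c
      obtain ⟨Q, hQ⟩ := hy c
      exact ⟨P + Q, fun t => by simp [hP, hQ, mul_add]⟩
    | smul a x _ hx =>
      intro c
      obtain ⟨P, hP⟩ := hx (c * a)
      exact ⟨P, fun t => by rw [hP]; simp [mul_assoc]⟩
  have hg' : g ∈ (Submodule.span ℂ (range (@fourier (2 * Real.pi)))).topologicalClosure := by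
    rw [span_fourier_closure_eq_top]; trivial
  rw [← SetLike.mem_coe, Submodule.topologicalClosure_coe, Metric.mem_closure_iff] at hg'
  obtain ⟨h, hh, hdist⟩ := hg' ε hε
  obtain ⟨P, hP⟩ := hspan h hh
  refine ⟨P, fun z hz => ?_⟩
  obtain ⟨t, ht⟩ : ∃ t : AddCircle (2 * Real.pi), ((AddCircle.toCircle t : Circle) : ℂ) = z := by
    have hz1 : z ∈ Submonoid.unitSphere ℂ := hz
    obtain ⟨t, ht⟩ := (AddCircle.homeomorphCircle Real.two_pi_pos.ne').surjective
      (⟨z, hz1⟩ : Circle)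
    refine ⟨t, ?_⟩
    rw [← AddCircle.homeomorphCircle_apply Real.two_pi_pos.ne', ht]
  have h1 : dist (g t) (h t) ≤ dist g h := ContinuousMap.dist_apply_le_dist t
  have h2 : |(h t - g t).re| ≤ ‖h t - g t‖ := Complex.abs_re_le_norm _
  rw [dist_comm, dist_eq_norm] at h1
  have h3 : (g t).re = u z := by simp [hg, ht]
  rw [← h3, ← ht, hP, ← Complex.sub_re]
  linarith

theorem re_polynomial_le_three_mul {P : Polynomial ℂ}
    (h0 : ∀ z ∈ ball (0 : ℂ) 1, 0 ≤ (P.eval z).re) {z : ℂ} (hz : ‖z‖ ≤ 1 / 2) :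
    (P.eval z).re ≤ 3 * (P.eval 0).re := by
  set b : ℂ := ((P.eval 0).im : ℂ) * I with hb
  set f : ℂ → ℂ := fun z => b - P.eval z with hf
  have hf0 : ‖f 0‖ = (P.eval 0).re := by
    have : f 0 = ((-(P.eval 0).re : ℝ) : ℂ) := by
      apply Complex.ext <;> simp [hf, hb]
    rw [this, norm_real, norm_neg, Real.norm_eq_abs, abs_of_nonneg (h0 0 (by simp))]
  have hd : DifferentiableOn ℂ f (ball 0 1) :=
    ((differentiable_const b).sub P.differentiable).differentiableOn
  have hz1 : z ∈ ball (0 : ℂ) 1 := by rw [mem_ball_zero_iff]; linarith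
  have hre : (P.eval z).re ≤ ‖f z‖ := by
    have h1 := Complex.abs_re_le_norm (f z)
    have h2 : (f z).re = -(P.eval z).re := by simp [hf, hb]
    rw [h2, abs_neg] at h1
    exact (le_abs_self _).trans h1
  refine le_of_forall_pos_le_add fun ε hε => ?_
  have key := Complex.borelCaratheodory (M := ε / 2) (by positivity) hd (fun w hw => by
    have : (f w).re = -(P.eval w).re := by simp [hf, hb]
    have h3 := h0 w hw
    simp only [mem_ofPred_eq, this]; linarith) one_pos hz1
  refine hre.trans (key.trans ?_)
  rw [hf0]
  have hz0 := norm_nonneg z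
  have hp : 0 < 1 - ‖z‖ := by linarith
  have hP0 := h0 0 (by simp)
  rw [← add_div, div_le_iff₀ hp]
  nlinarith

theorem contDiff_normSq_planar : ContDiff ℝ 2 (fun z : ℂ => normSq z) ∧
    ∀ z : ℂ, lap2 (fun z : ℂ => normSq z) z 1 = 4 := by
  have h : (fun z : ℂ => normSq z) = fun z : ℂ => 1 * z.im ^ 2 + 1 * z.re ^ 2 + 0 * z.re := by
    ext z; rw [normSq_apply]; ring
  rw [h]
  refine ⟨contDiff_iff_contDiffAt.2 fun z => (fderiv_quadratic_planar 1 1 0 z).1, fun z => ?_⟩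
  rw [(fderiv_quadratic_planar 1 1 0 z).2]; norm_num

theorem planar_max_principle_disc {u : ℂ → ℝ} {m : ℝ} (hu : ContinuousOn u (closedBall 0 1))
    (hu2 : ∀ z ∈ ball (0 : ℂ) 1, ContDiffAt ℝ 2 u z) (hlap : ∀ z ∈ ball (0 : ℂ) 1, 0 ≤ lap2 u z 1)
    (hb : ∀ z ∈ sphere (0 : ℂ) 1, u z ≤ m) : ∀ z ∈ closedBall (0 : ℂ) 1, u z ≤ m := by
  refine planar_max_principle (isCompact_closedBall 0 1) (B := sphere 0 1) hu ?_ hb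
  rintro z ⟨hz, hzs⟩
  have hzb : z ∈ ball (0 : ℂ) 1 := by
    rw [mem_closedBall] at hz
    rw [mem_sphere] at hzs
    exact mem_ball.2 (lt_of_le_of_ne hz hzs)
  exact ⟨mem_of_superset (isOpen_ball.mem_nhds hzb) ball_subset_closedBall, hu2 z hzb, hlap z hzb⟩

/-- Harnack-type comparison on the unit disc between a nonpositive subharmonic function and a
function dominated by its negative on the boundary. -/
theorem harnack_comparison {v w : ℂ → ℝ} {δ a : ℝ} (ha : 0 ≤ a)
    (hv : ContinuousOn v (closedBall 0 1)) (hv2 : ∀ z ∈ ball (0 : ℂ) 1, ContDiffAt ℝ 2 v z)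
    (hvl : ∀ z ∈ ball (0 : ℂ) 1, 0 ≤ lap2 v z 1) (hv0 : ∀ z ∈ sphere (0 : ℂ) 1, v z ≤ 0)
    (hvδ : -δ ≤ v 0)
    (hw : ContinuousOn w (closedBall 0 1)) (hw2 : ∀ z ∈ ball (0 : ℂ) 1, ContDiffAt ℝ 2 w z)
    (hwl : ∀ z ∈ ball (0 : ℂ) 1, -a ≤ lap2 w z 1) (hwv : ∀ z ∈ sphere (0 : ℂ) 1, w z ≤ -v z)
    {z : ℂ} (hz : ‖z‖ ≤ 1 / 2) : w z ≤ 3 * δ + a := by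
  refine le_of_forall_pos_le_add fun ε hε => ?_
  obtain ⟨P₀, hP₀⟩ := exists_polynomial_re_near (u := fun z => -v z) (ε := ε / 6)
    ((hv.mono sphere_subset_closedBall).neg) (by positivity)
  set P := P₀ + Polynomial.C ((ε / 6 : ℝ) : ℂ) with hP
  have hPre : ∀ z, (P.eval z).re = (P₀.eval z).re + ε / 6 := fun z => by
    simp only [hP, Polynomial.eval_add, Polynomial.eval_C, Complex.add_re, Complex.ofReal_re]
  have hPs : ∀ z ∈ sphere (0 : ℂ) 1, -v z ≤ (P.eval z).re ∧ (P.eval z).re ≤ -v z + ε / 3 := by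
    intro z hz
    have := abs_le.1 (hP₀ z hz)
    rw [hPre]; constructor <;> linarith
  have hPc : ContinuousOn (fun z => (P.eval z).re) (closedBall 0 1) := fun z _ =>
    (lap2_re_polynomial P z).1.continuousAt.continuousWithinAt
  have h1 := planar_max_principle_disc (u := fun z => v z + (P.eval z).re) (m := ε / 3)
    (hv.add hPc) (fun z hz => (hv2 z hz).add (lap2_re_polynomial P z).1)
    (fun z hz => by
      rw [lap2_add (hv2 z hz) (lap2_re_polynomial P z).1, (lap2_re_polynomial P z).2, add_zero]
      exact hvl z hz)
    (fun z hz => by have := hPs z hz; linarith) 0 (by simp)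
  have hneg : ∀ z : ℂ, ContDiffAt ℝ 2 (fun z => ((-P).eval z).re) z :=
    fun z => (lap2_re_polynomial (-P) z).1
  have h2 := planar_max_principle_disc (u := fun z => ((-P).eval z).re) (m := 0)
    (fun z _ => (hneg z).continuousAt.continuousWithinAt) (fun z _ => hneg z)
    (fun z _ => (lap2_re_polynomial (-P) z).2.ge)
    (fun z hz => by
      have := hPs z hz
      have := hv0 z hz
      simp only [Polynomial.eval_neg, Complex.neg_re]; linarith)
  have h3 := re_polynomial_le_three_mul (P := P) (fun z hz => by
    have := h2 z (ball_subset_closedBall hz)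
    simp only [Polynomial.eval_neg, Complex.neg_re] at this; linarith) hz
  have hq : ∀ z : ℂ, ContDiffAt ℝ 2 (fun z : ℂ => a / 4 * normSq z) z := fun z =>
    (contDiff_const.mul contDiff_normSq_planar.1).contDiffAt
  have hql : ∀ z : ℂ, lap2 (fun z : ℂ => a / 4 * normSq z) z 1 = a := fun z => by
    have := lap2_clm_comp ((a / 4) • ContinuousLinearMap.id ℝ ℝ)
      (contDiff_normSq_planar.1.contDiffAt (x := z)) 1
    simp only [contDiff_normSq_planar.2 z, smul_apply, id_apply,
      smul_eq_mul] at this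
    rw [this]; ring
  have h4 := planar_max_principle_disc
    (u := fun z => w z - (P.eval z).re + a / 4 * normSq z) (m := a / 4)
    ((hw.sub hPc).add fun z _ => (hq z).continuousAt.continuousWithinAt)
    (fun z hz => ((hw2 z hz).sub (lap2_re_polynomial P z).1).add (hq z))
    (fun z hz => by
      rw [lap2_add ((hw2 z hz).sub (lap2_re_polynomial P z).1) (hq z),
        lap2_sub (hw2 z hz) (lap2_re_polynomial P z).1, (lap2_re_polynomial P z).2, hql]
      have := hwl z hz
      linarith)
    (fun z hz => by
      have h5 := hPs z hz
      have h6 := hwv z hz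
      have : normSq z = 1 := by
        rw [← Complex.sq_norm, mem_sphere_zero_iff_norm.1 hz, one_pow]
      rw [this]; linarith) z (by rw [mem_closedBall_zero_iff]; linarith)
  have h5 : 0 ≤ a / 4 * normSq z := mul_nonneg (by positivity) (Complex.normSq_nonneg z)
  beta_reduce at h1 h4
  linarith

theorem tendstoLocallyUniformlyOn_of_equicontinuous {X Y : Type*} [PseudoMetricSpace X]
    [PseudoMetricSpace Y] {U : Set X} {f : ℕ → X → Y} {F : X → Y}
    (hpt : ∀ x ∈ U, Tendsto (fun n => f n x) atTop (𝓝 (F x)))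
    (heq : ∀ x ∈ U, ∀ ε > 0, ∃ r > 0, ∀ᶠ n in atTop, ∀ y ∈ ball x r, dist (f n y) (f n x) ≤ ε) :
    TendstoLocallyUniformlyOn f F atTop U := by
  rw [Metric.tendstoLocallyUniformlyOn_iff]
  intro ε hε x hx
  obtain ⟨r, hr, h⟩ := heq x hx (ε / 4) (by positivity)
  have hlim : ∀ y ∈ U ∩ ball x r, dist (F y) (F x) ≤ ε / 4 := fun y hy =>
    le_of_tendsto ((hpt y hy.1).dist (hpt x hx)) (h.mono fun n hn => hn y hy.2)
  refine ⟨U ∩ ball x r, inter_mem self_mem_nhdsWithin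
    (mem_nhdsWithin_of_mem_nhds (ball_mem_nhds x hr)), ?_⟩
  filter_upwards [h, (Metric.tendsto_nhds.1 (hpt x hx)) (ε / 4) (by positivity)] with n h1 h2 y hy
  have h3 := h1 y hy.2
  have h4 := hlim y hy
  have := dist_triangle4 (F y) (F x) (f n x) (f n y)
  rw [dist_comm (F x), dist_comm (f n x) (f n y)] at this
  linarith

/-- Arzelà–Ascoli for sequences that are eventually pointwise bounded and equicontinuous. -/
theorem exists_subseq_tendstoLocallyUniformlyOn {X W : Type*} [MetricSpace X]
    [SecondCountableTopology X] [MetricSpace W] [ProperSpace W] {U : Set X} {f : ℕ → X → W} (c : W)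
    (hb : ∀ x ∈ U, ∃ C, ∀ᶠ n in atTop, dist (f n x) c ≤ C)
    (heq : ∀ x ∈ U, ∀ ε > 0, ∃ r > 0, ∀ᶠ n in atTop, ∀ y ∈ ball x r, dist (f n y) (f n x) ≤ ε) :
    ∃ φ : ℕ → ℕ, StrictMono φ ∧ ∃ F : X → W,
      TendstoLocallyUniformlyOn (fun k => f (φ k)) F atTop U := by
  obtain ⟨S, hSc, hSd⟩ := TopologicalSpace.exists_countable_dense U
  have := hSc.to_subtype
  have hb' : ∀ s : S, ∃ C : ℝ, ∃ N : ℕ, ∀ n ≥ N, dist (f n (s : U)) c ≤ C := fun s => by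
    obtain ⟨C, hC⟩ := hb (s : U) (s : U).2
    obtain ⟨N, hN⟩ := eventually_atTop.1 hC
    exact ⟨C, N, hN⟩
  choose C N hN using hb'
  have hK : IsCompact (Set.pi univ fun s : S => closedBall c (max 0 (C s))) :=
    isCompact_univ_pi fun s => isCompact_closedBall c _
  obtain ⟨a, -, φ, hφ, hlim⟩ := hK.tendsto_subseq (x := fun n (s : S) =>
    if N s ≤ n then f n (s : U) else c) (fun n s _ => by
      by_cases h : N s ≤ n
      · simp only [h, if_true]; exact (hN s n h).trans (le_max_right _ _)
      · simp [h])
  have hpt : ∀ s : S, Tendsto (fun k => f (φ k) (s : U)) atTop (𝓝 (a s)) := fun s => by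
    have h1 := (tendsto_pi_nhds.1 hlim) s
    refine h1.congr' ?_
    filter_upwards [hφ.tendsto_atTop.eventually_ge_atTop (N s)] with k hk
    simp [hk]
  have hcauchy : ∀ x ∈ U, ∃ y, Tendsto (fun k => f (φ k) x) atTop (𝓝 y) := by
    intro x hx
    refine cauchySeq_tendsto_of_complete (Metric.cauchySeq_iff'.2 fun ε hε => ?_)
    obtain ⟨r, hr, h⟩ := heq x hx (ε / 4) (by positivity)
    obtain ⟨s, hs, hsx⟩ := hSd.exists_mem_open (U := {y : U | dist (y : X) x < r})
      (isOpen_lt (continuous_subtype_val.dist continuous_const) continuous_const)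
      ⟨⟨x, hx⟩, by simpa using hr⟩
    have h1 := (Metric.tendsto_nhds.1 (hpt ⟨s, hs⟩)) (ε / 8) (by positivity)
    obtain ⟨M, hM⟩ := eventually_atTop.1 ((hφ.tendsto_atTop.eventually h).and h1)
    refine ⟨M, fun k hk => ?_⟩
    obtain ⟨h2, h3⟩ := hM k hk
    obtain ⟨h4, h5⟩ := hM M le_rfl
    have h6 := h2 s hsx
    have h7 := h4 s hsx
    have t1 := dist_triangle4 (f (φ k) x) (f (φ k) s) (f (φ M) s) (f (φ M) x)
    have t2 := dist_triangle_right (f (φ k) s) (f (φ M) s) (a ⟨s, hs⟩)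
    rw [dist_comm] at h6
    linarith
  have : Nonempty W := ⟨c⟩
  choose! F hF using hcauchy
  refine ⟨φ, hφ, F, tendstoLocallyUniformlyOn_of_equicontinuous hF fun x hx ε hε => ?_⟩
  obtain ⟨r, hr, h⟩ := heq x hx ε hε
  exact ⟨r, hr, hφ.tendsto_atTop.eventually h⟩

/-- A locally uniform limit of maps with equicontinuous derivatives is differentiable and the
derivatives converge locally uniformly. -/
theorem differentiableAt_of_equicontinuous_fderiv [ProperSpace V] [CompleteSpace W]
    {U : Set V} (hU : IsOpen U) {f : ℕ → V → W} {F : V → W}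
    (hf : TendstoLocallyUniformlyOn f F atTop U)
    (heq : ∀ x ∈ U, ∀ ε > 0, ∃ r > 0, ∀ᶠ n in atTop, ∀ y ∈ ball x r, DifferentiableAt ℝ (f n) y ∧
      ‖fderiv ℝ (f n) y - fderiv ℝ (f n) x‖ ≤ ε) :
    (∀ x ∈ U, DifferentiableAt ℝ F x) ∧
      TendstoLocallyUniformlyOn (fun n => fderiv ℝ (f n)) (fderiv ℝ F) atTop U := by
  have hcauchy : ∀ x ∈ U, ∃ L, Tendsto (fun n => fderiv ℝ (f n) x) atTop (𝓝 L) := by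
    intro x hx
    refine cauchySeq_tendsto_of_complete (Metric.cauchySeq_iff'.2 fun ε hε => ?_)
    obtain ⟨r, hr, h⟩ := heq x hx (ε / 8) (by positivity)
    obtain ⟨t, ht, htr, htU⟩ : ∃ t > 0, t < r ∧ closedBall x t ⊆ U := by
      obtain ⟨t, ht, h⟩ := Metric.isOpen_iff.1 hU x hx
      exact ⟨min (t / 2) (r / 2), by positivity, (min_le_right _ _).trans_lt (by linarith),
        (closedBall_subset_ball ((min_le_left _ _).trans_lt (by linarith))).trans h⟩
    have hu := ((tendstoLocallyUniformlyOn_iff_forall_isCompact hU).1 hf) _ htU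
      (isCompact_closedBall x t)
    rw [Metric.tendstoUniformlyOn_iff] at hu
    obtain ⟨M, hM⟩ := eventually_atTop.1 (h.and (hu (ε * t / 32) (by positivity)))
    refine ⟨M, fun k hk => ?_⟩
    have key : ∀ n ≥ M, ∀ v : V, ‖v‖ ≤ t → ‖f n (x + v) - f n x - fderiv ℝ (f n) x v‖ ≤
        ε / 8 * ‖v‖ := by
      intro n hn v hv
      have := (convex_ball x r).norm_image_sub_le_of_norm_fderiv_le' (𝕜 := ℝ) (f := f n)
        (φ := fderiv ℝ (f n) x) (C := ε / 8) (x := x) (y := x + v)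
        (fun y hy => ((hM n hn).1 y hy).1) (fun y hy => ((hM n hn).1 y hy).2)
        (mem_ball_self hr) (by simpa using hv.trans_lt htr)
      simpa using this
    rw [dist_eq_norm]
    refine lt_of_le_of_lt (ContinuousLinearMap.opNorm_le_of_shell (f := fderiv ℝ (f k) x -
      fderiv ℝ (f M) x) (ε := t) ht (C := ε * (3 / 4)) (by positivity) (c := (2 : ℝ))
      (by norm_num) ?_) (by linarith)
    intro v hv1 hv2
    have hv : ‖v‖ ≤ t := hv2.le
    have a1 := key k hk v hv
    have a2 := key M le_rfl v hv
    have hxv : x + v ∈ closedBall x t := by simpa using hv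
    have b1 := (hM k hk).2 _ hxv
    have b2 := (hM M le_rfl).2 _ hxv
    have b3 := (hM k hk).2 _ (mem_closedBall_self ht.le)
    have b4 := (hM M le_rfl).2 _ (mem_closedBall_self ht.le)
    rw [dist_eq_norm] at b1 b2 b3 b4
    have e : (fderiv ℝ (f k) x - fderiv ℝ (f M) x) v =
        ((f M (x + v) - f M x - fderiv ℝ (f M) x v) - (f k (x + v) - f k x - fderiv ℝ (f k) x v)) +
        (((F (x + v) - f M (x + v)) - (F (x + v) - f k (x + v))) +
        ((F x - f k x) - (F x - f M x))) := by
      rw [sub_apply]; abel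
    rw [e]
    refine (norm_add_le _ _).trans ?_
    have c1 := norm_sub_le (f M (x + v) - f M x - fderiv ℝ (f M) x v)
      (f k (x + v) - f k x - fderiv ℝ (f k) x v)
    have c2 := norm_add_le ((F (x + v) - f M (x + v)) - (F (x + v) - f k (x + v)))
      ((F x - f k x) - (F x - f M x))
    have c3 := norm_sub_le (F (x + v) - f M (x + v)) (F (x + v) - f k (x + v))
    have c4 := norm_sub_le (F x - f k x) (F x - f M x)
    have hvt : t ≤ 2 * ‖v‖ := by
      rw [Real.norm_of_nonneg (by norm_num : (0:ℝ) ≤ 2)] at hv1; linarith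
    nlinarith
  choose! F' hF' using hcauchy
  have hloc : TendstoLocallyUniformlyOn (fun n => fderiv ℝ (f n)) F' atTop U := by
    refine tendstoLocallyUniformlyOn_of_equicontinuous hF' fun x hx ε hε => ?_
    obtain ⟨r, hr, h⟩ := heq x hx ε hε
    exact ⟨r, hr, h.mono fun n hn y hy => (dist_eq_norm _ _).trans_le (hn y hy).2⟩
  have hderiv : ∀ x ∈ U, HasFDerivAt F (F' x) x := by
    intro x hx
    refine hasFDerivAt_of_tendstoUniformlyOnFilter (l := atTop) (f := f)
      (f' := fun n => fderiv ℝ (f n)) ?_ ?_ ?_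
    · have := tendstoLocallyUniformlyOn_iff_filter.1 hloc x hx
      rwa [hU.nhdsWithin_eq hx] at this
    · obtain ⟨r, hr, h⟩ := heq x hx 1 one_pos
      exact (h.prod_mk (ball_mem_nhds x hr)).mono fun p hp => (hp.1 _ hp.2).1.hasFDerivAt
    · filter_upwards [hU.mem_nhds hx] with y hy
      exact hf.tendsto_at hy
  exact ⟨fun x hx => (hderiv x hx).differentiableAt,
    hloc.congr_right fun x hx => (hderiv x hx).fderiv.symm⟩

section Levi

variable {V' : Type*} [NormedAddCommGroup V'] [NormedSpace ℝ V']

/-- The first-order coefficient `DJ(v)(Jv) - DJ(Jv)v` of the Levi operator of `J`. -/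
def levTorsion (J : V → V →L[ℝ] V) (x v : V) : V :=
  fderiv ℝ J x v (J x v) - fderiv ℝ J x (J x v) v

/-- The Levi operator of `J` on vector-valued maps, expanded in second derivatives. -/
def lev (J : V → V →L[ℝ] V) (u : V → W) (x v : V) : W :=
  fderiv ℝ (fderiv ℝ u) x v v + fderiv ℝ (fderiv ℝ u) x (J x v) (J x v)
    - fderiv ℝ u x (levTorsion J x v)

theorem fderiv_clm_comp_apply_apply
    {A : U → V →L[ℝ] W} {B : U → V' →L[ℝ] V} {x : U} (hA : DifferentiableAt ℝ A x)
    (hB : DifferentiableAt ℝ B x) (a : U) (b : V') :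
    fderiv ℝ (fun y => (A y).comp (B y)) x a b =
      fderiv ℝ A x a (B x b) + A x (fderiv ℝ B x a b) := by
  rw [(hA.hasFDerivAt.clm_comp hB.hasFDerivAt).fderiv]
  simp [add_comm]

theorem leviForm_eq_lev {J : E → E →L[ℝ] E} {u : E → ℝ} {x X : E} (hu : ContDiffAt ℝ 2 u x)
    (hJ : DifferentiableAt ℝ J x) (hsq : (J x).comp (J x) = -(ContinuousLinearMap.id ℝ E)) :
    leviForm J u x X = lev J u x X := by
  have hJJ : J x (J x X) = -X := by
    have := congrArg (fun L : E →L[ℝ] E => L X) hsq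
    simpa using this
  unfold leviForm lev levTorsion
  rw [fderiv_clm_comp_apply_apply hu.differentiableAt_fderiv_two hJ,
    fderiv_clm_comp_apply_apply hu.differentiableAt_fderiv_two hJ, hJJ]
  simp only [map_neg, map_sub]
  ring

theorem lev_Jst (u : E → W) (x v : E) :
    lev (fun _ => Jst E) u x v = lap2 u x v := by
  simp [lev, lap2, levTorsion, Jst]

/-- Chain rule for the Levi operator along a holomorphic map. -/
theorem lev_comp {J₁ : V → V →L[ℝ] V} {J₂ : V' → V' →L[ℝ] V'} {φ : V → V'} {u : V' → W} {x : V}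
    (hu : ContDiffAt ℝ 2 u (φ x)) (hφ : ContDiffAt ℝ 2 φ x)
    (hhol : (fderiv ℝ φ x).comp (J₁ x) = (J₂ (φ x)).comp (fderiv ℝ φ x)) (X : V) :
    lev J₁ (fun y => u (φ y)) x X =
      fderiv ℝ (fderiv ℝ u) (φ x) (fderiv ℝ φ x X) (fderiv ℝ φ x X)
      + fderiv ℝ (fderiv ℝ u) (φ x) (J₂ (φ x) (fderiv ℝ φ x X)) (J₂ (φ x) (fderiv ℝ φ x X))
      + fderiv ℝ u (φ x) (lev J₁ φ x X) := by
  have h : fderiv ℝ φ x (J₁ x X) = J₂ (φ x) (fderiv ℝ φ x X) :=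
    congrArg (fun L : V →L[ℝ] V' => L X) hhol
  unfold lev
  rw [fderiv_fderiv_comp_apply hu hφ, fderiv_fderiv_comp_apply hu hφ, h,
    fderiv_fun_comp x (hu.differentiableAt (by norm_num)) (hφ.differentiableAt (by norm_num))]
  simp only [comp_apply, map_add, map_sub]
  abel

/-- A holomorphic map satisfies a second order equation with right-hand side quadratic in its
first derivative. -/
theorem lev_of_holomorphic {J₁ : V → V →L[ℝ] V} {J₂ : V' → V' →L[ℝ] V'} {φ : V → V'} {x : V}
    (hφ : ContDiffAt ℝ 2 φ x) (h₁ : DifferentiableAt ℝ J₁ x) (h₂ : DifferentiableAt ℝ J₂ (φ x))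
    (hhol : ∀ᶠ y in 𝓝 x, (fderiv ℝ φ y).comp (J₁ y) = (J₂ (φ y)).comp (fderiv ℝ φ y))
    (hsq : ∀ v, J₁ x (J₁ x v) = -v) (X : V) :
    lev J₁ φ x X = -levTorsion J₂ (φ x) (fderiv ℝ φ x X) := by
  have h : ∀ v, fderiv ℝ φ x (J₁ x v) = J₂ (φ x) (fderiv ℝ φ x v) := fun v =>
    congrArg (fun L : V →L[ℝ] V' => L v) hhol.self_of_nhds
  have hφ1 := hφ.differentiableAt (by norm_num)
  have key : ∀ Y Z : V, fderiv ℝ (fderiv ℝ φ) x Y (J₁ x Z) + fderiv ℝ φ x (fderiv ℝ J₁ x Y Z) =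
      fderiv ℝ J₂ (φ x) (fderiv ℝ φ x Y) (fderiv ℝ φ x Z)
        + J₂ (φ x) (fderiv ℝ (fderiv ℝ φ) x Y Z) := by
    intro Y Z
    have e := congrArg (fun L : V →L[ℝ] V →L[ℝ] V' => L Y Z)
      (Filter.EventuallyEq.fderiv_eq (𝕜 := ℝ) (f := fun y => (J₂ (φ y)).comp (fderiv ℝ φ y)) hhol)
    beta_reduce at e
    rw [fderiv_clm_comp_apply_apply hφ.differentiableAt_fderiv_two h₁,
      fderiv_clm_comp_apply_apply (A := fun y => J₂ (φ y)) (h₂.comp x hφ1)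
        hφ.differentiableAt_fderiv_two, fderiv_fun_comp x h₂ hφ1] at e
    simpa using e
  have k1 := key X (J₁ x X)
  have k2 := key (J₁ x X) X
  rw [hsq, h] at k1
  rw [h, ← fderiv_fderiv_symm hφ X] at k2
  unfold lev levTorsion
  rw [map_sub]
  rw [map_neg] at k1
  have e1 : fderiv ℝ (fderiv ℝ φ) x X X = fderiv ℝ φ x (fderiv ℝ J₁ x X (J₁ x X)) -
      (fderiv ℝ J₂ (φ x) (fderiv ℝ φ x X) (J₂ (φ x) (fderiv ℝ φ x X))
        + J₂ (φ x) (fderiv ℝ (fderiv ℝ φ) x X (J₁ x X))) := by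
    rw [← k1]; abel
  have e2 : fderiv ℝ (fderiv ℝ φ) x (J₁ x X) (J₁ x X) =
      (fderiv ℝ J₂ (φ x) (J₂ (φ x) (fderiv ℝ φ x X)) (fderiv ℝ φ x X)
        + J₂ (φ x) (fderiv ℝ (fderiv ℝ φ) x X (J₁ x X)))
      - fderiv ℝ φ x (fderiv ℝ J₁ x (J₁ x X) X) := by
    rw [← k2]; abel
  rw [e1, e2]
  abel

/-- Biholomorphic invariance of the Levi operator. -/
theorem lev_comp_of_holomorphic {J₁ : V → V →L[ℝ] V} {J₂ : V' → V' →L[ℝ] V'} {φ : V → V'}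
    {u : V' → W} {x : V} (hu : ContDiffAt ℝ 2 u (φ x))
    (hφ : ContDiffAt ℝ 2 φ x) (h₁ : DifferentiableAt ℝ J₁ x) (h₂ : DifferentiableAt ℝ J₂ (φ x))
    (hhol : ∀ᶠ y in 𝓝 x, (fderiv ℝ φ y).comp (J₁ y) = (J₂ (φ y)).comp (fderiv ℝ φ y))
    (hsq : ∀ v, J₁ x (J₁ x v) = -v) (X : V) :
    lev J₁ (fun y => u (φ y)) x X = lev J₂ u (φ x) (fderiv ℝ φ x X) := by
  rw [lev_comp hu hφ hhol.self_of_nhds, lev_of_holomorphic hφ h₁ h₂ hhol hsq, map_neg,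
    ← sub_eq_add_neg]
  rfl

end Levi

/-- A `(Jst, J)`-holomorphic map: the complex Laplacians are the torsion of `J`. -/
theorem lap2_of_holomorphic
    {J : V → V →L[ℝ] V} {φ : E → V} {x : E} (hφ : ContDiffAt ℝ 2 φ x)
    (hJ : DifferentiableAt ℝ J (φ x))
    (hhol : ∀ᶠ y in 𝓝 x, (fderiv ℝ φ y).comp (Jst E) = (J (φ y)).comp (fderiv ℝ φ y)) (X : E) :
    lap2 φ x X = -levTorsion J (φ x) (fderiv ℝ φ x X) := by
  rw [← lev_Jst]
  refine lev_of_holomorphic hφ (differentiableAt_const _) hJ hhol (fun v => ?_) X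
  simp [Jst, smul_smul]

theorem lap2_comp_of_holomorphic
    {J : V → V →L[ℝ] V} {φ : E → V} {u : V → W} {x : E} (hu : ContDiffAt ℝ 2 u (φ x))
    (hφ : ContDiffAt ℝ 2 φ x) (hJ : DifferentiableAt ℝ J (φ x))
    (hhol : ∀ᶠ y in 𝓝 x, (fderiv ℝ φ y).comp (Jst E) = (J (φ y)).comp (fderiv ℝ φ y)) (X : E) :
    lap2 (fun y => u (φ y)) x X = lev J u (φ x) (fderiv ℝ φ x X) := by
  rw [← lev_Jst]
  refine lev_comp_of_holomorphic hu hφ (differentiableAt_const _) hJ hhol (fun v => ?_) X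
  simp [Jst, smul_smul]

theorem norm_levTorsion_le
    {J : V → V →L[ℝ] V} {x : V} {K : ℝ} (hJ : ‖J x‖ ≤ K) (hDJ : ‖fderiv ℝ J x‖ ≤ K) (v : V) :
    ‖levTorsion J x v‖ ≤ 2 * K ^ 2 * ‖v‖ ^ 2 := by
  have hK : 0 ≤ K := (norm_nonneg _).trans hJ
  have hJv : ‖J x v‖ ≤ K * ‖v‖ := (J x).le_of_opNorm_le hJ v
  have h : ∀ a b : V, ‖fderiv ℝ J x a b‖ ≤ K * ‖a‖ * ‖b‖ := fun a b =>
    ((fderiv ℝ J x).le_opNorm₂ a b).trans (by gcongr)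
  have h1 := h v (J x v)
  have h2 := h (J x v) v
  have h3 := norm_sub_le (fderiv ℝ J x v (J x v)) (fderiv ℝ J x (J x v) v)
  have h4 : K * ‖v‖ * ‖J x v‖ ≤ K * ‖v‖ * (K * ‖v‖) := by gcongr
  unfold levTorsion
  nlinarith

theorem lap2_const_smul {f : E → W} {x : E}
    (c : ℝ) (hf : ContDiffAt ℝ 2 f x) (v : E) :
    lap2 (fun y => c • f y) x v = c • lap2 f x v := by
  simpa using lap2_clm_comp (c • ContinuousLinearMap.id ℝ W) hf v

theorem lap2_const_mul {f : E → ℝ} {x : E} (c : ℝ) (hf : ContDiffAt ℝ 2 f x) (v : E) :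
    lap2 (fun y => c * f y) x v = c * lap2 f x v := lap2_const_smul c hf v

theorem contDiffAt_log_norm_planar {z : ℂ} (hz : z ≠ 0) :
    ContDiffAt ℝ 2 (fun w : ℂ => Real.log ‖w‖) z ∧ lap2 (fun w : ℂ => Real.log ‖w‖) z 1 = 0 := by
  have h := (analyticAt_id (𝕜 := ℂ) (z := z)).harmonicAt_log_norm hz
  refine ⟨h.1, ?_⟩
  have h2 := h.2.self_of_nhds
  rw [InnerProductSpace.laplacian_eq_iteratedFDeriv_complexPlane] at h2
  simp only [iteratedFDeriv_two_apply, Matrix.cons_val_zero, Matrix.cons_val_one,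
    Pi.zero_apply, id] at h2
  simpa [lap2] using h2

/-- A bounded subharmonic function on a large disc cannot have Laplacian bounded below on a small
disc. -/
theorem radius_le_of_subharmonic {u : ℂ → ℝ} {R M a s : ℝ} (ha : 0 < a) (hs : 0 < s)
    (hM : ∀ z ∈ ball (0 : ℂ) R, |u z| ≤ M) (hu : ∀ z ∈ ball (0 : ℂ) R, ContDiffAt ℝ 2 u z)
    (hlap : ∀ z ∈ ball (0 : ℂ) R, 0 ≤ lap2 u z 1)
    (hlap' : ∀ z ∈ ball (0 : ℂ) R, ‖z‖ ≤ 2 * s → a ≤ lap2 u z 1) :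
    R ≤ 4 * s * Real.exp (8 * M / (3 * a * s ^ 2)) := by
  by_contra hcon
  push Not at hcon
  have hR : 0 < R := lt_of_le_of_lt (by positivity) hcon
  have hM0 : 0 ≤ M := (abs_nonneg _).trans (hM 0 (mem_ball_self hR))
  have hexp1 : 1 ≤ Real.exp (8 * M / (3 * a * s ^ 2)) := Real.one_le_exp (by positivity)
  have hsR : 2 * s < R / 2 := by nlinarith
  set T := R / (2 * s) with hT
  have hT2 : 2 < T := by rw [hT, lt_div_iff₀ (by positivity)]; linarith
  have hlogT : 8 * M / (3 * a * s ^ 2) < Real.log T := by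
    rw [Real.lt_log_iff_exp_lt (by linarith), hT, lt_div_iff₀ (by positivity)]
    nlinarith [Real.exp_pos (8 * M / (3 * a * s ^ 2))]
  have hlogT0 : 0 < Real.log T := Real.log_pos (by linarith)
  have hmem : ∀ z : ℂ, ‖z‖ ≤ R / 2 → z ∈ ball (0 : ℂ) R := fun z hz => by
    rw [mem_ball_zero_iff]; linarith
  have hcu : ContinuousOn u (closedBall 0 (R / 2)) := fun z hz =>
    (hu z (hmem z (by simpa using hz))).continuousAt.continuousWithinAt
  obtain ⟨m, hm, hmM⟩ : ∃ m, (∀ z ∈ sphere (0 : ℂ) s, u z ≤ m) ∧ ∃ z ∈ sphere (0 : ℂ) s, u z = m := by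
    obtain ⟨w, hw, hmax⟩ := (isCompact_sphere (0 : ℂ) s).exists_isMaxOn
      (NormedSpace.sphere_nonempty.2 hs.le) (hcu.mono (sphere_subset_closedBall.trans
        (closedBall_subset_closedBall (by linarith))))
    exact ⟨u w, fun z hz => hmax hz, w, hw, rfl⟩
  have step1 : ∀ z ∈ closedBall (0 : ℂ) (R / 2) \ ball 0 s,
      u z + (-(2 * M / Real.log T)) * Real.log ‖z‖ ≤ m + (-(2 * M / Real.log T)) * Real.log s := by
    have hpos : ∀ z ∈ closedBall (0 : ℂ) (R / 2) \ ball 0 s, z ≠ 0 ∧ s ≤ ‖z‖ ∧ ‖z‖ ≤ R / 2 := by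
      rintro z ⟨h1, h2⟩
      rw [mem_ball_zero_iff, not_lt] at h2
      exact ⟨norm_pos_iff.1 (by linarith), h2, by simpa using h1⟩
    refine planar_max_principle ((isCompact_closedBall _ _).diff isOpen_ball)
      (B := sphere 0 s ∪ sphere 0 (R / 2)) ?_ ?_ ?_
    · refine (hcu.mono sdiff_subset).add (continuousOn_const.mul fun z hz => ?_)
      exact (contDiffAt_log_norm_planar (hpos z hz).1).1.continuousAt.continuousWithinAt
    · rintro z ⟨hz, hzB⟩
      obtain ⟨h0, h1, h2⟩ := hpos z hz
      simp only [mem_union, mem_sphere_zero_iff_norm, not_or] at hzB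
      have hlog := contDiffAt_log_norm_planar h0
      have hz' := hmem z h2
      refine ⟨?_, (hu z hz').add (contDiffAt_const.mul hlog.1), ?_⟩
      · refine mem_of_superset ((isOpen_ball.sdiff isClosed_closedBall).mem_nhds
          (x := z) (s := ball (0:ℂ) (R / 2) \ closedBall 0 s) ⟨?_, ?_⟩)
          (sdiff_subset_sdiff ball_subset_closedBall ball_subset_closedBall)
        · rw [mem_ball_zero_iff]; exact lt_of_le_of_ne h2 hzB.2
        · rw [mem_closedBall_zero_iff, not_le]; exact lt_of_le_of_ne h1 (Ne.symm hzB.1)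
      · rw [lap2_add (hu z hz') (contDiffAt_const.mul hlog.1), lap2_const_mul _ hlog.1, hlog.2]
        simpa using hlap z hz'
    · rintro z (hz | hz)
      · rw [mem_sphere_zero_iff_norm.1 hz]; linarith [hm z hz]
      · rw [mem_sphere_zero_iff_norm] at hz
        obtain ⟨w, hw, hwm⟩ := hmM
        rw [mem_sphere_zero_iff_norm] at hw
        have h1 := (abs_le.1 (hM z (hmem z hz.le))).2
        have h2 := (abs_le.1 (hM w (hmem w (by linarith)))).1
        have h3 : Real.log (R / 2) = Real.log s + Real.log T := by
          rw [← Real.log_mul hs.ne' (by positivity), hT]; congr 1; field_simp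
        rw [hz, h3]
        have h4 : 2 * M / Real.log T * Real.log T = 2 * M := by field_simp
        nlinarith
  have step2 : ∀ z ∈ closedBall (0 : ℂ) (2 * s), u z + (-(a / 4)) * normSq z ≤
      m + 2 * M / Real.log T * Real.log 2 + (-(a / 4)) * (2 * s) ^ 2 := by
    have hm' : ∀ z ∈ closedBall (0 : ℂ) (2 * s), z ∈ ball (0 : ℂ) R := fun z hz =>
      hmem z (by rw [mem_closedBall_zero_iff] at hz; linarith)
    refine planar_max_principle (isCompact_closedBall _ _) (B := sphere 0 (2 * s)) ?_ ?_ ?_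
    · exact (hcu.mono (closedBall_subset_closedBall (by linarith))).add
        (continuousOn_const.mul contDiff_normSq_planar.1.continuous.continuousOn)
    · rintro z ⟨hz, hzs⟩
      have hz' := hm' z hz
      refine ⟨mem_of_superset (isOpen_ball.mem_nhds (x := z) ?_) ball_subset_closedBall,
        (hu z hz').add (contDiffAt_const.mul contDiff_normSq_planar.1.contDiffAt), ?_⟩
      · rw [mem_closedBall_zero_iff] at hz
        rw [mem_sphere_zero_iff_norm] at hzs
        exact mem_ball_zero_iff.2 (lt_of_le_of_ne hz hzs)
      · rw [lap2_add (hu z hz') (contDiffAt_const.mul contDiff_normSq_planar.1.contDiffAt),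
          lap2_const_mul _ contDiff_normSq_planar.1.contDiffAt, contDiff_normSq_planar.2]
        have := hlap' z hz' (by simpa using hz)
        linarith
    · intro z hz
      rw [mem_sphere_zero_iff_norm] at hz
      have h1 := step1 z ⟨by rw [mem_closedBall_zero_iff]; linarith,
        by rw [mem_ball_zero_iff]; linarith⟩
      rw [normSq_eq_norm_sq, hz]
      rw [hz, Real.log_mul (by norm_num) hs.ne'] at h1
      linarith
  obtain ⟨w, hw, hwm⟩ := hmM
  rw [mem_sphere_zero_iff_norm] at hw
  have h1 := step2 w (by rw [mem_closedBall_zero_iff]; linarith)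
  rw [normSq_eq_norm_sq, hw, hwm] at h1
  have hlog2 : Real.log 2 ≤ 1 := by linarith [Real.log_two_lt_d9]
  have h2 : 2 * M / Real.log T * Real.log 2 ≤ 2 * M / Real.log T :=
    mul_le_of_le_one_right (by positivity) hlog2
  have h3 : 3 * a * s ^ 2 * Real.log T ≤ 8 * M := by
    have : 3 * a * s ^ 2 / 4 ≤ 2 * M / Real.log T := by nlinarith
    rw [le_div_iff₀ hlogT0] at this
    linarith
  rw [div_lt_iff₀ (by positivity)] at hlogT
  linarith

/-- Interior gradient bound for holomorphic maps into a bounded strictly pseudoconvex region. -/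
theorem exists_norm_fderiv_le_of_strictPSH [ProperSpace E] {K M c : ℝ} (hc : 0 < c) :
    ∃ C > 0, ∀ (J : V → V →L[ℝ] V) (r : V → ℝ) (S : Set V) (f : E → V) (p : E) (ρ : ℝ), 0 < ρ →
      (∀ y ∈ S, ‖J y‖ ≤ K ∧ ‖fderiv ℝ J y‖ ≤ K ∧ DifferentiableAt ℝ J y ∧ ContDiffAt ℝ 2 r y ∧
        |r y| ≤ M ∧ ∀ X, c * ‖X‖ ^ 2 ≤ lev J r y X) →
      (∀ x ∈ ball p ρ, f x ∈ S ∧ ContDiffAt ℝ 2 f x ∧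
        (fderiv ℝ f x).comp (Jst E) = (J (f x)).comp (fderiv ℝ f x)) →
      ‖fderiv ℝ f p‖ ≤ C / ρ := by
  set H := 32 + 8 * K ^ 2 with hH
  have hH0 : 32 ≤ H := by rw [hH]; nlinarith [sq_nonneg K]
  set s := 1 / (2 * (4 * H) ^ 2) with hs
  have hs0 : 0 < s := by positivity
  have hs1 : 2 * s < 1 / 8 := by
    rw [hs, mul_one_div, div_lt_iff₀ (by positivity)]; nlinarith
  set R₀ := 4 * s * Real.exp (8 * M / (3 * (c / 16) * s ^ 2)) with hR₀
  have hR₀0 : 0 < R₀ := by positivity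
  refine ⟨4 * (R₀ + 1), by positivity, fun J r S f p ρ hρ hS hf => ?_⟩
  rcases (norm_nonneg (fderiv ℝ f p)).eq_or_lt with h0 | h0
  · rw [← h0]; positivity
  have hsub : closedBall p (ρ / 2) ⊆ ball p ρ := closedBall_subset_ball (by linarith)
  obtain ⟨x₀, d, hd, hdR, hball, hL, h1, h2⟩ := exists_doubling_point (m := fun x => ‖fderiv ℝ f x‖)
    (half_pos hρ) (fun y hy => ((hf y (hsub hy)).2.1.fderiv_right (m := 1)
      (by norm_num)).continuousAt.norm.continuousWithinAt) h0
  set L := ‖fderiv ℝ f x₀‖ with hLdef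
  suffices h : d * L / 2 ≤ R₀ + 1 by
    rw [le_div_iff₀ hρ]; linarith
  by_contra hcon
  push Not at hcon
  set R := d * L / 2 with hR
  obtain ⟨v, hv1, hv2⟩ : ∃ v : E, ‖v‖ ≤ 1 ∧ L / 2 ≤ ‖fderiv ℝ f x₀ v‖ := by
    by_contra hno
    push Not at hno
    have : ‖fderiv ℝ f x₀‖ ≤ L / 2 := opNorm_le_of_unit_norm (by positivity)
      fun v hv => (hno v hv.le).le
    linarith
  set e : E := L⁻¹ • v with he
  have heL : ‖e‖ ≤ L⁻¹ := by
    rw [he, norm_smul, Real.norm_of_nonneg (by positivity)]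
    exact mul_le_of_le_one_right (by positivity) hv1
  set φ : ℂ → V := fun ζ => f (x₀ + ζ • e) with hφ
  have hmem2 : ∀ ζ ∈ ball (0 : ℂ) R, x₀ + ζ • e ∈ ball x₀ (d / 2) := fun ζ hζ => by
    rw [mem_ball_zero_iff] at hζ
    rw [mem_ball_iff_norm, add_sub_cancel_left, norm_smul]
    calc ‖ζ‖ * ‖e‖ ≤ ‖ζ‖ * L⁻¹ := by gcongr
      _ < R * L⁻¹ := by gcongr
      _ = d / 2 := by rw [hR]; field_simp
  have hmem : ∀ ζ ∈ ball (0 : ℂ) R, x₀ + ζ • e ∈ ball p ρ := fun ζ hζ =>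
    hsub (ball_subset_closedBall (hball (ball_subset_ball (by linarith) (hmem2 ζ hζ))))
  have hφe : φ = fun ζ => f (x₀ + lineMap e ζ) := by ext; simp [hφ]
  have hφ2 : ∀ ζ ∈ ball (0 : ℂ) R, ContDiffAt ℝ 2 φ ζ := fun ζ hζ => by
    rw [hφe]
    refine ContDiffAt.comp (g := f) ζ ?_ (contDiff_const.add (lineMap e).contDiff).contDiffAt
    simpa using (hf _ (hmem ζ hζ)).2.1
  have hDφ : ∀ ζ ∈ ball (0 : ℂ) R, ∀ b, fderiv ℝ φ ζ b = fderiv ℝ f (x₀ + ζ • e) (b • e) :=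
    fun ζ hζ b => by
      have hd := (hf _ (hmem ζ hζ)).2.1.differentiableAt (by norm_num)
      have := fderiv_comp_affine (f := f) (c := x₀) (A := lineMap e) (x := ζ) (by simpa using hd)
      rw [hφe, this]; simp
  have hDφn : ∀ ζ ∈ ball (0 : ℂ) R, ‖fderiv ℝ φ ζ‖ ≤ 2 := fun ζ hζ =>
    opNorm_le_bound _ (by norm_num) fun b => by
      rw [hDφ ζ hζ]
      refine (le_opNorm _ _).trans ?_
      have := h2 _ (hmem2 ζ hζ)
      rw [norm_smul]
      calc ‖fderiv ℝ f (x₀ + ζ • e)‖ * (‖b‖ * ‖e‖) ≤ (2 * L) * (‖b‖ * L⁻¹) := by gcongr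
        _ = 2 * ‖b‖ := by field_simp
  have hlapφ : ∀ ζ ∈ ball (0 : ℂ) R, ∀ b : ℂ, ‖b‖ = 1 → ‖lap2 φ ζ b‖ ≤ 8 * K ^ 2 := by
    intro ζ hζ b hb
    obtain ⟨q1, q2, q3⟩ := hf _ (hmem ζ hζ)
    have hev : ∀ᶠ y in 𝓝 (x₀ + ζ • e), (fderiv ℝ f y).comp (Jst E) = (J (f y)).comp (fderiv ℝ f y) := by
      filter_upwards [isOpen_ball.mem_nhds (hmem ζ hζ)] with y hy using (hf y hy).2.2
    rw [hφ, lap2_comp_line q2, lap2_of_holomorphic q2 (hS _ q1).2.2.1 hev, norm_neg]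
    refine (norm_levTorsion_le (hS _ q1).1 (hS _ q1).2.1 _).trans ?_
    rw [← hDφ ζ hζ]
    have h3 : ‖fderiv ℝ φ ζ b‖ ≤ 2 := by
      refine ((fderiv ℝ φ ζ).le_of_opNorm_le (hDφn ζ hζ) b).trans ?_
      rw [hb]; norm_num
    calc 2 * K ^ 2 * ‖fderiv ℝ φ ζ b‖ ^ 2 ≤ 2 * K ^ 2 * 2 ^ 2 := by gcongr
      _ = 8 * K ^ 2 := by ring
  have hone : ∀ ζ : ℂ, ‖ζ‖ < 1 → ζ ∈ ball (0 : ℂ) R := fun ζ hζ => by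
    rw [mem_ball_zero_iff]; linarith
  have hlow : ∀ ζ ∈ ball (0 : ℂ) R, ‖ζ‖ ≤ 2 * s → 1 / 4 ≤ ‖fderiv ℝ φ ζ 1‖ := by
    intro ζ hζR hζ
    have h3 := norm_fderiv_sub_le_sqrt (f := φ) (x₀ := 0) (ρ := 1) (M := 2) (A := 8 * K ^ 2)
      (x := 0) (y := ζ) one_pos (by positivity) (fun y hy => hφ2 y (hone y (by simpa using hy)))
      (fun y hy => hDφn y (hone y (by simpa using hy)))
      (fun y hy => hlapφ y (hone y (by simpa using hy))) (by simp)
      (by rw [mem_ball_zero_iff]; linarith)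
    have h4 : √‖ζ - 0‖ ≤ 1 / (4 * H) := by
      rw [sub_zero]
      refine (Real.sqrt_le_sqrt hζ).trans ?_
      rw [Real.sqrt_le_left (by positivity), hs]
      apply le_of_eq; field_simp
    have h5 : ‖fderiv ℝ φ ζ - fderiv ℝ φ 0‖ ≤ 1 / 4 := by
      refine h3.trans ?_
      rw [Real.sqrt_one]
      calc (16 * 2 / 1 + 8 * K ^ 2 * 1) * √‖ζ - 0‖ ≤ H * (1 / (4 * H)) := by
            rw [hH] at h4 ⊢; rw [hH] at hH0
            refine mul_le_mul (by linarith) h4 (Real.sqrt_nonneg _) (by linarith)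
        _ = 1 / 4 := by field_simp
    have h6 : ‖(fderiv ℝ φ ζ - fderiv ℝ φ 0) 1‖ ≤ 1 / 4 * ‖(1 : ℂ)‖ :=
      le_of_opNorm_le _ h5 _
    have h7 : 1 / 2 ≤ ‖fderiv ℝ φ 0 1‖ := by
      rw [hDφ 0 (hone 0 (by simp)), zero_smul, add_zero, one_smul, he, map_smul, norm_smul,
        Real.norm_of_nonneg (by positivity)]
      calc 1 / 2 = L⁻¹ * (L / 2) := by field_simp
        _ ≤ _ := by gcongr
    rw [norm_one, sub_apply] at h6
    have := norm_sub_norm_le (fderiv ℝ φ 0 1) (fderiv ℝ φ ζ 1)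
    rw [norm_sub_rev] at this
    linarith
  have hr2 : ∀ ζ ∈ ball (0 : ℂ) R, ContDiffAt ℝ 2 r (φ ζ) := fun ζ hζ =>
    (hS _ (hf _ (hmem ζ hζ)).1).2.2.2.1
  have hlapu : ∀ ζ ∈ ball (0 : ℂ) R, c * ‖fderiv ℝ φ ζ 1‖ ^ 2 ≤ lap2 (fun ζ => r (φ ζ)) ζ 1 := by
    intro ζ hζ
    obtain ⟨q1, q2, q3⟩ := hf _ (hmem ζ hζ)
    have hev : ∀ᶠ y in 𝓝 (x₀ + ζ • e), (fderiv ℝ f y).comp (Jst E) = (J (f y)).comp (fderiv ℝ f y) := by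
      filter_upwards [isOpen_ball.mem_nhds (hmem ζ hζ)] with y hy using (hf y hy).2.2
    have h3 : ContDiffAt ℝ 2 (fun y => r (f y)) (x₀ + ζ • e) :=
      ContDiffAt.comp (g := r) _ (hr2 ζ hζ) q2
    have h4 := lap2_comp_line (f := fun y => r (f y)) h3 1
    rw [hφ]
    rw [h4, lap2_comp_of_holomorphic (φ := f) (u := r) (hr2 ζ hζ) q2 (hS _ q1).2.2.1 hev]
    have := hDφ ζ hζ 1
    rw [hφ] at this
    rw [this]
    exact (hS _ q1).2.2.2.2.2 _
  have := radius_le_of_subharmonic (u := fun ζ => r (φ ζ)) (R := R) (M := M) (a := c / 16)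
    (s := s) (by positivity) hs0 (fun z hz => (hS _ (hf _ (hmem z hz)).1).2.2.2.2.1)
    (fun z hz => ContDiffAt.comp z (hr2 z hz) (hφ2 z hz))
    (fun z hz => le_trans (by positivity) (hlapu z hz))
    (fun z hz hzs => by
      have h3 := hlapu z hz
      have h4 := hlow z hz hzs
      have : c * (1 / 4) ^ 2 ≤ c * ‖fderiv ℝ φ z 1‖ ^ 2 := by gcongr
      linarith)
  linarith

/-- Interior `C^{2,1/2}` estimate for maps whose Laplacians are controlled by first derivatives. -/
theorem exists_norm_fderiv_fderiv_le [ProperSpace E] {ρ M K : ℝ} (hρ : 0 < ρ) (hM : 0 ≤ M)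
    (hK : 0 < K) :
    ∃ C > 0, ∀ (f : E → W) (x₀ : E), (∀ y ∈ ball x₀ ρ, ContDiffAt ℝ 2 f y) →
      (∀ y ∈ ball x₀ ρ, ‖fderiv ℝ f y‖ ≤ M) →
      (∀ x ∈ ball x₀ ρ, ∀ y ∈ ball x₀ ρ, ∀ v, ‖v‖ = 1 →
        ‖lap2 f x v - lap2 f y v‖ ≤ K * (‖x - y‖ + ‖fderiv ℝ f x - fderiv ℝ f y‖)) →
      (∀ x ∈ ball x₀ (ρ / 2), ‖fderiv ℝ (fderiv ℝ f) x‖ ≤ C) ∧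
      ∀ x ∈ ball x₀ (ρ / 16), ∀ y ∈ ball x₀ (ρ / 16),
        ‖fderiv ℝ (fderiv ℝ f) x - fderiv ℝ (fderiv ℝ f) y‖ ≤ C * √‖x - y‖ := by
  set C₁ := 16 * M * (2 + K * (ρ / 4)) / (ρ / 4) + 1 with hC₁
  have hC₁0 : 0 < C₁ := by positivity
  set C₂ := 16 * C₁ / √(ρ / 2) + K * (1 + C₁) * √(ρ / 2) with hC₂
  have hC₂0 : 0 < C₂ := by positivity
  refine ⟨C₁ + C₂, by positivity, fun f x₀ hf hDf hlap => ?_⟩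
  have hmem : ∀ h : E, ‖h‖ < ρ / 4 → ∀ x ∈ ball x₀ (3 * ρ / 4), x ∈ ball x₀ ρ ∧ x + h ∈ ball x₀ ρ := by
    intro h hh x hx
    rw [mem_ball_iff_norm] at hx
    simp only [mem_ball_iff_norm]
    refine ⟨by linarith, ?_⟩
    have := norm_add_le (x - x₀) h
    rw [show x + h - x₀ = x - x₀ + h by abel]
    linarith
  have hDz : ∀ h : E, ‖h‖ < ρ / 4 → ∀ x ∈ ball x₀ (3 * ρ / 4),
      fderiv ℝ (fun y => f (y + h) - f y) x = fderiv ℝ f (x + h) - fderiv ℝ f x := by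
    intro h hh x hx
    obtain ⟨m1, m2⟩ := hmem h hh x hx
    have d1 : DifferentiableAt ℝ (fun y => f (y + h)) x :=
      ((hf _ m2).comp_add_right_const (x := x) (h := h)).differentiableAt (by norm_num)
    rw [fderiv_fun_sub d1 ((hf _ m1).differentiableAt (by norm_num)), fderiv_comp_add_right]
  have hz2 : ∀ h : E, ‖h‖ < ρ / 4 → ∀ x ∈ ball x₀ (3 * ρ / 4),
      ContDiffAt ℝ 2 (fun y => f (y + h) - f y) x := fun h hh x hx =>
    (hf _ (hmem h hh x hx).2).comp_add_right_const.sub (hf _ (hmem h hh x hx).1)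
  have hzlap : ∀ h : E, ‖h‖ < ρ / 4 → ∀ x ∈ ball x₀ (3 * ρ / 4), ∀ v, ‖v‖ = 1 →
      ‖lap2 (fun y => f (y + h) - f y) x v‖ ≤
        K * (‖h‖ + ‖fderiv ℝ (fun y => f (y + h) - f y) x‖) := by
    intro h hh x hx v hv
    obtain ⟨m1, m2⟩ := hmem h hh x hx
    rw [lap2_sub (hf _ m2).comp_add_right_const (hf _ m1), lap2_comp_add_left, hDz h hh x hx]
    simpa using hlap _ m2 _ m1 v hv
  have hstep : ∀ h : E, ‖h‖ < ρ / 4 → ∀ x ∈ ball x₀ (ρ / 2),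
      ‖fderiv ℝ f (x + h) - fderiv ℝ f x‖ ≤ C₁ * ‖h‖ := by
    intro h hh x hx
    have hsub : ∀ y ∈ ball x (ρ / 4), y ∈ ball x₀ (3 * ρ / 4) := fun y hy => by
      rw [mem_ball] at *
      have := dist_triangle y x x₀
      linarith
    rw [← hDz h hh x (hsub x (mem_ball_self (by positivity)))]
    refine norm_fderiv_le_of_lap2_affine (K := K) (by positivity) hM hK (norm_nonneg h)
      (fun y hy => hz2 h hh y (hsub y hy)) (fun y hy => ?_) (fun y hy => hzlap h hh y (hsub y hy))
    obtain ⟨m1, m2⟩ := hmem h hh y (hsub y hy)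
    have := (convex_ball x₀ ρ).norm_image_sub_le_of_norm_fderiv_le (𝕜 := ℝ) (f := f)
      (fun z hz => (hf z hz).differentiableAt (by norm_num)) hDf m1 m2
    simpa using this
  have hsmall : ∀ᶠ h in 𝓝 (0 : E), ‖h‖ < ρ / 4 := by
    filter_upwards [ball_mem_nhds (0 : E) (show 0 < ρ / 4 by positivity)] with h hh
    simpa using hh
  have hsub : ∀ y ∈ ball x₀ (ρ / 2), y ∈ ball x₀ (3 * ρ / 4) := fun y hy =>
    ball_subset_ball (by linarith) hy
  have hD2 : ∀ x ∈ ball x₀ (ρ / 2), HasFDerivAt (fun h => fderiv ℝ f (x + h))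
      (fderiv ℝ (fderiv ℝ f) x) 0 := by
    intro x hx
    have h1 := (hf x (ball_subset_ball (by linarith) hx)).differentiableAt_fderiv_two.hasFDerivAt
    exact (hasFDerivAt_comp_add_left x).2 (by simpa using h1)
  refine ⟨fun x hx => ?_, fun x hx y hy => ?_⟩
  · have := (hD2 x hx).le_of_lip' hC₁0.le (by
      filter_upwards [hsmall] with h hh
      simpa using hstep h hh x hx)
    linarith
  · have hx' : x ∈ ball x₀ (ρ / 2) := ball_subset_ball (by linarith) hx
    have hy' : y ∈ ball x₀ (ρ / 2) := ball_subset_ball (by linarith) hy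
    have := ((hD2 x hx').sub (hD2 y hy')).le_of_lip' (C := C₂ * √‖x - y‖) (by positivity) (by
      filter_upwards [hsmall] with h hh
      have h1 := norm_fderiv_sub_le_sqrt (f := fun y => f (y + h) - f y) (x₀ := x₀) (ρ := ρ / 2)
        (M := C₁ * ‖h‖) (A := K * (1 + C₁) * ‖h‖) (x := y) (y := x) (by positivity) (by positivity)
        (fun w hw => hz2 h hh w (hsub w hw))
        (fun w hw => by rw [hDz h hh w (hsub w hw)]; exact hstep h hh w hw)
        (fun w hw v hv => by
          refine (hzlap h hh w (hsub w hw) v hv).trans ?_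
          rw [hDz h hh w (hsub w hw)]
          have := hstep h hh w hw
          rw [mul_assoc]
          gcongr
          linarith)
        (by rwa [show ρ / 2 / 8 = ρ / 16 by ring]) (by rwa [show ρ / 2 / 8 = ρ / 16 by ring])
      rw [hDz h hh x (hsub x hx'), hDz h hh y (hsub y hy')] at h1
      have e : (16 * (C₁ * ‖h‖) / √(ρ / 2) + K * (1 + C₁) * ‖h‖ * √(ρ / 2)) * √‖x - y‖ =
          C₂ * √‖x - y‖ * ‖h‖ := by rw [hC₂]; ring
      rw [e] at h1
      simp only [Pi.sub_apply, add_zero, sub_zero]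
      rwa [show ∀ a b c d : E →L[ℝ] W, a - b - (c - d) = a - c - (b - d) from
        fun a b c d => by abel] at h1)
    refine this.trans ?_
    gcongr
    linarith

theorem contDiffOn_two_of_fderiv {U : Set V} (hU : IsOpen U) {f : V → W}
    (h1 : ∀ x ∈ U, DifferentiableAt ℝ f x) (h2 : ∀ x ∈ U, DifferentiableAt ℝ (fderiv ℝ f) x)
    (h3 : ContinuousOn (fderiv ℝ (fderiv ℝ f)) U) : ContDiffOn ℝ 2 f U := by
  have e : ContDiffOn ℝ 1 (fderiv ℝ f) U :=
    (contDiffOn_succ_iff_fderiv_of_isOpen (n := 0) hU).2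
      ⟨fun x hx => (h2 x hx).differentiableWithinAt, by simp, by simpa using h3⟩
  exact (contDiffOn_succ_iff_fderiv_of_isOpen (n := 1) hU).2
    ⟨fun x hx => (h1 x hx).differentiableWithinAt, by simp, e⟩

/-- A locally uniform limit of maps with locally uniformly bounded and Hölder second derivatives
is of class `C²`, and the derivatives converge. -/
theorem contDiffOn_two_of_tendstoLocallyUniformlyOn [ProperSpace V] [CompleteSpace W]
    {U : Set V} (hU : IsOpen U) {f : ℕ → V → W} {F : V → W}
    (hf : TendstoLocallyUniformlyOn f F atTop U)
    (hH : ∀ x ∈ U, ∃ r > 0, ∃ C, ∀ᶠ n in atTop, (∀ y ∈ ball x r, ContDiffAt ℝ 2 (f n) y ∧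
      ‖fderiv ℝ (fderiv ℝ (f n)) y‖ ≤ C) ∧ ∀ y ∈ ball x r, ∀ z ∈ ball x r,
      ‖fderiv ℝ (fderiv ℝ (f n)) y - fderiv ℝ (fderiv ℝ (f n)) z‖ ≤ C * √‖y - z‖) :
    ContDiffOn ℝ 2 F U ∧
      TendstoLocallyUniformlyOn (fun n => fderiv ℝ (f n)) (fderiv ℝ F) atTop U ∧
      TendstoLocallyUniformlyOn (fun n => fderiv ℝ (fderiv ℝ (f n))) (fderiv ℝ (fderiv ℝ F))
        atTop U := by
  obtain ⟨d1, t1⟩ := differentiableAt_of_equicontinuous_fderiv hU hf (by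
    intro x hx ε hε
    obtain ⟨r, hr, C, h⟩ := hH x hx
    have hC : C < |C| + 1 := by linarith [le_abs_self C]
    refine ⟨min r (ε / (|C| + 1)), by positivity, h.mono fun n hn y hy => ?_⟩
    have hyr := ball_subset_ball (min_le_left _ _) hy
    refine ⟨(hn.1 y hyr).1.differentiableAt (by norm_num), ?_⟩
    have h1 := (convex_ball x r).norm_image_sub_le_of_norm_fderiv_le (𝕜 := ℝ)
      (f := fderiv ℝ (f n)) (fun z hz => (hn.1 z hz).1.differentiableAt_fderiv_two)
      (fun z hz => (hn.1 z hz).2) (mem_ball_self hr) hyr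
    have h2 : ‖y - x‖ ≤ ε / (|C| + 1) := by
      rw [mem_ball_iff_norm] at hy
      exact hy.le.trans (min_le_right _ _)
    calc _ ≤ C * ‖y - x‖ := h1
      _ ≤ (|C| + 1) * (ε / (|C| + 1)) := by gcongr
      _ = ε := by field_simp)
  obtain ⟨d2, t2⟩ := differentiableAt_of_equicontinuous_fderiv hU t1 (by
    intro x hx ε hε
    obtain ⟨r, hr, C, h⟩ := hH x hx
    have hC : C < |C| + 1 := by linarith [le_abs_self C]
    refine ⟨min r ((ε / (|C| + 1)) ^ 2), by positivity, h.mono fun n hn y hy => ?_⟩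
    have hyr := ball_subset_ball (min_le_left _ _) hy
    refine ⟨(hn.1 y hyr).1.differentiableAt_fderiv_two, ?_⟩
    have h2 : √‖y - x‖ ≤ ε / (|C| + 1) := by
      rw [mem_ball_iff_norm] at hy
      exact (Real.sqrt_le_left (by positivity)).2 (hy.le.trans (min_le_right _ _))
    calc _ ≤ C * √‖y - x‖ := hn.2 y hyr x (mem_ball_self hr)
      _ ≤ (|C| + 1) * (ε / (|C| + 1)) := by gcongr
      _ = ε := by field_simp)
  refine ⟨contDiffOn_two_of_fderiv hU d1 d2 fun x hx => ?_, t1, t2⟩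
  obtain ⟨r, hr, C, h⟩ := hH x hx
  have hB : IsOpen (U ∩ ball x r) := hU.inter isOpen_ball
  have hc : ContinuousOn (fderiv ℝ (fderiv ℝ F)) (U ∩ ball x r) :=
    (t2.mono inter_subset_left).continuousOn (h.mono fun n hn y hy =>
      (((hn.1 y hy.2).1.fderiv_right (m := 1) (by norm_num)).fderiv_right (m := 0)
        (by norm_num)).continuousAt.continuousWithinAt).frequently
  exact (hc.continuousAt (hB.mem_nhds ⟨hx, mem_ball_self hr⟩)).continuousWithinAt

theorem lap2_prodMk {W W' : Type*} [NormedAddCommGroup W] [NormedSpace ℝ W]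
    [NormedAddCommGroup W'] [NormedSpace ℝ W'] {f : E → W} {g : E → W'} {x : E}
    (hf : ContDiffAt ℝ 2 f x) (hg : ContDiffAt ℝ 2 g x) (v : E) :
    lap2 (fun y => (f y, g y)) x v = (lap2 f x v, lap2 g x v) := by
  have h := hf.prodMk hg
  exact Prod.ext (lap2_clm_comp (ContinuousLinearMap.fst ℝ W W') h v).symm
    (lap2_clm_comp (ContinuousLinearMap.snd ℝ W W') h v).symm

/-- Stability of first differences of a `C²` map. -/
theorem norm_difference_sub_difference_le {Y W : Type*} [NormedAddCommGroup Y] [NormedSpace ℝ Y]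
    [NormedAddCommGroup W] [NormedSpace ℝ W] {N : Y → W} {S : Set Y} (hS : Convex ℝ S)
    {K t : ℝ} (ht : 0 ≤ t) (hN : ∀ y ∈ S, ContDiffAt ℝ 2 N y) (h1 : ∀ y ∈ S, ‖fderiv ℝ N y‖ ≤ K)
    (h2 : ∀ y ∈ S, ‖fderiv ℝ (fderiv ℝ N) y‖ ≤ K) {a b a' b' : Y} (ha : a ∈ S) (ha' : a' ∈ S)
    (hb : a + t • b ∈ S) (hb' : a' + t • b' ∈ S) (hab : a + t • b' ∈ S) :
    ‖(N (a + t • b) - N a) - (N (a' + t • b') - N a')‖ ≤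
      t * K * (‖b - b'‖ + ‖b'‖ * ‖a - a'‖) := by
  have e1 : ‖N (a + t • b) - N (a + t • b')‖ ≤ K * (t * ‖b - b'‖) := by
    have := hS.norm_image_sub_le_of_norm_fderiv_le (𝕜 := ℝ) (f := N)
      (fun z hz => (hN z hz).differentiableAt (by norm_num)) h1 hab hb
    rwa [add_sub_add_left_eq_sub, ← smul_sub, norm_smul, Real.norm_of_nonneg ht] at this
  have hK : 0 ≤ K := (norm_nonneg _).trans (h1 a ha)
  have hseg : Convex ℝ (S ∩ (fun y => y + t • b') ⁻¹' S) :=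
    hS.inter (hS.translate_preimage_left (t • b'))
  have e2 : ‖(N (a + t • b') - N a) - (N (a' + t • b') - N a')‖ ≤ K * (t * ‖b'‖) * ‖a - a'‖ := by
    refine hseg.norm_image_sub_le_of_norm_fderiv_le (𝕜 := ℝ) (f := fun y => N (y + t • b') - N y)
      (fun y hy => ?_) (fun y hy => ?_) ⟨ha', hb'⟩ ⟨ha, hab⟩
    · exact (((hN _ hy.2).comp_add_right_const (x := y)).differentiableAt (by norm_num)).sub
        ((hN y hy.1).differentiableAt (by norm_num))
    · have d1 : DifferentiableAt ℝ (fun z => N (z + t • b')) y :=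
        ((hN _ hy.2).comp_add_right_const (x := y)).differentiableAt (by norm_num)
      rw [fderiv_fun_sub d1 ((hN y hy.1).differentiableAt (by norm_num)), fderiv_comp_add_right]
      have := hS.norm_image_sub_le_of_norm_fderiv_le (𝕜 := ℝ) (f := fderiv ℝ N)
        (fun z hz => (hN z hz).differentiableAt_fderiv_two) h2 hy.1 hy.2
      rwa [add_sub_cancel_left, norm_smul, Real.norm_of_nonneg ht] at this
  calc _ = ‖(N (a + t • b) - N (a + t • b')) + ((N (a + t • b') - N a) - (N (a' + t • b') - N a'))‖ := by
        congr 1; abel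
    _ ≤ _ := (norm_add_le _ _).trans (add_le_add e1 e2)
    _ = _ := by ring

theorem exists_fderiv_bounds_near {Y Z W : Type*} [NormedAddCommGroup Y] [NormedSpace ℝ Y]
    [NormedAddCommGroup Z] [NormedSpace ℝ Z] [NormedAddCommGroup W] [NormedSpace ℝ W]
    {N : Z × Y → W} {S : Set Z} (hS : IsCompact S) {q : Y}
    (hN : ∀ v ∈ S, ContDiffAt ℝ 2 N (v, q)) :
    ∃ η > 0, ∃ K > 0, ∀ y ∈ ball q η, ∀ v ∈ S, ContDiffAt ℝ 2 N (v, y) ∧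
      ‖fderiv ℝ N (v, y)‖ ≤ K ∧ ‖fderiv ℝ (fderiv ℝ N) (v, y)‖ ≤ K := by
  set m : Z × Y → ℝ := fun z => ‖fderiv ℝ N z‖ + ‖fderiv ℝ (fderiv ℝ N) z‖ with hm
  have hmc : ∀ v ∈ S, ContinuousAt m (v, q) := fun v hv =>
    have h1 := (hN v hv).fderiv_right (m := 1) (by norm_num)
    h1.continuousAt.norm.add (h1.fderiv_right (m := 0) (by norm_num)).continuousAt.norm
  obtain ⟨K, hK⟩ := hS.bddAbove_image (f := fun v => m (v, q)) fun v hv =>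
    ((hmc v hv).comp (f := fun v : Z => (v, q)) (by fun_prop)).continuousWithinAt
  have hK' : ∀ v ∈ S, m (v, q) < |K| + 1 := fun v hv => by
    have : m (v, q) ≤ K := hK ⟨v, hv, rfl⟩
    linarith [le_abs_self K]
  have hev := hS.eventually_forall_of_forall_eventually (x₀ := q)
    (P := fun y v => ContDiffAt ℝ 2 N (v, y) ∧ m (v, y) < |K| + 1) (fun v hv => by
      have h1 : ∀ᶠ z in 𝓝 (v, q), ContDiffAt ℝ 2 N z ∧ m z < |K| + 1 :=
        ((hN v hv).eventually (by simp)).and ((hmc v hv).eventually_lt_const (hK' v hv))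
      have h2 : Tendsto (fun z : Y × Z => (z.2, z.1)) (𝓝 (q, v)) (𝓝 (v, q)) :=
        (continuous_swap.tendsto (q, v))
      exact h2.eventually h1)
  obtain ⟨η, hη, h⟩ := Metric.eventually_nhds_iff_ball.1 hev
  refine ⟨η, hη, |K| + 1, by positivity, fun y hy v hv => ?_⟩
  obtain ⟨h1, h2⟩ := h y hy v hv
  have a1 := norm_nonneg (fderiv ℝ N (v, y))
  have a2 := norm_nonneg (fderiv ℝ (fderiv ℝ N) (v, y))
  rw [hm] at h2
  exact ⟨h1, by linarith, by linarith⟩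

theorem norm_difference_quotient_sub_le {Y Z W : Type*} [NormedAddCommGroup Y] [NormedSpace ℝ Y]
    [NormedAddCommGroup Z] [NormedSpace ℝ Z] [NormedAddCommGroup W] [NormedSpace ℝ W]
    {N : Z × Y → W} {q : Y} {η K : ℝ} {v : Z}
    (hN : ∀ y ∈ ball q η, ContDiffAt ℝ 2 N (v, y) ∧
      ‖fderiv ℝ N (v, y)‖ ≤ K ∧ ‖fderiv ℝ (fderiv ℝ N) (v, y)‖ ≤ K) :
    (∀ y₁ ∈ ball q η, ∀ y₂ ∈ ball q η, ‖N (v, y₁) - N (v, y₂)‖ ≤ K * ‖y₁ - y₂‖) ∧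
    ∀ (t : ℝ) (d₁ d₂ : Y), 0 < t → ∀ y₁ ∈ ball q η, ∀ y₂ ∈ ball q η, y₁ + t • d₁ ∈ ball q η →
      y₂ + t • d₂ ∈ ball q η → y₁ + t • d₂ ∈ ball q η →
      ‖t⁻¹ • (N (v, y₁ + t • d₁) - N (v, y₁)) - t⁻¹ • (N (v, y₂ + t • d₂) - N (v, y₂))‖ ≤
        K * (‖d₁ - d₂‖ + ‖d₂‖ * ‖y₁ - y₂‖) := by
  have hSc : Convex ℝ (({v} : Set Z) ×ˢ ball q η) := (convex_singleton v).prod (convex_ball _ _)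
  have hSN : ∀ z ∈ ({v} : Set Z) ×ˢ ball q η, ContDiffAt ℝ 2 N z ∧
      ‖fderiv ℝ N z‖ ≤ K ∧ ‖fderiv ℝ (fderiv ℝ N) z‖ ≤ K := by
    rintro ⟨v', y⟩ ⟨h1, h2⟩
    obtain rfl : v' = v := h1
    exact hN y h2
  have hnorm0 : ∀ z : Y, ‖((0 : Z), z)‖ = ‖z‖ := fun z => by rw [Prod.norm_def]; simp
  refine ⟨fun y₁ h₁ y₂ h₂ => ?_, fun t d₁ d₂ ht y₁ h₁ y₂ h₂ h₃ h₄ h₅ => ?_⟩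
  · have h := hSc.norm_image_sub_le_of_norm_fderiv_le (𝕜 := ℝ) (f := N)
      (fun z hz => (hSN z hz).1.differentiableAt (by norm_num)) (fun z hz => (hSN z hz).2.1)
      (x := (v, y₂)) (y := (v, y₁)) ⟨rfl, h₂⟩ ⟨rfl, h₁⟩
    rwa [Prod.mk_sub_mk, sub_self, hnorm0] at h
  · have hdiff := norm_difference_sub_difference_le hSc ht.le (fun z hz => (hSN z hz).1)
      (fun z hz => (hSN z hz).2.1) (fun z hz => (hSN z hz).2.2) (a := (v, y₁)) (b := (0, d₁))
      (a' := (v, y₂)) (b' := (0, d₂)) ⟨rfl, h₁⟩ ⟨rfl, h₂⟩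
      ⟨by simp, by simpa using h₃⟩ ⟨by simp, by simpa using h₄⟩ ⟨by simp, by simpa using h₅⟩
    simp only [Prod.smul_mk, Prod.mk_add_mk, smul_zero, add_zero, Prod.mk_sub_mk,
      sub_self, hnorm0] at hdiff
    rw [← smul_sub, norm_smul, norm_inv, Real.norm_of_nonneg ht.le]
    calc _ ≤ t⁻¹ * (t * K * (‖d₁ - d₂‖ + ‖d₂‖ * ‖y₁ - y₂‖)) := by gcongr
      _ = _ := by field_simp

set_option maxHeartbeats 1000000 in
/-- Regularity gain for the equation `lap2 U x v = N (v, (U x, DU x))`: directional derivatives of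
`U` are of class `C²` and satisfy the differentiated equation. -/
theorem contDiffAt_fderiv_apply_of_lap2_eq [ProperSpace E] [CompleteSpace W] {D : Set E}
    (hD : IsOpen D) {U : E → W}
    {N : E × (W × (E →L[ℝ] W)) → W} (hU : ∀ x ∈ D, ContDiffAt ℝ 2 U x)
    (hN : ∀ x ∈ D, ∀ v, ContDiffAt ℝ 2 N (v, (U x, fderiv ℝ U x)))
    (heq : ∀ x ∈ D, ∀ v, lap2 U x v = N (v, (U x, fderiv ℝ U x))) {x₀ : E} (hx₀ : x₀ ∈ D) (e : E) :
    ContDiffAt ℝ 2 (fun x => fderiv ℝ U x e) x₀ ∧ ∀ v,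
      lap2 (fun x => fderiv ℝ U x e) x₀ v = fderiv ℝ N (v, (U x₀, fderiv ℝ U x₀))
        (0, fderiv ℝ (fun x => (U x, fderiv ℝ U x)) x₀ e) := by
  set q : E → W × (E →L[ℝ] W) := fun x => (U x, fderiv ℝ U x) with hq
  obtain ⟨η, hη, K, hK, hNb⟩ := exists_fderiv_bounds_near (N := N) (isCompact_sphere (0 : E) 1)
    (q := q x₀) (fun v _ => hN x₀ hx₀ v)
  have hqd : ∀ x ∈ D, HasFDerivAt q ((fderiv ℝ U x).prod (fderiv ℝ (fderiv ℝ U) x)) x := fun x hx =>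
    ((hU x hx).differentiableAt (by norm_num)).hasFDerivAt.prodMk
      (hU x hx).differentiableAt_fderiv_two.hasFDerivAt
  set L := ‖fderiv ℝ U x₀‖ + ‖fderiv ℝ (fderiv ℝ U) x₀‖ + 1 with hL
  have hL0 : 0 < L := by positivity
  obtain ⟨ρ, hρ, hball⟩ : ∃ ρ > 0, ∀ x ∈ ball x₀ (2 * ρ), x ∈ D ∧ q x ∈ ball (q x₀) (η / 2) ∧
      ‖fderiv ℝ U x‖ ≤ L ∧ ‖fderiv ℝ (fderiv ℝ U) x‖ ≤ L := by
    have h1 := (hU x₀ hx₀).fderiv_right (m := 1) (by norm_num)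
    have h2 := h1.continuousAt.norm.eventually_lt_const (show ‖fderiv ℝ U x₀‖ < L by
      rw [hL]; linarith [norm_nonneg (fderiv ℝ (fderiv ℝ U) x₀)])
    have h3 := (h1.fderiv_right (m := 0) (by norm_num)).continuousAt.norm.eventually_lt_const
      (show ‖fderiv ℝ (fderiv ℝ U) x₀‖ < L by rw [hL]; linarith [norm_nonneg (fderiv ℝ U x₀)])
    have h4 := (hqd x₀ hx₀).continuousAt.eventually (ball_mem_nhds (q x₀) (half_pos hη))
    obtain ⟨ρ, hρ, h⟩ := Metric.eventually_nhds_iff_ball.1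
      ((hD.eventually_mem hx₀).and (h4.and (h2.and h3)))
    refine ⟨ρ / 2, by positivity, fun x hx => ?_⟩
    obtain ⟨a1, a2, a3, a4⟩ := h x (by rwa [mul_div_cancel₀ _ (two_ne_zero)] at hx)
    exact ⟨a1, a2, a3.le, a4.le⟩
  have hsub : ∀ x ∈ ball x₀ ρ, x ∈ ball x₀ (2 * ρ) := fun x hx => ball_subset_ball (by linarith) hx
  have hqL : ∀ x ∈ ball x₀ (2 * ρ), ∀ y ∈ ball x₀ (2 * ρ), ‖q y - q x‖ ≤ L * ‖y - x‖ := by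
    intro x hx y hy
    refine (convex_ball x₀ (2 * ρ)).norm_image_sub_le_of_norm_hasFDerivWithin_le (𝕜 := ℝ)
      (fun z hz => (hqd z (hball z hz).1).hasFDerivWithinAt) (fun z hz => ?_) hx hy
    rw [opNorm_prod]
    exact max_le (hball z hz).2.2.1 (hball z hz).2.2.2
  have hDUL : ∀ x ∈ ball x₀ (2 * ρ), ∀ y ∈ ball x₀ (2 * ρ),
      ‖fderiv ℝ U y - fderiv ℝ U x‖ ≤ L * ‖y - x‖ := fun x hx y hy =>
    (le_max_right _ _).trans (hqL x hx y hy)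
  set w : ℝ → E → W := fun t x => t⁻¹ • (U (x + t • e) - U x) with hw
  set V : ℝ → E → W × W := fun t x => (U x, w t x) with hV
  set K' := K * (1 + L + L * ‖e‖ + L * ‖e‖ * L) with hK'
  obtain ⟨C, hC, hest⟩ := exists_norm_fderiv_fderiv_le (E := E) (W := W × W) (ρ := ρ)
    (M := L + L * ‖e‖) (K := K') hρ (by positivity) (by positivity)
  have hgood : ∀ t : ℝ, 0 < t → t * ‖e‖ < ρ → t * (L * ‖e‖) < η / 2 →
      (∀ x ∈ ball x₀ ρ, ContDiffAt ℝ 2 (V t) x ∧ ContDiffAt ℝ 2 (w t) x ∧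
        ‖fderiv ℝ (w t) x‖ ≤ L * ‖e‖ ∧
        (∀ v, lap2 (w t) x v = t⁻¹ • (N (v, q (x + t • e)) - N (v, q x)))) ∧
      (∀ x ∈ ball x₀ (ρ / 2), ‖fderiv ℝ (fderiv ℝ (V t)) x‖ ≤ C) ∧
      ∀ x ∈ ball x₀ (ρ / 16), ∀ y ∈ ball x₀ (ρ / 16),
        ‖fderiv ℝ (fderiv ℝ (V t)) x - fderiv ℝ (fderiv ℝ (V t)) y‖ ≤ C * √‖x - y‖ := by
    intro t ht hte htη
    have hte' : ‖t • e‖ = t * ‖e‖ := by rw [norm_smul, Real.norm_of_nonneg ht.le]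
    have hadd : ∀ x ∈ ball x₀ ρ, x + t • e ∈ ball x₀ (2 * ρ) := fun x hx => by
      rw [mem_ball_iff_norm] at *
      have := norm_add_le (x - x₀) (t • e)
      rw [show x + t • e - x₀ = x - x₀ + t • e by abel]
      linarith
    have hs2 : ∀ x ∈ ball x₀ ρ, ContDiffAt ℝ 2 (fun y => U (y + t • e) - U y) x := fun x hx =>
      (hU _ (hball _ (hadd x hx)).1).comp_add_right_const.sub (hU x (hball x (hsub x hx)).1)
    have hw2 : ∀ x ∈ ball x₀ ρ, ContDiffAt ℝ 2 (w t) x := fun x hx => (hs2 x hx).const_smul t⁻¹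
    have hDw : ∀ x ∈ ball x₀ ρ, fderiv ℝ (w t) x = t⁻¹ • (fderiv ℝ U (x + t • e) - fderiv ℝ U x) := by
      intro x hx
      have d1 : DifferentiableAt ℝ (fun y => U (y + t • e)) x :=
        ((hU _ (hball _ (hadd x hx)).1).comp_add_right_const (x := x)
          (h := t • e)).differentiableAt (by norm_num)
      have d2 : DifferentiableAt ℝ U x := (hU x (hball x (hsub x hx)).1).differentiableAt (by norm_num)
      have h1 := fderiv_fun_const_smul (d1.fun_sub d2) t⁻¹
      rw [fderiv_fun_sub d1 d2, fderiv_comp_add_right] at h1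
      exact h1
    have hDwn : ∀ x ∈ ball x₀ ρ, ‖fderiv ℝ (w t) x‖ ≤ L * ‖e‖ := fun x hx => by
      rw [hDw x hx, norm_smul, norm_inv, Real.norm_of_nonneg ht.le]
      have := hDUL x (hsub x hx) _ (hadd x hx)
      rw [add_sub_cancel_left, hte'] at this
      calc t⁻¹ * _ ≤ t⁻¹ * (L * (t * ‖e‖)) := by gcongr
        _ = _ := by field_simp
    have hlapw : ∀ x ∈ ball x₀ ρ, ∀ v, lap2 (w t) x v = t⁻¹ • (N (v, q (x + t • e)) - N (v, q x)) := by
      intro x hx v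
      rw [hw]
      rw [lap2_const_smul _ (hs2 x hx), lap2_sub (hU _ (hball _ (hadd x hx)).1).comp_add_right_const
        (hU x (hball x (hsub x hx)).1), lap2_comp_add_left, heq _ (hball _ (hadd x hx)).1,
        heq x (hball x (hsub x hx)).1]
    have hV2 : ∀ x ∈ ball x₀ ρ, ContDiffAt ℝ 2 (V t) x := fun x hx =>
      (hU x (hball x (hsub x hx)).1).prodMk (hw2 x hx)
    have hDV : ∀ x ∈ ball x₀ ρ, fderiv ℝ (V t) x = (fderiv ℝ U x).prod (fderiv ℝ (w t) x) := fun x hx =>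
      (((hU x (hball x (hsub x hx)).1).differentiableAt (by norm_num)).hasFDerivAt.prodMk
        ((hw2 x hx).differentiableAt (by norm_num)).hasFDerivAt).fderiv
    refine ⟨fun x hx => ⟨hV2 x hx, hw2 x hx, hDwn x hx, hlapw x hx⟩, ?_⟩
    refine hest (V t) x₀ hV2 (fun x hx => ?_) fun x hx y hy v hv => ?_
    · rw [hDV x hx, opNorm_prod]
      refine max_le ((hball x (hsub x hx)).2.2.1.trans ?_) ((hDwn x hx).trans ?_)
      · linarith [show 0 ≤ L * ‖e‖ by positivity]
      · linarith
    · have hvS : v ∈ sphere (0 : E) 1 := by simpa using hv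
      have hqm : ∀ x ∈ ball x₀ (2 * ρ), q x ∈ ball (q x₀) η := fun x hx =>
        ball_subset_ball (by linarith) (hball x hx).2.1
      obtain ⟨hN1, hN2⟩ := norm_difference_quotient_sub_le (fun y hy => hNb y hy v hvS)
      set δ : E → W × (E →L[ℝ] W) := fun x => t⁻¹ • (q (x + t • e) - q x) with hδ
      have hqδ : ∀ x, q x + t • δ x = q (x + t • e) := fun x => by
        rw [hδ]; simp [smul_smul, mul_inv_cancel₀ ht.ne']
      have hδn : ∀ x ∈ ball x₀ ρ, ‖δ x‖ ≤ L * ‖e‖ := fun x hx => by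
        rw [hδ, norm_smul, norm_inv, Real.norm_of_nonneg ht.le]
        have := hqL x (hsub x hx) _ (hadd x hx)
        rw [add_sub_cancel_left, hte'] at this
        calc t⁻¹ * _ ≤ t⁻¹ * (L * (t * ‖e‖)) := by gcongr
          _ = _ := by field_simp
      have hmix : ∀ x ∈ ball x₀ ρ, ∀ y ∈ ball x₀ ρ, q x + t • δ y ∈ ball (q x₀) η := fun x hx y hy => by
        have h1 := (hball x (hsub x hx)).2.1
        have h0 := hδn y hy
        rw [mem_ball_iff_norm] at h1 ⊢
        have h2 := norm_add_le (q x - q x₀) (t • δ y)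
        rw [norm_smul, Real.norm_of_nonneg ht.le] at h2
        have h3 : t * ‖δ y‖ ≤ t * (L * ‖e‖) := by gcongr
        rw [show q x + t • δ y - q x₀ = q x - q x₀ + t • δ y by abel]
        linarith
      have hdiff := hN2 t (δ x) (δ y) ht (q x) (hqm x (hsub x hx)) (q y) (hqm y (hsub y hy))
        (hmix x hx x hx) (hmix y hy y hy) (hmix x hx y hy)
      rw [hqδ, hqδ] at hdiff
      have hq1 := hqL y (hsub y hy) x (hsub x hx)
      have hw1 : ‖w t x - w t y‖ ≤ L * ‖e‖ * ‖x - y‖ :=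
        (convex_ball x₀ ρ).norm_image_sub_le_of_norm_fderiv_le (𝕜 := ℝ)
          (fun z hz => (hw2 z hz).differentiableAt (by norm_num)) hDwn hy hx
      have hDVn : ‖fderiv ℝ (w t) x - fderiv ℝ (w t) y‖ ≤ ‖fderiv ℝ (V t) x - fderiv ℝ (V t) y‖ := by
        rw [hDV x hx, hDV y hy]
        refine opNorm_le_bound _ (norm_nonneg _) fun b => ?_
        refine le_trans ?_ (le_opNorm _ b)
        exact le_max_right _ _
      have hδd : ‖δ x - δ y‖ ≤ L * ‖e‖ * ‖x - y‖ + ‖fderiv ℝ (V t) x - fderiv ℝ (V t) y‖ := by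
        have e1 : δ x - δ y = (w t x - w t y, fderiv ℝ (w t) x - fderiv ℝ (w t) y) := by
          rw [hDw x hx, hDw y hy]
          rfl
        rw [e1]
        refine max_le ?_ ?_
        · exact hw1.trans (le_add_of_nonneg_right (norm_nonneg _))
        · exact hDVn.trans (le_add_of_nonneg_left (by positivity))
      have hlV : ∀ x ∈ ball x₀ ρ, lap2 (V t) x v =
          (N (v, q x), t⁻¹ • (N (v, q (x + t • e)) - N (v, q x))) := fun x hx => by
        rw [hV]
        rw [lap2_prodMk (hU x (hball x (hsub x hx)).1) (hw2 x hx), hlapw x hx,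
          heq x (hball x (hsub x hx)).1]
      rw [hlV x hx, hlV y hy]
      set dV := ‖fderiv ℝ (V t) x - fderiv ℝ (V t) y‖
      have hdV : 0 ≤ dV := norm_nonneg _
      refine max_le ?_ ?_
      · have h1 := hN1 (q x) (hqm x (hsub x hx)) (q y) (hqm y (hsub y hy))
        calc _ ≤ K * (L * ‖x - y‖) := h1.trans (by gcongr)
          _ = K * L * ‖x - y‖ := by ring
          _ ≤ K' * (‖x - y‖ + dV) := by
            rw [hK']
            refine mul_le_mul ?_ (by linarith) (norm_nonneg _) (by positivity)
            gcongr
            linarith [show 0 ≤ L * ‖e‖ by positivity, show 0 ≤ L * ‖e‖ * L by positivity]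
      · change ‖t⁻¹ • (N (v, q (x + t • e)) - N (v, q x)) - t⁻¹ • (N (v, q (y + t • e)) - N (v, q y))‖ ≤ _
        calc _ ≤ K * (‖δ x - δ y‖ + ‖δ y‖ * ‖q x - q y‖) := hdiff
          _ ≤ K * ((L * ‖e‖ * ‖x - y‖ + dV) + (L * ‖e‖) * (L * ‖x - y‖)) := by
            have := hδn y hy
            gcongr
          _ ≤ K' * (‖x - y‖ + dV) := by
            rw [hK', mul_assoc K]
            refine mul_le_mul_of_nonneg_left ?_ hK.le
            have h1 : 0 ≤ L * ‖e‖ := by positivity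
            have h2 : 0 ≤ L * ‖e‖ * L := by positivity
            have h3 := mul_nonneg h1 hdV
            have h4 := mul_nonneg h2 hdV
            have h5 := mul_nonneg hL0.le hdV
            have h6 := mul_nonneg hL0.le (norm_nonneg (x - y))
            have h7 := norm_nonneg (x - y)
            linear_combination h3 + h4 + h5 + h6 + h7
  have ht : Tendsto (fun n : ℕ => ((n : ℝ))⁻¹) atTop (𝓝 0) := tendsto_inv_atTop_nhds_zero_nat
  have hevt : ∀ᶠ n : ℕ in atTop, 0 < (n : ℝ)⁻¹ ∧ (n : ℝ)⁻¹ * ‖e‖ < ρ ∧ (n : ℝ)⁻¹ * (L * ‖e‖) < η / 2 := by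
    have h1 : Tendsto (fun n : ℕ => ((n : ℝ))⁻¹ * ‖e‖) atTop (𝓝 0) := by simpa using ht.mul_const ‖e‖
    have h2 : Tendsto (fun n : ℕ => ((n : ℝ))⁻¹ * (L * ‖e‖)) atTop (𝓝 0) := by
      simpa using ht.mul_const (L * ‖e‖)
    filter_upwards [eventually_gt_atTop 0, h1.eventually_lt_const hρ,
      h2.eventually_lt_const (half_pos hη)] with n a1 a2 a3
    exact ⟨by positivity, a2, a3⟩
  have hlim : ∀ {W' : Type _} [NormedAddCommGroup W'] [NormedSpace ℝ W'] (h : E → W') (x : E),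
      DifferentiableAt ℝ h x → Tendsto (fun n : ℕ => ((n : ℝ)⁻¹)⁻¹ • (h (x + (n : ℝ)⁻¹ • e) - h x))
        atTop (𝓝 (fderiv ℝ h x e)) := by
    intro W' _ _ h x hh
    simp only [inv_inv]
    exact (hh.hasFDerivAt.lim_real e).comp tendsto_natCast_atTop_atTop
  have hTLU : TendstoLocallyUniformlyOn (fun n : ℕ => V ((n : ℝ)⁻¹)) (fun x => (U x, fderiv ℝ U x e))
      atTop (ball x₀ (ρ / 16)) := by
    refine tendstoLocallyUniformlyOn_of_equicontinuous (fun x hx => ?_) fun x hx ε hε => ?_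
    · refine tendsto_const_nhds.prodMk_nhds (hlim U x ?_)
      exact (hU x (hball x (ball_subset_ball (by linarith) hx)).1).differentiableAt (by norm_num)
    · obtain ⟨r, hr, hrb⟩ := Metric.isOpen_iff.1 (isOpen_ball (x := x₀) (ε := ρ)) x
        (ball_subset_ball (by linarith) hx)
      refine ⟨min r (ε / (L + L * ‖e‖)), by positivity, hevt.mono fun n hn y hy => ?_⟩
      obtain ⟨h1, -⟩ := hgood _ hn.1 hn.2.1 hn.2.2
      have hy1 := hrb (ball_subset_ball (min_le_left _ _) hy)
      have hx1 := hrb (mem_ball_self hr)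
      have hyx : ‖y - x‖ ≤ ε / (L + L * ‖e‖) := by
        rw [mem_ball_iff_norm] at hy
        exact hy.le.trans (min_le_right _ _)
      have h2 : ‖U y - U x‖ ≤ L * ‖y - x‖ :=
        (le_max_left _ _).trans (hqL x (hsub x hx1) y (hsub y hy1))
      have h3 : ‖w (n : ℝ)⁻¹ y - w (n : ℝ)⁻¹ x‖ ≤ L * ‖e‖ * ‖y - x‖ :=
        (convex_ball x₀ ρ).norm_image_sub_le_of_norm_fderiv_le (𝕜 := ℝ)
          (fun z hz => (h1 z hz).2.1.differentiableAt (by norm_num)) (fun z hz => (h1 z hz).2.2.1) hx1 hy1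
      have hle : (L + L * ‖e‖) * ‖y - x‖ ≤ ε := by
        calc _ ≤ (L + L * ‖e‖) * (ε / (L + L * ‖e‖)) := by gcongr
          _ = ε := by field_simp
      have hp1 : 0 ≤ L * ‖y - x‖ := by positivity
      have hp2 : 0 ≤ L * ‖e‖ * ‖y - x‖ := by positivity
      rw [dist_eq_norm]
      refine max_le ?_ ?_
      · exact h2.trans (by linarith)
      · exact h3.trans (by linarith)
  obtain ⟨c1, c2, c3⟩ := contDiffOn_two_of_tendstoLocallyUniformlyOn isOpen_ball hTLU (by
    intro x hx
    obtain ⟨r, hr, hrb⟩ := Metric.isOpen_iff.1 (isOpen_ball (x := x₀) (ε := ρ / 16)) x hx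
    refine ⟨r, hr, C, hevt.mono fun n hn => ?_⟩
    obtain ⟨h1, h2, h3⟩ := hgood _ hn.1 hn.2.1 hn.2.2
    exact ⟨fun y hy => ⟨(h1 y (ball_subset_ball (by linarith) (hrb hy))).1,
      h2 y (ball_subset_ball (by linarith) (hrb hy))⟩, fun y hy z hz => h3 y (hrb hy) z (hrb hz)⟩)
  have hx₀m : x₀ ∈ ball x₀ (ρ / 16) := mem_ball_self (by positivity)
  have hpair : ContDiffAt ℝ 2 (fun x => (U x, fderiv ℝ U x e)) x₀ :=
    c1.contDiffAt (isOpen_ball.mem_nhds hx₀m)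
  have hsnd : ContDiffAt ℝ 2 (fun x => fderiv ℝ U x e) x₀ := hpair.snd
  refine ⟨hsnd, fun v => ?_⟩
  have hl1 : Tendsto (fun n : ℕ => lap2 (V ((n : ℝ)⁻¹)) x₀ v) atTop
      (𝓝 (lap2 (fun x => (U x, fderiv ℝ U x e)) x₀ v)) := by
    have h1 := c3.tendsto_at hx₀m
    have h2 : ∀ a : E, Tendsto (fun n : ℕ => fderiv ℝ (fderiv ℝ (V ((n : ℝ)⁻¹))) x₀ a a) atTop
        (𝓝 (fderiv ℝ (fderiv ℝ (fun x => (U x, fderiv ℝ U x e))) x₀ a a)) := fun a =>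
      ((by fun_prop : Continuous fun T : E →L[ℝ] E →L[ℝ] W × W => T a a).tendsto _).comp h1
    exact (h2 v).add (h2 _)
  rw [lap2_prodMk (hU x₀ hx₀) hsnd] at hl1
  have hl2 := (continuous_snd.tendsto _).comp hl1
  have hNd : DifferentiableAt ℝ N (v, q x₀) := (hN x₀ hx₀ v).differentiableAt (by norm_num)
  have hcomp : HasFDerivAt (fun x => N (v, q x)) ((fderiv ℝ N (v, q x₀)).comp
      ((0 : E →L[ℝ] E).prod (fderiv ℝ q x₀))) x₀ :=
    HasFDerivAt.comp (g := N) x₀ hNd.hasFDerivAt ((hasFDerivAt_const v x₀).prodMk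
      (hqd x₀ hx₀).differentiableAt.hasFDerivAt)
  have hl3 := hlim (fun x => N (v, q x)) x₀ hcomp.differentiableAt
  rw [hcomp.fderiv] at hl3
  refine tendsto_nhds_unique (hl2.congr' ?_) (by simpa using hl3)
  filter_upwards [hevt] with n hn
  obtain ⟨h1, -⟩ := hgood _ hn.1 hn.2.1 hn.2.2
  obtain ⟨-, b2, -, b4⟩ := h1 x₀ (mem_ball_self hρ)
  simp only [Function.comp]
  rw [hV]
  rw [lap2_prodMk (hU x₀ hx₀) b2]
  simpa using b4 v

theorem contDiffOn_of_lap2_eq_aux.{u} {V : Type u} [NormedAddCommGroup V] [NormedSpace ℂ V]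
    [FiniteDimensional ℝ V] {D : Set V} (hD : IsOpen D) (n : ℕ) :
    ∀ (W : Type u) [NormedAddCommGroup W] [NormedSpace ℝ W] [FiniteDimensional ℝ W]
      (O : Set (W × (V →L[ℝ] W))) (N : V × (W × (V →L[ℝ] W)) → W) (U : V → W), IsOpen O →
      ContDiffOn ℝ (⊤ : ℕ∞) N (univ ×ˢ O) → (∀ x ∈ D, ContDiffAt ℝ 2 U x) →
      (∀ x ∈ D, (U x, fderiv ℝ U x) ∈ O) →
      (∀ x ∈ D, ∀ v, lap2 U x v = N (v, (U x, fderiv ℝ U x))) → ContDiffOn ℝ (n + 2 : ℕ) U D := by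
  induction n with
  | zero =>
    intro W _ _ _ O N U hO hN hU hUO heq
    exact fun x hx => (hU x hx).contDiffWithinAt
  | succ n ih =>
    intro W _ _ _ O N U hO hN hU hUO heq
    have : ProperSpace V := FiniteDimensional.proper ℝ V
    have : CompleteSpace W := FiniteDimensional.complete ℝ W
    have hop : IsOpen ((univ : Set V) ×ˢ O) := isOpen_univ.prod hO
    have hNat : ∀ v, ∀ u ∈ O, ContDiffAt ℝ (⊤ : ℕ∞) N (v, u) := fun v u hu =>
      hN.contDiffAt (hop.mem_nhds ⟨mem_univ _, hu⟩)
    have key := fun x hx e => contDiffAt_fderiv_apply_of_lap2_eq hD (N := N) hU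
      (fun x hx v => contDiffAt_infty.1 (hNat v _ (hUO x hx)) 2) heq (x₀ := x) hx e
    have hDU : ∀ x ∈ D, ContDiffAt ℝ 2 (fderiv ℝ U) x := fun x hx =>
      (contDiffOn_clm_apply.2 fun e y hy => (key y hy e).1.contDiffWithinAt).contDiffAt
        (hD.mem_nhds hx)
    have hC : ContDiffOn ℝ (n + 2 : ℕ) (fun x => (U x, fderiv ℝ U x)) D := by
      refine ih (W × (V →L[ℝ] W)) (O ×ˢ univ)
        (fun z => (N (z.1, z.2.1), ((fderiv ℝ N (z.1, z.2.1)).comp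
          (ContinuousLinearMap.inr ℝ V (W × (V →L[ℝ] W)))).comp z.2.2)) _ (hO.prod isOpen_univ)
        ?_ (fun x hx => (hU x hx).prodMk (hDU x hx)) (fun x hx => ⟨hUO x hx, mem_univ _⟩)
        fun x hx v => ?_
      · have hp : ContDiff ℝ (⊤ : ℕ∞) (fun z : V × ((W × (V →L[ℝ] W)) ×
            (V →L[ℝ] (W × (V →L[ℝ] W)))) => (z.1, z.2.1)) := by fun_prop
        have hm : MapsTo (fun z : V × ((W × (V →L[ℝ] W)) ×
            (V →L[ℝ] (W × (V →L[ℝ] W)))) => (z.1, z.2.1)) (univ ×ˢ (O ×ˢ univ)) (univ ×ˢ O) :=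
          fun z hz => ⟨mem_univ _, hz.2.1⟩
        have hDN : ContDiffOn ℝ (⊤ : ℕ∞) (fderiv ℝ N) (univ ×ˢ O) :=
          hN.fderiv_of_isOpen hop (by simp)
        refine (hN.comp hp.contDiffOn hm).prodMk ?_
        exact ((hDN.comp hp.contDiffOn hm).clm_comp contDiffOn_const).clm_comp
          (contDiff_snd.comp contDiff_snd).contDiffOn
      · rw [lap2_prodMk (hU x hx) (hDU x hx), heq x hx]
        refine Prod.ext rfl (ContinuousLinearMap.ext fun e => ?_)
        have h1 := (key x hx e).2 v
        have h2 := lap2_clm_comp (ContinuousLinearMap.apply ℝ W e) (hDU x hx) (v := v)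
        simp only [ContinuousLinearMap.apply_apply] at h2
        rw [← h2]
        exact h1
    have h2 : ContDiffOn ℝ (n + 2 : ℕ) (fderiv ℝ U) D := contDiff_snd.comp_contDiffOn hC
    have h3 : ContDiffOn ℝ ((n + 2 : ℕ) + 1) U D :=
      (contDiffOn_succ_iff_fderiv_of_isOpen hD).2
        ⟨fun x hx => ((hU x hx).differentiableAt (by norm_num)).differentiableWithinAt, by simp, h2⟩
    exact_mod_cast h3

/-- A `C²` solution of `lap2 U x v = N (v, (U x, DU x))` with smooth `N` is smooth. -/
theorem contDiffOn_of_lap2_eq.{u} {V W : Type u} [NormedAddCommGroup V] [NormedSpace ℂ V]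
    [FiniteDimensional ℝ V] [NormedAddCommGroup W] [NormedSpace ℝ W] [FiniteDimensional ℝ W]
    {D : Set V} (hD : IsOpen D) {O : Set (W × (V →L[ℝ] W))} (hO : IsOpen O)
    {N : V × (W × (V →L[ℝ] W)) → W} (hN : ContDiffOn ℝ (⊤ : ℕ∞) N (univ ×ˢ O)) {U : V → W}
    (hU : ∀ x ∈ D, ContDiffAt ℝ 2 U x) (hUO : ∀ x ∈ D, (U x, fderiv ℝ U x) ∈ O)
    (heq : ∀ x ∈ D, ∀ v, lap2 U x v = N (v, (U x, fderiv ℝ U x))) :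
    ContDiffOn ℝ (⊤ : ℕ∞) U D :=
  contDiffOn_infty.2 fun n => (contDiffOn_of_lap2_eq_aux hD n W O N U hO hN hU hUO heq).of_le
    (by exact_mod_cast Nat.le_add_right n 2)

/-- A `C²` map into an almost complex manifold that is `(J_st, J)`-holomorphic is smooth. -/
theorem contDiffOn_of_holomorphic {V : Type*} [NormedAddCommGroup V] [NormedSpace ℂ V]
    [FiniteDimensional ℝ V] {D Ω : Set V} (hD : IsOpen D) (hΩ : IsOpen Ω) {J : V → V →L[ℝ] V}
    (hJ : ContDiffOn ℝ (⊤ : ℕ∞) J Ω) {f : V → V} (hf : ∀ x ∈ D, ContDiffAt ℝ 2 f x)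
    (hfΩ : MapsTo f D Ω)
    (hhol : ∀ x ∈ D, (fderiv ℝ f x).comp (Jst V) = (J (f x)).comp (fderiv ℝ f x)) :
    ContDiffOn ℝ (⊤ : ℕ∞) f D := by
  refine contDiffOn_of_lap2_eq hD (O := Ω ×ˢ univ) (hΩ.prod isOpen_univ)
    (N := fun z => -levTorsion J z.2.1 (z.2.2 z.1)) ?_ hf (fun x hx => ⟨hfΩ hx, mem_univ _⟩)
    fun x hx v => ?_
  · have hm : MapsTo (fun z : V × (V × (V →L[ℝ] V)) => z.2.1) (univ ×ˢ (Ω ×ˢ univ)) Ω :=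
      fun z hz => hz.2.1
    have h1 : ContDiffOn ℝ (⊤ : ℕ∞) (fun z : V × (V × (V →L[ℝ] V)) => J z.2.1)
      (univ ×ˢ (Ω ×ˢ univ)) := hJ.comp (by fun_prop) hm
    have h2 : ContDiffOn ℝ (⊤ : ℕ∞) (fun z : V × (V × (V →L[ℝ] V)) => fderiv ℝ J z.2.1)
      (univ ×ˢ (Ω ×ˢ univ)) := (hJ.fderiv_of_isOpen hΩ (by simp)).comp (by fun_prop) hm
    have h3 : ContDiffOn ℝ (⊤ : ℕ∞) (fun z : V × (V × (V →L[ℝ] V)) => z.2.2 z.1)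
      (univ ×ˢ (Ω ×ˢ univ)) := (by fun_prop : ContDiff ℝ (⊤ : ℕ∞)
        (fun z : V × (V × (V →L[ℝ] V)) => z.2.2 z.1)).contDiffOn
    have h4 := h1.clm_apply h3
    exact (((h2.clm_apply h3).clm_apply h4).sub ((h2.clm_apply h4).clm_apply h3)).neg
  · have hd : DifferentiableAt ℝ J (f x) :=
      (hJ.contDiffAt (hΩ.mem_nhds (hfΩ hx))).differentiableAt (by simp)
    exact lap2_of_holomorphic (hf x hx) hd ((hD.eventually_mem hx).mono hhol) v

set_option maxSynthPendingDepth 3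

section Bernstein

variable {J : V → V →L[ℝ] V} {u w : V → ℝ} {x : V}

theorem lev_add (hu : ContDiffAt ℝ 2 u x)
    (hw : ContDiffAt ℝ 2 w x) (X : V) :
    lev J (fun y => u y + w y) x X = lev J u x X + lev J w x X := by
  unfold lev
  rw [fderiv_fderiv_add hu hw, fderiv_fun_add (hu.differentiableAt (by norm_num))
    (hw.differentiableAt (by norm_num))]
  simp only [add_apply]
  ring

theorem lev_sum {ι : Type*} (s : Finset ι) {u : ι → V → ℝ}
    (hu : ∀ i ∈ s, ContDiffAt ℝ 2 (u i) x) (X : V) :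
    lev J (fun y => ∑ i ∈ s, u i y) x X = ∑ i ∈ s, lev J (u i) x X := by
  classical
  induction s using Finset.induction_on with
  | empty => simp [lev]
  | insert a s ha ih =>
    simp only [Finset.sum_insert ha]
    rw [lev_add (hu a (Finset.mem_insert_self a s))
      (ContDiffAt.sum fun i hi => hu i (Finset.mem_insert_of_mem hi)),
      ih fun i hi => hu i (Finset.mem_insert_of_mem hi)]

theorem fderiv_fderiv_mul (hu : ContDiffAt ℝ 2 u x)
    (hw : ContDiffAt ℝ 2 w x) (a b : V) :
    fderiv ℝ (fderiv ℝ (fun y => u y * w y)) x a b =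
      u x * fderiv ℝ (fderiv ℝ w) x a b + w x * fderiv ℝ (fderiv ℝ u) x a b +
        fderiv ℝ u x a * fderiv ℝ w x b + fderiv ℝ w x a * fderiv ℝ u x b := by
  have h1 : fderiv ℝ (fun y => u y * w y) =ᶠ[𝓝 x]
      fun y => u y • fderiv ℝ w y + w y • fderiv ℝ u y := by
    filter_upwards [hu.eventually_differentiableAt_two, hw.eventually_differentiableAt_two]
      with y h1 h2
    exact fderiv_fun_mul h1 h2
  have d1 := (hu.differentiableAt (by norm_num)).hasFDerivAt
  have d2 := (hw.differentiableAt (by norm_num)).hasFDerivAt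
  have h2 := (d1.fun_smul hw.differentiableAt_fderiv_two.hasFDerivAt).fun_add
    (d2.fun_smul hu.differentiableAt_fderiv_two.hasFDerivAt)
  rw [h1.fderiv_eq, h2.fderiv]
  simp
  ring

/-- The gradient form of the Levi operator. -/
def levGrad (J : V → V →L[ℝ] V) (u w : V → ℝ) (x X : V) : ℝ :=
  fderiv ℝ u x X * fderiv ℝ w x X + fderiv ℝ u x (J x X) * fderiv ℝ w x (J x X)

theorem lev_mul (hu : ContDiffAt ℝ 2 u x)
    (hw : ContDiffAt ℝ 2 w x) (X : V) :
    lev J (fun y => u y * w y) x X =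
      u x * lev J w x X + w x * lev J u x X + 2 * levGrad J u w x X := by
  unfold lev levGrad
  rw [fderiv_fderiv_mul hu hw, fderiv_fderiv_mul hu hw,
    fderiv_fun_mul (hu.differentiableAt (by norm_num)) (hw.differentiableAt (by norm_num))]
  simp
  ring

theorem lev_nonpos_of_isLocalMax
    (hu : ContDiffAt ℝ 2 u x) (hm : IsLocalMax u x) (X : V) : lev J u x X ≤ 0 := by
  unfold lev
  rw [hm.fderiv_eq_zero]
  have h1 := fderiv_fderiv_nonpos_of_isLocalMax hu hm X
  have h2 := fderiv_fderiv_nonpos_of_isLocalMax hu hm (J x X)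
  simp
  linarith

theorem abs_lev_le {K : ℝ} (hJ : ‖J x‖ ≤ K)
    (hDJ : ‖fderiv ℝ J x‖ ≤ K) (X : V) :
    |lev J u x X| ≤ ((1 + K ^ 2) * ‖fderiv ℝ (fderiv ℝ u) x‖ + 2 * K ^ 2 * ‖fderiv ℝ u x‖) *
      ‖X‖ ^ 2 := by
  have hK : 0 ≤ K := (norm_nonneg _).trans hJ
  have hJX : ‖J x X‖ ≤ K * ‖X‖ := (J x).le_of_opNorm_le hJ X
  have h1 := (fderiv ℝ (fderiv ℝ u) x).le_opNorm₂ X X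
  have h2 : ‖fderiv ℝ (fderiv ℝ u) x (J x X) (J x X)‖ ≤
      ‖fderiv ℝ (fderiv ℝ u) x‖ * (K * ‖X‖) * (K * ‖X‖) :=
    ((fderiv ℝ (fderiv ℝ u) x).le_opNorm₂ _ _).trans (by gcongr)
  have h3 : ‖fderiv ℝ u x (levTorsion J x X)‖ ≤ ‖fderiv ℝ u x‖ * (2 * K ^ 2 * ‖X‖ ^ 2) :=
    ((fderiv ℝ u x).le_opNorm _).trans (by gcongr; exact norm_levTorsion_le hJ hDJ X)
  rw [← Real.norm_eq_abs]
  unfold lev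
  refine (norm_sub_le _ _).trans ?_
  have h4 := norm_add_le (fderiv ℝ (fderiv ℝ u) x X X) (fderiv ℝ (fderiv ℝ u) x (J x X) (J x X))
  linarith

/-- The Levi operator of a directional derivative of a solution of `lev J u = 0`. -/
theorem abs_lev_fderiv_apply_le {K : ℝ}
    (hu : ContDiffAt ℝ 3 u x) (hJ : ContDiffAt ℝ 2 J x) (h0 : ‖J x‖ ≤ K)
    (h1 : ‖fderiv ℝ J x‖ ≤ K) (h2 : ‖fderiv ℝ (fderiv ℝ J) x‖ ≤ K) {X : V}
    (hlev : ∀ᶠ y in 𝓝 x, lev J u y X = 0) (e : V) :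
    |lev J (fun y => fderiv ℝ u y e) x X| ≤
      (2 * K ^ 2 * ‖fderiv ℝ (fderiv ℝ u) x‖ + 4 * K ^ 2 * ‖fderiv ℝ u x‖) * (‖e‖ * ‖X‖ ^ 2) := by
  have hK : 0 ≤ K := (norm_nonneg _).trans h0
  have hu1 : ContDiffAt ℝ 2 (fderiv ℝ u) x := hu.fderiv_right (by norm_num)
  have hA := hu1.differentiableAt_fderiv_two.hasFDerivAt
  have hA1 := (hu1.differentiableAt (by norm_num)).hasFDerivAt
  have hJ1 := (hJ.differentiableAt (by norm_num)).hasFDerivAt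
  have hJ2 := hJ.differentiableAt_fderiv_two.hasFDerivAt
  have hX := hasFDerivAt_const (𝕜 := ℝ) X x
  have hJX := hJ1.clm_apply hX
  have hT := ((hJ2.clm_apply hX).clm_apply hJX).fun_sub ((hJ2.clm_apply hJX).clm_apply hX)
  have hL := (((hA.clm_apply hX).clm_apply hX).fun_add
    ((hA.clm_apply hJX).clm_apply hJX)).fun_sub (hA1.clm_apply hT)
  have hz := (HasFDerivAt.congr_of_eventuallyEq hL.differentiableAt.hasFDerivAt
    (f₁ := fun _ => (0 : ℝ)) (hlev.mono fun y hy => hy.symm)).unique (hasFDerivAt_const (0 : ℝ) x)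
  rw [hL.fderiv] at hz
  have hze := congrArg (fun L : V →L[ℝ] ℝ => L e) hz
  have hue : fderiv ℝ (fun y => fderiv ℝ u y e) =ᶠ[𝓝 x] fun y => fderiv ℝ (fderiv ℝ u) y e := by
    have h3 : ∀ᶠ y in 𝓝 x, ContDiffAt ℝ 3 u y := hu.eventually (by simp)
    filter_upwards [h3] with y hy
    have hy2 : ContDiffAt ℝ 2 u y := hy.of_le (by norm_num)
    ext v
    have := (hy2.differentiableAt_fderiv_two.hasFDerivAt.clm_apply
      (hasFDerivAt_const (𝕜 := ℝ) e y)).fderiv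
    rw [this]
    simp [fderiv_fderiv_symm hy2 v e]
  have hue2 : ∀ a b, fderiv ℝ (fderiv ℝ (fun y => fderiv ℝ u y e)) x a b =
      fderiv ℝ (fderiv ℝ (fderiv ℝ u)) x e a b := fun a b => by
    rw [hue.fderiv_eq, (hA.clm_apply (hasFDerivAt_const (𝕜 := ℝ) e x)).fderiv,
      fderiv_fderiv_symm hu1 e a]
    simp
  have key : lev J (fun y => fderiv ℝ u y e) x X =
      -(fderiv ℝ (fderiv ℝ u) x (fderiv ℝ J x e X) (J x X)
        + fderiv ℝ (fderiv ℝ u) x (J x X) (fderiv ℝ J x e X))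
      + fderiv ℝ u x (fderiv ℝ (fderiv ℝ J) x e X (J x X) + fderiv ℝ J x X (fderiv ℝ J x e X)
        - fderiv ℝ (fderiv ℝ J) x e (J x X) X - fderiv ℝ J x (fderiv ℝ J x e X) X) := by
    unfold lev
    rw [hue2, hue2, hue.eq_of_nhds]
    unfold levTorsion
    simp at hze ⊢
    linarith
  have hJX' : ‖J x X‖ ≤ K * ‖X‖ := (J x).le_of_opNorm_le h0 X
  have hDJ : ∀ a b : V, ‖fderiv ℝ J x a b‖ ≤ K * ‖a‖ * ‖b‖ := fun a b =>
    ((fderiv ℝ J x).le_opNorm₂ a b).trans (by gcongr)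
  have hDDJ : ∀ a b : V, ‖fderiv ℝ (fderiv ℝ J) x e a b‖ ≤ K * ‖e‖ * ‖a‖ * ‖b‖ := fun a b => by
    refine ((fderiv ℝ (fderiv ℝ J) x e).le_opNorm₂ a b).trans ?_
    gcongr
    exact (fderiv ℝ (fderiv ℝ J) x).le_of_opNorm_le h2 e
  have b1 : ‖fderiv ℝ (fderiv ℝ u) x (fderiv ℝ J x e X) (J x X)‖ ≤
      ‖fderiv ℝ (fderiv ℝ u) x‖ * (K * ‖e‖ * ‖X‖) * (K * ‖X‖) :=
    ((fderiv ℝ (fderiv ℝ u) x).le_opNorm₂ _ _).trans (by gcongr; exact hDJ e X)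
  have b2 : ‖fderiv ℝ (fderiv ℝ u) x (J x X) (fderiv ℝ J x e X)‖ ≤
      ‖fderiv ℝ (fderiv ℝ u) x‖ * (K * ‖X‖) * (K * ‖e‖ * ‖X‖) :=
    ((fderiv ℝ (fderiv ℝ u) x).le_opNorm₂ _ _).trans (by gcongr; exact hDJ e X)
  have b3 : ‖fderiv ℝ (fderiv ℝ J) x e X (J x X)‖ ≤ K * ‖e‖ * ‖X‖ * (K * ‖X‖) :=
    (hDDJ _ _).trans (by gcongr)
  have b4 : ‖fderiv ℝ J x X (fderiv ℝ J x e X)‖ ≤ K * ‖X‖ * (K * ‖e‖ * ‖X‖) :=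
    (hDJ _ _).trans (by gcongr; exact hDJ e X)
  have b5 : ‖fderiv ℝ (fderiv ℝ J) x e (J x X) X‖ ≤ K * ‖e‖ * (K * ‖X‖) * ‖X‖ :=
    (hDDJ _ _).trans (by gcongr)
  have b6 : ‖fderiv ℝ J x (fderiv ℝ J x e X) X‖ ≤ K * (K * ‖e‖ * ‖X‖) * ‖X‖ :=
    (hDJ _ _).trans (by gcongr; exact hDJ e X)
  set Q := fderiv ℝ (fderiv ℝ J) x e X (J x X) + fderiv ℝ J x X (fderiv ℝ J x e X)
        - fderiv ℝ (fderiv ℝ J) x e (J x X) X - fderiv ℝ J x (fderiv ℝ J x e X) X with hQ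
  have b7 : ‖Q‖ ≤ 4 * K ^ 2 * (‖e‖ * ‖X‖ ^ 2) := by
    have c1 := norm_sub_le (fderiv ℝ (fderiv ℝ J) x e X (J x X) + fderiv ℝ J x X (fderiv ℝ J x e X)
        - fderiv ℝ (fderiv ℝ J) x e (J x X) X) (fderiv ℝ J x (fderiv ℝ J x e X) X)
    have c2 := norm_sub_le (fderiv ℝ (fderiv ℝ J) x e X (J x X) + fderiv ℝ J x X (fderiv ℝ J x e X))
        (fderiv ℝ (fderiv ℝ J) x e (J x X) X)
    have c3 := norm_add_le (fderiv ℝ (fderiv ℝ J) x e X (J x X)) (fderiv ℝ J x X (fderiv ℝ J x e X))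
    rw [hQ]
    linarith
  have b8 : ‖fderiv ℝ u x Q‖ ≤ ‖fderiv ℝ u x‖ * (4 * K ^ 2 * (‖e‖ * ‖X‖ ^ 2)) :=
    ((fderiv ℝ u x).le_opNorm _).trans (by gcongr)
  rw [key, ← Real.norm_eq_abs]
  refine (norm_add_le _ _).trans ?_
  rw [norm_neg]
  have b9 := norm_add_le (fderiv ℝ (fderiv ℝ u) x (fderiv ℝ J x e X) (J x X))
    (fderiv ℝ (fderiv ℝ u) x (J x X) (fderiv ℝ J x e X))
  linarith

end Bernstein

section BernsteinEstimate

theorem bernstein_term_le {η u L α₁ α₂ d₁ d₂ Λ B ε D₁ D₂ : ℝ} (h0 : 0 ≤ η) (h1 : η ≤ 1)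
    (hα : α₁ ^ 2 + α₂ ^ 2 ≤ B) (hΛ : |Λ| ≤ B) (hB : 0 ≤ B) (hL : |L| ≤ B * (D₂ + D₁))
    (hε : 0 < ε) :
    η ^ 2 * d₁ ^ 2 - η ^ 2 * (ε * D₂ ^ 2) - (19 * B + B ^ 2 / ε) * u ^ 2 - B * D₁ ^ 2 ≤
      2 * (η * u) * (η * L + u * Λ + 2 * (α₁ * d₁ + α₂ * d₂)) +
        2 * ((η * d₁ + u * α₁) * (η * d₁ + u * α₁) + (η * d₂ + u * α₂) * (η * d₂ + u * α₂)) := by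
  have hη2 : η ^ 2 ≤ 1 := by nlinarith
  have e1 : -(η ^ 2 * (ε * D₂ ^ 2)) - B ^ 2 / ε * u ^ 2 - B * u ^ 2 - B * D₁ ^ 2 ≤
      2 * η ^ 2 * (u * L) := by
    have a1 : -(|u| * (B * (D₂ + D₁))) ≤ u * L := by
      have : |u * L| ≤ |u| * (B * (D₂ + D₁)) := by rw [abs_mul]; gcongr
      linarith [neg_abs_le (u * L)]
    have a2 : 2 * (|u| * (B * D₂)) ≤ ε * D₂ ^ 2 + B ^ 2 / ε * u ^ 2 := by
      have hs : 0 ≤ (ε * D₂ - B * |u|) ^ 2 / ε := by positivity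
      have : (ε * D₂ - B * |u|) ^ 2 / ε = ε * D₂ ^ 2 + B ^ 2 / ε * u ^ 2 - 2 * (|u| * (B * D₂)) := by
        field_simp
        rw [← sq_abs u]
        ring
      linarith
    have a3 : 2 * (|u| * (B * D₁)) ≤ B * u ^ 2 + B * D₁ ^ 2 := by
      have : 0 ≤ B * (|u| - D₁) ^ 2 := by positivity
      rw [← sq_abs u]
      nlinarith
    have a4 : 0 ≤ B ^ 2 / ε * u ^ 2 + B * u ^ 2 + B * D₁ ^ 2 := by positivity
    have a5 : -(ε * D₂ ^ 2 + (B ^ 2 / ε * u ^ 2 + B * u ^ 2 + B * D₁ ^ 2)) ≤ 2 * (u * L) := by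
      linarith
    have a6 := mul_le_mul_of_nonneg_left a5 (sq_nonneg η)
    have a7 := mul_le_mul_of_nonneg_right hη2 a4
    linarith
  have e2 : -(2 * B * u ^ 2) ≤ 2 * η * u ^ 2 * Λ := by
    have a1 : |2 * η * u ^ 2 * Λ| ≤ 2 * 1 * u ^ 2 * B := by
      rw [abs_mul, abs_of_nonneg (by positivity : 0 ≤ 2 * η * u ^ 2)]
      gcongr
    linarith [neg_abs_le (2 * η * u ^ 2 * Λ)]
  have e3 : 16 * u ^ 2 * (α₁ ^ 2 + α₂ ^ 2) ≤ 16 * u ^ 2 * B := by gcongr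
  have e4 : 0 ≤ (η * d₁ + 4 * u * α₁) ^ 2 + (η * d₂ + 4 * u * α₂) ^ 2 := by positivity
  have e5 : 0 ≤ η ^ 2 * d₂ ^ 2 + 2 * u ^ 2 * (α₁ ^ 2 + α₂ ^ 2) := by positivity
  linarith

variable [FiniteDimensional ℝ V]

theorem exists_abs_repr_le {ι : Type*} [Fintype ι] (b : Module.Basis ι ℝ V) :
    ∃ c > 0, ∀ (v : V) k, |b.repr v k| ≤ c * ‖v‖ := by
  have h1 : ∀ k, ∃ c > 0, ∀ v : V, |b.repr v k| ≤ c * ‖v‖ := fun k => by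
    set T : V →L[ℝ] ℝ := LinearMap.toContinuousLinearMap (b.coord k)
    refine ⟨‖T‖ + 1, by positivity, fun v => ?_⟩
    have := T.le_opNorm v
    change ‖b.repr v k‖ ≤ _ at this
    rw [← Real.norm_eq_abs]
    linarith [norm_nonneg v]
  choose c hc h using h1
  refine ⟨∑ k, c k + 1, add_pos_of_nonneg_of_pos (Finset.sum_nonneg fun k _ => (hc k).le) one_pos,
    fun v k => (h k v).trans ?_⟩
  gcongr
  linarith [Finset.single_le_sum (fun k _ => (hc k).le) (Finset.mem_univ k)]

theorem norm_sq_le_sum_basis {ι W : Type*} [Fintype ι] [NormedAddCommGroup W] [NormedSpace ℝ W]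
    (b : Module.Basis ι ℝ V) {c : ℝ} (hc : 0 < c) (hcb : ∀ (v : V) k, |b.repr v k| ≤ c * ‖v‖)
    (T : V →L[ℝ] W) : ‖T‖ ^ 2 ≤ c ^ 2 * Fintype.card ι * ∑ k, ‖T (b k)‖ ^ 2 := by
  have h1 : ‖T‖ ≤ c * ∑ k, ‖T (b k)‖ := by
    refine T.opNorm_le_bound (by positivity) fun v => ?_
    conv_lhs => rw [← b.sum_repr v, map_sum]
    refine (norm_sum_le _ _).trans ?_
    rw [mul_right_comm, Finset.mul_sum]
    refine Finset.sum_le_sum fun k _ => ?_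
    rw [map_smul, norm_smul, Real.norm_eq_abs]
    exact mul_le_mul_of_nonneg_right (hcb v k) (norm_nonneg _)
  have h2 : (∑ k, ‖T (b k)‖) ^ 2 ≤ Fintype.card ι * ∑ k, ‖T (b k)‖ ^ 2 := by
    simpa using sq_sum_le_card_mul_sum_sq (s := Finset.univ) (f := fun k => ‖T (b k)‖)
  calc ‖T‖ ^ 2 ≤ (c * ∑ k, ‖T (b k)‖) ^ 2 := by gcongr
    _ = c ^ 2 * (∑ k, ‖T (b k)‖) ^ 2 := by ring
    _ ≤ c ^ 2 * (Fintype.card ι * ∑ k, ‖T (b k)‖ ^ 2) := by gcongr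
    _ = _ := by ring

theorem exists_norm_sq_le_sum_basis {ι : Type*} [Fintype ι] (b : Module.Basis ι ℝ V) :
    ∃ C > 0, (∀ T : V →L[ℝ] ℝ, ‖T‖ ^ 2 ≤ C * ∑ k, T (b k) ^ 2) ∧
      ∀ B : V →L[ℝ] V →L[ℝ] ℝ, ‖B‖ ^ 2 ≤ C * ∑ k, ∑ l, B (b k) (b l) ^ 2 := by
  obtain ⟨c, hc, hcb⟩ := exists_abs_repr_le b
  set C₁ := c ^ 2 * Fintype.card ι with hC₁
  have hC₁0 : 0 ≤ C₁ := by positivity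
  refine ⟨C₁ + C₁ ^ 2 + 1, by positivity, fun T => (norm_sq_le_sum_basis b hc hcb T).trans ?_, fun B => ?_⟩
  · have h0 : 0 ≤ ∑ k, T (b k) ^ 2 := Finset.sum_nonneg fun k _ => sq_nonneg _
    simp only [Real.norm_eq_abs, sq_abs]
    exact mul_le_mul_of_nonneg_right (by nlinarith) h0
  · have h0 : 0 ≤ ∑ k, ∑ l, B (b k) (b l) ^ 2 :=
      Finset.sum_nonneg fun k _ => Finset.sum_nonneg fun l _ => sq_nonneg _
    have h1 : ∑ k, ‖B (b k)‖ ^ 2 ≤ ∑ k, C₁ * ∑ l, B (b k) (b l) ^ 2 :=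
      Finset.sum_le_sum fun k _ => by
        simpa only [Real.norm_eq_abs, sq_abs] using norm_sq_le_sum_basis b hc hcb (B (b k))
    have h2 := mul_le_mul_of_nonneg_left h1 hC₁0
    rw [← Finset.mul_sum] at h2
    have h3 : 0 ≤ C₁ * ∑ k, ∑ l, B (b k) (b l) ^ 2 := mul_nonneg hC₁0 h0
    have h4 := norm_sq_le_sum_basis b hc hcb B
    rw [add_mul, add_mul, one_mul, sq, mul_assoc]
    linarith

end BernsteinEstimate

section BernsteinBound

variable [FiniteDimensional ℝ V]

theorem exists_bump_bounds (x₀ : V) {ρ : ℝ} (hρ : 0 < ρ) :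
    ∃ (η : V → ℝ) (B : ℝ), ContDiff ℝ 2 η ∧ (∀ y, 0 ≤ η y ∧ η y ≤ 1) ∧
      (∀ y ∈ ball x₀ (ρ / 4), η y = 1) ∧ (∀ y, η y ≠ 0 → y ∈ ball x₀ (ρ / 2)) ∧ 0 ≤ B ∧
      ∀ y ∈ closedBall x₀ (ρ / 2), ‖fderiv ℝ η y‖ ≤ B ∧ ‖fderiv ℝ (fderiv ℝ η) y‖ ≤ B := by
  let η : ContDiffBump x₀ := ⟨ρ / 4, ρ / 2, by positivity, by linarith⟩
  have h2 : ContDiff ℝ 2 η := η.contDiff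
  have h3 : ContDiff ℝ 1 (fderiv ℝ η) := h2.fderiv_right (by norm_num)
  obtain ⟨B₁, hB₁⟩ := (isCompact_closedBall x₀ (ρ / 2)).exists_bound_of_continuousOn
    h3.continuous.continuousOn
  obtain ⟨B₂, hB₂⟩ := (isCompact_closedBall x₀ (ρ / 2)).exists_bound_of_continuousOn
    (h3.continuous_fderiv (by norm_num)).continuousOn
  refine ⟨η, max B₁ B₂, h2, fun y => ⟨η.nonneg, η.le_one⟩, fun y hy =>
    η.one_of_mem_closedBall (ball_subset_closedBall hy), fun y hy => ?_,
    ((norm_nonneg _).trans (hB₁ x₀ (mem_closedBall_self (by positivity)))).trans (le_max_left _ _),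
    fun y hy => ⟨(hB₁ y hy).trans (le_max_left _ _), (hB₂ y hy).trans (le_max_right _ _)⟩⟩
  have : y ∈ Function.support η := hy
  rwa [η.support_eq] at this

set_option maxHeartbeats 1000000 in
theorem exists_norm_fderiv_le_of_lev_eq_zero_aux {n : ℕ} (b : Module.Basis (Fin n) ℝ V) (x₀ : V)
    {ρ K M : ℝ} (hρ : 0 < ρ) :
    ∃ C, ∀ (J : V → V →L[ℝ] V) (u : V → ℝ),
      (∀ y ∈ ball x₀ ρ, ContDiffAt ℝ 2 J y ∧ ‖J y‖ ≤ K ∧ ‖fderiv ℝ J y‖ ≤ K ∧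
        ‖fderiv ℝ (fderiv ℝ J) y‖ ≤ K ∧ ContDiffAt ℝ 3 u y ∧ |u y| ≤ M ∧
        ∀ X, lev J u y X = 0) →
      ∀ y ∈ ball x₀ (ρ / 4), ‖fderiv ℝ u y‖ ≤ C := by
  obtain ⟨C₀, hC₀, hb1, hb2⟩ := exists_norm_sq_le_sum_basis b
  obtain ⟨η, Bη, hη2, hη01, hη1, hηsupp, hBη, hηB⟩ := exists_bump_bounds x₀ hρ
  set m := ∑ k, ‖b k‖ with hm
  have hm0 : 0 ≤ m := Finset.sum_nonneg fun k _ => norm_nonneg _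
  have hbm : ∀ k, ‖b k‖ ≤ m := fun k =>
    Finset.single_le_sum (f := fun k => ‖b k‖) (fun k _ => norm_nonneg _) (Finset.mem_univ k)
  set B₁ := Bη ^ 2 * m ^ 2 * (1 + K ^ 2) with hB₁
  set B₂ := ((1 + K ^ 2) * Bη + 2 * K ^ 2 * Bη) * m ^ 2 with hB₂
  set B₃ := 4 * K ^ 2 * (m * m ^ 2) with hB₃
  set B := B₁ + B₂ + B₃ with hB
  clear_value B₁ B₂ B₃ B m
  have hB₁0 : 0 ≤ B₁ := by rw [hB₁]; positivity
  have hB₂0 : 0 ≤ B₂ := by rw [hB₂]; positivity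
  have hB₃0 : 0 ≤ B₃ := by rw [hB₃]; positivity
  have hB0 : 0 ≤ B := by rw [hB]; positivity
  set ε := 1 / ((n : ℝ) ^ 2 * C₀ + 1) with hε
  clear_value ε
  have hε0 : 0 < ε := by rw [hε]; positivity
  set A := (19 * B + B ^ 2 / ε) * n + (n : ℝ) ^ 2 * B * C₀ + 1 with hA
  clear_value A
  have hA0 : 0 < A := by rw [hA]; positivity
  refine ⟨√(C₀ * (A * M ^ 2)), fun J u h => ?_⟩
  set p : V → ℝ := fun y => ∑ l, fderiv ℝ u y (b l) ^ 2 with hp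
  set s : Fin n → V → ℝ := fun l y => η y * fderiv ℝ u y (b l) with hs
  set W : V → ℝ := fun y => (∑ l, s l y * s l y) + A * (u y * u y) with hW
  have hWp : ∀ y, W y = η y ^ 2 * p y + A * u y ^ 2 := fun y => by
    simp only [hW, hs, hp, Finset.mul_sum]
    congr 1
    · exact Finset.sum_congr rfl fun l _ => by ring
    · ring
  have hul : ∀ y ∈ ball x₀ ρ, ∀ l, ContDiffAt ℝ 2 (fun y => fderiv ℝ u y (b l)) y := fun y hy l =>
    ((h y hy).2.2.2.2.1.fderiv_right (m := 2) (by norm_num)).clm_apply contDiffAt_const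
  have hsl : ∀ y ∈ ball x₀ ρ, ∀ l, ContDiffAt ℝ 2 (s l) y := fun y hy l =>
    hη2.contDiffAt.mul (hul y hy l)
  have hu2 : ∀ y ∈ ball x₀ ρ, ContDiffAt ℝ 2 u y := fun y hy =>
    (h y hy).2.2.2.2.1.of_le (by norm_num)
  have hss : ∀ y ∈ ball x₀ ρ, ContDiffAt ℝ 2 (fun y => ∑ l, s l y * s l y) y := fun y hy =>
    ContDiffAt.sum fun l _ => (hsl y hy l).mul (hsl y hy l)
  have huu : ∀ y ∈ ball x₀ ρ, ContDiffAt ℝ 2 (fun y => u y * u y) y := fun y hy =>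
    (hu2 y hy).mul (hu2 y hy)
  have hW2 : ∀ y ∈ ball x₀ ρ, ContDiffAt ℝ 2 W y := fun y hy =>
    (hss y hy).add (contDiffAt_const.mul (huu y hy))
  have hsub : closedBall x₀ (ρ / 2) ⊆ ball x₀ ρ := closedBall_subset_ball (by linarith)
  obtain ⟨x₁, hx₁, hmax⟩ := (isCompact_closedBall x₀ (ρ / 2)).exists_isMaxOn
    (nonempty_closedBall.2 (by positivity)) (f := W)
    fun y hy => (hW2 y (hsub hy)).continuousAt.continuousWithinAt
  have hu2M : u x₁ ^ 2 ≤ M ^ 2 := by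
    rw [← sq_abs]
    have := (h x₁ (hsub hx₁)).2.2.2.2.2.1
    gcongr
  have key : W x₁ ≤ A * M ^ 2 := by
    suffices η x₁ ^ 2 * p x₁ ≤ 0 by
      rw [hWp]
      have := mul_le_mul_of_nonneg_left hu2M hA0.le
      linarith
    rcases eq_or_ne (η x₁) 0 with h0 | h0
    · simp [h0]
    have hloc : IsLocalMax W x₁ := by
      filter_upwards [isOpen_ball.mem_nhds (hηsupp x₁ h0)] with y hy
      exact hmax (ball_subset_closedBall hy)
    obtain ⟨hJ2, hJK, hDJ, hDDJ, hu3, -, hlev⟩ := h x₁ (hsub hx₁)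
    have hK0 : 0 ≤ K := (norm_nonneg _).trans hJK
    set D₂ := ‖fderiv ℝ (fderiv ℝ u) x₁‖
    set D₁ := ‖fderiv ℝ u x₁‖ with hD₁
    have hD₂0 : 0 ≤ D₂ := norm_nonneg _
    have hD₁0 : 0 ≤ D₁ := norm_nonneg _
    have hlevW : ∀ k, lev J W x₁ (b k) = (∑ l, lev J (fun y => s l y * s l y) x₁ (b k)) +
        2 * A * (fderiv ℝ u x₁ (b k) ^ 2 + fderiv ℝ u x₁ (J x₁ (b k)) ^ 2) := fun k => by
      have e := lev_add (J := J) (hss x₁ (hsub hx₁))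
        ((contDiffAt_const (c := A)).mul (huu x₁ (hsub hx₁))) (b k)
      rw [lev_sum _ fun l _ => (hsl x₁ (hsub hx₁) l).mul (hsl x₁ (hsub hx₁) l)] at e
      rw [show W = fun y => (∑ l, s l y * s l y) + A * (u y * u y) from rfl, e,
        lev_mul contDiffAt_const (huu x₁ (hsub hx₁)), lev_mul (hu2 x₁ (hsub hx₁))
        (hu2 x₁ (hsub hx₁)), hlev]
      simp [lev, levGrad]
      ring
    have hterm : ∀ k l, η x₁ ^ 2 * fderiv ℝ (fderiv ℝ u) x₁ (b k) (b l) ^ 2 -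
        η x₁ ^ 2 * (ε * D₂ ^ 2) - (19 * B + B ^ 2 / ε) * fderiv ℝ u x₁ (b l) ^ 2 - B * D₁ ^ 2 ≤
        lev J (fun y => s l y * s l y) x₁ (b k) := fun k l => by
      have hmk : ‖b k‖ ^ 2 ≤ m ^ 2 := by have := hbm k; gcongr
      have e1 : fderiv ℝ (s l) x₁ = η x₁ • fderiv ℝ (fun y => fderiv ℝ u y (b l)) x₁ +
          fderiv ℝ u x₁ (b l) • fderiv ℝ η x₁ :=
        fderiv_fun_mul (hη2.contDiffAt.differentiableAt (by norm_num))
          ((hul x₁ (hsub hx₁) l).differentiableAt (by norm_num))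
      have e2 : fderiv ℝ (fun y => fderiv ℝ u y (b l)) x₁ (b k) =
          fderiv ℝ (fderiv ℝ u) x₁ (b k) (b l) := by
        have d := ((hu2 x₁ (hsub hx₁)).differentiableAt_fderiv_two.hasFDerivAt).clm_apply
          (hasFDerivAt_const (b l) x₁)
        rw [d.fderiv]
        simp
      have hΛ : |lev J η x₁ (b k)| ≤ B := by
        have := abs_lev_le (u := η) hJK hDJ (b k)
        have h1 := (hηB x₁ hx₁).1
        have h2 := (hηB x₁ hx₁).2
        calc _ ≤ _ := this
          _ ≤ B₂ := by rw [hB₂]; gcongr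
          _ ≤ B := by linarith
      have hα : fderiv ℝ η x₁ (b k) ^ 2 + fderiv ℝ η x₁ (J x₁ (b k)) ^ 2 ≤ B := by
        have a1 : |fderiv ℝ η x₁ (b k)| ≤ Bη * m :=
          ((fderiv ℝ η x₁).le_of_opNorm_le (hηB x₁ hx₁).1 _).trans (by gcongr; exact hbm k)
        have a2 : |fderiv ℝ η x₁ (J x₁ (b k))| ≤ Bη * (K * m) :=
          ((fderiv ℝ η x₁).le_of_opNorm_le (hηB x₁ hx₁).1 _).trans (by
            gcongr; exact ((J x₁).le_of_opNorm_le hJK _).trans (by gcongr; exact hbm k))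
        rw [← sq_abs, ← sq_abs (fderiv ℝ η x₁ (J x₁ (b k)))]
        calc _ ≤ (Bη * m) ^ 2 + (Bη * (K * m)) ^ 2 := by gcongr
          _ = B₁ := by rw [hB₁]; ring
          _ ≤ B := by linarith
      have hL : |lev J (fun y => fderiv ℝ u y (b l)) x₁ (b k)| ≤ B * (D₂ + D₁) := by
        have ev : ∀ᶠ y in 𝓝 x₁, lev J u y (b k) = 0 := by
          filter_upwards [isOpen_ball.mem_nhds (hsub hx₁)] with y hy
          exact (h y hy).2.2.2.2.2.2 (b k)
        have := abs_lev_fderiv_apply_le hu3 hJ2 hJK hDJ hDDJ ev (b l)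
        have hl := hbm l
        calc _ ≤ _ := this
          _ ≤ (4 * K ^ 2 * D₂ + 4 * K ^ 2 * D₁) * (m * m ^ 2) := by gcongr; norm_num
          _ = B₃ * (D₂ + D₁) := by rw [hB₃]; ring
          _ ≤ B * (D₂ + D₁) := by
            have : 0 ≤ D₂ + D₁ := add_nonneg hD₂0 hD₁0
            gcongr
            linarith
      have := bernstein_term_le (η := η x₁) (u := fderiv ℝ u x₁ (b l))
        (d₁ := fderiv ℝ (fderiv ℝ u) x₁ (b k) (b l))
        (d₂ := fderiv ℝ (fun y => fderiv ℝ u y (b l)) x₁ (J x₁ (b k))) (hη01 x₁).1 (hη01 x₁).2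
        hα hΛ hB0 hL hε0
      refine this.trans (le_of_eq ?_)
      rw [lev_mul (hsl x₁ (hsub hx₁) l) (hsl x₁ (hsub hx₁) l),
        lev_mul hη2.contDiffAt (hul x₁ (hsub hx₁) l)]
      simp only [levGrad, e1, add_apply, smul_apply, e2, smul_eq_mul]
      simp only [hs]
      ring
    have hsum : ∑ k, lev J W x₁ (b k) ≤ 0 := Finset.sum_nonpos fun k _ =>
      lev_nonpos_of_isLocalMax (hW2 x₁ (hsub hx₁)) hloc (b k)
    have hlow : ∑ k, ((∑ l, (η x₁ ^ 2 * fderiv ℝ (fderiv ℝ u) x₁ (b k) (b l) ^ 2 -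
        η x₁ ^ 2 * (ε * D₂ ^ 2) - (19 * B + B ^ 2 / ε) * fderiv ℝ u x₁ (b l) ^ 2 - B * D₁ ^ 2)) +
        2 * A * fderiv ℝ u x₁ (b k) ^ 2) ≤ ∑ k, lev J W x₁ (b k) := by
      refine Finset.sum_le_sum fun k _ => ?_
      rw [hlevW]
      refine add_le_add (Finset.sum_le_sum fun l _ => hterm k l) ?_
      have := sq_nonneg (fderiv ℝ u x₁ (J x₁ (b k)))
      gcongr
      linarith
    simp only [Finset.sum_add_distrib, Finset.sum_sub_distrib, ← Finset.mul_sum,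
      Finset.sum_const, Finset.card_univ, Fintype.card_fin, nsmul_eq_mul] at hlow
    have hpx : ∑ k, fderiv ℝ u x₁ (b k) ^ 2 = p x₁ := rfl
    rw [hpx] at hlow
    have hp0 : 0 ≤ p x₁ := Finset.sum_nonneg fun _ _ => sq_nonneg _
    have hD1 : D₁ ^ 2 ≤ C₀ * p x₁ := hb1 _
    have hD2 : D₂ ^ 2 ≤ C₀ * ∑ k, ∑ l, fderiv ℝ (fderiv ℝ u) x₁ (b k) (b l) ^ 2 := hb2 _
    set Q := ∑ k, ∑ l, fderiv ℝ (fderiv ℝ u) x₁ (b k) (b l) ^ 2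
    have hQ0 : 0 ≤ Q := Finset.sum_nonneg fun _ _ => Finset.sum_nonneg fun _ _ => sq_nonneg _
    have hεQ : (n : ℝ) ^ 2 * (ε * D₂ ^ 2) ≤ Q := by
      calc (n : ℝ) ^ 2 * (ε * D₂ ^ 2) ≤ (n : ℝ) ^ 2 * (ε * (C₀ * Q)) := by gcongr
        _ = (n ^ 2 * C₀) / (n ^ 2 * C₀ + 1) * Q := by rw [hε]; ring
        _ ≤ 1 * Q := by
          gcongr
          rw [div_le_one (by positivity)]
          linarith
        _ = Q := one_mul _
    have hnn : (n : ℝ) ^ 2 * (B * D₁ ^ 2) ≤ n ^ 2 * B * C₀ * p x₁ := by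
      calc (n : ℝ) ^ 2 * (B * D₁ ^ 2) ≤ (n : ℝ) ^ 2 * (B * (C₀ * p x₁)) := by gcongr
        _ = _ := by ring
    have hηQ := mul_le_mul_of_nonneg_left hεQ (sq_nonneg (η x₁))
    have hp1 : p x₁ ≤ 0 := by
      have hAp : A * p x₁ = (19 * B + B ^ 2 / ε) * n * p x₁ + n ^ 2 * B * C₀ * p x₁ + p x₁ := by
        rw [hA]; ring
      have hAp0 : 0 ≤ A * p x₁ := mul_nonneg hA0.le hp0
      linarith
    exact mul_nonpos_of_nonneg_of_nonpos (sq_nonneg _) hp1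
  intro y hy
  have hy2 : y ∈ closedBall x₀ (ρ / 2) :=
    ball_subset_closedBall (ball_subset_ball (by linarith) hy)
  have h1 : W y ≤ A * M ^ 2 := (hmax hy2).trans key
  have h2 : p y ≤ A * M ^ 2 := by
    rw [hWp, hη1 y hy] at h1
    have : 0 ≤ A * u y ^ 2 := mul_nonneg hA0.le (sq_nonneg _)
    linarith
  refine Real.le_sqrt_of_sq_le ((hb1 _).trans ?_)
  gcongr

theorem exists_norm_fderiv_le_of_lev_eq_zero (x₀ : V) {ρ K M : ℝ} (hρ : 0 < ρ) :
    ∃ C, ∀ (J : V → V →L[ℝ] V) (u : V → ℝ),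
      (∀ y ∈ ball x₀ ρ, ContDiffAt ℝ 2 J y ∧ ‖J y‖ ≤ K ∧ ‖fderiv ℝ J y‖ ≤ K ∧
        ‖fderiv ℝ (fderiv ℝ J) y‖ ≤ K ∧ ContDiffAt ℝ 3 u y ∧ |u y| ≤ M ∧
        ∀ X, lev J u y X = 0) →
      ∀ y ∈ ball x₀ (ρ / 4), ‖fderiv ℝ u y‖ ≤ C :=
  exists_norm_fderiv_le_of_lev_eq_zero_aux (Module.finBasis ℝ V) x₀ hρ

end BernsteinBound

section StrongMaximumPrinciple

theorem fderiv_fderiv_exp {g : V → ℝ} {x : V} (hg : ContDiffAt ℝ 2 g x) (v w : V) :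
    fderiv ℝ (fderiv ℝ (fun y => Real.exp (g y))) x v w =
      Real.exp (g x) * (fderiv ℝ (fderiv ℝ g) x v w + fderiv ℝ g x v * fderiv ℝ g x w) := by
  have h1 : fderiv ℝ (fun y => Real.exp (g y)) =ᶠ[𝓝 x] fun y => Real.exp (g y) • fderiv ℝ g y := by
    filter_upwards [hg.eventually_differentiableAt_two] with y h
    exact h.hasFDerivAt.exp.fderiv
  have d1 := (hg.differentiableAt (by norm_num)).hasFDerivAt.exp
  have h2 := d1.fun_smul hg.differentiableAt_fderiv_two.hasFDerivAt
  rw [h1.fderiv_eq, h2.fderiv]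
  simp
  ring

theorem lev_exp {J : V → V →L[ℝ] V} {g : V → ℝ} {x : V} (hg : ContDiffAt ℝ 2 g x) (X : V) :
    lev J (fun y => Real.exp (g y)) x X =
      Real.exp (g x) * (lev J g x X + levGrad J g g x X) := by
  unfold lev levGrad
  rw [fderiv_fderiv_exp hg, fderiv_fderiv_exp hg,
    (hg.differentiableAt (by norm_num)).hasFDerivAt.exp.fderiv]
  simp
  ring

theorem lev_const_mul {J : V → V →L[ℝ] V} {u : V → ℝ} {x : V} (c : ℝ) (hu : ContDiffAt ℝ 2 u x)
    (X : V) : lev J (fun y => c * u y) x X = c * lev J u x X := by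
  rw [lev_mul contDiffAt_const hu]
  simp [lev, levGrad]

theorem lev_sub_const {J : V → V →L[ℝ] V} {u : V → ℝ} {x : V} (c : ℝ) (X : V) :
    lev J (fun y => u y - c) x X = lev J u x X := by
  unfold lev
  have : fderiv ℝ (fun y => u y - c) = fderiv ℝ u := by
    funext y
    exact fderiv_sub_const c
  rw [this]

variable {V : Type*} [NormedAddCommGroup V] [InnerProductSpace ℝ V]

theorem fderiv_norm_sub_sq (a x v : V) :
    fderiv ℝ (fun y => ‖y - a‖ ^ 2) x v = 2 * inner ℝ (x - a) v := by
  have := ((hasFDerivAt_id x).sub_const a).norm_sq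
  rw [show (fun y => ‖y - a‖ ^ 2) = fun y => ‖id y - a‖ ^ 2 from rfl, this.fderiv]
  simp [inner_sub_left]

theorem fderiv_fderiv_norm_sub_sq (a x v w : V) :
    fderiv ℝ (fderiv ℝ (fun y => ‖y - a‖ ^ 2)) x v w = 2 * inner ℝ v w := by
  have h : fderiv ℝ (fun y : V => ‖y - a‖ ^ 2) = fun y => (2 : ℝ) • innerSL ℝ (y - a) := by
    funext y
    ext v
    rw [fderiv_norm_sub_sq]
    simp [inner_sub_left]
  have h2 : HasFDerivAt (fun y : V => (2 : ℝ) • innerSL ℝ (y - a)) ((2 : ℝ) • innerSL ℝ) x :=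
    (((innerSL ℝ (E := V)).hasFDerivAt (x := x - a)).comp x
      ((hasFDerivAt_id x).sub_const a)).fun_const_smul 2
  rw [h, h2.fderiv]
  simp
  rfl

theorem contDiff_norm_sub_sq (a : V) {n : WithTop ℕ∞} : ContDiff ℝ n fun y : V => ‖y - a‖ ^ 2 :=
  (contDiff_id.sub contDiff_const).norm_sq ℝ

/-- The Hopf barrier is strictly plurisubharmonic away from its centre in the radial direction. -/
theorem lev_exp_neg_norm_sq_pos {J : V → V →L[ℝ] V} {a x : V} {K α s R : ℝ}
    (hJ : ‖J x‖ ≤ K) (hDJ : ‖fderiv ℝ J x‖ ≤ K) (hs : 0 < s) (hsx : s ≤ ‖x - a‖)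
    (hxR : ‖x - a‖ ≤ R) (hα : 1 + K ^ 2 + 2 * K ^ 2 * R < 2 * α * s ^ 2) :
    0 < lev J (fun y => Real.exp (-α * ‖y - a‖ ^ 2)) x (x - a) := by
  have hq : ContDiffAt ℝ 2 (fun y : V => ‖y - a‖ ^ 2) x := (contDiff_norm_sub_sq a).contDiffAt
  have hR : 0 ≤ R := (norm_nonneg _).trans hxR
  have hα0 : 0 < α := by
    by_contra h
    have : 2 * α * s ^ 2 ≤ 0 := by nlinarith [sq_nonneg s]
    have : 0 ≤ 1 + K ^ 2 + 2 * K ^ 2 * R := by positivity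
    linarith
  rw [lev_exp (contDiffAt_const.mul hq)]
  refine mul_pos (Real.exp_pos _) ?_
  have e1 : ∀ v, fderiv ℝ (fun y => -α * ‖y - a‖ ^ 2) x v = -α * (2 * inner ℝ (x - a) v) :=
    fun v => by
      rw [fderiv_const_mul (hq.differentiableAt (by norm_num))]
      simp [← fderiv_norm_sub_sq]
  rw [lev_const_mul _ hq, levGrad, e1, e1, lev, fderiv_norm_sub_sq, fderiv_fderiv_norm_sub_sq,
    fderiv_fderiv_norm_sub_sq, real_inner_self_eq_norm_sq, real_inner_self_eq_norm_sq]
  set X := x - a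
  have h1 : ‖J x X‖ ^ 2 ≤ K ^ 2 * ‖X‖ ^ 2 := by
    rw [← mul_pow]
    have := (J x).le_of_opNorm_le hJ X
    gcongr
  have h2 : -(‖X‖ * (2 * K ^ 2 * ‖X‖ ^ 2)) ≤ inner ℝ X (levTorsion J x X) := by
    have h3 := abs_real_inner_le_norm X (levTorsion J x X)
    have h4 := norm_levTorsion_le hJ hDJ X
    have h5 : ‖X‖ * ‖levTorsion J x X‖ ≤ ‖X‖ * (2 * K ^ 2 * ‖X‖ ^ 2) := by gcongr
    linarith [neg_abs_le (inner ℝ X (levTorsion J x X))]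
  have h6 : ‖X‖ * (2 * K ^ 2 * ‖X‖ ^ 2) ≤ 2 * K ^ 2 * R * ‖X‖ ^ 2 := by
    nlinarith [mul_nonneg (mul_nonneg (sq_nonneg K) (sub_nonneg.2 hxR)) (sq_nonneg ‖X‖)]
  have h7 : s ^ 2 ≤ ‖X‖ ^ 2 := by gcongr
  have h8 : 0 < ‖X‖ ^ 2 := lt_of_lt_of_le (by positivity) h7
  have h9 : (1 + K ^ 2 + 2 * K ^ 2 * R) * ‖X‖ ^ 2 < 2 * α * ‖X‖ ^ 2 * ‖X‖ ^ 2 := by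
    gcongr
    nlinarith
  have h10 := sq_nonneg (inner ℝ X (J x X))
  have h11 : 0 < α * (2 * α * ‖X‖ ^ 2 * ‖X‖ ^ 2 - (‖X‖ ^ 2 + ‖J x X‖ ^ 2 -
      inner ℝ X (levTorsion J x X))) := mul_pos hα0 (by linarith)
  nlinarith [mul_nonneg (sq_nonneg α) h10]

variable [FiniteDimensional ℝ V]

/-- Local step of the strong maximum principle for limits of subsolutions. -/
theorem eq_zero_near_of_limit_subsolution {J : ℕ → V → V →L[ℝ] V} {u : ℕ → V → ℝ} {U : V → ℝ}
    {z₀ : V} {r K : ℝ} (hr : 0 < r)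
    (h : ∀ᶠ n in atTop, ∀ y ∈ ball z₀ (3 * r), ‖J n y‖ ≤ K ∧ ‖fderiv ℝ (J n) y‖ ≤ K ∧
      ContDiffAt ℝ 2 (u n) y ∧ ∀ X, 0 ≤ lev (J n) (u n) y X)
    (hlim : TendstoLocallyUniformlyOn u U atTop (ball z₀ (3 * r)))
    (hU : ContinuousOn U (ball z₀ (3 * r)))
    (hneg : ∀ y ∈ ball z₀ (3 * r), U y ≤ 0) (hz₀ : U z₀ = 0) : ∀ p ∈ ball z₀ r, U p = 0 := by
  by_contra! hcon
  obtain ⟨p, hp, hp0⟩ := hcon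
  have hK : 0 ≤ K := by
    obtain ⟨n, hn⟩ := h.exists
    exact (norm_nonneg _).trans (hn z₀ (mem_ball_self (by positivity))).1
  rw [mem_ball, dist_comm] at hp
  have hsub : closedBall p (dist z₀ p) ⊆ ball z₀ (3 * r) := fun y hy => by
    rw [mem_ball]
    have h1 : dist y p ≤ dist z₀ p := hy
    have h2 := dist_triangle y p z₀
    rw [dist_comm p z₀] at h2
    linarith
  have hUc : ContinuousOn U (closedBall p (dist z₀ p)) := hU.mono hsub
  have hZ : IsCompact (closedBall p (dist z₀ p) ∩ U ⁻¹' {0}) :=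
    (isCompact_closedBall p _).of_isClosed_subset
      (hUc.preimage_isClosed_of_isClosed isClosed_closedBall isClosed_singleton) inter_subset_left
  obtain ⟨z, ⟨hz1, hz2⟩, hzmin⟩ := hZ.exists_isMinOn (f := fun y => dist y p)
    ⟨z₀, le_refl (dist z₀ p), hz₀⟩ (by fun_prop)
  have hz0 : U z = 0 := hz2
  have hlt : ∀ y, dist y p < dist z p → U y < 0 := fun y hy => by
    have hym : y ∈ closedBall p (dist z₀ p) := hy.le.trans hz1
    refine lt_of_le_of_ne (hneg y (hsub hym)) fun h0 => ?_
    exact absurd (hzmin (show y ∈ closedBall p (dist z₀ p) ∩ U ⁻¹' {0} from ⟨hym, h0⟩)) (not_le.2 hy)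
  set d := (2⁻¹ : ℝ) • (z - p) with hd
  set a := p + d with ha
  have hzad : z - a = d := by
    have : z - p = (2 : ℝ) • d := by rw [hd, smul_smul]; norm_num
    rw [ha, ← sub_sub, this, two_smul]; abel
  set R := ‖d‖ with hR
  have hzp : dist z p = 2 * R := by
    rw [dist_eq_norm, hR, hd, norm_smul]; norm_num; ring
  have hR0 : 0 < R := by
    have : 0 < dist z p := dist_pos.2 fun e => hp0 (e ▸ hz0)
    linarith
  have hRr : 2 * R < r := by
    rw [← hzp]
    exact lt_of_le_of_lt hz1 hp
  have hstrict : ∀ y, ‖y - a‖ ≤ R → y ≠ z → U y < 0 := fun y hy hyz => by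
    refine hlt y ?_
    by_contra hge
    push Not at hge
    rw [hzp, dist_eq_norm] at hge
    have e1 : y - p = (y - a) + d := by rw [ha]; abel
    have e2 : y - z = (y - a) - d := by rw [← hzad]; abel
    have hpl := parallelogram_law_with_norm ℝ (y - a) d
    rw [← e1, ← e2] at hpl
    have : 0 < ‖y - z‖ := norm_pos_iff.2 (sub_ne_zero.2 hyz)
    nlinarith [norm_nonneg (y - a)]
  set s := R / 2 with hs
  have hs0 : 0 < s := by positivity
  obtain ⟨α, hα⟩ : ∃ α : ℝ, 1 + K ^ 2 + 2 * K ^ 2 * (2 * R) < 2 * α * s ^ 2 :=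
    ⟨(1 + K ^ 2 + 2 * K ^ 2 * (2 * R) + 1) / (2 * s ^ 2), by
      have : 2 * ((1 + K ^ 2 + 2 * K ^ 2 * (2 * R) + 1) / (2 * s ^ 2)) * s ^ 2 =
        1 + K ^ 2 + 2 * K ^ 2 * (2 * R) + 1 := by field_simp
      linarith⟩
  have hα0 : 0 < α := by
    by_contra hc
    have : 2 * α * s ^ 2 ≤ 0 := by nlinarith [sq_nonneg s]
    have : 0 ≤ 1 + K ^ 2 + 2 * K ^ 2 * (2 * R) := by positivity
    linarith
  set q : V → ℝ := fun y => Real.exp (-α * ‖y - a‖ ^ 2) with hq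
  set b : V → ℝ := fun y => q y - Real.exp (-α * R ^ 2) with hb
  have hq2 : ∀ y, ContDiffAt ℝ 2 q y := fun y =>
    (contDiffAt_const.mul (contDiff_norm_sub_sq a).contDiffAt).exp
  have hb2 : ∀ y, ContDiffAt ℝ 2 b y := fun y => (hq2 y).sub contDiffAt_const
  have hbz : b z = 0 := by simp [hb, hq, hzad, hR]
  have hbpos : ∀ y, 0 ≤ b y → ‖y - a‖ ≤ R := fun y hy => by
    have h1 : Real.exp (-α * R ^ 2) ≤ Real.exp (-α * ‖y - a‖ ^ 2) := by
      simpa [hb, hq] using hy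
    rw [Real.exp_le_exp] at h1
    exact abs_le_of_sq_le_sq' (by nlinarith) hR0.le |>.2
  have hcs : closedBall z s ⊆ ball z₀ (3 * r) := fun y hy => by
    have h1 : dist y z ≤ s := hy
    have h2 := dist_triangle y z z₀
    have h3 := dist_triangle z p z₀
    rw [dist_comm p z₀] at h3
    rw [mem_ball]
    linarith
  have hUcs : ContinuousOn U (closedBall z s) := hU.mono hcs
  obtain ⟨ε, hε, m, hm, hεm⟩ : ∃ ε > 0, ∃ m > 0, ∀ y ∈ sphere z s, U y + ε * b y ≤ -m := by
    have hUsp : ContinuousOn U (sphere z s) := hUcs.mono sphere_subset_closedBall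
    have hbc : Continuous b := continuous_iff_continuousAt.2 fun y => (hb2 y).continuousAt
    obtain ⟨B, hB⟩ := (isCompact_sphere z s).exists_bound_of_continuousOn hbc.continuousOn
    have hT : IsCompact (sphere z s ∩ {y | 0 ≤ b y}) :=
      (isCompact_sphere z s).inter_right (isClosed_le continuous_const hbc)
    obtain ⟨m₀, hm₀, hUm⟩ : ∃ m₀ > 0, ∀ y ∈ sphere z s ∩ {y | 0 ≤ b y}, U y ≤ -m₀ := by
      rcases (sphere z s ∩ {y | 0 ≤ b y}).eq_empty_or_nonempty with he | hne
      · exact ⟨1, one_pos, fun y hy => by simp [he] at hy⟩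
      obtain ⟨y₁, hy₁, hmx⟩ := hT.exists_isMaxOn hne (hUsp.mono inter_subset_left)
      refine ⟨-U y₁, neg_pos.2 (hstrict y₁ (hbpos y₁ hy₁.2) ?_), fun y hy => by
        rw [neg_neg]; exact hmx hy⟩
      rintro rfl
      have := hy₁.1
      simp at this
      linarith
    have hlt' : ∀ y ∈ sphere z s, U y + (m₀ / (2 * (|B| + 1))) * b y < 0 := fun y hy => by
      have hpos : 0 < m₀ / (2 * (|B| + 1)) := by positivity
      by_cases hby : 0 ≤ b y
      · have h1 := hUm y ⟨hy, hby⟩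
        have h2 : b y ≤ |B| + 1 := by
          have := hB y hy
          rw [Real.norm_eq_abs] at this
          linarith [le_abs_self (b y), le_abs_self B]
        have h3 : (m₀ / (2 * (|B| + 1))) * b y ≤ m₀ / 2 := by
          calc _ ≤ (m₀ / (2 * (|B| + 1))) * (|B| + 1) := by gcongr
            _ = m₀ / 2 := by field_simp
        linarith
      · push Not at hby
        have h1 := hneg y (hcs (sphere_subset_closedBall hy))
        have := mul_neg_of_pos_of_neg hpos hby
        linarith
    refine ⟨m₀ / (2 * (|B| + 1)), by positivity, ?_⟩
    rcases (sphere z s).eq_empty_or_nonempty with he | hne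
    · exact ⟨1, one_pos, fun y hy => by simp [he] at hy⟩
    obtain ⟨y₁, hy₁, hmx⟩ := (isCompact_sphere z s).exists_isMaxOn hne
      (f := fun y => U y + (m₀ / (2 * (|B| + 1))) * b y)
      (hUsp.add (continuousOn_const.mul hbc.continuousOn))
    exact ⟨-(U y₁ + (m₀ / (2 * (|B| + 1))) * b y₁), neg_pos.2 (hlt' y₁ hy₁), fun y hy => by
      rw [neg_neg]; exact hmx hy⟩
  have huni : TendstoUniformlyOn u U atTop (closedBall z s) :=
    (tendstoLocallyUniformlyOn_iff_forall_isCompact isOpen_ball).1 hlim _ hcs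
      (isCompact_closedBall z s)
  obtain ⟨n, hn, hclose⟩ := (h.and (Metric.tendstoUniformlyOn_iff.1 huni (m / 3) (by positivity))).exists
  set w : V → ℝ := fun y => u n y + ε * b y with hw
  have hw2 : ∀ y ∈ closedBall z s, ContDiffAt ℝ 2 w y := fun y hy =>
    (hn y (hcs hy)).2.2.1.add (contDiffAt_const.mul (hb2 y))
  have hd' : ∀ y ∈ closedBall z s, |U y - u n y| < m / 3 := fun y hy => by
    rw [← Real.dist_eq]; exact hclose y hy
  obtain ⟨x₁, hx₁, hmax⟩ := (isCompact_closedBall z s).exists_isMaxOn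
    (nonempty_closedBall.2 hs0.le) (f := w)
    fun y hy => (hw2 y hy).continuousAt.continuousWithinAt
  have hx1b : x₁ ∈ ball z s := by
    rw [← closedBall_sdiff_sphere]
    refine ⟨hx₁, fun hsp => ?_⟩
    have h1 := hεm x₁ hsp
    have h2 := abs_lt.1 (hd' x₁ hx₁)
    have hzm : z ∈ closedBall z s := mem_closedBall_self hs0.le
    have h3 := abs_lt.1 (hd' z hzm)
    have h4 : w z ≤ w x₁ := hmax hzm
    simp only [hw] at h4
    rw [hbz] at h4
    rw [hz0] at h3
    linarith [h2.1, h3.2]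
  have hloc : IsLocalMax w x₁ := by
    filter_upwards [isOpen_ball.mem_nhds hx1b] with y hy
    exact hmax (ball_subset_closedBall hy)
  have hle := lev_nonpos_of_isLocalMax (J := J n) (hw2 x₁ hx₁) hloc (x₁ - a)
  obtain ⟨hJ1, hJ2, hu2, hlev⟩ := hn x₁ (hcs hx₁)
  rw [hw, lev_add hu2 (contDiffAt_const.mul (hb2 x₁)), lev_const_mul _ (hb2 x₁), hb,
    lev_sub_const] at hle
  have hx1z : ‖x₁ - z‖ ≤ s := by rw [← dist_eq_norm]; exact hx₁
  have e3 : x₁ - a = (x₁ - z) + d := by rw [← hzad]; abel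
  have hlow : s ≤ ‖x₁ - a‖ := by
    have h1 := norm_sub_le (x₁ - a) (x₁ - z)
    rw [show x₁ - a - (x₁ - z) = d by rw [e3]; abel] at h1
    linarith
  have hup : ‖x₁ - a‖ ≤ 2 * R := by
    rw [e3]
    exact (norm_add_le _ _).trans (by linarith)
  have hpos := lev_exp_neg_norm_sq_pos (α := α) hJ1 hJ2 hs0 hlow hup hα
  have := mul_pos hε hpos
  linarith [hlev (x₁ - a)]

/-- Strong maximum principle for locally uniform limits of subsolutions. -/
theorem eq_zero_of_limit_subsolution {J : ℕ → V → V →L[ℝ] V} {u : ℕ → V → ℝ} {U : V → ℝ}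
    {S : Set V} (hS : IsOpen S) (hconn : IsPreconnected S)
    (h : ∀ x ∈ S, ∃ r > 0, ∃ K, ∀ᶠ n in atTop, ∀ y ∈ ball x r, ‖J n y‖ ≤ K ∧
      ‖fderiv ℝ (J n) y‖ ≤ K ∧ ContDiffAt ℝ 2 (u n) y ∧ ∀ X, 0 ≤ lev (J n) (u n) y X)
    (hlim : TendstoLocallyUniformlyOn u U atTop S) (hU : ContinuousOn U S)
    (hneg : ∀ y ∈ S, U y ≤ 0) {x₀ : V} (hx₀ : x₀ ∈ S) (h0 : U x₀ = 0) : ∀ x ∈ S, U x = 0 := by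
  have hopen : IsOpen (S ∩ U ⁻¹' {0}) := by
    rw [Metric.isOpen_iff]
    rintro x ⟨hx, hx0⟩
    obtain ⟨r, hr, K, hK⟩ := h x hx
    obtain ⟨r', hr', hr'S⟩ := Metric.isOpen_iff.1 hS x hx
    set t := min r r' / 3 with ht
    have ht0 : 0 < t := by positivity
    have h1 : 3 * t ≤ r := by rw [ht]; linarith [min_le_left r r']
    have h2 : 3 * t ≤ r' := by rw [ht]; linarith [min_le_right r r']
    have hsub : ball x (3 * t) ⊆ S := (ball_subset_ball h2).trans hr'S
    refine ⟨t, ht0, fun y hy => ⟨hsub (ball_subset_ball (by linarith) hy), ?_⟩⟩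
    exact eq_zero_near_of_limit_subsolution ht0
      (hK.mono fun n hn y hy => hn y (ball_subset_ball h1 hy)) (hlim.mono hsub) (hU.mono hsub)
      (fun y hy => hneg y (hsub hy)) hx0 y hy
  have hopen' : IsOpen (S ∩ U ⁻¹' {0}ᶜ) := hU.isOpen_inter_preimage hS isOpen_compl_singleton
  intro x hx
  by_contra hne
  obtain ⟨y, -, ⟨-, hy⟩, ⟨-, hy'⟩⟩ := hconn _ _ hopen hopen'
    (fun y hy => by
      by_cases hy0 : U y = 0
      · exact Or.inl ⟨hy, hy0⟩
      · exact Or.inr ⟨hy, hy0⟩) ⟨x₀, hx₀, hx₀, h0⟩ ⟨x, hx, hx, hne⟩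
  exact hy' hy

end StrongMaximumPrinciple

theorem exists_norm_fderiv_le_of_holomorphic [FiniteDimensional ℝ V] (x₀ : V) {ρ K M : ℝ}
    (hρ : 0 < ρ) :
    ∃ C, ∀ (J : V → V →L[ℝ] V) (Ψ : V → E),
      (∀ y ∈ ball x₀ ρ, ContDiffAt ℝ 2 J y ∧ ‖J y‖ ≤ K ∧ ‖fderiv ℝ J y‖ ≤ K ∧
        ‖fderiv ℝ (fderiv ℝ J) y‖ ≤ K ∧ (∀ v, J y (J y v) = -v) ∧ ContDiffAt ℝ 3 Ψ y ∧
        ‖Ψ y‖ ≤ M ∧ (fderiv ℝ Ψ y).comp (J y) = (Jst E).comp (fderiv ℝ Ψ y)) →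
      ∀ y ∈ ball x₀ (ρ / 4), ‖fderiv ℝ Ψ y‖ ≤ C := by
  obtain ⟨C, hC⟩ := exists_norm_fderiv_le_of_lev_eq_zero (V := V) x₀ (K := K) (M := M) hρ
  refine ⟨max C 0, fun J Ψ h y hy => ?_⟩
  refine opNorm_le_bound _ (le_max_right _ _) fun v => ?_
  obtain ⟨l, hl1, hlv⟩ := exists_dual_vector'' ℝ (fderiv ℝ Ψ y v)
  have hy' : y ∈ ball x₀ ρ := ball_subset_ball (by linarith) hy
  have key := hC J (fun z => l (Ψ z)) (fun z hz => ?_) y hy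
  · have hd : HasFDerivAt (fun z => l (Ψ z)) (l.comp (fderiv ℝ Ψ y)) y :=
      l.hasFDerivAt.comp y ((h y hy').2.2.2.2.2.1.differentiableAt (by norm_num)).hasFDerivAt
    rw [hd.fderiv] at key
    have h1 := (l.comp (fderiv ℝ Ψ y)).le_of_opNorm_le key v
    rw [comp_apply, hlv] at h1
    simp only [RCLike.ofReal_real_eq_id, id_eq, norm_norm] at h1
    exact h1.trans (by gcongr; exact le_max_left _ _)
  · obtain ⟨hJ, h1, h2, h3, hsq, hΨ, hM, -⟩ := h z hz
    refine ⟨hJ, h1, h2, h3, l.contDiff.contDiffAt.comp z hΨ, ?_, fun X => ?_⟩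
    · calc |l (Ψ z)| ≤ ‖l‖ * ‖Ψ z‖ := l.le_opNorm _
        _ ≤ 1 * M := by gcongr
        _ = M := one_mul M
    · have hhol : ∀ᶠ y in 𝓝 z, (fderiv ℝ Ψ y).comp (J y) =
          ((fun _ => Jst E) (Ψ y)).comp (fderiv ℝ Ψ y) := by
        filter_upwards [isOpen_ball.mem_nhds hz] with y hy
        exact (h y hy).2.2.2.2.2.2.2
      rw [lev_comp_of_holomorphic (J₂ := fun _ => Jst E) l.contDiff.contDiffAt
        (hΨ.of_le (by norm_num)) (hJ.differentiableAt (by norm_num)) (differentiableAt_const _)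
        hhol hsq]
      rw [lev_Jst]
      have : fderiv ℝ (fun w : E => l w) = fun _ => l := by
        funext w
        exact l.fderiv
      simp [lap2, this]

theorem limit_inverse_of_holomorphic {D U : Set E2} (hD : IsOpen D)
    (hDb : Bornology.IsBounded D) (hDne : D.Nonempty) (hU : IsOpen U) (hUc : IsPreconnected U)
    {Uν : ℕ → Set E2} {Φ Ψ : ℕ → E2 → E2} {J : ℕ → E2 → E2 →L[ℝ] E2} {F : E2 → E2} {ρ : E2 → ℝ}
    (hΨD : ∀ n, MapsTo (Ψ n) (Uν n) D)
    (hleft : ∀ n, ∀ x ∈ D, Ψ n (Φ n x) = x) (hright : ∀ n, ∀ y ∈ Uν n, Φ n (Ψ n y) = y)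
    (hloc : ∀ y ∈ U, ∃ r > 0, ∃ K, ∀ᶠ n in atTop, ball y r ⊆ Uν n ∧ ∀ z ∈ ball y r,
      ContDiffAt ℝ 2 (J n) z ∧ ‖J n z‖ ≤ K ∧ ‖fderiv ℝ (J n) z‖ ≤ K ∧
        ‖fderiv ℝ (fderiv ℝ (J n)) z‖ ≤ K ∧ (∀ v, J n z (J n z v) = -v) ∧
        ContDiffAt ℝ 3 (Ψ n) z ∧
        (fderiv ℝ (Ψ n) z).comp (J n z) = (Jst E2).comp (fderiv ℝ (Ψ n) z))
    (hlim : TendstoLocallyUniformlyOn Φ F atTop D) (hFU : MapsTo F D U)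
    (hFc : ContinuousOn F D)
    (hρc : ContinuousOn ρ (closure D)) (hρ2 : ∀ x ∈ D, ContDiffAt ℝ 2 ρ x)
    (hρlap : ∀ x ∈ D, ∀ v, 0 ≤ lap2 ρ x v) (hρneg : ∀ x ∈ D, ρ x < 0)
    (hρ0 : ∀ x ∈ frontier D, ρ x = 0) :
    ∃ G : E2 → E2, MapsTo G U D ∧ (∀ x ∈ D, G (F x) = x) ∧ (∀ y ∈ U, F (G y) = y) ∧
      ∀ y ∈ U, ∃ r > 0, ∃ C, ∀ a ∈ ball y r, ∀ b ∈ ball y r, ‖G a - G b‖ ≤ C * ‖a - b‖ := by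
  obtain ⟨M, hM⟩ := hDb.exists_norm_le
  have hlip : ∀ y ∈ U, ∃ r > 0, ∃ C > 0, ∀ᶠ n in atTop, ∀ a ∈ ball y r, ∀ b ∈ ball y r,
      ‖Ψ n a - Ψ n b‖ ≤ C * ‖a - b‖ := by
    intro y hy
    obtain ⟨r, hr, K, hK⟩ := hloc y hy
    obtain ⟨C, hC⟩ := exists_norm_fderiv_le_of_holomorphic (E := E2) y (K := K) (M := M) hr
    refine ⟨r / 4, by positivity, max C 1, by positivity, hK.mono fun n hn a ha b hb => ?_⟩
    refine (convex_ball y (r / 4)).norm_image_sub_le_of_norm_fderiv_le (𝕜 := ℝ) (f := Ψ n)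
      (fun z hz => ?_) (fun z hz => ?_) hb ha
    · exact (hn.2 z (ball_subset_ball (by linarith) hz)).2.2.2.2.2.1.differentiableAt (by norm_num)
    · refine (hC (J n) (Ψ n) (fun z hz => ?_) z hz).trans (le_max_left _ _)
      obtain ⟨h1, h2, h3, h4, h5, h6, h7⟩ := hn.2 z hz
      exact ⟨h1, h2, h3, h4, h5, h6, hM _ (hΨD n (hn.1 hz)), h7⟩
  have hmem : ∀ y ∈ U, ∀ᶠ n in atTop, y ∈ Uν n := fun y hy => by
    obtain ⟨r, hr, K, hK⟩ := hloc y hy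
    exact hK.mono fun n hn => hn.1 (mem_ball_self hr)
  obtain ⟨φ, hφ, G, hG⟩ := exists_subseq_tendstoLocallyUniformlyOn (U := U) (f := Ψ) 0
    (fun y hy => ⟨M, (hmem y hy).mono fun n hn => by
      rw [dist_zero_right]; exact hM _ (hΨD n hn)⟩)
    (fun y hy ε hε => by
      obtain ⟨r, hr, C, hC, h⟩ := hlip y hy
      refine ⟨min r (ε / C), by positivity, h.mono fun n hn z hz => ?_⟩
      have h1 := hn z (ball_subset_ball (min_le_left _ _) hz) y (mem_ball_self hr)
      have h2 : ‖z - y‖ ≤ ε / C := by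
        rw [← dist_eq_norm]; exact (mem_ball.1 hz).le.trans (min_le_right _ _)
      rw [dist_eq_norm]
      calc _ ≤ C * ‖z - y‖ := h1
        _ ≤ C * (ε / C) := by gcongr
        _ = ε := by field_simp)
  have hφt := hφ.tendsto_atTop
  have hGpt : ∀ y ∈ U, Tendsto (fun k => Ψ (φ k) y) atTop (𝓝 (G y)) := fun y hy =>
    hG.tendsto_at hy
  have hGlip : ∀ y ∈ U, ∃ r > 0, ∃ C, ∀ a ∈ ball y r, ∀ b ∈ ball y r,
      ‖G a - G b‖ ≤ C * ‖a - b‖ := fun y hy => by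
    obtain ⟨r, hr, C, hC, h⟩ := hlip y hy
    obtain ⟨r', hr', hU'⟩ := Metric.isOpen_iff.1 hU y hy
    refine ⟨min r r', by positivity, C, fun a ha b hb => ?_⟩
    refine le_of_tendsto ((hGpt a (hU' (ball_subset_ball (min_le_right _ _) ha))).sub
      (hGpt b (hU' (ball_subset_ball (min_le_right _ _) hb)))).norm
      ((hφt.eventually h).mono fun n hn => ?_)
    exact hn a (ball_subset_ball (min_le_left _ _) ha) b (ball_subset_ball (min_le_left _ _) hb)
  have hGc : ContinuousOn G U := fun y hy => by
    obtain ⟨r, hr, C, h⟩ := hGlip y hy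
    refine ContinuousAt.continuousWithinAt (Metric.continuousAt_iff.2 fun ε hε => ?_)
    refine ⟨min r (ε / (|C| + 1)), by positivity, fun {z} hz => ?_⟩
    have h1 := h z (lt_of_lt_of_le hz (min_le_left _ _)) y (mem_ball_self hr)
    have h2 : dist z y < ε / (|C| + 1) := lt_of_lt_of_le hz (min_le_right _ _)
    rw [dist_eq_norm] at h2 ⊢
    calc _ ≤ C * ‖z - y‖ := h1
      _ ≤ (|C| + 1) * ‖z - y‖ := by gcongr; linarith [le_abs_self C]
      _ < (|C| + 1) * (ε / (|C| + 1)) := by gcongr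
      _ = ε := by field_simp
  have hGcl : ∀ y ∈ U, G y ∈ closure D := fun y hy =>
    mem_closure_of_tendsto (hGpt y hy) ((hφt.eventually (hmem y hy)).mono fun n hn => hΨD _ hn)
  have hGF : ∀ x ∈ D, G (F x) = x := fun x hx => by
    have h1 : Tendsto (fun k => Φ (φ k) x) atTop (𝓝[U] (F x)) :=
      tendsto_nhdsWithin_iff.2 ⟨(hlim.tendsto_at hx).comp hφt,
        ((hlim.tendsto_at hx).comp hφt).eventually (hU.mem_nhds (hFU hx))⟩
    have h2 := hG.tendsto_comp (hGc _ (hFU hx)) (hFU hx) h1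
    refine tendsto_nhds_unique h2 (tendsto_const_nhds.congr fun k => (hleft _ x hx).symm)
  have hρcl : ∀ x ∈ closure D, ρ x ≤ 0 := fun x hx => by
    by_cases hxD : x ∈ D
    · exact (hρneg x hxD).le
    · exact (hρ0 x (by rw [hD.frontier_eq]; exact ⟨hx, hxD⟩)).le
  have hcomp : IsCompact (closure D) := hDb.isCompact_closure
  have hρu : UniformContinuousOn ρ (closure D) := hcomp.uniformContinuousOn_of_continuous hρc
  have hρlim : TendstoLocallyUniformlyOn (fun k y => ρ (Ψ (φ k) y)) (fun y => ρ (G y)) atTop U := by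
    rw [Metric.tendstoLocallyUniformlyOn_iff] at hG ⊢
    intro ε hε y hy
    obtain ⟨δ, hδ, h⟩ := Metric.uniformContinuousOn_iff.1 hρu ε hε
    obtain ⟨t, ht, h2⟩ := hG δ hδ y hy
    obtain ⟨r, hr, K, hK⟩ := hloc y hy
    refine ⟨t ∩ (ball y r ∩ U), inter_mem ht (inter_mem
      (mem_nhdsWithin_of_mem_nhds (ball_mem_nhds y hr)) self_mem_nhdsWithin), ?_⟩
    filter_upwards [h2, hφt.eventually hK] with k hk hk2 z hz
    exact h _ (hGcl z hz.2.2) _ (subset_closure (hΨD _ (hk2.1 hz.2.1))) (hk z hz.1)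
  have hGD : MapsTo G U D := by
    by_contra hcon
    simp only [MapsTo, not_forall] at hcon
    obtain ⟨y₀, hy₀, hy₀D⟩ := hcon
    have h0 := eq_zero_of_limit_subsolution (J := fun k => J (φ k)) hU hUc ?_ hρlim
      (hρc.comp hGc hGcl) (fun y hy => hρcl _ (hGcl y hy)) hy₀
      (hρ0 _ (by rw [hD.frontier_eq]; exact ⟨hGcl y₀ hy₀, hy₀D⟩))
    · obtain ⟨x, hx⟩ := hDne
      have := h0 (F x) (hFU hx)
      rw [hGF x hx] at this
      exact absurd this (hρneg x hx).ne
    · intro y hy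
      obtain ⟨r, hr, K, hK⟩ := hloc y hy
      refine ⟨r, hr, K, (hφt.eventually hK).mono fun k hk z hz => ?_⟩
      obtain ⟨h1, h2, h3, h4, h5, h6, h7⟩ := hk.2 z hz
      have hzD := hΨD _ (hk.1 hz)
      have h6' : ContDiffAt ℝ 2 (Ψ (φ k)) z := h6.of_le (by norm_num)
      refine ⟨h2, h3, (hρ2 _ hzD).comp z h6', fun X => ?_⟩
      have hhol : ∀ᶠ y in 𝓝 z, (fderiv ℝ (Ψ (φ k)) y).comp (J (φ k) y) =
          ((fun _ => Jst E2) (Ψ (φ k) y)).comp (fderiv ℝ (Ψ (φ k)) y) := by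
        filter_upwards [isOpen_ball.mem_nhds hz] with y hy
        exact (hk.2 y hy).2.2.2.2.2.2
      rw [lev_comp_of_holomorphic (J₂ := fun _ => Jst E2) (hρ2 _ hzD) h6'
        (h1.differentiableAt (by norm_num)) (differentiableAt_const _) hhol h5, lev_Jst]
      exact hρlap _ hzD _
  refine ⟨G, hGD, hGF, fun y hy => ?_, hGlip⟩
  have h1 : Tendsto (fun k => Ψ (φ k) y) atTop (𝓝[D] (G y)) :=
    tendsto_nhdsWithin_iff.2 ⟨hGpt y hy, (hGpt y hy).eventually (hD.mem_nhds (hGD hy))⟩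
  have hlim' : TendstoLocallyUniformlyOn (fun k => Φ (φ k)) F atTop D :=
    fun u hu x hx => by
      obtain ⟨t, ht, h⟩ := hlim u hu x hx
      exact ⟨t, ht, hφt.eventually h⟩
  have h2 := hlim'.tendsto_comp (hFc _ (hGD hy)) (hGD hy) h1
  exact tendsto_nhds_unique h2 (tendsto_const_nhds.congr'
    ((hφt.eventually (hmem y hy)).mono fun k hk => (hright _ y hk).symm))

theorem norm_torsion_sub_le {A A' : V →L[ℝ] V →L[ℝ] V} {j j' : V →L[ℝ] V} {v v' : V} {K M : ℝ}
    (hA : ‖A‖ ≤ K) (hA' : ‖A'‖ ≤ K) (hj : ‖j‖ ≤ K) (hj' : ‖j'‖ ≤ K) (hv : ‖v‖ ≤ M)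
    (hv' : ‖v'‖ ≤ M) :
    ‖(A v (j v) - A (j v) v) - (A' v' (j' v') - A' (j' v') v')‖ ≤
      2 * K * M ^ 2 * (‖A - A'‖ + ‖j - j'‖) + 4 * K ^ 2 * M * ‖v - v'‖ := by
  have hK : 0 ≤ K := (norm_nonneg _).trans hA
  have hM : 0 ≤ M := (norm_nonneg _).trans hv
  have hjv : ‖j v‖ ≤ K * M := (j.le_of_opNorm_le hj v).trans (by gcongr)
  have hjv' : ‖j' v'‖ ≤ K * M := (j'.le_of_opNorm_le hj' v').trans (by gcongr)
  have hd : ‖j v - j' v'‖ ≤ ‖j - j'‖ * M + K * ‖v - v'‖ := by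
    have e : j v - j' v' = (j - j') v + j' (v - v') := by simp
    rw [e]
    refine (norm_add_le _ _).trans (add_le_add ?_ (j'.le_of_opNorm_le hj' _))
    exact ((j - j').le_opNorm v).trans (by gcongr)
  have bil : ∀ (a a' b b' : V) (α α' δa δb : ℝ), ‖a‖ ≤ α → ‖b‖ ≤ α' → ‖a'‖ ≤ α →
      ‖a - a'‖ ≤ δa → ‖b - b'‖ ≤ δb → ‖A a b - A' a' b'‖ ≤
        ‖A - A'‖ * α * α' + K * δa * α' + K * α * δb := by
    intro a a' b b' α α' δa δb ha hb ha' hda hdb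
    have e : A a b - A' a' b' = (A - A') a b + A' (a - a') b + A' a' (b - b') := by simp
    have hα : 0 ≤ α := (norm_nonneg _).trans ha
    have hδa : 0 ≤ δa := (norm_nonneg _).trans hda
    rw [e]
    refine (norm_add₃_le).trans (add_le_add (add_le_add ?_ ?_) ?_)
    · exact ((A - A').le_opNorm₂ a b).trans (by gcongr)
    · exact (A'.le_opNorm₂ _ _).trans (by gcongr)
    · exact (A'.le_opNorm₂ _ _).trans (by gcongr)
  have h1 := bil v v' (j v) (j' v') M (K * M) _ _ hv hjv hv' le_rfl hd
  have h2 := bil (j v) (j' v') v v' (K * M) M _ _ hjv hv hjv' hd le_rfl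
  have e : (A v (j v) - A (j v) v) - (A' v' (j' v') - A' (j' v') v') =
      (A v (j v) - A' v' (j' v')) - (A (j v) v - A' (j' v') v') := by abel
  rw [e]
  refine (norm_sub_le _ _).trans ((add_le_add h1 h2).trans (le_of_eq ?_))
  ring

theorem abs_lev_sub_lev_le {J J' : V → V →L[ℝ] V} {u : V → ℝ} {x X : V} {K ε N : ℝ}
    (hJ : ‖J x‖ ≤ K) (hJ' : ‖J' x‖ ≤ K) (hD : ‖fderiv ℝ J x‖ ≤ K) (hD' : ‖fderiv ℝ J' x‖ ≤ K)
    (h0 : ‖J x - J' x‖ ≤ ε) (h1 : ‖fderiv ℝ J x - fderiv ℝ J' x‖ ≤ ε)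
    (hu1 : ‖fderiv ℝ u x‖ ≤ N) (hu2 : ‖fderiv ℝ (fderiv ℝ u) x‖ ≤ N) :
    |lev J u x X - lev J' u x X| ≤ 6 * K * N * ε * ‖X‖ ^ 2 := by
  have hK : 0 ≤ K := (norm_nonneg _).trans hJ
  have hε : 0 ≤ ε := (norm_nonneg _).trans h0
  have hN : 0 ≤ N := (norm_nonneg _).trans hu1
  have ht := norm_torsion_sub_le (v := X) (v' := X) hD hD' hJ hJ' le_rfl le_rfl
  rw [sub_self, norm_zero, mul_zero, add_zero] at ht
  have hJX : ‖J x X‖ ≤ K * ‖X‖ := (J x).le_of_opNorm_le hJ X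
  have hJX' : ‖J' x X‖ ≤ K * ‖X‖ := (J' x).le_of_opNorm_le hJ' X
  have hdX : ‖J x X - J' x X‖ ≤ ε * ‖X‖ := (J x - J' x).le_of_opNorm_le h0 X
  have e : lev J u x X - lev J' u x X =
      fderiv ℝ (fderiv ℝ u) x (J x X - J' x X) (J x X) +
      fderiv ℝ (fderiv ℝ u) x (J' x X) (J x X - J' x X) -
      fderiv ℝ u x (levTorsion J x X - levTorsion J' x X) := by
    simp only [lev, map_sub, sub_apply]
    ring
  rw [e, ← Real.norm_eq_abs]
  have b1 : ‖fderiv ℝ (fderiv ℝ u) x (J x X - J' x X) (J x X)‖ ≤ N * (ε * ‖X‖) * (K * ‖X‖) :=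
    ((fderiv ℝ (fderiv ℝ u) x).le_opNorm₂ _ _).trans (by gcongr)
  have b2 : ‖fderiv ℝ (fderiv ℝ u) x (J' x X) (J x X - J' x X)‖ ≤ N * (K * ‖X‖) * (ε * ‖X‖) :=
    ((fderiv ℝ (fderiv ℝ u) x).le_opNorm₂ _ _).trans (by gcongr)
  have b3 : ‖fderiv ℝ u x (levTorsion J x X - levTorsion J' x X)‖ ≤
      N * (2 * K * ‖X‖ ^ 2 * (ε + ε)) :=
    ((fderiv ℝ u x).le_opNorm _).trans (by
      gcongr
      exact ht.trans (by gcongr))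
  calc _ ≤ _ := norm_sub_le _ _
    _ ≤ _ := add_le_add ((norm_add_le _ _).trans (add_le_add b1 b2)) b3
    _ = _ := by ring

theorem ContDiffOn.continuousOn_fderiv_fderiv {u : V → W} {U : Set V} (hu : ContDiffOn ℝ 2 u U)
    (hU : IsOpen U) : ContinuousOn (fderiv ℝ (fderiv ℝ u)) U :=
  ((hu.fderiv_of_isOpen hU (m := 1) (by norm_num)).fderiv_of_isOpen hU (m := 0)
    (by norm_num)).continuousOn

theorem ContDiffOn.continuousOn_fderiv_of_two {u : V → W} {U : Set V} (hu : ContDiffOn ℝ 2 u U)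
    (hU : IsOpen U) : ContinuousOn (fderiv ℝ u) U :=
  (hu.fderiv_of_isOpen hU (m := 1) (by norm_num)).continuousOn

theorem exists_bound_two {u : V → W} {U S : Set V} (hu : ContDiffOn ℝ 2 u U) (hU : IsOpen U)
    (hS : IsCompact S) (hSU : S ⊆ U) : ∃ C, ∀ x ∈ S, ‖u x‖ ≤ C ∧ ‖fderiv ℝ u x‖ ≤ C ∧
      ‖fderiv ℝ (fderiv ℝ u) x‖ ≤ C := by
  obtain ⟨a, ha⟩ := hS.exists_bound_of_continuousOn (hu.continuousOn.mono hSU)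
  obtain ⟨b, hb⟩ := hS.exists_bound_of_continuousOn ((hu.continuousOn_fderiv_of_two hU).mono hSU)
  obtain ⟨c, hc⟩ := hS.exists_bound_of_continuousOn ((hu.continuousOn_fderiv_fderiv hU).mono hSU)
  exact ⟨max a (max b c), fun x hx => ⟨(ha x hx).trans (le_max_left _ _),
    (hb x hx).trans ((le_max_left _ _).trans (le_max_right _ _)),
    (hc x hx).trans ((le_max_right _ _).trans (le_max_right _ _))⟩⟩

theorem exists_lev_lower_bound [FiniteDimensional ℝ V] {J : V → V →L[ℝ] V} {u : V → ℝ}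
    {U S : Set V} (hJ : ContDiffOn ℝ 2 J U) (hu : ContDiffOn ℝ 2 u U) (hU : IsOpen U)
    (hS : IsCompact S) (hSU : S ⊆ U) (hpos : ∀ x ∈ S, ∀ X, X ≠ 0 → 0 < lev J u x X) :
    ∃ c > 0, ∀ x ∈ S, ∀ X, c * ‖X‖ ^ 2 ≤ lev J u x X := by
  have hcomp : IsCompact (S ×ˢ sphere (0 : V) 1) := hS.prod (isCompact_sphere 0 1)
  have hcont : ContinuousOn (fun q : V × V => lev J u q.1 q.2) (S ×ˢ sphere (0 : V) 1) := by
    have m1 : MapsTo (fun q : V × V => q.1) (S ×ˢ sphere (0 : V) 1) U := fun q hq => hSU hq.1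
    have c1 := (hJ.continuousOn.comp continuousOn_fst m1)
    have c2 := ((hJ.continuousOn_fderiv_of_two hU).comp continuousOn_fst m1)
    have c3 := ((hu.continuousOn_fderiv_of_two hU).comp continuousOn_fst m1)
    have c4 := ((hu.continuousOn_fderiv_fderiv hU).comp continuousOn_fst m1)
    have c5 : ContinuousOn (fun q : V × V => q.2) (S ×ˢ sphere (0 : V) 1) := continuousOn_snd
    have c6 := c1.clm_apply c5
    exact (((c4.clm_apply c5).clm_apply c5).add ((c4.clm_apply c6).clm_apply c6)).sub
      (c3.clm_apply (((c2.clm_apply c5).clm_apply c6).sub ((c2.clm_apply c6).clm_apply c5)))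
  have hhom : ∀ x (t : ℝ) X, lev J u x (t • X) = t ^ 2 * lev J u x X := fun x t X => by
    simp only [lev, levTorsion, map_smul, smul_apply, smul_eq_mul, ← smul_sub, map_sub]
    ring
  obtain ⟨c, hc, h⟩ : ∃ c > 0, ∀ q ∈ S ×ˢ sphere (0 : V) 1, c ≤ lev J u q.1 q.2 := by
    rcases (S ×ˢ sphere (0 : V) 1).eq_empty_or_nonempty with he | hne
    · exact ⟨1, one_pos, fun q hq => by simp [he] at hq⟩
    obtain ⟨q, hq, hmin⟩ := hcomp.exists_isMinOn hne hcont
    refine ⟨_, hpos q.1 hq.1 q.2 ?_, fun q' hq' => hmin hq'⟩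
    rintro h0
    have := hq.2
    rw [h0] at this
    simp at this
  refine ⟨c, hc, fun x hx X => ?_⟩
  rcases eq_or_ne X 0 with rfl | hX
  · simp [lev, levTorsion]
  have hn : ‖X‖ ≠ 0 := norm_ne_zero_iff.2 hX
  have h1 := h (x, ‖X‖⁻¹ • X) ⟨hx, by simp [norm_smul, hn]⟩
  have h2 : lev J u x X = ‖X‖ ^ 2 * lev J u x (‖X‖⁻¹ • X) := by
    rw [hhom]; field_simp
  rw [h2, mul_comm]
  gcongr

theorem norm_sub_le_c2Dist {A B : E → W} {S U : Set E} (hU : IsOpen U) (hS : IsCompact S)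
    (hSU : S ⊆ U) (hA : ContDiffOn ℝ 2 A U) (hB : ContDiffOn ℝ 2 B U) {x : E} (hx : x ∈ S) :
    ‖A x - B x‖ ≤ c2Dist A B S ∧ ‖fderiv ℝ A x - fderiv ℝ B x‖ ≤ c2Dist A B S ∧
      ‖fderiv ℝ (fderiv ℝ A) x - fderiv ℝ (fderiv ℝ B) x‖ ≤ c2Dist A B S := by
  obtain ⟨a, ha⟩ := exists_bound_two hA hU hS hSU
  obtain ⟨b, hb⟩ := exists_bound_two hB hU hS hSU
  have hbdd : BddAbove (range fun x : S => max ‖A (x : E) - B (x : E)‖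
      (max ‖fderiv ℝ A (x : E) - fderiv ℝ B (x : E)‖
        ‖fderiv ℝ (fderiv ℝ A) (x : E) - fderiv ℝ (fderiv ℝ B) (x : E)‖)) := by
    refine ⟨a + b, ?_⟩
    rintro _ ⟨y, rfl⟩
    obtain ⟨a1, a2, a3⟩ := ha y y.2
    obtain ⟨b1, b2, b3⟩ := hb y y.2
    exact max_le ((norm_sub_le _ _).trans (add_le_add a1 b1))
      (max_le ((norm_sub_le _ _).trans (add_le_add a2 b2))
        ((norm_sub_le _ _).trans (add_le_add a3 b3)))
  have h := le_ciSup hbdd ⟨x, hx⟩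
  exact ⟨(le_max_left _ _).trans h, ((le_max_left _ _).trans (le_max_right _ _)).trans h,
    ((le_max_right _ _).trans (le_max_right _ _)).trans h⟩

variable {Ω G D : Set E2} {J : E2 → E2 →L[ℝ] E2} {r : E2 → ℝ} {f g : ℕ → E2 → E2}
  {Jν : ℕ → E2 → E2 →L[ℝ] E2} {K c : ℝ} {q p : E2} {y : ℕ → E2} {s : ℕ → ℝ}
  {A B : ℕ → E2 →L[ℝ] E2} {A₀ B₀ : E2 →L[ℝ] E2}

/-- A sequence of diffeomorphisms `f ν : D → G` onto a strictly pseudoconvex domain, holomorphic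
for structures `Jν ν` converging in `C²` to `J`, with all the bounds uniform in `ν`. -/
structure UniformizingSequence (Ω G D : Set E2) (J : E2 → E2 →L[ℝ] E2) (r : E2 → ℝ)
    (f g : ℕ → E2 → E2) (Jν : ℕ → E2 → E2 →L[ℝ] E2) (K c : ℝ) : Prop where
  isOpen_ambient : IsOpen Ω
  smooth : ContDiffOn ℝ (⊤ : ℕ∞) J Ω
  defining : ContDiffOn ℝ 2 r Ω
  isOpen_target : IsOpen G
  isCompact_closure : IsCompact (closure G)
  closure_subset : closure G ⊆ Ω
  mem_target_iff : ∀ x, x ∈ G ↔ x ∈ Ω ∧ r x < 0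
  fderiv_ne_zero : ∀ x ∈ frontier G, fderiv ℝ r x ≠ 0
  isOpen_source : IsOpen D
  isConnected_source : IsConnected D
  isBounded_source : Bornology.IsBounded D
  diffeo : ∀ n, IsDiffeoOn (f n) (g n) D G
  hol : ∀ n, ∀ x ∈ D, (fderiv ℝ (f n) x).comp (Jst E2) = (Jν n (f n x)).comp (fderiv ℝ (f n) x)
  hol_symm : ∀ n, ∀ y ∈ G,
    (fderiv ℝ (g n) y).comp (Jν n y) = (Jst E2).comp (fderiv ℝ (g n) y)
  sq_structure : ∀ n, ∀ y ∈ G, ∀ v, Jν n y (Jν n y v) = -v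
  smooth_structure : ∀ n, ContDiffOn ℝ (⊤ : ℕ∞) (Jν n) G
  pos : 0 < c
  one_le : 1 ≤ K
  structure_le : ∀ n, ∀ y ∈ G, ‖Jν n y‖ ≤ K ∧ ‖fderiv ℝ (Jν n) y‖ ≤ K ∧
    ‖fderiv ℝ (fderiv ℝ (Jν n)) y‖ ≤ K
  limit_structure_le : ∀ y ∈ closure G, ‖J y‖ ≤ K ∧ ‖fderiv ℝ J y‖ ≤ K ∧
    ‖fderiv ℝ (fderiv ℝ J) y‖ ≤ K
  defining_le : ∀ y ∈ closure G, ‖r y‖ ≤ K ∧ ‖fderiv ℝ r y‖ ≤ K ∧ ‖fderiv ℝ (fderiv ℝ r) y‖ ≤ K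
  le_lev : ∀ n, ∀ y ∈ G, ∀ X, c * ‖X‖ ^ 2 ≤ lev (Jν n) r y X
  conv : ∀ ε > 0, ∀ᶠ n in atTop, ∀ y ∈ G, ‖Jν n y - J y‖ ≤ ε ∧
    ‖fderiv ℝ (Jν n) y - fderiv ℝ J y‖ ≤ ε ∧
    ‖fderiv ℝ (fderiv ℝ (Jν n)) y - fderiv ℝ (fderiv ℝ J) y‖ ≤ ε
  exhaustion : ∃ ρ : E2 → ℝ, ContinuousOn ρ (closure D) ∧ (∀ x ∈ D, ContDiffAt ℝ 2 ρ x) ∧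
    (∀ x ∈ D, ∀ v, 0 ≤ lap2 ρ x v) ∧ (∀ x ∈ D, ρ x < 0) ∧ ∀ x ∈ frontier D, ρ x = 0

theorem IsDiffeoOn.fderiv_comp {f g : E → E} {s t : Set E} (h : IsDiffeoOn f g s t)
    (hs : IsOpen s) (ht : IsOpen t) {x : E} (hx : x ∈ s) :
    (fderiv ℝ g (f x)).comp (fderiv ℝ f x) = ContinuousLinearMap.id ℝ E := by
  obtain ⟨h1, h2, h3, h4, h5, h6⟩ := h
  have hf := ((h1.contDiffAt (hs.mem_nhds hx)).differentiableAt (by simp)).hasFDerivAt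
  have hg := ((h2.contDiffAt (ht.mem_nhds (h3 hx))).differentiableAt (by simp)).hasFDerivAt
  have e : (fun y => g (f y)) =ᶠ[𝓝 x] id := by
    filter_upwards [hs.mem_nhds hx] with y hy using h5 y hy
  exact ((hg.comp x hf).congr_of_eventuallyEq e.symm).unique (hasFDerivAt_id x)

theorem IsDiffeoOn.symm {f g : E → E} {s t : Set E} (h : IsDiffeoOn f g s t) :
    IsDiffeoOn g f t s :=
  ⟨h.2.1, h.1, h.2.2.2.1, h.2.2.1, h.2.2.2.2.2, h.2.2.2.2.1⟩

theorem UniformizingSequence.comp_strictMono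
    (h : UniformizingSequence Ω G D J r f g Jν K c) {φ : ℕ → ℕ} (hφ : Tendsto φ atTop atTop) :
    UniformizingSequence Ω G D J r (fun n => f (φ n)) (fun n => g (φ n)) (fun n => Jν (φ n)) K c :=
  { h with
    diffeo := fun _ => h.diffeo _
    hol := fun _ => h.hol _
    hol_symm := fun _ => h.hol_symm _
    sq_structure := fun _ => h.sq_structure _
    smooth_structure := fun _ => h.smooth_structure _
    structure_le := fun _ => h.structure_le _
    le_lev := fun _ => h.le_lev _
    conv := fun ε hε => hφ.eventually (h.conv ε hε) }

theorem exists_uniformizingSequence (hΩ : IsOpen Ω)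
    (hJ : IsACS Ω J) (hr : ContDiffOn ℝ 2 r Ω) (hrpsh : StrictPSHOn J r Ω)
    (hGdef : G = {x ∈ Ω | r x < 0}) (hGcomp : IsCompact (closure G))
    (hGΩ : closure G ⊆ Ω) (hdr : ∀ x ∈ frontier G, fderiv ℝ r x ≠ 0)
    (hDopen : IsOpen D) (hDconn : IsConnected D) (hDbdd : Bornology.IsBounded D)
    (hdiffeo : ∀ ν, IsDiffeoOn (f ν) (g ν) D G)
    (hnbhd : ∀ ν, ∃ D' G' : Set E2, IsOpen D' ∧ closure D ⊆ D' ∧ IsOpen G' ∧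
      IsDiffeoOn (f ν) (g ν) D' G')
    (hJν : ∀ ν y, Jν ν y = (fderiv ℝ (f ν) (g ν y)).comp ((Jst E2).comp (fderiv ℝ (g ν) y)))
    (hJνconv : Tendsto (fun ν => c2Dist (Jν ν) J (closure G)) atTop (𝓝 0)) :
    ∃ N K c, UniformizingSequence Ω G D J r (fun n => f (n + N)) (fun n => g (n + N))
      (fun n => Jν (n + N)) K c := by
  have hGopen : IsOpen G := by
    rw [hGdef]
    exact hr.continuousOn.isOpen_inter_preimage hΩ isOpen_Iio
  have hDcl : IsCompact (closure D) := hDbdd.isCompact_closure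
  have hsmooth : ∀ ν, ∃ U, IsOpen U ∧ closure G ⊆ U ∧ U ⊆ Ω ∧
      ContDiffOn ℝ (⊤ : ℕ∞) (Jν ν) U := by
    intro ν
    obtain ⟨D', G', hD', hDD', hG', h'⟩ := hnbhd ν
    have hsub : closure G ⊆ G' := by
      have himg : IsCompact (f ν '' closure D) := hDcl.image_of_continuousOn
        (h'.1.continuousOn.mono hDD')
      have h1 : closure G ⊆ f ν '' closure D := by
        refine closure_minimal (fun y hy => ?_) himg.isClosed
        exact ⟨g ν y, subset_closure ((hdiffeo ν).2.2.2.1 hy), (hdiffeo ν).2.2.2.2.2 y hy⟩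
      rintro y hy
      obtain ⟨x, hx, rfl⟩ := h1 hy
      exact h'.2.2.1 (hDD' hx)
    refine ⟨G' ∩ Ω, hG'.inter hΩ, subset_inter hsub hGΩ, inter_subset_right, ?_⟩
    have hDf : ContDiffOn ℝ (⊤ : ℕ∞) (fderiv ℝ (f ν)) D' :=
      h'.1.fderiv_of_isOpen hD' (by simp)
    have hDg : ContDiffOn ℝ (⊤ : ℕ∞) (fderiv ℝ (g ν)) G' :=
      h'.2.1.fderiv_of_isOpen hG' (by simp)
    have := (hDf.comp h'.2.1 h'.2.2.2.1).clm_comp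
      ((contDiffOn_const (c := Jst E2)).clm_comp hDg)
    exact (this.congr fun y _ => hJν ν y).mono inter_subset_left
  have hJΩ2 : ContDiffOn ℝ 2 J Ω := contDiffOn_infty.1 hJ.smooth 2
  have hclose : ∀ ν, ∀ x ∈ closure G, ‖Jν ν x - J x‖ ≤ c2Dist (Jν ν) J (closure G) ∧
      ‖fderiv ℝ (Jν ν) x - fderiv ℝ J x‖ ≤ c2Dist (Jν ν) J (closure G) ∧
      ‖fderiv ℝ (fderiv ℝ (Jν ν)) x - fderiv ℝ (fderiv ℝ J) x‖ ≤
        c2Dist (Jν ν) J (closure G) := fun ν x hx => by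
    obtain ⟨U, hU, hGU, hUΩ, hs⟩ := hsmooth ν
    exact norm_sub_le_c2Dist hU hGcomp hGU (contDiffOn_infty.1 hs 2) (hJΩ2.mono hUΩ) hx
  obtain ⟨K₁, hK₁⟩ := exists_bound_two hJΩ2 hΩ hGcomp hGΩ
  obtain ⟨K₂, hK₂⟩ := exists_bound_two hr hΩ hGcomp hGΩ
  have hlevpos : ∀ x ∈ closure G, ∀ X, X ≠ 0 → 0 < lev J r x X := by
    intro x hx X hX
    rw [← leviForm_eq_lev (hr.contDiffAt (hΩ.mem_nhds (hGΩ hx)))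
      ((hJΩ2.contDiffAt (hΩ.mem_nhds (hGΩ hx))).differentiableAt (by norm_num))
      (hJ.sq x (hGΩ hx))]
    exact hrpsh x (hGΩ hx) X hX
  obtain ⟨c, hc, hcl⟩ := exists_lev_lower_bound hJΩ2 hr hΩ hGcomp hGΩ hlevpos
  set K := max 1 (max (K₁ + 1) K₂) with hKdef
  have hK1 : 1 ≤ K := le_max_left _ _
  have hKK₁ : K₁ + 1 ≤ K := (le_max_left _ _).trans (le_max_right _ _)
  have hKK₂ : K₂ ≤ K := (le_max_right _ _).trans (le_max_right _ _)
  clear_value K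
  have hε : 0 < min 1 (c / (12 * K * K)) := by positivity
  obtain ⟨N, hN⟩ := eventually_atTop.1 (hJνconv.eventually (gt_mem_nhds hε))
  have hbd : ∀ n, ∀ y ∈ closure G, ‖Jν (n + N) y‖ ≤ K ∧ ‖fderiv ℝ (Jν (n + N)) y‖ ≤ K ∧
      ‖fderiv ℝ (fderiv ℝ (Jν (n + N))) y‖ ≤ K := by
    intro n y hy
    have h1 : c2Dist (Jν (n + N)) J (closure G) ≤ 1 :=
      (hN (n + N) (by lia)).le.trans (min_le_left _ _)
    obtain ⟨a1, a2, a3⟩ := hclose (n + N) y hy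
    obtain ⟨b1, b2, b3⟩ := hK₁ y hy
    refine ⟨?_, ?_, ?_⟩
    · linarith [norm_le_norm_add_norm_sub' (Jν (n + N) y) (J y)]
    · linarith [norm_le_norm_add_norm_sub' (fderiv ℝ (Jν (n + N)) y) (fderiv ℝ J y)]
    · linarith [norm_le_norm_add_norm_sub' (fderiv ℝ (fderiv ℝ (Jν (n + N))) y)
        (fderiv ℝ (fderiv ℝ J) y)]
  have hJbd : ∀ y ∈ closure G, ‖J y‖ ≤ K ∧ ‖fderiv ℝ J y‖ ≤ K ∧ ‖fderiv ℝ (fderiv ℝ J) y‖ ≤ K := by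
    intro y hy
    obtain ⟨b1, b2, b3⟩ := hK₁ y hy
    exact ⟨by linarith, by linarith, by linarith⟩
  have hrbd : ∀ y ∈ closure G, ‖r y‖ ≤ K ∧ ‖fderiv ℝ r y‖ ≤ K ∧ ‖fderiv ℝ (fderiv ℝ r) y‖ ≤ K := by
    intro y hy
    obtain ⟨b1, b2, b3⟩ := hK₂ y hy
    exact ⟨by linarith, by linarith, by linarith⟩
  have hlev : ∀ n, ∀ y ∈ G, ∀ X, c / 2 * ‖X‖ ^ 2 ≤ lev (Jν (n + N)) r y X := by
    intro n y hy X
    have hy' := subset_closure hy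
    have hd : c2Dist (Jν (n + N)) J (closure G) ≤ c / (12 * K * K) :=
      (hN (n + N) (by lia)).le.trans (min_le_right _ _)
    obtain ⟨a1, a2, -⟩ := hclose (n + N) y hy'
    have h1 := abs_lev_sub_lev_le (X := X) (hbd n y hy').1 (hJbd y hy').1 (hbd n y hy').2.1
      (hJbd y hy').2.1 (a1.trans hd) (a2.trans hd) (hrbd y hy').2.1 (hrbd y hy').2.2
    have e : 6 * K * K * (c / (12 * K * K)) = c / 2 := by field_simp; norm_num
    rw [e] at h1
    linarith [hcl y hy' X, (abs_le.1 h1).1]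
  have hid : ∀ n, ∀ y ∈ G, (fderiv ℝ (g n) y).comp (fderiv ℝ (f n) (g n y)) =
      ContinuousLinearMap.id ℝ E2 := fun n y hy => by
    have := (hdiffeo n).fderiv_comp hDopen hGopen ((hdiffeo n).2.2.2.1 hy)
    rwa [(hdiffeo n).2.2.2.2.2 y hy] at this
  have hid' : ∀ n, ∀ y ∈ G, (fderiv ℝ (f n) (g n y)).comp (fderiv ℝ (g n) y) =
      ContinuousLinearMap.id ℝ E2 := fun n y hy =>
    (hdiffeo n).symm.fderiv_comp hGopen hDopen hy
  have hholf : ∀ n, ∀ x ∈ D, (fderiv ℝ (f n) x).comp (Jst E2) =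
      (Jν n (f n x)).comp (fderiv ℝ (f n) x) := by
    intro n x hx
    ext1 v
    have h1 := DFunLike.congr_fun (hid n (f n x) ((hdiffeo n).2.2.1 hx)) v
    simp only [comp_apply, id_apply,
      (hdiffeo n).2.2.2.2.1 x hx] at h1
    simp only [hJν, comp_apply, (hdiffeo n).2.2.2.2.1 x hx, h1]
  have hsq : ∀ n, ∀ y ∈ G, ∀ v, Jν n y (Jν n y v) = -v := by
    intro n y hy v
    have h1 := DFunLike.congr_fun (hid n y hy) (Jst E2 (fderiv ℝ (g n) y v))
    have h2 := DFunLike.congr_fun (hid' n y hy) v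
    simp only [comp_apply, id_apply] at h1 h2
    have h3 : Jst E2 (Jst E2 (fderiv ℝ (g n) y v)) = -(fderiv ℝ (g n) y v) := by
      simp [Jst, smul_smul]
    simp only [hJν, comp_apply, h1, h3, map_neg, h2]
  have hmem : ∀ x, x ∈ G ↔ x ∈ Ω ∧ r x < 0 := fun x => by rw [hGdef]; rfl
  refine ⟨N, K, c / 2, hΩ, hJ.smooth, hr, hGopen, hGcomp, hGΩ, hmem, hdr, hDopen, hDconn, hDbdd,
    fun n => hdiffeo _, fun n => hholf _, ?_, fun n => hsq _, ?_, by positivity, hK1,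
    fun n y hy => hbd n y (subset_closure hy), hJbd, hrbd, hlev, ?_, ?_⟩
  · intro n y hy
    ext1 v
    have h1 := DFunLike.congr_fun (hid (n + N) y hy) (Jst E2 (fderiv ℝ (g (n + N)) y v))
    simp only [comp_apply, id_apply] at h1
    simp only [hJν, comp_apply, h1]
  · intro n
    obtain ⟨U, hU, hGU, hUΩ, hs⟩ := hsmooth (n + N)
    exact hs.mono (subset_closure.trans hGU)
  · intro ε hε
    have h1 := (tendsto_add_atTop_nat N).eventually (hJνconv.eventually (gt_mem_nhds hε))
    filter_upwards [h1] with n hn y hy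
    obtain ⟨a1, a2, a3⟩ := hclose (n + N) y (subset_closure hy)
    exact ⟨a1.trans hn.le, a2.trans hn.le, a3.trans hn.le⟩
  · obtain ⟨D', G', hD', hDD', hG', h'⟩ := hnbhd N
    have hcont : ContinuousOn (f N) (closure D) := h'.1.continuousOn.mono hDD'
    have hmaps : MapsTo (f N) (closure D) (closure G) := fun x hx =>
      ((hcont x hx).mono subset_closure).mem_closure hx (hdiffeo N).2.2.1
    refine ⟨fun x => r (f N x), hr.continuousOn.comp hcont (hmaps.mono_right hGΩ), ?_, ?_, ?_, ?_⟩
    · intro x hx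
      exact (hr.contDiffAt (hΩ.mem_nhds (hGΩ (hmaps (subset_closure hx))))).comp x
        (contDiffAt_infty.1 ((hdiffeo N).1.contDiffAt (hDopen.mem_nhds hx)) 2)
    · intro x hx v
      have hfx := (hdiffeo N).2.2.1 hx
      obtain ⟨U, hU, hGU, hUΩ, hs⟩ := hsmooth N
      rw [lap2_comp_of_holomorphic (J := Jν N)
        (hr.contDiffAt (hΩ.mem_nhds (hGΩ (subset_closure hfx))))
        (contDiffAt_infty.1 ((hdiffeo N).1.contDiffAt (hDopen.mem_nhds hx)) 2)
        ((hs.contDiffAt (hU.mem_nhds (hGU (subset_closure hfx)))).differentiableAt (by simp))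
        (by filter_upwards [hDopen.mem_nhds hx] with y hy using hholf N y hy)]
      have := hlev 0 _ hfx (fderiv ℝ (f N) x v)
      rw [Nat.zero_add] at this
      exact le_trans (by positivity) this
    · intro x hx
      exact ((hmem _).1 ((hdiffeo N).2.2.1 hx)).2
    · intro x hx
      have hxc : x ∈ closure D := frontier_subset_closure hx
      have hfc := hmaps hxc
      have hnot : f N x ∉ G := by
        intro hfG
        have h1 := (hdiffeo N).2.2.2.1 hfG
        rw [h'.2.2.2.2.1 x (hDD' hxc)] at h1
        exact (hDopen.frontier_eq ▸ hx).2 h1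
      have hle : r (f N x) ≤ 0 := by
        have : MapsTo r G (Iic 0) := fun y hy => ((hmem y).1 hy).2.le
        have h2 := (((hr.continuousOn.mono hGΩ) _ hfc).mono subset_closure).mem_closure hfc this
        rwa [isClosed_Iic.closure_eq] at h2
      refine le_antisymm hle ?_
      by_contra hneg
      exact hnot ((hmem _).2 ⟨hGΩ hfc, not_le.1 hneg⟩)

theorem le_sub_of_le_lap2 {u : E → ℝ} {x v : E} {a m : ℝ}
    (hu : ∀ z : ℂ, ‖z‖ ≤ 1 → ContDiffAt ℝ 2 u (x + z • v))
    (hlap : ∀ z : ℂ, ‖z‖ ≤ 1 → 4 * a ≤ lap2 u (x + z • v) v)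
    (hm : ∀ z : ℂ, ‖z‖ ≤ 1 → u (x + z • v) ≤ m) : u x ≤ m - a := by
  have hcomp : ∀ z : ℂ, ‖z‖ ≤ 1 → ContDiffAt ℝ 2 (fun z : ℂ => u (x + z • v)) z := fun z hz =>
    ContDiffAt.comp (g := u) (f := fun z : ℂ => x + z • v) z (hu z hz)
      (by fun_prop)
  have hq : ∀ z : ℂ, ContDiffAt ℝ 2 (fun z : ℂ => a * normSq z) z := fun z =>
    (contDiff_const.mul contDiff_normSq_planar.1).contDiffAt
  have key := planar_max_principle_disc (u := fun z : ℂ => u (x + z • v) - a * normSq z)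
    (m := m - a)
    (fun z hz => ((hcomp z (by simpa using hz)).continuousAt.sub
      (hq z).continuousAt).continuousWithinAt)
    (fun z hz => (hcomp z (by simpa using (mem_ball_zero_iff.1 hz).le)).sub (hq z))
    (fun z hz => by
      have hz' : ‖z‖ ≤ 1 := (mem_ball_zero_iff.1 hz).le
      rw [lap2_sub (hcomp z hz') (hq z), lap2_comp_line (hu z hz'), one_smul,
        lap2_const_mul a contDiff_normSq_planar.1.contDiffAt, contDiff_normSq_planar.2]
      linarith [hlap z hz'])
    (fun z hz => by
      have hz' : ‖z‖ = 1 := mem_sphere_zero_iff_norm.1 hz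
      have := hm z hz'.le
      simp only [normSq_eq_norm_sq, hz']
      linarith) 0 (by simp)
  simpa using key

section

variable {𝕜 V : Type*} [NontriviallyNormedField 𝕜] [CompleteSpace 𝕜] [NormedAddCommGroup V]
  [NormedSpace 𝕜 V] [FiniteDimensional 𝕜 V]

theorem exists_equiv_of_lipschitz_left_inverse {F G : V → V} {x : V} {L : V →L[𝕜] V} {s C : ℝ}
    (hF : HasFDerivAt F L x) (hs : 0 < s) (hleft : ∀ᶠ y in 𝓝 x, G (F y) = y)
    (hG : ∀ a ∈ ball (F x) s, ∀ b ∈ ball (F x) s, ‖G a - G b‖ ≤ C * ‖a - b‖) :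
    ∃ L' : V ≃L[𝕜] V, HasFDerivAt F (L' : V →L[𝕜] V) x := by
  have hinj : Function.Injective L := by
    rw [injective_iff_map_eq_zero]
    intro v hv
    by_contra hv0
    have hvn : 0 < ‖v‖ := norm_pos_iff.2 hv0
    set ε := 1 / (2 * (|C| + 1)) with hε
    have hε0 : 0 < ε := by positivity
    have h1 := hF.isLittleO.def hε0
    have h2 := hF.continuousAt.eventually (ball_mem_nhds (F x) hs)
    have hlim : Tendsto (fun t : 𝕜 => x + t • v) (𝓝[≠] 0) (𝓝 x) := by
      have : ContinuousAt (fun t : 𝕜 => x + t • v) 0 := by fun_prop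
      have := this.tendsto
      simp only [zero_smul, add_zero] at this
      exact this.mono_left nhdsWithin_le_nhds
    obtain ⟨t, ⟨⟨ht1, ht2⟩, ht3⟩, ht⟩ := ((hlim.eventually ((h1.and h2).and hleft)).and
      self_mem_nhdsWithin).exists
    have h4 := hG _ ht2 _ (mem_ball_self hs)
    rw [ht3, hleft.self_of_nhds] at h4
    simp only [add_sub_cancel_left, map_smul, hv, smul_zero, sub_zero] at h4 ht1
    have htv : 0 < ‖t • v‖ := norm_pos_iff.2 (smul_ne_zero ht hv0)
    have h5 : ‖t • v‖ ≤ (|C| + 1) * (ε * ‖t • v‖) :=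
      h4.trans (mul_le_mul (by linarith [le_abs_self C]) ht1 (norm_nonneg _) (by positivity))
    have h6 : (|C| + 1) * (ε * ‖t • v‖) = ‖t • v‖ / 2 := by
      rw [hε]; field_simp
    linarith
  refine ⟨(LinearEquiv.ofInjectiveEndo (L : V →ₗ[𝕜] V) hinj).toContinuousLinearEquiv, ?_⟩
  convert hF using 1
  ext v
  rfl

end

theorem contDiffOn_inverse [FiniteDimensional ℝ V] {F G : V → V} {D U : Set V} (hD : IsOpen D)
    (hU : IsOpen U)
    (hF : ContDiffOn ℝ (⊤ : ℕ∞) F D) (hFU : MapsTo F D U) (hGD : MapsTo G U D)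
    (hleft : ∀ x ∈ D, G (F x) = x) (hright : ∀ y ∈ U, F (G y) = y)
    (hlip : ∀ y ∈ U, ∃ s > 0, ∃ C, ∀ a ∈ ball y s, ∀ b ∈ ball y s, ‖G a - G b‖ ≤ C * ‖a - b‖) :
    ContDiffOn ℝ (⊤ : ℕ∞) G U := by
  have hGc : ContinuousOn G U := by
    intro y hy
    obtain ⟨s, hs, C, h⟩ := hlip y hy
    have : LipschitzOnWith (Real.toNNReal C) G (ball y s) :=
      LipschitzOnWith.of_dist_le_mul fun a ha b hb => by
        rw [dist_eq_norm, dist_eq_norm]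
        exact (h a ha b hb).trans (by gcongr; exact Real.le_coe_toNNReal C)
    exact (this.continuousOn.continuousAt (ball_mem_nhds y hs)).continuousWithinAt
  let e : OpenPartialHomeomorph V V :=
    { toFun := F
      invFun := G
      source := D
      target := U
      map_source' := hFU
      map_target' := hGD
      left_inv' := hleft
      right_inv' := hright
      open_source := hD
      open_target := hU
      continuousOn_toFun := hF.continuousOn
      continuousOn_invFun := hGc }
  intro y hy
  have hx := hGD hy
  have hc := hF.contDiffAt (hD.mem_nhds hx)
  obtain ⟨s, hs, C, h⟩ := hlip y hy
  rw [← hright y hy] at h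
  have : CompleteSpace V := FiniteDimensional.complete ℝ V
  obtain ⟨L, hL⟩ := exists_equiv_of_lipschitz_left_inverse
    (hc.differentiableAt (by simp)).hasFDerivAt hs
    (by filter_upwards [hD.mem_nhds hx] with z hz using hleft z hz) h
  exact (e.contDiffAt_symm (a := y) hy hL hc).contDiffWithinAt

theorem Filter.Tendsto.clm_apply' {ι : Type*} {l : Filter ι} {a : ι → V →L[ℝ] W} {a₀ : V →L[ℝ] W}
    {v : ι → V} {v₀ : V} (ha : Tendsto a l (𝓝 a₀)) (hv : Tendsto v l (𝓝 v₀)) :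
    Tendsto (fun i => a i (v i)) l (𝓝 (a₀ v₀)) :=
  (isBoundedBilinearMap_apply (𝕜 := ℝ) (E := V) (F := W)).continuous.tendsto (a₀, v₀) |>.comp
    (ha.prodMk_nhds hv)

theorem tendsto_of_norm_sub_le {X ι : Type*} [SeminormedAddCommGroup X] {l : Filter ι} {a b : ι → X}
    {b₀ : X} (hb : Tendsto b l (𝓝 b₀)) (hab : ∀ ε > 0, ∀ᶠ i in l, ‖a i - b i‖ ≤ ε) :
    Tendsto a l (𝓝 b₀) := by
  have : Tendsto (fun i => a i - b i) l (𝓝 0) := Metric.tendsto_nhds.2 fun ε hε =>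
    (hab (ε / 2) (half_pos hε)).mono fun i hi => by
      rw [dist_zero_right]
      exact hi.trans_lt (half_lt_self hε)
  simpa using this.add hb

namespace UniformizingSequence

theorem mapsTo (h : UniformizingSequence Ω G D J r f g Jν K c) (n : ℕ) : MapsTo (f n) D G :=
  (h.diffeo n).2.2.1

theorem mapsTo_symm (h : UniformizingSequence Ω G D J r f g Jν K c) (n : ℕ) : MapsTo (g n) G D :=
  (h.diffeo n).2.2.2.1

theorem contDiffAt (h : UniformizingSequence Ω G D J r f g Jν K c) (n : ℕ) {x : E2} (hx : x ∈ D) :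
    ContDiffAt ℝ 2 (f n) x :=
  contDiffAt_infty.1 ((h.diffeo n).1.contDiffAt (h.isOpen_source.mem_nhds hx)) 2

theorem contDiffAt_structure (h : UniformizingSequence Ω G D J r f g Jν K c) (n : ℕ) {y : E2}
    (hy : y ∈ G) : ContDiffAt ℝ 2 (Jν n) y :=
  contDiffAt_infty.1 ((h.smooth_structure n).contDiffAt (h.isOpen_target.mem_nhds hy)) 2

theorem contDiffAt_defining (h : UniformizingSequence Ω G D J r f g Jν K c) {y : E2}
    (hy : y ∈ closure G) : ContDiffAt ℝ 2 r y :=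
  h.defining.contDiffAt (h.isOpen_ambient.mem_nhds (h.closure_subset hy))

theorem neg_of_mem (h : UniformizingSequence Ω G D J r f g Jν K c) {y : E2} (hy : y ∈ G) :
    r y < 0 :=
  ((h.mem_target_iff y).1 hy).2

theorem eventually_hol (h : UniformizingSequence Ω G D J r f g Jν K c) (n : ℕ) {x : E2}
    (hx : x ∈ D) : ∀ᶠ y in 𝓝 x,
      (fderiv ℝ (f n) y).comp (Jst E2) = (Jν n (f n y)).comp (fderiv ℝ (f n) y) := by
  filter_upwards [h.isOpen_source.mem_nhds hx] with y hy using h.hol n y hy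

theorem lap2_eq (h : UniformizingSequence Ω G D J r f g Jν K c) (n : ℕ) {x : E2} (hx : x ∈ D)
    (v : E2) : lap2 (f n) x v = -levTorsion (Jν n) (f n x) (fderiv ℝ (f n) x v) :=
  lap2_of_holomorphic (h.contDiffAt n hx)
    ((h.contDiffAt_structure n (h.mapsTo n hx)).differentiableAt (by norm_num))
    (h.eventually_hol n hx) v

theorem norm_lap2_le (h : UniformizingSequence Ω G D J r f g Jν K c) (n : ℕ) {x : E2} (hx : x ∈ D)
    {v : E2} (hv : ‖v‖ = 1) : ‖lap2 (f n) x v‖ ≤ 2 * K ^ 2 * ‖fderiv ℝ (f n) x‖ ^ 2 := by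
  obtain ⟨h1, h2, -⟩ := h.structure_le n _ (h.mapsTo n hx)
  rw [h.lap2_eq n hx, norm_neg]
  refine (norm_levTorsion_le h1 h2 _).trans ?_
  have := (fderiv ℝ (f n) x).le_opNorm v
  rw [hv, mul_one] at this
  gcongr

theorem lap2_defining_eq (h : UniformizingSequence Ω G D J r f g Jν K c) (n : ℕ) {x : E2}
    (hx : x ∈ D) (v : E2) :
    lap2 (fun y => r (f n y)) x v = lev (Jν n) r (f n x) (fderiv ℝ (f n) x v) :=
  lap2_comp_of_holomorphic (h.contDiffAt_defining (subset_closure (h.mapsTo n hx)))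
    (h.contDiffAt n hx) ((h.contDiffAt_structure n (h.mapsTo n hx)).differentiableAt (by norm_num))
    (h.eventually_hol n hx) v

theorem contDiffAt_comp_defining (h : UniformizingSequence Ω G D J r f g Jν K c) (n : ℕ) {x : E2}
    (hx : x ∈ D) : ContDiffAt ℝ 2 (fun y => r (f n y)) x :=
  (h.contDiffAt_defining (subset_closure (h.mapsTo n hx))).comp x (h.contDiffAt n hx)

theorem exists_fderiv_le (h : UniformizingSequence Ω G D J r f g Jν K c) :
    ∃ C > 0, ∀ n p ρ, 0 < ρ → ball p ρ ⊆ D → ‖fderiv ℝ (f n) p‖ ≤ C / ρ := by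
  obtain ⟨C, hC, hA⟩ := exists_norm_fderiv_le_of_strictPSH (E := E2) (V := E2) (K := K) (M := K)
    h.pos
  refine ⟨C, hC, fun n p ρ hρ hsub => hA (Jν n) r G (f n) p ρ hρ (fun y hy => ?_) fun x hx =>
    ⟨h.mapsTo n (hsub hx), h.contDiffAt n (hsub hx), h.hol n x (hsub hx)⟩⟩
  obtain ⟨h1, h2, -⟩ := h.structure_le n y hy
  exact ⟨h1, h2, (h.contDiffAt_structure n hy).differentiableAt (by norm_num),
    h.contDiffAt_defining (subset_closure hy), (h.defining_le y (subset_closure hy)).1,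
    h.le_lev n y hy⟩

/-- Near each point of the source the derivatives are bounded uniformly. -/
theorem exists_local_bound (h : UniformizingSequence Ω G D J r f g Jν K c) {x : E2} (hx : x ∈ D) :
    ∃ s > 0, ∃ M > 0, ball x s ⊆ D ∧ ∀ n, ∀ y ∈ ball x s, ‖fderiv ℝ (f n) y‖ ≤ M := by
  obtain ⟨C, hC, hA⟩ := h.exists_fderiv_le
  obtain ⟨s, hs, hsub⟩ := Metric.isOpen_iff.1 h.isOpen_source x hx
  refine ⟨s / 2, by positivity, C / (s / 2), by positivity,
    (ball_subset_ball (by linarith)).trans hsub, fun n y hy => hA n y _ (by positivity) ?_⟩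
  refine (ball_subset_ball' ?_).trans hsub
  have := mem_ball.1 hy
  linarith

theorem norm_sub_le_of_bound (h : UniformizingSequence Ω G D J r f g Jν K c) {x : E2} {s M : ℝ}
    (hsub : ball x s ⊆ D) (n : ℕ) (hM : ∀ y ∈ ball x s, ‖fderiv ℝ (f n) y‖ ≤ M) {y z : E2}
    (hy : y ∈ ball x s) (hz : z ∈ ball x s) : ‖f n y - f n z‖ ≤ M * ‖y - z‖ :=
  (convex_ball x s).norm_image_sub_le_of_norm_fderiv_le (𝕜 := ℝ)
    (fun w hw => (h.contDiffAt n (hsub hw)).differentiableAt (by norm_num)) hM hz hy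

theorem exists_subseq (h : UniformizingSequence Ω G D J r f g Jν K c) :
    ∃ φ : ℕ → ℕ, StrictMono φ ∧ ∃ F : E2 → E2,
      TendstoLocallyUniformlyOn (fun k => f (φ k)) F atTop D := by
  obtain ⟨R, hR⟩ := h.isCompact_closure.isBounded.subset_closedBall (0 : E2)
  refine exists_subseq_tendstoLocallyUniformlyOn (0 : E2)
    (fun x hx => ⟨R, Eventually.of_forall fun n => hR (subset_closure (h.mapsTo n hx))⟩)
    fun x hx ε hε => ?_
  obtain ⟨s, hs, M, hM, hsub, hb⟩ := h.exists_local_bound hx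
  refine ⟨min s (ε / M), by positivity, Eventually.of_forall fun n y hy => ?_⟩
  have h1 := h.norm_sub_le_of_bound hsub n (hb n) (ball_subset_ball (min_le_left _ _) hy)
    (mem_ball_self hs)
  have h2 : ‖y - x‖ ≤ ε / M := (mem_ball_iff_norm.1 hy).le.trans (min_le_right _ _)
  rw [dist_eq_norm]
  calc _ ≤ M * ‖y - x‖ := h1
    _ ≤ M * (ε / M) := by gcongr
    _ = ε := by field_simp

/-- Locally uniform limits are holomorphic, with convergence of the first derivatives. -/
theorem hol_of_tendsto (h : UniformizingSequence Ω G D J r f g Jν K c) {F : E2 → E2}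
    (hF : TendstoLocallyUniformlyOn f F atTop D) :
    MapsTo F D (closure G) ∧ (∀ x ∈ D, DifferentiableAt ℝ F x ∧
      (fderiv ℝ F x).comp (Jst E2) = (J (F x)).comp (fderiv ℝ F x)) ∧
    TendstoLocallyUniformlyOn (fun n => fderiv ℝ (f n)) (fderiv ℝ F) atTop D := by
  have hmaps : MapsTo F D (closure G) := fun x hx =>
    mem_closure_of_tendsto (hF.tendsto_at hx) (Eventually.of_forall fun n => h.mapsTo n hx)
  obtain ⟨hd, hlim⟩ := differentiableAt_of_equicontinuous_fderiv h.isOpen_source hF (by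
    intro x hx ε hε
    obtain ⟨s, hs, M, hM, hsub, hb⟩ := h.exists_local_bound hx
    set A := 2 * K ^ 2 * M ^ 2 with hA
    set B := 16 * M / √s + A * √s with hB
    have hA0 : 0 ≤ A := by positivity
    have hB0 : 0 < B := by positivity
    clear_value A B
    refine ⟨min (s / 8) ((ε / B) ^ 2), by positivity, Eventually.of_forall fun n y hy => ?_⟩
    have hy8 : y ∈ ball x (s / 8) := ball_subset_ball (min_le_left _ _) hy
    have hys : y ∈ ball x s := ball_subset_ball (by linarith) hy8
    refine ⟨(h.contDiffAt n (hsub hys)).differentiableAt (by norm_num), ?_⟩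
    have h1 := norm_fderiv_sub_le_sqrt (f := f n) hs hA0 (fun z hz => h.contDiffAt n (hsub hz))
      (hb n) (fun z hz v hv => (h.norm_lap2_le n (hsub hz) hv).trans (by
        rw [hA]; gcongr; exact hb n z hz)) (mem_ball_self (by positivity)) hy8
    rw [← hB] at h1
    refine h1.trans ?_
    have h2 : √‖y - x‖ ≤ ε / B := Real.sqrt_le_iff.2
      ⟨by positivity, (mem_ball_iff_norm.1 hy).le.trans (min_le_right _ _)⟩
    calc B * √‖y - x‖ ≤ B * (ε / B) := by gcongr
      _ = ε := by field_simp)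
  refine ⟨hmaps, fun x hx => ⟨hd x hx, ?_⟩, hlim⟩
  have t1 : Tendsto (fun n => fderiv ℝ (f n) x) atTop (𝓝 (fderiv ℝ F x)) := hlim.tendsto_at hx
  have t2 : Tendsto (fun n => J (f n x)) atTop (𝓝 (J (F x))) := by
    have hFx := h.closure_subset (hmaps hx)
    exact (h.smooth.continuousOn.continuousAt (h.isOpen_ambient.mem_nhds hFx)).tendsto.comp
      (hF.tendsto_at hx)
  have t3 : Tendsto (fun n => Jν n (f n x)) atTop (𝓝 (J (F x))) :=
    tendsto_of_norm_sub_le t2 fun ε hε => (h.conv ε hε).mono fun n hn => (hn _ (h.mapsTo n hx)).1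
  ext1 v
  have t5 : Tendsto (fun n => fderiv ℝ (f n) x (Jst E2 v)) atTop (𝓝 (fderiv ℝ F x (Jst E2 v))) :=
    t1.clm_apply' tendsto_const_nhds
  have t6 : Tendsto (fun n => Jν n (f n x) (fderiv ℝ (f n) x v)) atTop
      (𝓝 (J (F x) (fderiv ℝ F x v))) := t3.clm_apply' (t1.clm_apply' tendsto_const_nhds)
  refine tendsto_nhds_unique t5 (t6.congr fun n => ?_)
  exact (DFunLike.congr_fun (h.hol n x hx) v).symm

theorem tendsto_defining (h : UniformizingSequence Ω G D J r f g Jν K c) {F : E2 → E2}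
    (hF : TendstoLocallyUniformlyOn f F atTop D) :
    TendstoLocallyUniformlyOn (fun n x => r (f n x)) (fun x => r (F x)) atTop D := by
  obtain ⟨hmaps, -⟩ := h.hol_of_tendsto hF
  refine tendstoLocallyUniformlyOn_of_equicontinuous (fun x hx => ?_) fun x hx ε hε => ?_
  · exact ((h.contDiffAt_defining (hmaps hx)).continuousAt.tendsto).comp (hF.tendsto_at hx)
  · obtain ⟨s, hs, M, hM, hsub, hb⟩ := h.exists_local_bound hx
    have hK : 0 < K := lt_of_lt_of_le one_pos h.one_le
    refine ⟨min s (ε / (K * M)), by positivity, Eventually.of_forall fun n y hy => ?_⟩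
    have h1 : ‖r (f n y) - r (f n x)‖ ≤ K * M * ‖y - x‖ := by
      refine (convex_ball x s).norm_image_sub_le_of_norm_fderiv_le (𝕜 := ℝ)
        (f := fun y => r (f n y))
        (fun w hw => (h.contDiffAt_comp_defining n (hsub hw)).differentiableAt (by norm_num))
        (fun w hw => ?_) (mem_ball_self hs) (ball_subset_ball (min_le_left _ _) hy)
      have hfw := subset_closure (h.mapsTo n (hsub hw))
      rw [fderiv_fun_comp w ((h.contDiffAt_defining hfw).differentiableAt (by norm_num))
        ((h.contDiffAt n (hsub hw)).differentiableAt (by norm_num))]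
      exact (opNorm_comp_le _ _).trans
        (mul_le_mul (h.defining_le _ hfw).2.1 (hb n w hw) (norm_nonneg _) hK.le)
    have h2 : ‖y - x‖ ≤ ε / (K * M) := (mem_ball_iff_norm.1 hy).le.trans (min_le_right _ _)
    rw [dist_eq_norm]
    calc _ ≤ K * M * ‖y - x‖ := h1
      _ ≤ K * M * (ε / (K * M)) := by gcongr
      _ = ε := by field_simp

/-- A locally uniform limit either takes its values in the target, or is a constant in its
boundary. -/
theorem mapsTo_or_const (h : UniformizingSequence Ω G D J r f g Jν K c) {F : E2 → E2}
    (hF : TendstoLocallyUniformlyOn f F atTop D) :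
    MapsTo F D G ∨ ∃ q ∈ frontier G, ∀ x ∈ D, F x = q := by
  obtain ⟨hmaps, hhol, hlim⟩ := h.hol_of_tendsto hF
  have hr := h.tendsto_defining hF
  have hle : ∀ x ∈ D, r (F x) ≤ 0 := fun x hx =>
    le_of_tendsto (hr.tendsto_at hx) (Eventually.of_forall fun n => (h.neg_of_mem (h.mapsTo n hx)).le)
  by_cases hlt : ∀ x ∈ D, r (F x) < 0
  · exact Or.inl fun x hx => (h.mem_target_iff _).2 ⟨h.closure_subset (hmaps hx), hlt x hx⟩
  right
  push Not at hlt
  obtain ⟨x₀, hx₀, h0⟩ := hlt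
  have hzero : ∀ x ∈ D, r (F x) = 0 := by
    refine eq_zero_of_limit_subsolution (J := fun _ _ => Jst E2) h.isOpen_source
      h.isConnected_source.isPreconnected (fun x hx => ?_) hr (fun x hx => ?_) hle hx₀
      (le_antisymm (hle _ hx₀) h0)
    · obtain ⟨s, hs, hsub⟩ := Metric.isOpen_iff.1 h.isOpen_source x hx
      refine ⟨s, hs, ‖Jst E2‖, Eventually.of_forall fun n y hy => ⟨le_rfl, ?_,
        h.contDiffAt_comp_defining n (hsub hy), fun X => ?_⟩⟩
      · simp
      · rw [lev_Jst, h.lap2_defining_eq n (hsub hy)]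
        exact le_trans (mul_nonneg h.pos.le (sq_nonneg _)) (h.le_lev n _ (h.mapsTo n (hsub hy)) _)
    · exact ((h.contDiffAt_defining (hmaps hx)).continuousAt.comp
        (hhol x hx).1.continuousAt).continuousWithinAt
  have hDF : ∀ x ∈ D, fderiv ℝ F x = 0 := by
    intro x hx
    by_contra hne
    obtain ⟨v, hv⟩ : ∃ v, fderiv ℝ F x v ≠ 0 := by
      by_contra hcon
      push Not at hcon
      exact hne (ContinuousLinearMap.ext hcon)
    set η := ‖fderiv ℝ F x v‖ with hη
    have hη0 : 0 < η := norm_pos_iff.2 hv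
    have hv0 : 0 < ‖v‖ := norm_pos_iff.2 fun hv' => hv (by rw [hv', map_zero])
    obtain ⟨s, hs, hsub⟩ := Metric.isOpen_iff.1 h.isOpen_source x hx
    obtain ⟨t, ht, hts⟩ : ∃ t > 0, ∀ᶠ n in atTop, ∀ y ∈ ball x t, η / 2 ≤ ‖fderiv ℝ (f n) y v‖ := by
      obtain ⟨W, hW, hW'⟩ := Metric.tendstoLocallyUniformlyOn_iff.1 hlim (η / (8 * ‖v‖))
        (by positivity) x hx
      rw [h.isOpen_source.nhdsWithin_eq hx] at hW
      obtain ⟨t₁, ht₁, hs₁⟩ := Metric.mem_nhds_iff.1 hW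
      obtain ⟨s', hs', M, hM, hsub', hb⟩ := h.exists_local_bound hx
      have hB0 : 0 < 16 * M / √s' + (2 * K ^ 2 * M ^ 2) * √s' :=
        add_pos_of_pos_of_nonneg (by positivity) (by positivity)
      set B := 16 * M / √s' + (2 * K ^ 2 * M ^ 2) * √s' with hB
      clear_value B
      refine ⟨min t₁ (min (s' / 8) ((η / (8 * ‖v‖) / B) ^ 2)), by positivity, ?_⟩
      filter_upwards [hW'] with n hn y hy
      have hy8 : y ∈ ball x (s' / 8) :=
        ball_subset_ball ((min_le_right _ _).trans (min_le_left _ _)) hy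
      have h1 := norm_fderiv_sub_le_sqrt (f := f n) hs' (A := 2 * K ^ 2 * M ^ 2) (by positivity)
        (fun z hz => h.contDiffAt n (hsub' hz))
        (hb n) (fun z hz v hv => (h.norm_lap2_le n (hsub' hz) hv).trans (by
          gcongr; exact hb n z hz)) (mem_ball_self (by positivity)) hy8
      rw [← hB] at h1
      have h2 : √‖y - x‖ ≤ η / (8 * ‖v‖) / B := Real.sqrt_le_iff.2
        ⟨by positivity, (mem_ball_iff_norm.1 hy).le.trans
          ((min_le_right _ _).trans (min_le_right _ _))⟩
      have h3 : ‖fderiv ℝ (f n) y - fderiv ℝ (f n) x‖ ≤ η / (8 * ‖v‖) := by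
        refine h1.trans ?_
        calc B * √‖y - x‖ ≤ B * (η / (8 * ‖v‖) / B) := by gcongr
          _ = _ := by field_simp
      have h4 := (hn x (hs₁ (mem_ball_self ht₁))).le
      rw [dist_eq_norm] at h4
      have h5 := (fderiv ℝ (f n) y - fderiv ℝ (f n) x).le_of_opNorm_le h3 v
      have h6 := (fderiv ℝ F x - fderiv ℝ (f n) x).le_of_opNorm_le h4 v
      have e : η / (8 * ‖v‖) * ‖v‖ = η / 8 := by field_simp
      rw [e, sub_apply] at h5 h6
      have h7 := norm_sub_norm_le (fderiv ℝ F x v) (fderiv ℝ (f n) x v)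
      have h8 := norm_sub_norm_le (fderiv ℝ (f n) x v) (fderiv ℝ (f n) y v)
      rw [norm_sub_rev] at h8
      linarith
    set τ := min s t / (2 * ‖v‖) with hτ
    have hτ0 : 0 < τ := by positivity
    set a := c * (τ * (η / 2)) ^ 2 / 4 with ha
    have ha0 : 0 < a := by have := h.pos; positivity
    have hball : ∀ z : ℂ, ‖z‖ ≤ 1 → x + z • ((τ : ℂ) • v) ∈ ball x (min s t) := by
      intro z hz
      have h9 : τ * ‖v‖ = min s t / 2 := by rw [hτ]; field_simp
      have h10 : 0 < min s t := by positivity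
      rw [mem_ball_iff_norm, add_sub_cancel_left, norm_smul, norm_smul, norm_real,
        Real.norm_of_nonneg hτ0.le, h9]
      nlinarith [norm_nonneg z]
    have hlow : ∀ᶠ n in atTop, r (f n x) ≤ -a := by
      filter_upwards [hts] with n hn
      have := le_sub_of_le_lap2 (u := fun y => r (f n y)) (x := x) (v := (τ : ℂ) • v) (a := a)
        (m := 0)
        (fun z hz => h.contDiffAt_comp_defining n
          (hsub (ball_subset_ball (min_le_left _ _) (hball z hz))))
        (fun z hz => ?_)
        (fun z hz => (h.neg_of_mem (h.mapsTo n
          (hsub (ball_subset_ball (min_le_left _ _) (hball z hz))))).le)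
      · simpa using this
      · have hz1 := hball z hz
        have hzD := hsub (ball_subset_ball (min_le_left _ _) hz1)
        rw [h.lap2_defining_eq n hzD]
        refine le_trans ?_ (h.le_lev n _ (h.mapsTo n hzD) _)
        have e : (τ : ℂ) • v = τ • v := coe_smul τ v
        have h11 := hn _ (ball_subset_ball (min_le_right _ _) hz1)
        rw [e] at h11 ⊢
        rw [map_smul, norm_smul, Real.norm_of_nonneg hτ0.le]
        have hc := h.pos
        have : 4 * a = c * (τ * (η / 2)) ^ 2 := by rw [ha]; ring
        rw [this]
        gcongr
    have := le_of_tendsto (hr.tendsto_at hx) hlow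
    linarith [hzero x hx]
  have hconst : ∀ x ∈ D, F x = F x₀ := fun x hx =>
    h.isOpen_source.is_const_of_fderiv_eq_zero (𝕜 := ℝ) h.isConnected_source.isPreconnected
      (fun y hy => (hhol y hy).1.differentiableWithinAt) (fun y hy => hDF y hy) hx hx₀
  refine ⟨F x₀, ?_, hconst⟩
  rw [h.isOpen_target.frontier_eq]
  exact ⟨hmaps hx₀, fun hG => (h.neg_of_mem hG).ne (hzero x₀ hx₀)⟩

end UniformizingSequence

namespace UniformizingSequence

theorem norm_comp_sub_le (h : UniformizingSequence Ω G D J r f g Jν K c) {x : E2} {s M : ℝ}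
    (hsub : ball x s ⊆ D) (n : ℕ) (hM : ∀ y ∈ ball x s, ‖fderiv ℝ (f n) y‖ ≤ M) {A : E2 → W}
    (hA : ∀ y ∈ G, DifferentiableAt ℝ A y)
    (hAK : ∀ y ∈ G, ‖fderiv ℝ A y‖ ≤ K) {y z : E2}
    (hy : y ∈ ball x s) (hz : z ∈ ball x s) : ‖A (f n y) - A (f n z)‖ ≤ K * M * ‖y - z‖ := by
  refine (convex_ball x s).norm_image_sub_le_of_norm_fderiv_le (𝕜 := ℝ)
    (f := fun y => A (f n y)) (fun w hw => ?_) (fun w hw => ?_) hz hy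
  · exact (hA _ (h.mapsTo n (hsub hw))).comp w
      ((h.contDiffAt n (hsub hw)).differentiableAt (by norm_num))
  · rw [fderiv_fun_comp w (hA _ (h.mapsTo n (hsub hw)))
      ((h.contDiffAt n (hsub hw)).differentiableAt (by norm_num))]
    exact (opNorm_comp_le _ _).trans (mul_le_mul (hAK _ (h.mapsTo n (hsub hw)))
      (hM w hw) (norm_nonneg _) (zero_le_one.trans h.one_le))

theorem norm_lap2_sub_le (h : UniformizingSequence Ω G D J r f g Jν K c) {x : E2} {s M : ℝ}
    (hs : 0 < s) (hsub : ball x s ⊆ D) (n : ℕ) (hM : ∀ y ∈ ball x s, ‖fderiv ℝ (f n) y‖ ≤ M)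
    {y z : E2} (hy : y ∈ ball x s) (hz : z ∈ ball x s) {v : E2} (hv : ‖v‖ = 1) :
    ‖lap2 (f n) y v - lap2 (f n) z v‖ ≤
      (4 * K ^ 2 * M ^ 3 + 4 * K ^ 2 * M) * (‖y - z‖ + ‖fderiv ℝ (f n) y - fderiv ℝ (f n) z‖) := by
  have hM0 : 0 ≤ M := (norm_nonneg _).trans (hM x (mem_ball_self hs))
  have hfy := h.mapsTo n (hsub hy)
  have hfz := h.mapsTo n (hsub hz)
  have h1 : ∀ w ∈ ball x s, ‖fderiv ℝ (f n) w v‖ ≤ M := fun w hw => by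
    simpa [hv] using (fderiv ℝ (f n) w).le_of_opNorm_le (hM w hw) v
  have h2 := h.norm_comp_sub_le hsub n hM (A := Jν n)
    (fun w hw => (h.contDiffAt_structure n hw).differentiableAt (by norm_num))
    (fun w hw => (h.structure_le n w hw).2.1) hy hz
  have h3 := h.norm_comp_sub_le hsub n hM (A := fderiv ℝ (Jν n))
    (fun w hw => (h.contDiffAt_structure n hw).differentiableAt_fderiv_two)
    (fun w hw => (h.structure_le n w hw).2.2) hy hz
  have h4 : ‖fderiv ℝ (f n) y v - fderiv ℝ (f n) z v‖ ≤ ‖fderiv ℝ (f n) y - fderiv ℝ (f n) z‖ := by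
    simpa [hv] using (fderiv ℝ (f n) y - fderiv ℝ (f n) z).le_opNorm v
  have h5 := norm_torsion_sub_le (h.structure_le n _ hfy).2.1 (h.structure_le n _ hfz).2.1
    (h.structure_le n _ hfy).1 (h.structure_le n _ hfz).1 (h1 y hy) (h1 z hz)
  have hK := h.one_le
  rw [h.lap2_eq n (hsub hy), h.lap2_eq n (hsub hz), neg_sub_neg, norm_sub_rev]
  unfold levTorsion
  refine h5.trans ?_
  calc _ ≤ 2 * K * M ^ 2 * (K * M * ‖y - z‖ + K * M * ‖y - z‖) +
        4 * K ^ 2 * M * ‖fderiv ℝ (f n) y - fderiv ℝ (f n) z‖ := by gcongr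
    _ ≤ _ := by
      have e1 : 0 ≤ 4 * K ^ 2 * M * ‖y - z‖ := by positivity
      have e2 : 0 ≤ 4 * K ^ 2 * M ^ 3 * ‖fderiv ℝ (f n) y - fderiv ℝ (f n) z‖ := by positivity
      nlinarith

theorem contDiffOn_of_tendsto (h : UniformizingSequence Ω G D J r f g Jν K c) {F : E2 → E2}
    (hF : TendstoLocallyUniformlyOn f F atTop D) : ContDiffOn ℝ (⊤ : ℕ∞) F D := by
  have h2 : ContDiffOn ℝ 2 F D := by
    refine (contDiffOn_two_of_tendstoLocallyUniformlyOn h.isOpen_source hF fun x hx => ?_).1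
    obtain ⟨s, hs, M, hM, hsub, hb⟩ := h.exists_local_bound hx
    have hK := h.one_le
    obtain ⟨C, hC, hB⟩ := exists_norm_fderiv_fderiv_le (E := E2) (W := E2) (ρ := s) (M := M)
      (K := 4 * K ^ 2 * M ^ 3 + 4 * K ^ 2 * M) hs hM.le (by positivity)
    refine ⟨s / 16, by positivity, C, Eventually.of_forall fun n => ?_⟩
    obtain ⟨b1, b2⟩ := hB (f n) x (fun y hy => h.contDiffAt n (hsub hy)) (hb n)
      (fun y hy z hz v hv => h.norm_lap2_sub_le hs hsub n (hb n) hy hz hv)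
    exact ⟨fun y hy => ⟨h.contDiffAt n (hsub (ball_subset_ball (by linarith) hy)),
      b1 y (ball_subset_ball (by linarith) hy)⟩, b2⟩
  obtain ⟨hmaps, hhol, -⟩ := h.hol_of_tendsto hF
  exact contDiffOn_of_holomorphic h.isOpen_source h.isOpen_ambient h.smooth
    (fun x hx => h2.contDiffAt (h.isOpen_source.mem_nhds hx)) (hmaps.mono_right h.closure_subset)
    fun x hx => (hhol x hx).2

theorem isPreconnected_target (h : UniformizingSequence Ω G D J r f g Jν K c) :
    IsPreconnected G := by
  have : G = f 0 '' D := by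
    refine Subset.antisymm (fun y hy => ⟨g 0 y, h.mapsTo_symm 0 hy, ?_⟩) (h.mapsTo 0).image_subset
    exact (h.diffeo 0).2.2.2.2.2 y hy
  rw [this]
  exact h.isConnected_source.isPreconnected.image _ (h.diffeo 0).1.continuousOn

theorem exists_isDiffeoOn (h : UniformizingSequence Ω G D J r f g Jν K c) {F : E2 → E2}
    (hF : TendstoLocallyUniformlyOn f F atTop D) (hFG : MapsTo F D G) :
    ∃ F', IsDiffeoOn F F' D G := by
  have hsm := h.contDiffOn_of_tendsto hF
  obtain ⟨ρ, r1, r2, r3, r4, r5⟩ := h.exhaustion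
  obtain ⟨F', h1, h2, h3, h4⟩ := limit_inverse_of_holomorphic h.isOpen_source h.isBounded_source
    h.isConnected_source.nonempty h.isOpen_target h.isPreconnected_target (Uν := fun _ => G)
    (Ψ := g) (J := Jν) h.mapsTo_symm (fun n => (h.diffeo n).2.2.2.2.1)
    (fun n => (h.diffeo n).2.2.2.2.2) (fun y hy => by
      obtain ⟨s, hs, hsub⟩ := Metric.isOpen_iff.1 h.isOpen_target y hy
      refine ⟨s, hs, K, Eventually.of_forall fun n => ⟨hsub, fun z hz => ?_⟩⟩
      obtain ⟨b1, b2, b3⟩ := h.structure_le n z (hsub hz)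
      exact ⟨h.contDiffAt_structure n (hsub hz), b1, b2, b3, h.sq_structure n z (hsub hz),
        contDiffAt_infty.1 ((h.diffeo n).2.1.contDiffAt (h.isOpen_target.mem_nhds (hsub hz))) 3,
        h.hol_symm n z (hsub hz)⟩) hF hFG hsm.continuousOn r1 r2 r3 r4 r5
  exact ⟨F', hsm, contDiffOn_inverse h.isOpen_source h.isOpen_target hsm hFG h1 h2 h3 h4, hFG, h1,
    h2, h3⟩

end UniformizingSequence

theorem norm_sub_le_of_segment {H : V → W} {a b : V} {L : ℝ}
    (h : ∀ θ ∈ Icc (0 : ℝ) 1, DifferentiableAt ℝ H (a + θ • (b - a)) ∧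
      ‖fderiv ℝ H (a + θ • (b - a))‖ ≤ L) : ‖H b - H a‖ ≤ L * ‖b - a‖ := by
  have h' : ∀ z ∈ segment ℝ a b, DifferentiableAt ℝ H z ∧ ‖fderiv ℝ H z‖ ≤ L := by
    intro z hz
    rw [segment_eq_image'] at hz
    obtain ⟨θ, hθ, rfl⟩ := hz
    exact h θ hθ
  exact (convex_segment a b).norm_image_sub_le_of_norm_hasFDerivWithin_le (𝕜 := ℝ)
    (fun z hz => (h' z hz).1.hasFDerivAt.hasFDerivWithinAt) (fun z hz => (h' z hz).2)
    (left_mem_segment ℝ a b) (right_mem_segment ℝ a b)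

/-- A sublevel set is quasiconvex near a noncritical point. -/
theorem exists_norm_sub_le_of_sublevel {r : V → ℝ} {q : V}
    (hr : ContDiffAt ℝ 2 r q) (hdr : fderiv ℝ r q ≠ 0) {t₁ : ℝ} (ht₁ : 0 < t₁) :
    ∃ t > 0, ∃ C ≥ 1, ∀ x ∈ ball q t, ∀ y ∈ ball q t, r x < 0 → r y < 0 → ∀ (H : V → W) (L : ℝ),
      (∀ z ∈ ball q t₁, ‖z - x‖ ≤ C * ‖y - x‖ → r z < 0 → DifferentiableAt ℝ H z ∧
        ‖fderiv ℝ H z‖ ≤ L) → ‖H y - H x‖ ≤ C * L * ‖y - x‖ := by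
  obtain ⟨n, hn⟩ : ∃ n, fderiv ℝ r q n = 1 := by
    obtain ⟨v, hv⟩ : ∃ v, fderiv ℝ r q v ≠ 0 := by
      by_contra hcon
      push Not at hcon
      exact hdr (ContinuousLinearMap.ext hcon)
    exact ⟨(fderiv ℝ r q v)⁻¹ • v, by rw [map_smul, smul_eq_mul, inv_mul_cancel₀ hv]⟩
  have hn0 : 0 < ‖n‖ := norm_pos_iff.2 fun h => by simp [h] at hn
  set m := ‖fderiv ℝ r q‖ with hm
  have hm0 : 0 ≤ m := norm_nonneg _
  set ε := min 1 (1 / (2 * ‖n‖)) with hε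
  have hε0 : 0 < ε := by positivity
  have hε1 : ε ≤ 1 := min_le_left _ _
  have hεn : ε * ‖n‖ ≤ 1 / 2 := by
    have : ε ≤ 1 / (2 * ‖n‖) := min_le_right _ _
    calc ε * ‖n‖ ≤ 1 / (2 * ‖n‖) * ‖n‖ := by gcongr
      _ = 1 / 2 := by field_simp
  have hstrict := (hr.hasStrictFDerivAt (by norm_num)).isLittleO.def hε0
  rw [nhds_prod_eq, Filter.eventually_prod_self_iff'] at hstrict
  obtain ⟨U, hU, hU'⟩ := hstrict
  obtain ⟨t₂, ht₂, hsub⟩ := Metric.mem_nhds_iff.1 hU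
  have hlin : ∀ a ∈ ball q t₂, ∀ b ∈ ball q t₂, |r b - r a - fderiv ℝ r q (b - a)| ≤ ε * ‖b - a‖ :=
    fun a ha b hb => hU' b (hsub hb) a (hsub ha)
  clear_value ε
  set κ := 2 * (m + 1) with hκ
  have hκ0 : 0 < κ := by positivity
  set C := 3 * (1 + κ * ‖n‖) with hC
  have hC1 : 1 ≤ C := by rw [hC]; nlinarith [mul_pos hκ0 hn0]
  refine ⟨min t₁ t₂ / (1 + 2 * C), by positivity, C, hC1, fun x hx y hy hrx hry H L hH => ?_⟩
  set t := min t₁ t₂ / (1 + 2 * C) with ht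
  have ht0 : 0 < t := by positivity
  have htt : t * (1 + 2 * C) = min t₁ t₂ := by rw [ht]; field_simp
  set l := ‖y - x‖ with hl
  have hl0 : 0 ≤ l := norm_nonneg _
  have hx' := mem_ball_iff_norm.1 hx
  have hy' := mem_ball_iff_norm.1 hy
  have hl2 : l < 2 * t := by
    have : y - x = (y - q) - (x - q) := by abel
    rw [hl, this]
    linarith [norm_sub_le (y - q) (x - q)]
  have hnear : ∀ z, ‖z - x‖ ≤ C * l → z ∈ ball q (min t₁ t₂) := by
    intro z hz
    rw [mem_ball_iff_norm]
    have : z - q = (z - x) + (x - q) := by abel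
    rw [this, ← htt]
    nlinarith [norm_add_le (z - x) (x - q)]
  have hdist : ∀ θ ∈ Icc (0 : ℝ) 1, ∀ τ ∈ Icc (0 : ℝ) 1,
      ‖x + θ • (y - x) - (τ * (κ * l)) • n - x‖ ≤ C * l := by
    intro θ hθ τ hτ
    have e : x + θ • (y - x) - (τ * (κ * l)) • n - x = θ • (y - x) - (τ * (κ * l)) • n := by abel
    rw [e]
    refine (norm_sub_le _ _).trans ?_
    rw [norm_smul, norm_smul, Real.norm_of_nonneg hθ.1,
      Real.norm_of_nonneg (mul_nonneg hτ.1 (mul_nonneg hκ0.le hl0)), ← hl]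
    have h1 : θ * l ≤ 1 * l := by gcongr; exact hθ.2
    have h2 : τ * (κ * l) * ‖n‖ ≤ 1 * (κ * l) * ‖n‖ := by gcongr; exact hτ.2
    have h3 : 0 ≤ κ * l * ‖n‖ := by positivity
    rw [hC]; nlinarith
  have hdown : ∀ θ ∈ Icc (0 : ℝ) 1, ∀ τ ∈ Icc (0 : ℝ) 1,
      r (x + θ • (y - x) - (τ * (κ * l)) • n) ≤ r (x + θ • (y - x)) - τ * (κ * l) / 2 := by
    intro θ hθ τ hτ
    have ha := ball_subset_ball (min_le_right t₁ t₂) (hnear _ (hdist θ hθ 0 (by simp)))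
    have hb := ball_subset_ball (min_le_right t₁ t₂) (hnear _ (hdist θ hθ τ hτ))
    rw [zero_mul, zero_smul, sub_zero] at ha
    have h1 := (abs_le.1 (hlin _ ha _ hb)).2
    rw [sub_sub_cancel_left, map_neg, map_smul, hn, norm_neg, norm_smul,
      Real.norm_of_nonneg (mul_nonneg hτ.1 (mul_nonneg hκ0.le hl0)), smul_eq_mul] at h1
    have h2 : 0 ≤ τ * (κ * l) := mul_nonneg hτ.1 (mul_nonneg hκ0.le hl0)
    nlinarith
  have hgood : ∀ θ ∈ Icc (0 : ℝ) 1, ∀ τ ∈ Icc (0 : ℝ) 1,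
      r (x + θ • (y - x) - (τ * (κ * l)) • n) < 0 →
      DifferentiableAt ℝ H (x + θ • (y - x) - (τ * (κ * l)) • n) ∧
      ‖fderiv ℝ H (x + θ • (y - x) - (τ * (κ * l)) • n)‖ ≤ L := fun θ hθ τ hτ hneg =>
    hH _ (ball_subset_ball (min_le_left t₁ t₂) (hnear _ (hdist θ hθ τ hτ))) (hdist θ hθ τ hτ) hneg
  have h01 : (0 : ℝ) ∈ Icc (0 : ℝ) 1 := by simp
  have h11 : (1 : ℝ) ∈ Icc (0 : ℝ) 1 := by simp
  have s1 : ‖H (x - (κ * l) • n) - H x‖ ≤ L * ‖x - (κ * l) • n - x‖ := by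
    refine norm_sub_le_of_segment fun τ hτ => ?_
    have e : x + τ • (x - (κ * l) • n - x) = x + (0 : ℝ) • (y - x) - (τ * (κ * l)) • n := by
      module
    rw [e]
    refine hgood 0 h01 τ hτ ((hdown 0 h01 τ hτ).trans_lt ?_)
    rw [zero_smul, add_zero]
    have : 0 ≤ τ * (κ * l) := mul_nonneg hτ.1 (mul_nonneg hκ0.le hl0)
    linarith
  have s3 : ‖H (y - (κ * l) • n) - H y‖ ≤ L * ‖y - (κ * l) • n - y‖ := by
    refine norm_sub_le_of_segment fun τ hτ => ?_
    have e : y + τ • (y - (κ * l) • n - y) = x + (1 : ℝ) • (y - x) - (τ * (κ * l)) • n := by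
      module
    rw [e]
    refine hgood 1 h11 τ hτ ((hdown 1 h11 τ hτ).trans_lt ?_)
    rw [one_smul, add_sub_cancel]
    have : 0 ≤ τ * (κ * l) := mul_nonneg hτ.1 (mul_nonneg hκ0.le hl0)
    linarith
  have s2 : ‖H (y - (κ * l) • n) - H (x - (κ * l) • n)‖ ≤
      L * ‖y - (κ * l) • n - (x - (κ * l) • n)‖ := by
    refine norm_sub_le_of_segment fun θ hθ => ?_
    have e : x - (κ * l) • n + θ • (y - (κ * l) • n - (x - (κ * l) • n)) =
        x + θ • (y - x) - (1 * (κ * l)) • n := by module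
    rw [e]
    refine hgood θ hθ 1 h11 ((hdown θ hθ 1 h11).trans_lt ?_)
    have ha := ball_subset_ball (min_le_right t₁ t₂) (hnear _ (hdist θ hθ 0 h01))
    have hb := ball_subset_ball (min_le_right t₁ t₂) (hnear _ (hdist 0 h01 0 h01))
    rw [zero_mul, zero_smul, sub_zero] at ha
    simp only [zero_mul, zero_smul, sub_zero, add_zero] at hb
    have h1 := (abs_le.1 (hlin _ hb _ ha)).2
    rw [add_sub_cancel_left] at h1
    have h2 : fderiv ℝ r q (θ • (y - x)) ≤ m * ‖θ • (y - x)‖ :=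
      (le_abs_self _).trans ((fderiv ℝ r q).le_opNorm _)
    have h3 : ‖θ • (y - x)‖ ≤ l := by
      rw [norm_smul, Real.norm_of_nonneg hθ.1, ← hl]
      nlinarith [hθ.2]
    have h4 : (m + ε) * ‖θ • (y - x)‖ ≤ (m + 1) * l := by gcongr
    rw [hκ]
    linarith
  have e1 : x - (κ * l) • n - x = -((κ * l) • n) := by abel
  have e3 : y - (κ * l) • n - y = -((κ * l) • n) := by abel
  have e2 : y - (κ * l) • n - (x - (κ * l) • n) = y - x := by abel
  have hκl : ‖-((κ * l) • n)‖ = κ * l * ‖n‖ := by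
    rw [norm_neg, norm_smul, Real.norm_of_nonneg (mul_nonneg hκ0.le hl0)]
  rw [e1, hκl] at s1
  rw [e3, hκl] at s3
  rw [e2, ← hl] at s2
  have hL : 0 ≤ L := (norm_nonneg _).trans (hgood 0 h01 0 h01 (by simpa using hrx)).2
  have htri : H y - H x = -(H (y - (κ * l) • n) - H y) +
      (H (y - (κ * l) • n) - H (x - (κ * l) • n)) + (H (x - (κ * l) • n) - H x) := by abel
  rw [htri]
  refine (norm_add_le _ _).trans ?_
  have h5 := norm_add_le (-(H (y - (κ * l) • n) - H y))
    (H (y - (κ * l) • n) - H (x - (κ * l) • n))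
  rw [norm_neg] at h5
  have h6 : 0 ≤ L * l := mul_nonneg hL hl0
  have h7 : 0 ≤ L * (κ * l * ‖n‖) := by positivity
  rw [hC]
  nlinarith


namespace UniformizingSequence

/-- Near a boundary point the structures satisfy uniform Lipschitz and Taylor estimates. -/
theorem exists_taylor_bound (h : UniformizingSequence Ω G D J r f g Jν K c)
    (hq : q ∈ frontier G) : ∃ t > 0, ∃ C ≥ 1, ∀ n, ∀ x ∈ G ∩ ball q t, ∀ y ∈ G ∩ ball q t,
      ‖Jν n y - Jν n x‖ ≤ C * ‖y - x‖ ∧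
      ‖Jν n y - Jν n x - fderiv ℝ (Jν n) x (y - x)‖ ≤ C * ‖y - x‖ ^ 2 := by
  have hqc := frontier_subset_closure hq
  have hrq := h.contDiffAt_defining hqc
  have hdr := h.fderiv_ne_zero q hq
  have hK := h.one_le
  obtain ⟨t₁, ht₁, hsub₁⟩ := Metric.isOpen_iff.1 h.isOpen_ambient q (h.closure_subset hqc)
  have hG : ∀ z ∈ ball q t₁, r z < 0 → z ∈ G := fun z hz hneg =>
    (h.mem_target_iff z).2 ⟨hsub₁ hz, hneg⟩
  obtain ⟨t₂, ht₂, C₂, hC₂, h₂⟩ := exists_norm_sub_le_of_sublevel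
    (W := E2 →L[ℝ] E2 →L[ℝ] E2) hrq hdr ht₁
  obtain ⟨t₃, ht₃, C₃, hC₃, h₃⟩ := exists_norm_sub_le_of_sublevel
    (W := E2 →L[ℝ] E2) hrq hdr (lt_min ht₁ ht₂)
  have hC0 : 0 ≤ C₂ * C₃ := by nlinarith
  refine ⟨min t₂ t₃, lt_min ht₂ ht₃, C₂ * C₃ ^ 2 * K, ?_, fun n x hx y hy => ⟨?_, ?_⟩⟩
  · have : 1 ≤ C₂ * C₃ ^ 2 := by nlinarith
    nlinarith
  · have h1 := h₃ x (ball_subset_ball (min_le_right _ _) hx.2) y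
      (ball_subset_ball (min_le_right _ _) hy.2) (h.neg_of_mem hx.1) (h.neg_of_mem hy.1) (Jν n) K
      fun z hz _ hneg => by
        have hzG := hG z (ball_subset_ball (min_le_left _ _) hz) hneg
        exact ⟨(h.contDiffAt_structure n hzG).differentiableAt (by norm_num),
          (h.structure_le n z hzG).2.1⟩
    refine h1.trans ?_
    have : C₃ ≤ C₂ * C₃ ^ 2 := by nlinarith
    gcongr
  · have h1 := h₃ x (ball_subset_ball (min_le_right _ _) hx.2) y
      (ball_subset_ball (min_le_right _ _) hy.2) (h.neg_of_mem hx.1) (h.neg_of_mem hy.1)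
      (fun z => Jν n z - fderiv ℝ (Jν n) x z) (C₂ * K * (C₃ * ‖y - x‖)) fun z hz hzx hneg => by
        have hzG := hG z (ball_subset_ball (min_le_left _ _) hz) hneg
        have hd := (h.contDiffAt_structure n hzG).differentiableAt (by norm_num)
        have hL : DifferentiableAt ℝ (fun z => fderiv ℝ (Jν n) x z) z :=
          (fderiv ℝ (Jν n) x).differentiableAt
        refine ⟨hd.sub hL, ?_⟩
        rw [fderiv_fun_sub hd hL, ContinuousLinearMap.fderiv]
        have h4 := h₂ x (ball_subset_ball (min_le_left _ _) hx.2) z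
          (ball_subset_ball (min_le_right _ _) hz) (h.neg_of_mem hx.1) hneg (fderiv ℝ (Jν n)) K
          fun w hw _ hwneg => ⟨(h.contDiffAt_structure n (hG w hw hwneg)).differentiableAt_fderiv_two,
            (h.structure_le n w (hG w hw hwneg)).2.2⟩
        refine h4.trans ?_
        gcongr
    have e : Jν n y - fderiv ℝ (Jν n) x y - (Jν n x - fderiv ℝ (Jν n) x x) =
        Jν n y - Jν n x - fderiv ℝ (Jν n) x (y - x) := by
      rw [map_sub]; abel
    rw [e] at h1
    refine h1.trans (le_of_eq ?_)
    ring

end UniformizingSequence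

/-- Second order Taylor expansion with the Hessian frozen at a nearby point. -/
theorem exists_taylor_two {r : V → ℝ} {q : V}
    (hr : ContDiffAt ℝ 2 r q) {ε : ℝ} (hε : 0 < ε) :
    ∃ t > 0, ∀ x ∈ ball q t, ∀ y ∈ ball q t,
      |r x - r y - fderiv ℝ r y (x - y) - (1 / 2) * fderiv ℝ (fderiv ℝ r) q (x - y) (x - y)| ≤
        ε * ‖x - y‖ ^ 2 := by
  have hs : HasStrictFDerivAt (fderiv ℝ r) (fderiv ℝ (fderiv ℝ r) q) q :=
    (hr.fderiv_right (m := 1) (by norm_num)).hasStrictFDerivAt (by norm_num)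
  have h1 := hs.isLittleO.def hε
  rw [nhds_prod_eq] at h1
  have h2 : ∀ᶠ z : V × V in 𝓝 q ×ˢ 𝓝 q, ‖fderiv ℝ r z.1 - fderiv ℝ r z.2 -
      fderiv ℝ (fderiv ℝ r) q (z.1 - z.2)‖ ≤ ε * ‖z.1 - z.2‖ ∧ DifferentiableAt ℝ r z.1 :=
    h1.and (tendsto_fst.eventually hr.eventually_differentiableAt_two)
  obtain ⟨S, hS, hS'⟩ := Filter.eventually_prod_self_iff'.1 h2
  obtain ⟨t, ht, hts⟩ := Metric.mem_nhds_iff.1 hS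
  refine ⟨t, ht, fun x hx y hy => ?_⟩
  set B := fderiv ℝ (fderiv ℝ r) q with hB
  have hseg : segment ℝ y x ⊆ ball q t := (convex_ball q t).segment_subset hy hx
  have hd : ∀ z ∈ segment ℝ y x, HasFDerivWithinAt
      (fun z => r z - fderiv ℝ r y z - (1 / 2) * B (z - y) (z - y))
      (fderiv ℝ r z - fderiv ℝ r y - B (z - y)) (segment ℝ y x) z := by
    intro z hz
    have hz' := (hS' z (hts (hseg hz)) y (hts hy)).2
    have e1 : HasFDerivAt (fun z => B (z - y) (z - y)) (B (z - y) + B.flip (z - y)) z := by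
      have := (B.hasFDerivAt.comp z ((hasFDerivAt_id z).sub_const y)).clm_apply
        ((hasFDerivAt_id z).sub_const y)
      refine this.congr_fderiv ?_
      ext v
      simp
    have e2 : B (z - y) + B.flip (z - y) = (2 : ℝ) • B (z - y) := by
      ext v
      simp only [add_apply, ContinuousLinearMap.flip_apply, smul_apply, smul_eq_mul]
      rw [hB, fderiv_fderiv_symm hr v]
      ring
    rw [e2] at e1
    have e3 := (DifferentiableAt.hasFDerivAt hz').fun_sub (fderiv ℝ r y).hasFDerivAt
    refine ((e3.fun_sub (e1.const_mul (1 / 2))).congr_fderiv ?_).hasFDerivWithinAt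
    simp [smul_smul]
  have hb : ∀ z ∈ segment ℝ y x, ‖fderiv ℝ r z - fderiv ℝ r y - B (z - y)‖ ≤ ε * ‖x - y‖ := by
    intro z hz
    refine (hS' z (hts (hseg hz)) y (hts hy)).1.trans ?_
    have : ‖z - y‖ ≤ ‖x - y‖ := by
      obtain ⟨θ, hθ, rfl⟩ := (segment_eq_image' ℝ y x) ▸ hz
      rw [add_sub_cancel_left, norm_smul, Real.norm_of_nonneg hθ.1]
      nlinarith [hθ.2, norm_nonneg (x - y)]
    gcongr
  have := (convex_segment y x).norm_image_sub_le_of_norm_hasFDerivWithin_le hd hb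
    (left_mem_segment ℝ y x) (right_mem_segment ℝ y x)
  rw [Real.norm_eq_abs] at this
  refine le_trans (le_of_eq ?_) (this.trans (le_of_eq (by ring)))
  congr 1
  simp only [sub_self, map_zero, mul_zero, map_sub]
  ring

/-- Harnack comparison on balls. -/
theorem harnack_comparison_ball {v w : E → ℝ} {x : E} {ρ δ a : ℝ} (hρ : 0 < ρ) (ha : 0 ≤ a)
    (hv : ∀ y ∈ ball x ρ, ContDiffAt ℝ 2 v y) (hvl : ∀ y ∈ ball x ρ, ∀ u, 0 ≤ lap2 v y u)
    (hv0 : ∀ y ∈ ball x ρ, v y ≤ 0) (hvδ : -δ ≤ v x)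
    (hw : ∀ y ∈ ball x ρ, ContDiffAt ℝ 2 w y)
    (hwl : ∀ y ∈ ball x ρ, ∀ u, -(a * ‖u‖ ^ 2) ≤ lap2 w y u)
    (hwv : ∀ y ∈ ball x ρ, w y ≤ -v y) {y : E} (hy : y ∈ ball x (ρ / 4)) :
    w y ≤ 3 * δ + a * ρ ^ 2 := by
  set e : E := (ρ / (2 * ‖y - x‖)) • (y - x) with he
  have hen : ‖e‖ ≤ ρ / 2 := by
    rcases eq_or_ne (y - x) 0 with h0 | h0
    · rw [he, h0, smul_zero, norm_zero]; positivity
    · have : 0 < ‖y - x‖ := norm_pos_iff.2 h0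
      rw [he, norm_smul, Real.norm_of_nonneg (by positivity)]
      apply le_of_eq
      field_simp
  have hmem : ∀ z : ℂ, ‖z‖ ≤ 1 → x + z • e ∈ ball x ρ := fun z hz => by
    rw [mem_ball_iff_norm, add_sub_cancel_left, norm_smul]
    have := mul_le_mul hz hen (norm_nonneg _) zero_le_one
    linarith
  have hcl : ∀ z ∈ closedBall (0 : ℂ) 1, x + z • e ∈ ball x ρ := fun z hz =>
    hmem z (by simpa using hz)
  have hop : ∀ z ∈ ball (0 : ℂ) 1, x + z • e ∈ ball x ρ := fun z hz =>
    hcl z (ball_subset_closedBall hz)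
  have hsp : ∀ z ∈ sphere (0 : ℂ) 1, x + z • e ∈ ball x ρ := fun z hz =>
    hcl z (sphere_subset_closedBall hz)
  have hline : ContDiff ℝ 2 fun z : ℂ => x + z • e := by
    have := (contDiff_const (c := x)).add ((lineMap e).contDiff (n := 2))
    simpa using this
  have hC : ∀ {u : E → ℝ} {z : ℂ}, ContDiffAt ℝ 2 u (x + z • e) →
      ContDiffAt ℝ 2 (fun z : ℂ => u (x + z • e)) z := fun {u z} h =>
    h.comp z hline.contDiffAt
  have hnn : ‖y - x‖ < ρ / 4 := mem_ball_iff_norm.1 hy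
  have key := harnack_comparison (v := fun z : ℂ => v (x + z • e)) (w := fun z : ℂ => w (x + z • e))
    (δ := δ) (a := a * (ρ / 2) ^ 2) (by positivity)
    (fun z hz => (hC (hv _ (hcl z hz))).continuousAt.continuousWithinAt)
    (fun z hz => hC (hv _ (hop z hz)))
    (fun z hz => by rw [lap2_comp_line (hv _ (hop z hz))]; exact hvl _ (hop z hz) _)
    (fun z hz => hv0 _ (hsp z hz)) (by simpa using hvδ)
    (fun z hz => (hC (hw _ (hcl z hz))).continuousAt.continuousWithinAt)
    (fun z hz => hC (hw _ (hop z hz)))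
    (fun z hz => by
      rw [lap2_comp_line (hw _ (hop z hz)), one_smul]
      refine le_trans ?_ (hwl _ (hop z hz) e)
      gcongr)
    (fun z hz => hwv _ (hsp z hz)) (z := ((2 * ‖y - x‖ / ρ : ℝ) : ℂ)) (by
      rw [norm_real, Real.norm_of_nonneg (by positivity), div_le_iff₀ hρ]
      linarith)
  have hyx : x + ((2 * ‖y - x‖ / ρ : ℝ) : ℂ) • e = y := by
    rw [coe_smul, he, smul_smul]
    rcases eq_or_ne (y - x) 0 with h0 | h0
    · rw [h0, smul_zero, add_zero]; exact (sub_eq_zero.1 h0).symm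
    · have : 0 < ‖y - x‖ := norm_pos_iff.2 h0
      have e1 : 2 * ‖y - x‖ / ρ * (ρ / (2 * ‖y - x‖)) = 1 := by field_simp
      rw [e1, one_smul, add_sub_cancel]
  simp only [hyx] at key
  have : a * (ρ / 2) ^ 2 ≤ a * ρ ^ 2 := by
    have : (ρ / 2) ^ 2 ≤ ρ ^ 2 := by gcongr; linarith
    gcongr
  linarith

/-- The Levi form of a squared distance is comparable to the metric near the centre. -/
theorem lev_norm_sub_sq_bounds {V : Type*} [NormedAddCommGroup V] [InnerProductSpace ℝ V]
    {J : V → V →L[ℝ] V} {a x : V} {K : ℝ} (hK : 1 ≤ K) (hJ : ‖J x‖ ≤ K) (hDJ : ‖fderiv ℝ J x‖ ≤ K)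
    (hx : 2 * K ^ 2 * ‖x - a‖ ≤ 1) (X : V) :
    0 ≤ lev J (fun y => ‖y - a‖ ^ 2) x X ∧
      lev J (fun y => ‖y - a‖ ^ 2) x X ≤ 6 * K ^ 2 * ‖X‖ ^ 2 := by
  have h1 : |inner ℝ (x - a) (levTorsion J x X)| ≤ ‖X‖ ^ 2 := by
    refine (abs_real_inner_le_norm _ _).trans ?_
    have h2 := norm_levTorsion_le hJ hDJ X
    calc ‖x - a‖ * ‖levTorsion J x X‖ ≤ ‖x - a‖ * (2 * K ^ 2 * ‖X‖ ^ 2) := by gcongr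
      _ = (2 * K ^ 2 * ‖x - a‖) * ‖X‖ ^ 2 := by ring
      _ ≤ 1 * ‖X‖ ^ 2 := by gcongr
      _ = _ := one_mul _
  have h3 : ‖J x X‖ ^ 2 ≤ K ^ 2 * ‖X‖ ^ 2 := by
    rw [← mul_pow]
    have := (J x).le_of_opNorm_le hJ X
    gcongr
  have h4 : lev J (fun y => ‖y - a‖ ^ 2) x X = 2 * ‖X‖ ^ 2 + 2 * ‖J x X‖ ^ 2 -
      2 * inner ℝ (x - a) (levTorsion J x X) := by
    rw [lev, fderiv_fderiv_norm_sub_sq, fderiv_fderiv_norm_sub_sq, fderiv_norm_sub_sq,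
      real_inner_self_eq_norm_sq, real_inner_self_eq_norm_sq]
  have h5 := abs_le.1 h1
  have h6 : ‖X‖ ^ 2 ≤ K ^ 2 * ‖X‖ ^ 2 := by
    have : (1 : ℝ) ≤ K ^ 2 := by nlinarith
    nlinarith [sq_nonneg ‖X‖]
  rw [h4]
  constructor <;> nlinarith [sq_nonneg ‖J x X‖, h5.1, h5.2]

theorem abs_lev_le_of_bounds {J : V → V →L[ℝ] V} {u : V → ℝ} {x : V} {K : ℝ} (hK : 1 ≤ K) (hJ : ‖J x‖ ≤ K)
    (hDJ : ‖fderiv ℝ J x‖ ≤ K) (hu : ‖fderiv ℝ u x‖ ≤ K) (hu2 : ‖fderiv ℝ (fderiv ℝ u) x‖ ≤ K)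
    (X : V) : |lev J u x X| ≤ 4 * K ^ 3 * ‖X‖ ^ 2 := by
  refine (abs_lev_le hJ hDJ X).trans ?_
  have h1 : (1 + K ^ 2) * ‖fderiv ℝ (fderiv ℝ u) x‖ ≤ (1 + K ^ 2) * K := by gcongr
  have h2 : 2 * K ^ 2 * ‖fderiv ℝ u x‖ ≤ 2 * K ^ 2 * K := by gcongr
  have h3 : K ≤ K ^ 3 := le_self_pow₀ hK (by norm_num)
  gcongr
  linarith

/-- The position of `f x` lies in the anisotropic box of size `δ` around the base point `y`. -/
structure InBox (f : E2 → E2) (r : E2 → ℝ) (j : E2 →L[ℝ] E2) (y : E2) (C δ : ℝ) (x : E2) :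
    Prop where
  sq_le : ‖f x - y‖ ^ 2 ≤ C * δ
  defining_le : -r (f x) ≤ C * δ
  im_le : |fderiv ℝ r y (j (f x - y))| ≤ C * δ

/-- The first jet of `f` at `x` lies in the anisotropic box of size `δ`. -/
structure JetInBox (f : E2 → E2) (r : E2 → ℝ) (j : E2 →L[ℝ] E2) (y : E2) (C δ : ℝ) (x : E2) : Prop
    extends InBox f r j y C δ x where
  fderiv_sq_le : ‖fderiv ℝ f x‖ ^ 2 ≤ C * δ
  re_le : |fderiv ℝ r y (f x - y)| ≤ C * δ
  fderiv_re_le : ‖(fderiv ℝ r y).comp (fderiv ℝ f x)‖ ≤ C * δ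
  fderiv_im_le : ‖(fderiv ℝ r y).comp (j.comp (fderiv ℝ f x))‖ ≤ C * δ

theorem JetInBox.mono {f : E2 → E2} {j : E2 →L[ℝ] E2} {y x : E2} {C C' δ : ℝ}
    (h : JetInBox f r j y C δ x) (hC : C ≤ C') (hδ : 0 ≤ δ) : JetInBox f r j y C' δ x := by
  have : C * δ ≤ C' * δ := by gcongr
  exact ⟨⟨h.sq_le.trans this, h.defining_le.trans this, h.im_le.trans this⟩,
    h.fderiv_sq_le.trans this, h.re_le.trans this, h.fderiv_re_le.trans this,
    h.fderiv_im_le.trans this⟩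

namespace UniformizingSequence

theorem norm_sub_sq_le_of_inBox (h : UniformizingSequence Ω G D J r f g Jν K c) {n : ℕ} {x y : E2}
    {ρ A δ : ℝ} (hρ : 0 < ρ) (hsub : ball x ρ ⊆ D)
    (hnear : ∀ z ∈ ball x ρ, 2 * K ^ 2 * ‖f n z - y‖ ≤ 1) (hsq : ‖f n x - y‖ ^ 2 ≤ A * δ)
    (hdef : -r (f n x) ≤ A * δ) {z : E2} (hz : z ∈ ball x (ρ / 4)) :
    ‖f n z - y‖ ^ 2 ≤ 3 * A * (6 * K ^ 2 / c + 1) * δ := by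
  have hc := h.pos
  have hK := h.one_le
  set ε := c / (6 * K ^ 2) with hε
  have hε0 : 0 < ε := by positivity
  have hu : ∀ w ∈ ball x ρ, ContDiffAt ℝ 2 (fun z => ‖f n z - y‖ ^ 2) w := fun w hw =>
    ((contDiff_norm_sub_sq y).contDiffAt (x := f n w)).comp w (h.contDiffAt n (hsub hw))
  have hul : ∀ w ∈ ball x ρ, ∀ X, lap2 (fun z => ‖f n z - y‖ ^ 2) w X =
      lev (Jν n) (fun z => ‖z - y‖ ^ 2) (f n w) (fderiv ℝ (f n) w X) := fun w hw X =>
    lap2_comp_of_holomorphic (u := fun z => ‖z - y‖ ^ 2) (contDiff_norm_sub_sq y).contDiffAt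
      (h.contDiffAt n (hsub hw))
      ((h.contDiffAt_structure n (h.mapsTo n (hsub hw))).differentiableAt (by norm_num))
      (h.eventually_hol n (hsub hw)) X
  have hb : ∀ w ∈ ball x ρ, ∀ X, 0 ≤ lap2 (fun z => ‖f n z - y‖ ^ 2) w X ∧
      lap2 (fun z => ‖f n z - y‖ ^ 2) w X ≤ 6 * K ^ 2 * ‖fderiv ℝ (f n) w X‖ ^ 2 := by
    intro w hw X
    obtain ⟨h1, h2, -⟩ := h.structure_le n _ (h.mapsTo n (hsub hw))
    rw [hul w hw X]
    exact lev_norm_sub_sq_bounds hK h1 h2 (hnear w hw) _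
  have hr := fun w (hw : w ∈ ball x ρ) => h.contDiffAt_comp_defining n (hsub hw)
  have hεu : ∀ w ∈ ball x ρ, ContDiffAt ℝ 2 (fun z => ε * ‖f n z - y‖ ^ 2) w := fun w hw =>
    contDiffAt_const.mul (hu w hw)
  have key := harnack_comparison_ball (v := fun z => r (f n z) - ε * ‖f n z - y‖ ^ 2)
    (w := fun z => ε * ‖f n z - y‖ ^ 2) (δ := A * δ + ε * (A * δ)) hρ le_rfl
    (fun w hw => (hr w hw).sub (hεu w hw))
    (fun w hw X => by
      rw [lap2_sub (hr w hw) (hεu w hw), lap2_const_mul ε (hu w hw), h.lap2_defining_eq n (hsub hw)]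
      have h1 := h.le_lev n _ (h.mapsTo n (hsub hw)) (fderiv ℝ (f n) w X)
      have h2 := mul_le_mul_of_nonneg_left (hb w hw X).2 hε0.le
      have h3 : ε * (6 * K ^ 2 * ‖fderiv ℝ (f n) w X‖ ^ 2) = c * ‖fderiv ℝ (f n) w X‖ ^ 2 := by
        rw [hε]; field_simp
      linarith)
    (fun w hw => by
      have h1 := h.neg_of_mem (h.mapsTo n (hsub hw))
      have : 0 ≤ ε * ‖f n w - y‖ ^ 2 := by positivity
      linarith)
    (by
      have := mul_le_mul_of_nonneg_left hsq hε0.le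
      linarith)
    hεu
    (fun w hw X => by
      rw [lap2_const_mul ε (hu w hw)]
      have := mul_nonneg hε0.le (hb w hw X).1
      linarith)
    (fun w hw => by
      have h1 := h.neg_of_mem (h.mapsTo n (hsub hw))
      linarith) hz
  have h4 : 3 * A * (6 * K ^ 2 / c + 1) * δ = (3 * (A * δ + ε * (A * δ))) / ε := by
    rw [hε]; field_simp
  rw [h4, le_div_iff₀ hε0]
  linarith

theorem neg_defining_le_of_inBox (h : UniformizingSequence Ω G D J r f g Jν K c) {n : ℕ} {x : E2}
    {ρ A B δ : ℝ} (hρ : 0 < ρ) (hsub : ball x ρ ⊆ D) (hB : 0 ≤ B)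
    (hder : ∀ z ∈ ball x ρ, ‖fderiv ℝ (f n) z‖ ^ 2 ≤ B) (hdef : -r (f n x) ≤ A * δ)
    {z : E2} (hz : z ∈ ball x (ρ / 4)) :
    -r (f n z) ≤ 3 * (A * δ) + 4 * K ^ 3 * B * ρ ^ 2 := by
  have hK := h.one_le
  have hr := fun w (hw : w ∈ ball x ρ) => h.contDiffAt_comp_defining n (hsub hw)
  refine harnack_comparison_ball (v := fun z => r (f n z)) (w := fun z => -r (f n z)) hρ
    (by positivity) hr (fun w hw X => ?_)
    (fun w hw => (h.neg_of_mem (h.mapsTo n (hsub hw))).le) (by linarith)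
    (fun w hw => (hr w hw).neg) (fun w hw X => ?_) (fun w _ => le_rfl) hz
  · rw [h.lap2_defining_eq n (hsub hw)]
    refine le_trans ?_ (h.le_lev n _ (h.mapsTo n (hsub hw)) _)
    have := h.pos
    positivity
  · have e : lap2 (fun z => -r (f n z)) w X = -lap2 (fun z => r (f n z)) w X := by
      have := lap2_const_mul (-1) (hr w hw) X
      simpa using this
    rw [e, h.lap2_defining_eq n (hsub hw), neg_le_neg_iff]
    have hm := h.mapsTo n (hsub hw)
    obtain ⟨h1, h2, -⟩ := h.structure_le n _ hm
    obtain ⟨-, h3, h4⟩ := h.defining_le _ (subset_closure hm)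
    refine (le_abs_self _).trans ((abs_lev_le_of_bounds hK h1 h2 h3 h4 _).trans ?_)
    have h5 : ‖fderiv ℝ (f n) w X‖ ^ 2 ≤ B * ‖X‖ ^ 2 := by
      calc ‖fderiv ℝ (f n) w X‖ ^ 2 ≤ (‖fderiv ℝ (f n) w‖ * ‖X‖) ^ 2 := by
            gcongr; exact (fderiv ℝ (f n) w).le_opNorm X
        _ = ‖fderiv ℝ (f n) w‖ ^ 2 * ‖X‖ ^ 2 := mul_pow _ _ _
        _ ≤ _ := by gcongr; exact hder w hw
    calc 4 * K ^ 3 * ‖fderiv ℝ (f n) w X‖ ^ 2 ≤ 4 * K ^ 3 * (B * ‖X‖ ^ 2) := by gcongr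
      _ = _ := by ring

end UniformizingSequence

theorem norm_Jst_le : ‖Jst E‖ ≤ 1 :=
  opNorm_le_bound _ zero_le_one fun v => by simp [Jst, norm_smul]

namespace UniformizingSequence

theorem exists_jetInBox_of_inBox (h : UniformizingSequence Ω G D J r f g Jν K c)
    (hq : q ∈ frontier G) : ∃ t > 0, ∀ C ρ : ℝ, 0 < C → 0 < ρ → ∃ C', ∀ n x y, y ∈ G ∩ ball q t →
      ball x ρ ⊆ D → (∀ z ∈ ball x ρ, f n z ∈ ball q t) →
      InBox (f n) r (Jν n y) y C (-r y) x →
      ∀ z ∈ ball x (ρ / 64), JetInBox (f n) r (Jν n y) y C' (-r y) z := by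
  have hK := h.one_le
  have hc := h.pos
  have hqc := frontier_subset_closure hq
  obtain ⟨t₁, ht₁, C₁, hC₁, hJ⟩ := h.exists_taylor_bound hq
  obtain ⟨t₂, ht₂, hr⟩ := exists_taylor_two (h.contDiffAt_defining hqc) one_pos
  have hKinv : (0 : ℝ) < 1 / (128 * K ^ 2) := by positivity
  refine ⟨min (min t₁ t₂) (1 / (128 * K ^ 2)), by positivity, fun C ρ hC hρ => ?_⟩
  set t := min (min t₁ t₂) (1 / (128 * K ^ 2)) with ht
  have ht0 : 0 < t := by positivity
  have htt₁ : t ≤ t₁ := (min_le_left _ _).trans (min_le_left _ _)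
  have htt₂ : t ≤ t₂ := (min_le_left _ _).trans (min_le_right _ _)
  have htK : 2 * K ^ 2 * (2 * t) ≤ 1 / 32 := by
    have : t ≤ 1 / (128 * K ^ 2) := min_le_right _ _
    rw [le_div_iff₀ (by positivity)] at this
    linarith
  clear_value t
  obtain ⟨A₂, hA₂⟩ : ∃ A, A = 3 * C * (6 * K ^ 2 / c + 1) := ⟨_, rfl⟩
  obtain ⟨A₃, hA₃⟩ : ∃ A, A = (256 / ρ) ^ 2 * A₂ := ⟨_, rfl⟩
  obtain ⟨A₄, hA₄⟩ : ∃ A, A = 3 * C + 4 * K ^ 3 * A₃ * (ρ / 8) ^ 2 := ⟨_, rfl⟩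
  obtain ⟨A₅, hA₅⟩ : ∃ A, A = A₄ + 1 + (1 + K) * A₂ := ⟨_, rfl⟩
  obtain ⟨A₆, hA₆⟩ : ∃ A, A = 4 * A₅ / (ρ / 64) + ρ / 64 * (K * (2 * K ^ 2 * A₃)) / 4 := ⟨_, rfl⟩
  obtain ⟨A₇, hA₇⟩ : ∃ A, A = A₆ + K * C₁ * (A₂ + A₃) := ⟨_, rfl⟩
  have p₂ : 0 < A₂ := by rw [hA₂]; positivity
  have p₃ : 0 < A₃ := by rw [hA₃]; positivity
  have p₄ : 0 < A₄ := by rw [hA₄]; positivity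
  have p₅ : 0 < A₅ := by rw [hA₅]; positivity
  have p₆ : 0 < A₆ := by rw [hA₆]; positivity
  have p₇ : 0 < A₇ := by rw [hA₇]; positivity
  have p₈ : 0 ≤ A₇ * ρ := by positivity
  refine ⟨A₂ + A₃ + A₄ + A₅ + A₆ + A₇ + C + A₇ * ρ, fun n x y hy hsub hnear hbox => ?_⟩
  obtain ⟨δ, hδ⟩ : ∃ δ, δ = -r y := ⟨_, rfl⟩
  have hδ0 : 0 < δ := by rw [hδ]; linarith [h.neg_of_mem hy.1]
  rw [← hδ] at hbox ⊢
  have hfy : ∀ z ∈ ball x ρ, ‖f n z - y‖ ≤ 2 * t := fun z hz => by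
    have h1 := mem_ball_iff_norm.1 (hnear z hz)
    have h2 := mem_ball_iff_norm.1 hy.2
    have h3 : f n z - y = (f n z - q) - (y - q) := by abel
    rw [h3]
    linarith [norm_sub_le (f n z - q) (y - q)]
  have s₂ : ∀ z ∈ ball x (ρ / 4), ‖f n z - y‖ ^ 2 ≤ A₂ * δ := fun z hz => by
    rw [hA₂]
    refine h.norm_sub_sq_le_of_inBox hρ hsub (fun w hw => ?_) hbox.sq_le hbox.defining_le hz
    have : 2 * K ^ 2 * ‖f n w - y‖ ≤ 2 * K ^ 2 * (2 * t) := by gcongr; exact hfy w hw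
    linarith
  have sub_ball : ∀ {a b d : ℝ} {z : E2}, z ∈ ball x a → a + b ≤ d → ball z b ⊆ ball x d :=
    fun {a b d z} hz hab => ball_subset_ball' (by have := mem_ball.1 hz; linarith)
  have s₃ : ∀ z ∈ ball x (ρ / 8), ‖fderiv ℝ (f n) z‖ ^ 2 ≤ A₃ * δ := fun z hz => by
    have hs : ball z (ρ / 8) ⊆ ball x (ρ / 4) := sub_ball hz (by linarith)
    have hs' : ball z (ρ / 8) ⊆ ball x ρ := hs.trans (ball_subset_ball (by linarith))
    have h1 := norm_fderiv_le_of_small_oscillation (f := f n) (p := z) (c := y) (ρ := ρ / 8)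
      (μ := min √(A₂ * δ) (2 * t)) (K := 2 * K ^ 2) (by positivity)
      (lt_min (Real.sqrt_pos.2 (mul_pos p₂ hδ0)) (by positivity)) (by positivity) ?_
      (fun w hw => h.contDiffAt n (hsub (hs' hw)))
      (fun w hw => le_min (Real.le_sqrt_of_sq_le (s₂ w (hs hw))) (hfy w (hs' hw)))
      (fun w hw v hv => h.norm_lap2_le n (hsub (hs' hw)) hv)
    · have h2 : ‖fderiv ℝ (f n) z‖ ≤ 256 / ρ * √(A₂ * δ) := by
        refine h1.trans (le_trans ?_ (le_of_eq (?_ : 32 * √(A₂ * δ) / (ρ / 8) = _)))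
        · gcongr
          exact min_le_left _ _
        · field_simp; norm_num
      calc ‖fderiv ℝ (f n) z‖ ^ 2 ≤ (256 / ρ * √(A₂ * δ)) ^ 2 := by gcongr
        _ = A₃ * δ := by rw [mul_pow, Real.sq_sqrt (mul_pos p₂ hδ0).le, hA₃]; ring
    · refine le_trans ?_ htK
      gcongr
      exact min_le_right _ _
  have s₄ : ∀ z ∈ ball x (ρ / 32), -r (f n z) ≤ A₄ * δ := fun z hz => by
    have := h.neg_defining_le_of_inBox (n := n) (x := x) (ρ := ρ / 8) (A := C) (B := A₃ * δ)
      (δ := δ) (by positivity) ((ball_subset_ball (by linarith)).trans hsub) (by positivity) s₃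
      hbox.defining_le (z := z) (by convert hz using 2; ring)
    rw [hA₄]
    linarith
  have hq2 : ‖fderiv ℝ (fderiv ℝ r) q‖ ≤ K := (h.defining_le q hqc).2.2
  have hry : ‖fderiv ℝ r y‖ ≤ K := (h.defining_le y (subset_closure hy.1)).2.1
  have s₅ : ∀ z ∈ ball x (ρ / 32), |fderiv ℝ r y (f n z - y)| ≤ A₅ * δ := fun z hz => by
    have hz1 : z ∈ ball x ρ := ball_subset_ball (by linarith) hz
    have h1 := hr (f n z) (ball_subset_ball htt₂ (hnear z hz1)) y (ball_subset_ball htt₂ hy.2)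
    have h2 : |fderiv ℝ (fderiv ℝ r) q (f n z - y) (f n z - y)| ≤ K * ‖f n z - y‖ * ‖f n z - y‖ :=
      ((fderiv ℝ (fderiv ℝ r) q).le_opNorm₂ _ _).trans (by gcongr)
    have h3 := s₂ z (ball_subset_ball (by linarith) hz)
    have h4 := s₄ z hz
    have h5 := h.neg_of_mem (h.mapsTo n (hsub hz1))
    have h6 : (1 + K) * ‖f n z - y‖ ^ 2 ≤ (1 + K) * (A₂ * δ) := by gcongr
    have h7 : K * ‖f n z - y‖ * ‖f n z - y‖ = K * ‖f n z - y‖ ^ 2 := by ring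
    have h8 : 0 ≤ K * ‖f n z - y‖ ^ 2 := by positivity
    have b1 := abs_le.1 h1
    have b2 := abs_le.1 h2
    have h9 : A₅ * δ = A₄ * δ + δ + (1 + K) * (A₂ * δ) := by rw [hA₅]; ring
    have h10 : 0 < A₄ * δ := mul_pos p₄ hδ0
    rw [abs_le, h9]
    constructor <;> linarith [b1.1, b1.2, b2.1, b2.2]
  have s₆ : ∀ z ∈ ball x (ρ / 64), ‖(fderiv ℝ r y).comp (fderiv ℝ (f n) z)‖ ≤ A₆ * δ := by
    intro z hz
    have hs : ball z (ρ / 64) ⊆ ball x (ρ / 32) := sub_ball hz (by linarith)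
    have hs' : ball z (ρ / 64) ⊆ ball x ρ := hs.trans (ball_subset_ball (by linarith))
    have hcd := fun w (hw : w ∈ ball z (ρ / 64)) => h.contDiffAt n (hsub (hs' hw))
    have h1 := norm_fderiv_le_of_lap2 (f := fun w => fderiv ℝ r y (f n w)) (x := z) (ρ := ρ / 64)
      (M := A₅ * δ) (N := K * (2 * K ^ 2 * (A₃ * δ))) (by positivity) (fderiv ℝ r y y)
      (by positivity) (fun w hw => (fderiv ℝ r y).contDiff.contDiffAt.comp w (hcd w hw))
      (fun w hw => by
        rw [← map_sub]
        exact s₅ w (hs hw))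
      (fun w hw v hv => by
        rw [lap2_clm_comp _ (hcd w hw)]
        refine ((fderiv ℝ r y).le_opNorm _).trans ?_
        have h2 := h.norm_lap2_le n (hsub (hs' hw)) hv
        have h3 := s₃ w (ball_subset_ball (by linarith) (hs hw))
        have h4 : 2 * K ^ 2 * ‖fderiv ℝ (f n) w‖ ^ 2 ≤ 2 * K ^ 2 * (A₃ * δ) := by gcongr
        have h5 := h2.trans h4
        gcongr)
    have h2 : fderiv ℝ (fun w => fderiv ℝ r y (f n w)) z =
        (fderiv ℝ r y).comp (fderiv ℝ (f n) z) :=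
      ((fderiv ℝ r y).hasFDerivAt.comp z ((h.contDiffAt n (hsub (ball_subset_ball (by linarith)
        hz))).differentiableAt (by norm_num)).hasFDerivAt).fderiv
    rw [h2] at h1
    refine h1.trans (le_of_eq ?_)
    rw [hA₆]; ring
  have s₇ : ∀ z ∈ ball x (ρ / 64),
      ‖(fderiv ℝ r y).comp ((Jν n y).comp (fderiv ℝ (f n) z))‖ ≤ A₇ * δ := by
    intro z hz
    have hz1 : z ∈ ball x ρ := ball_subset_ball (by linarith) hz
    have e : (fderiv ℝ r y).comp ((Jν n y).comp (fderiv ℝ (f n) z)) =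
        ((fderiv ℝ r y).comp (fderiv ℝ (f n) z)).comp (Jst E2) -
        (fderiv ℝ r y).comp ((Jν n (f n z) - Jν n y).comp (fderiv ℝ (f n) z)) := by
      rw [ContinuousLinearMap.comp_assoc, h.hol n z (hsub hz1), ContinuousLinearMap.sub_comp,
        ContinuousLinearMap.comp_sub, sub_sub_cancel]
    have h1 := (hJ n y ⟨hy.1, ball_subset_ball htt₁ hy.2⟩ (f n z)
      ⟨h.mapsTo n (hsub hz1), ball_subset_ball htt₁ (hnear z hz1)⟩).1
    have h2 : ‖((fderiv ℝ r y).comp (fderiv ℝ (f n) z)).comp (Jst E2)‖ ≤ A₆ * δ := by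
      refine (opNorm_comp_le _ _).trans ?_
      exact mul_le_of_le_one_right (norm_nonneg _) norm_Jst_le |>.trans (s₆ z hz)
    have h3 : ‖(fderiv ℝ r y).comp ((Jν n (f n z) - Jν n y).comp (fderiv ℝ (f n) z))‖ ≤
        K * (C₁ * ‖f n z - y‖ * ‖fderiv ℝ (f n) z‖) :=
      (opNorm_comp_le _ _).trans (mul_le_mul hry
        ((opNorm_comp_le _ _).trans (by gcongr)) (norm_nonneg _)
        (by positivity))
    have h4 := s₂ z (ball_subset_ball (by linarith) hz)
    have h5 := s₃ z (ball_subset_ball (by linarith) hz)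
    have h6 : ‖f n z - y‖ * ‖fderiv ℝ (f n) z‖ ≤ (A₂ + A₃) * δ := by
      nlinarith [sq_nonneg (‖f n z - y‖ - ‖fderiv ℝ (f n) z‖), sq_nonneg ‖f n z - y‖,
        sq_nonneg ‖fderiv ℝ (f n) z‖]
    have h7 : K * (C₁ * ‖f n z - y‖ * ‖fderiv ℝ (f n) z‖) ≤ K * C₁ * ((A₂ + A₃) * δ) := by
      have : K * (C₁ * ‖f n z - y‖ * ‖fderiv ℝ (f n) z‖) =
        K * C₁ * (‖f n z - y‖ * ‖fderiv ℝ (f n) z‖) := by ring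
      rw [this]
      gcongr
    rw [e]
    refine (norm_sub_le _ _).trans ((add_le_add h2 (h3.trans h7)).trans (le_of_eq ?_))
    rw [hA₇]; ring
  have s₈ : ∀ z ∈ ball x (ρ / 64), |fderiv ℝ r y (Jν n y (f n z - y))| ≤ (C + A₇ * ρ) * δ := by
    intro z hz
    have h1 := (convex_ball x (ρ / 64)).norm_image_sub_le_of_norm_hasFDerivWithin_le
      (f := fun w => fderiv ℝ r y (Jν n y (f n w)))
      (f' := fun w => (fderiv ℝ r y).comp ((Jν n y).comp (fderiv ℝ (f n) w)))
      (fun w hw => ((fderiv ℝ r y).hasFDerivAt.comp w ((Jν n y).hasFDerivAt.comp w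
        ((h.contDiffAt n (hsub (ball_subset_ball (by linarith) hw))).differentiableAt
          (by norm_num)).hasFDerivAt)).hasFDerivWithinAt) s₇
      (mem_ball_self (by positivity)) hz
    have h2 : ‖z - x‖ ≤ ρ := by
      have := mem_ball_iff_norm.1 hz
      linarith
    have h3 : A₇ * δ * ‖z - x‖ ≤ A₇ * δ * ρ := by gcongr
    have h4 : fderiv ℝ r y (Jν n y (f n z - y)) = fderiv ℝ r y (Jν n y (f n x - y)) +
        (fderiv ℝ r y (Jν n y (f n z)) - fderiv ℝ r y (Jν n y (f n x))) := by
      simp only [map_sub]; ring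
    rw [h4]
    refine (abs_add_le _ _).trans ((add_le_add hbox.im_le (h1.trans h3)).trans (le_of_eq ?_))
    ring
  intro z hz
  have hz32 : z ∈ ball x (ρ / 32) := ball_subset_ball (by linarith) hz
  have hm : ∀ {A : ℝ}, A ≤ A₂ + A₃ + A₄ + A₅ + A₆ + A₇ + C + A₇ * ρ →
      A * δ ≤ (A₂ + A₃ + A₄ + A₅ + A₆ + A₇ + C + A₇ * ρ) * δ := fun h =>
    mul_le_mul_of_nonneg_right h hδ0.le
  exact ⟨⟨(s₂ z (ball_subset_ball (by linarith) hz)).trans (hm (by linarith)),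
    (s₄ z hz32).trans (hm (by linarith)), (s₈ z hz).trans (hm (by linarith))⟩,
    (s₃ z (ball_subset_ball (by linarith) hz)).trans (hm (by linarith)),
    (s₅ z hz32).trans (hm (by linarith)), (s₆ z hz).trans (hm (by linarith)),
    (s₇ z hz).trans (hm (by linarith))⟩

end UniformizingSequence

theorem eventually_mem_ball_of_tendstoLocallyUniformlyOn {X Y : Type*} [PseudoMetricSpace X]
    [PseudoMetricSpace Y] {Φ : ℕ → X → Y} {F : X → Y} {U : Set X} (hU : IsOpen U)
    (hΦ : TendstoLocallyUniformlyOn Φ F atTop U) (hF : ContinuousOn F U) {x : X} (hx : x ∈ U)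
    {ε : ℝ} (hε : 0 < ε) : ∃ t > 0, ball x t ⊆ U ∧ ∀ᶠ n in atTop, ∀ z ∈ ball x t,
      F z ∈ ball (F x) ε ∧ Φ n z ∈ ball (F x) ε := by
  obtain ⟨S, hS, h⟩ := Metric.tendstoLocallyUniformlyOn_iff.1 hΦ (ε / 2) (half_pos hε) x hx
  rw [hU.nhdsWithin_eq hx] at hS
  obtain ⟨t, ht, hsub⟩ := Metric.mem_nhds_iff.1 (inter_mem (inter_mem hS (hU.mem_nhds hx))
    ((hF.continuousAt (hU.mem_nhds hx)).preimage_mem_nhds (ball_mem_nhds _ (half_pos hε))))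
  refine ⟨t, ht, fun z hz => (hsub hz).1.2, h.mono fun n hn z hz => ?_⟩
  have h1 := mem_ball.1 (hsub hz).2
  have h2 := hn z (hsub hz).1.1
  rw [dist_comm] at h2
  exact ⟨mem_ball.2 (by linarith), (dist_triangle _ _ _).trans_lt (by linarith)⟩

namespace UniformizingSequence

/-- If the maps degenerate to a boundary point, their jets stay locally in anisotropic boxes. -/
theorem eventually_jetInBox (h : UniformizingSequence Ω G D J r f g Jν K c) {F : E2 → E2}
    (hF : TendstoLocallyUniformlyOn f F atTop D) (hFq : ∀ x ∈ D, F x = q) (hq : q ∈ frontier G)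
    (hp : p ∈ D) : ∀ x ∈ D, ∃ t > 0, ∃ C > 0, ball x t ⊆ D ∧ ∀ᶠ n in atTop, ∀ z ∈ ball x t,
      JetInBox (f n) r (Jν n (f n p)) (f n p) C (-r (f n p)) z := by
  obtain ⟨t, ht, hbox⟩ := h.exists_jetInBox_of_inBox hq
  have hmem {x} (hx : x ∈ D) : ∃ s > 0, ball x s ⊆ D ∧ ∀ᶠ n in atTop, ∀ z ∈ ball x s,
      f n z ∈ ball q t := by
    obtain ⟨s, hs, hsub, hev⟩ := eventually_mem_ball_of_tendstoLocallyUniformlyOn h.isOpen_source hF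
      (continuousOn_const.congr hFq) hx ht
    exact ⟨s, hs, hsub, hev.mono fun n hn z hz => hFq x hx ▸ (hn z hz).2⟩
  have hpq : ∀ᶠ n in atTop, f n p ∈ G ∩ ball q t := by
    obtain ⟨s, hs, -, hev⟩ := hmem hp
    filter_upwards [hev] with n hn using ⟨h.mapsTo n hp, hn p (mem_ball_self hs)⟩
  have hδ : ∀ n, 0 ≤ -r (f n p) := fun n => by linarith [h.neg_of_mem (h.mapsTo n hp)]
  have step : ∀ x ρ C, 0 < ρ → 0 < C → ball x ρ ⊆ D →
      (∀ᶠ n in atTop, ∀ z ∈ ball x ρ, f n z ∈ ball q t) →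
      (∀ᶠ n in atTop, InBox (f n) r (Jν n (f n p)) (f n p) C (-r (f n p)) x) →
      ∃ C > 0, ∀ᶠ n in atTop, ∀ z ∈ ball x (ρ / 64),
        JetInBox (f n) r (Jν n (f n p)) (f n p) C (-r (f n p)) z := by
    intro x ρ C hρ hC hsub hev hin
    obtain ⟨C', hC'⟩ := hbox C ρ hC hρ
    refine ⟨max C' 1, lt_max_of_lt_right one_pos, ?_⟩
    filter_upwards [hev, hin, hpq] with n h1 h2 h3 z hz
    exact (hC' n x _ h3 hsub h1 h2 z hz).mono (le_max_left _ _) (hδ n)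
  set S : Set E2 := {x | ∃ t > 0, ∃ C > 0, ball x t ⊆ D ∧ ∀ᶠ n in atTop, ∀ z ∈ ball x t,
      JetInBox (f n) r (Jν n (f n p)) (f n p) C (-r (f n p)) z} with hS
  have hSopen : IsOpen S := by
    rw [Metric.isOpen_iff]
    rintro x ⟨s, hs, C, hC, hsub, hev⟩
    refine ⟨s, hs, fun y hy => ?_⟩
    have hyx := mem_ball.1 hy
    have hs' : ball y (s - dist y x) ⊆ ball x s := ball_subset_ball' (by linarith)
    refine ⟨s - dist y x, by linarith, C, hC, hs'.trans hsub, ?_⟩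
    filter_upwards [hev] with n hn z hz using hn z (hs' hz)
  refine h.isConnected_source.isPreconnected.subset_of_closure_inter_subset hSopen ⟨p, hp, ?_⟩ ?_
  · obtain ⟨s, hs, hsub, hev⟩ := hmem hp
    obtain ⟨C, hC, hev'⟩ := step p s 1 hs one_pos hsub hev (Eventually.of_forall fun n =>
      ⟨by simpa using hδ n, by simp, by simpa using hδ n⟩)
    exact ⟨s / 64, by positivity, C, hC, (ball_subset_ball (by linarith)).trans hsub, hev'⟩
  · rintro x ⟨hxS, hx⟩
    obtain ⟨s, hs, hsub, hev⟩ := hmem hx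
    obtain ⟨y, hyS, hyx⟩ := Metric.mem_closure_iff.1 hxS (s / 256) (by positivity)
    obtain ⟨s', hs', C, hC, -, hev'⟩ := hyS
    have hsy : ball y (s / 2) ⊆ ball x s := ball_subset_ball' (by rw [dist_comm]; linarith)
    obtain ⟨C', hC', hev''⟩ := step y (s / 2) C (by positivity) hC (hsy.trans hsub)
      (hev.mono fun n hn z hz => hn z (hsy hz))
      (hev'.mono fun n hn => (hn y (mem_ball_self hs')).toInBox)
    have hxy : ball x (s / 256) ⊆ ball y (s / 2 / 64) := ball_subset_ball' (by linarith)
    exact ⟨s / 256, by positivity, C', hC', (ball_subset_ball (by linarith)).trans hsub,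
      hev''.mono fun n hn z hz => hn z (hxy hz)⟩

end UniformizingSequence

/-- The inclusion of a coordinate axis of `ℂ²`. -/
def inc (k : Fin 2) : ℂ →L[ℝ] E2 := lineMap (EuclideanSpace.single k 1)

/-- The coordinate functions of `ℂ²`. -/
def crd (k : Fin 2) : E2 →L[ℝ] ℂ := (EuclideanSpace.proj k : E2 →L[ℂ] ℂ).restrictScalars ℝ

@[simp] theorem crd_apply (k : Fin 2) (x : E2) : crd k x = x k := rfl

@[simp] theorem inc_apply (k : Fin 2) (z : ℂ) (l : Fin 2) : inc k z l = if l = k then z else 0 := by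
  simp [inc]

theorem inc_add_inc (x : E2) : inc 0 (x 0) + inc 1 (x 1) = x := by
  ext k
  fin_cases k <;> simp

theorem norm_inc (k : Fin 2) (z : ℂ) : ‖inc k z‖ = ‖z‖ := by
  simp [inc, norm_smul]

theorem norm_sq_eq_two (x : E2) : ‖x‖ ^ 2 = ‖x 0‖ ^ 2 + ‖x 1‖ ^ 2 := by
  rw [EuclideanSpace.norm_sq_eq, Fin.sum_univ_two]

theorem norm_coord_le (x : E2) (k : Fin 2) : ‖x k‖ ≤ ‖x‖ := PiLp.norm_apply_le x k

theorem norm_le_coord_add (x : E2) : ‖x‖ ≤ ‖x 0‖ + ‖x 1‖ := by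
  conv_lhs => rw [← inc_add_inc x]
  refine (norm_add_le _ _).trans ?_
  rw [norm_inc, norm_inc]

/-- The anisotropic dilation of weight `(2, 1)`. -/
def dil (s : ℝ) : E2 →L[ℝ] E2 :=
  (s ^ 2) • (inc 0).comp (crd 0) + s • (inc 1).comp (crd 1)

theorem dil_apply (s : ℝ) (x : E2) : dil s x = inc 0 ((s ^ 2 : ℝ) * x 0) + inc 1 (s * x 1) := by
  ext k
  fin_cases k <;> simp [dil]

theorem dil_apply_zero (s : ℝ) (x : E2) : dil s x 0 = (s ^ 2 : ℝ) * x 0 := by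
  simp [dil_apply]

theorem dil_apply_one (s : ℝ) (x : E2) : dil s x 1 = s * x 1 := by
  simp [dil_apply]

theorem dil_dil (s t : ℝ) (x : E2) : dil s (dil t x) = dil (s * t) x := by
  ext k
  fin_cases k
  · simp [dil_apply]; ring
  · simp [dil_apply]; ring

theorem dil_one (x : E2) : dil 1 x = x := by
  rw [dil_apply]
  simpa using inc_add_inc x

theorem dil_inv_dil {s : ℝ} (hs : s ≠ 0) (x : E2) : dil s⁻¹ (dil s x) = x := by
  rw [dil_dil, inv_mul_cancel₀ hs, dil_one]

theorem dil_dil_inv {s : ℝ} (hs : s ≠ 0) (x : E2) : dil s (dil s⁻¹ x) = x := by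
  rw [dil_dil, mul_inv_cancel₀ hs, dil_one]

theorem dil_Jst (s : ℝ) (x : E2) : dil s (Jst E2 x) = Jst E2 (dil s x) := by
  ext k
  fin_cases k <;> simp [dil_apply, Jst] <;> ring

theorem norm_dil_le {s : ℝ} (hs : 0 ≤ s) (hs1 : s ≤ 1) : ‖dil s‖ ≤ s := by
  refine opNorm_le_bound _ hs fun x => ?_
  refine le_of_sq_le_sq ?_ (by positivity)
  rw [norm_sq_eq_two, dil_apply_zero, dil_apply_one, mul_pow, norm_sq_eq_two x, norm_mul, norm_mul,
    mul_pow, mul_pow, norm_real, norm_real, Real.norm_of_nonneg hs,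
    Real.norm_of_nonneg (by positivity)]
  have h1 : (s ^ 2) ^ 2 ≤ s ^ 2 := by
    have : s ^ 2 ≤ 1 := pow_le_one₀ hs hs1
    nlinarith [sq_nonneg s]
  nlinarith [sq_nonneg ‖x 0‖]

theorem norm_dil_inv_le {s : ℝ} (hs : 0 < s) (hs1 : s ≤ 1) : ‖dil s⁻¹‖ ≤ (s ^ 2)⁻¹ := by
  refine opNorm_le_bound _ (by positivity) fun x => ?_
  refine le_of_sq_le_sq ?_ (by positivity)
  rw [norm_sq_eq_two, dil_apply_zero, dil_apply_one, mul_pow, norm_sq_eq_two x, norm_mul, norm_mul,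
    mul_pow, mul_pow, norm_real, norm_real, Real.norm_of_nonneg (by positivity),
    Real.norm_of_nonneg (by positivity), inv_pow]
  have h1 : (s ^ 2)⁻¹ ≤ ((s ^ 2)⁻¹) ^ 2 := by
    have : 1 ≤ (s ^ 2)⁻¹ := (one_le_inv₀ (by positivity)).2 (pow_le_one₀ hs.le hs1)
    exact le_self_pow₀ this (by norm_num)
  nlinarith [sq_nonneg ‖x 1‖]

/-- The complexification of a real functional with respect to a complex structure. -/
def cplx (ω : E2 →L[ℝ] ℝ) (j : E2 →L[ℝ] E2) : E2 →L[ℝ] ℂ :=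
  Complex.ofRealCLM.comp ω - I • Complex.ofRealCLM.comp (ω.comp j)

theorem cplx_apply (ω : E2 →L[ℝ] ℝ) (j : E2 →L[ℝ] E2) (x : E2) :
    cplx ω j x = ω x - I * ω (j x) := by
  simp [cplx]

theorem cplx_apply_structure (ω : E2 →L[ℝ] ℝ) {j : E2 →L[ℝ] E2} (hj : ∀ v, j (j v) = -v) (x : E2) :
    cplx ω j (j x) = I * cplx ω j x := by
  rw [cplx_apply, cplx_apply, hj, map_neg]
  push_cast
  linear_combination (ω (j x) : ℂ) * Complex.I_mul_I

/-- The linear coordinates determined by two real functionals and a complex structure. -/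
def coframe (ℓ η : E2 →L[ℝ] ℝ) (j : E2 →L[ℝ] E2) : E2 →L[ℝ] E2 :=
  (inc 0).comp (cplx ℓ j) + (inc 1).comp (cplx η j)

theorem coframe_apply_zero (ℓ η : E2 →L[ℝ] ℝ) (j : E2 →L[ℝ] E2) (x : E2) :
    coframe ℓ η j x 0 = cplx ℓ j x := by
  simp [coframe]

theorem coframe_apply_one (ℓ η : E2 →L[ℝ] ℝ) (j : E2 →L[ℝ] E2) (x : E2) :
    coframe ℓ η j x 1 = cplx η j x := by
  simp [coframe]

theorem coframe_structure (ℓ η : E2 →L[ℝ] ℝ) {j : E2 →L[ℝ] E2} (hj : ∀ v, j (j v) = -v) (x : E2) :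
    coframe ℓ η j (j x) = Jst E2 (coframe ℓ η j x) := by
  ext k
  fin_cases k
  · simp [coframe_apply_zero, cplx_apply_structure _ hj, Jst]
  · simp [coframe_apply_one, cplx_apply_structure _ hj, Jst]

theorem continuous_coframe (η : E2 →L[ℝ] ℝ) :
    Continuous fun z : (E2 →L[ℝ] ℝ) × (E2 →L[ℝ] E2) => coframe z.1 η z.2 := by
  unfold coframe cplx
  fun_prop

theorem exists_isUnit_coframe {ℓ : E2 →L[ℝ] ℝ} (hℓ : ℓ ≠ 0) {j : E2 →L[ℝ] E2}
    (hj : ∀ v, j (j v) = -v) : ∃ η : E2 →L[ℝ] ℝ, IsUnit (coframe ℓ η j) := by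
  obtain ⟨n, hn⟩ : ∃ n, ℓ n ≠ 0 := by
    by_contra! h
    exact hℓ (ContinuousLinearMap.ext h)
  have hmul : ∀ (ω : E2 →L[ℝ] ℝ) (X : E2) (z : ℂ), ω X ≠ 0 →
      ∃ Y ∈ Submodule.span ℝ {X, j X}, cplx ω j Y = z := by
    intro ω X z hX
    have h0 : cplx ω j X ≠ 0 := by
      intro h
      have := congrArg Complex.re h
      simp [cplx_apply] at this
      exact hX this
    refine ⟨(z / cplx ω j X).re • X + (z / cplx ω j X).im • j X,
      Submodule.mem_span_pair.2 ⟨_, _, rfl⟩, ?_⟩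
    rw [map_add, map_smul, map_smul, cplx_apply_structure _ hj, real_smul, real_smul]
    calc _ = ((z / cplx ω j X).re + (z / cplx ω j X).im * I) * cplx ω j X := by ring
      _ = z := by rw [re_add_im, div_mul_cancel₀ _ h0]
  obtain ⟨X₂, hX₂, hX₂0⟩ : ∃ X ∈ LinearMap.ker (cplx ℓ j : E2 →ₗ[ℝ] ℂ), X ≠ 0 := by
    refine Submodule.exists_mem_ne_zero_of_ne_bot (LinearMap.ker_ne_bot_of_finrank_lt ?_)
    rw [Complex.finrank_real_complex, finrank_real_of_complex, finrank_euclideanSpace]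
    norm_num
  have hker : cplx ℓ j X₂ = 0 := hX₂
  set η : E2 →L[ℝ] ℝ := innerSL ℝ X₂ with hη
  have hηX : η X₂ ≠ 0 := by
    rw [hη, innerSL_apply_apply, real_inner_self_eq_norm_sq]
    positivity
  refine ⟨η, ?_⟩
  have hsurj : Function.Surjective (coframe ℓ η j) := by
    intro w
    obtain ⟨Y, -, hY⟩ := hmul ℓ n (w 0) hn
    obtain ⟨Z, hZ, hZ'⟩ := hmul η X₂ (w 1 - cplx η j Y) hηX
    have hZ0 : cplx ℓ j Z = 0 := by
      obtain ⟨a, b, rfl⟩ := Submodule.mem_span_pair.1 hZ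
      rw [map_add, map_smul, map_smul, cplx_apply_structure _ hj, hker]
      simp
    refine ⟨Y + Z, ?_⟩
    ext k
    fin_cases k
    · simp [coframe_apply_zero, hY, hZ0]
    · simp [coframe_apply_one, hZ']
  rw [ContinuousLinearMap.isUnit_iff_bijective]
  exact ⟨(LinearMap.injective_iff_surjective (f := (coframe ℓ η j : E2 →ₗ[ℝ] E2))).2 hsurj, hsurj⟩

theorem tendsto_ringInverse {B : ℕ → E2 →L[ℝ] E2} {B₀ : E2 →L[ℝ] E2}
    (hB : Tendsto B atTop (𝓝 B₀)) (hB₀ : IsUnit B₀) :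
    Tendsto (fun n => Ring.inverse (B n)) atTop (𝓝 (Ring.inverse B₀)) ∧
      ∀ᶠ n in atTop, (∀ x, Ring.inverse (B n) (B n x) = x) ∧ ∀ x, B n (Ring.inverse (B n) x) = x := by
  obtain ⟨u, rfl⟩ := hB₀
  refine ⟨(NormedRing.inverse_continuousAt u).tendsto.comp hB, ?_⟩
  filter_upwards [hB.eventually (Units.isOpen.mem_nhds u.isUnit)] with n hn
  exact ⟨fun x => DFunLike.congr_fun (Ring.inverse_mul_cancel (B n) hn) x,
    fun x => DFunLike.congr_fun (Ring.mul_inverse_cancel (B n) hn) x⟩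

/-- The coordinate projections of `ℂ²`, as endomorphisms. -/
def axisProj (k : Fin 2) : E2 →L[ℝ] E2 := (inc k).comp (crd k)

theorem axisProj_apply (k : Fin 2) (x : E2) : axisProj k x = inc k (x k) := rfl

theorem dil_eq_smul (s : ℝ) : dil s = s • (axisProj 1 + s • axisProj 0) := by
  rw [dil, smul_add, smul_smul, ← sq, add_comm]
  rfl

theorem dil_inv_smul {s : ℝ} (hs : s ≠ 0) : (s ^ 2) • dil s⁻¹ = axisProj 0 + s • axisProj 1 := by
  rw [dil, smul_add, smul_smul, smul_smul, inv_pow, mul_inv_cancel₀ (pow_ne_zero 2 hs), one_smul,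
    sq, mul_assoc, mul_inv_cancel₀ hs, mul_one]
  rfl

/-- The two-sided composition `M ↦ S ∘ M ∘ T`. -/
def sandwich (S T : E2 →L[ℝ] E2) : (E2 →L[ℝ] E2) →L[ℝ] (E2 →L[ℝ] E2) :=
  (compL ℝ E2 E2 E2 S).comp ((compL ℝ E2 E2 E2).flip T)

theorem sandwich_apply (S T M : E2 →L[ℝ] E2) (x : E2) : sandwich S T M x = S (M (T x)) := rfl

theorem norm_sandwich_apply_le (S T M : E2 →L[ℝ] E2) : ‖sandwich S T M‖ ≤ ‖S‖ * ‖M‖ * ‖T‖ := by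
  calc ‖sandwich S T M‖ = ‖S.comp (M.comp T)‖ := rfl
    _ ≤ ‖S‖ * (‖M‖ * ‖T‖) := (S.opNorm_comp_le _).trans
      (mul_le_mul_of_nonneg_left (M.opNorm_comp_le T) (norm_nonneg _))
    _ = _ := by ring

/-- The structure `j` read in the affine coordinates `x ↦ y + T x`. -/
def rescaled (j : E2 → E2 →L[ℝ] E2) (y : E2) (S T : E2 →L[ℝ] E2) (x : E2) : E2 →L[ℝ] E2 :=
  sandwich S T (j (y + T x))

theorem contDiffAt_rescaled {j : E2 → E2 →L[ℝ] E2} {y : E2} {S T : E2 →L[ℝ] E2} {x : E2}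
    {k : WithTop ℕ∞} (hj : ContDiffAt ℝ k j (y + T x)) : ContDiffAt ℝ k (rescaled j y S T) x :=
  (sandwich S T).contDiff.contDiffAt.comp x
    (hj.comp x (contDiffAt_const.add T.contDiff.contDiffAt))

theorem norm_fderiv_rescaled_le {j : E2 → E2 →L[ℝ] E2} {y : E2} {S T : E2 →L[ℝ] E2} {x : E2}
    (hj : ContDiffAt ℝ 2 j (y + T x)) {K : ℝ} (h1 : ‖fderiv ℝ j (y + T x)‖ ≤ K)
    (h2 : ‖fderiv ℝ (fderiv ℝ j) (y + T x)‖ ≤ K) :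
    ‖fderiv ℝ (rescaled j y S T) x‖ ≤ ‖S‖ * ‖T‖ ^ 2 * K ∧
      ‖fderiv ℝ (fderiv ℝ (rescaled j y S T)) x‖ ≤ ‖S‖ * ‖T‖ ^ 3 * K := by
  have hK : 0 ≤ K := (norm_nonneg _).trans h1
  have hj' : ContDiffAt ℝ 2 (fun x => j (y + T x)) x :=
    hj.comp x (contDiffAt_const.add T.contDiff.contDiffAt)
  have e : rescaled j y S T = fun x => sandwich S T (j (y + T x)) := rfl
  constructor
  · refine opNorm_le_bound _ (by positivity) fun a => ?_
    have : fderiv ℝ (rescaled j y S T) x a = sandwich S T (fderiv ℝ j (y + T x) (T a)) := by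
      have h3 := ((sandwich S T).hasFDerivAt.comp x
        (hj'.differentiableAt (by simp)).hasFDerivAt).fderiv
      rw [fderiv_comp_affine T y (hj.differentiableAt (by simp))] at h3
      exact DFunLike.congr_fun h3 a
    rw [this]
    calc _ ≤ ‖S‖ * ‖fderiv ℝ j (y + T x) (T a)‖ * ‖T‖ := norm_sandwich_apply_le _ _ _
      _ ≤ ‖S‖ * (K * (‖T‖ * ‖a‖)) * ‖T‖ := by
        gcongr
        exact (le_opNorm _ _).trans (by gcongr; exact T.le_opNorm a)
      _ = _ := by ring
  · refine ContinuousLinearMap.opNorm_le_bound₂ _ (by positivity) fun a b => ?_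
    have : fderiv ℝ (fderiv ℝ (rescaled j y S T)) x a b =
        sandwich S T (fderiv ℝ (fderiv ℝ j) (y + T x) (T a) (T b)) := by
      rw [e, fderiv_fderiv_clm_comp (sandwich S T) hj' a b, fderiv_fderiv_comp_affine T y hj a b]
    rw [this]
    calc _ ≤ ‖S‖ * ‖fderiv ℝ (fderiv ℝ j) (y + T x) (T a) (T b)‖ * ‖T‖ :=
          norm_sandwich_apply_le _ _ _
      _ ≤ ‖S‖ * (K * (‖T‖ * ‖a‖) * (‖T‖ * ‖b‖)) * ‖T‖ := by
        gcongr
        refine (ContinuousLinearMap.le_opNorm₂ _ _ _).trans ?_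
        gcongr
        exacts [T.le_opNorm a, T.le_opNorm b]
      _ = _ := by ring

theorem coframe_re (ℓ η : E2 →L[ℝ] ℝ) (j : E2 →L[ℝ] E2) (x : E2) :
    (coframe ℓ η j x 0).re = ℓ x := by
  rw [coframe_apply_zero, cplx_apply]
  simp

theorem tendsto_coframe {ℓ : ℕ → E2 →L[ℝ] ℝ} {ℓ₀ : E2 →L[ℝ] ℝ} (η : E2 →L[ℝ] ℝ)
    (hℓ : Tendsto ℓ atTop (𝓝 ℓ₀)) {j : ℕ → E2 →L[ℝ] E2} {j₀ : E2 →L[ℝ] E2}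
    (hj : Tendsto j atTop (𝓝 j₀)) :
    Tendsto (fun n => coframe (ℓ n) η (j n)) atTop (𝓝 (coframe ℓ₀ η j₀)) := by
  have h1 : Tendsto (fun n => (ℓ n, j n)) atTop (𝓝 (ℓ₀, j₀)) := hℓ.prodMk_nhds hj
  have h2 : Tendsto (fun z : (E2 →L[ℝ] ℝ) × (E2 →L[ℝ] E2) => coframe z.1 η z.2) (𝓝 (ℓ₀, j₀))
     (𝓝 (coframe ℓ₀ η j₀)) := (continuous_coframe η).continuousAt
  have h3 := Tendsto.comp h2 h1
  simp only [Function.comp_def] at h3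
  exact h3

theorem exists_complex_frame {ℓ : ℕ → E2 →L[ℝ] ℝ} {ℓ₀ : E2 →L[ℝ] ℝ}
    (hℓ : Tendsto ℓ atTop (𝓝 ℓ₀)) (hℓ₀ : ℓ₀ ≠ 0) {j : ℕ → E2 →L[ℝ] E2} {j₀ : E2 →L[ℝ] E2}
    (hj : Tendsto j atTop (𝓝 j₀)) (hsq : ∀ n v, j n (j n v) = -v) (hsq₀ : ∀ v, j₀ (j₀ v) = -v) :
    ∃ (A B : ℕ → E2 →L[ℝ] E2) (A₀ B₀ : E2 →L[ℝ] E2), Tendsto A atTop (𝓝 A₀) ∧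
      Tendsto B atTop (𝓝 B₀) ∧
      (∀ᶠ n in atTop, (∀ x, A n (B n x) = x) ∧ ∀ x, B n (A n x) = x) ∧
      ((∀ x, A₀ (B₀ x) = x) ∧ ∀ x, B₀ (A₀ x) = x) ∧
      (∀ n x, B n (j n x) = Jst E2 (B n x)) ∧ (∀ x, B₀ (j₀ x) = Jst E2 (B₀ x)) ∧
      (∀ n x, (B n x 0).re = ℓ n x) ∧ ∀ x, (B₀ x 0).re = ℓ₀ x := by
  obtain ⟨η, hη⟩ := exists_isUnit_coframe hℓ₀ hsq₀
  have hB := tendsto_coframe η hℓ hj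
  obtain ⟨hA, hinv⟩ := tendsto_ringInverse hB hη
  obtain ⟨_, hinv₀⟩ := (tendsto_ringInverse
    (tendsto_const_nhds : Tendsto (fun _ : ℕ => coframe ℓ₀ η j₀) atTop _) hη).2.exists
  exact ⟨_, _, _, _, hA, hB, hinv, hinv₀,
    fun n => coframe_structure _ _ (hsq n), coframe_structure _ _ hsq₀,
    fun n => coframe_re _ _ _, coframe_re _ _ _⟩

/-- The linear coordinates used to blow up a strictly pseudoconvex domain along a sequence of
points `y n` converging to the boundary point `q`. -/
structure ScalingFrame (G : Set E2) (J : E2 → E2 →L[ℝ] E2) (r : E2 → ℝ)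
    (Jν : ℕ → E2 → E2 →L[ℝ] E2) (q : E2) (y : ℕ → E2) (s : ℕ → ℝ) (A B : ℕ → E2 →L[ℝ] E2)
    (A₀ B₀ : E2 →L[ℝ] E2) : Prop where
  mem : ∀ n, y n ∈ G
  pos : ∀ n, 0 < s n
  sq_eq : ∀ n, s n ^ 2 = -r (y n)
  tendsto_scale : Tendsto s atTop (𝓝 0)
  tendsto_point : Tendsto y atTop (𝓝 q)
  tendsto_frame : Tendsto A atTop (𝓝 A₀)
  tendsto_coframe : Tendsto B atTop (𝓝 B₀)
  inverse : ∀ᶠ n in atTop, (∀ x, A n (B n x) = x) ∧ ∀ x, B n (A n x) = x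
  inverse_limit : (∀ x, A₀ (B₀ x) = x) ∧ ∀ x, B₀ (A₀ x) = x
  structure_eq : ∀ n x, B n (Jν n (y n) x) = Jst E2 (B n x)
  limit_structure_eq : ∀ x, B₀ (J q x) = Jst E2 (B₀ x)
  re_eq : ∀ n x, (B n x 0).re = fderiv ℝ r (y n) x
  limit_re_eq : ∀ x, (B₀ x 0).re = fderiv ℝ r q x
  tendsto_structure : Tendsto (fun n => Jν n (y n)) atTop (𝓝 (J q))
  tendsto_fderiv : Tendsto (fun n => fderiv ℝ (Jν n) (y n)) atTop (𝓝 (fderiv ℝ J q))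

namespace UniformizingSequence

theorem defining_eq_zero (h : UniformizingSequence Ω G D J r f g Jν K c)
    (hq : q ∈ frontier G) : r q = 0 := by
  have hqΩ : q ∈ Ω := h.closure_subset (frontier_subset_closure hq)
  have hr : ContinuousWithinAt r G q :=
    ((h.defining.contDiffAt (h.isOpen_ambient.mem_nhds hqΩ)).continuousAt).continuousWithinAt
  have h1 : r q ≤ 0 := by
    have := mem_closure_iff_nhdsWithin_neBot.1 (frontier_subset_closure hq)
    exact le_of_tendsto hr (eventually_mem_nhdsWithin.mono fun y hy => (h.neg_of_mem hy).le)
  have h2 : ¬ r q < 0 := fun hlt => by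
    rw [h.isOpen_target.frontier_eq] at hq
    exact hq.2 ((h.mem_target_iff q).2 ⟨hqΩ, hlt⟩)
  linarith

theorem tendsto_structure (h : UniformizingSequence Ω G D J r f g Jν K c)
    (hq : q ∈ closure G) (hy : ∀ n, y n ∈ G) (hyq : Tendsto y atTop (𝓝 q)) :
    Tendsto (fun n => Jν n (y n)) atTop (𝓝 (J q)) ∧
      Tendsto (fun n => fderiv ℝ (Jν n) (y n)) atTop (𝓝 (fderiv ℝ J q)) := by
  have hJ2 : ContDiffAt ℝ 2 J q := contDiffAt_infty.1
    (h.smooth.contDiffAt (h.isOpen_ambient.mem_nhds (h.closure_subset hq))) 2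
  have hJ1 : ContinuousAt (fderiv ℝ J) q :=
    (hJ2.fderiv_right (m := 1) (by norm_num)).continuousAt
  exact ⟨tendsto_of_norm_sub_le (hJ2.continuousAt.tendsto.comp hyq)
      fun ε hε => (h.conv ε hε).mono fun n hn => (hn _ (hy n)).1,
    tendsto_of_norm_sub_le (hJ1.tendsto.comp hyq)
      fun ε hε => (h.conv ε hε).mono fun n hn => (hn _ (hy n)).2.1⟩

theorem structure_structure (h : UniformizingSequence Ω G D J r f g Jν K c)
    (hq : q ∈ closure G) (v : E2) : J q (J q v) = -v := by
  obtain ⟨y, hy, hyq⟩ := mem_closure_iff_seq_limit.1 hq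
  have hstr := (h.tendsto_structure hq hy hyq).1
  have h1 : Tendsto (fun n => Jν n (y n) * Jν n (y n)) atTop (𝓝 (J q * J q)) := hstr.mul hstr
  have h2 : (fun n => Jν n (y n) * Jν n (y n)) = fun _ => -(1 : E2 →L[ℝ] E2) := by
    funext n
    ext1 v
    simpa using h.sq_structure n _ (hy n) v
  rw [h2] at h1
  simpa using DFunLike.congr_fun (tendsto_nhds_unique h1 tendsto_const_nhds) v

theorem exists_scalingFrame (h : UniformizingSequence Ω G D J r f g Jν K c)
    (hq : q ∈ frontier G) (hy : ∀ n, y n ∈ G) (hyq : Tendsto y atTop (𝓝 q)) :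
    ∃ s A B A₀ B₀, ScalingFrame G J r Jν q y s A B A₀ B₀ := by
  have hqc : q ∈ closure G := frontier_subset_closure hq
  have hr2 : ContDiffAt ℝ 2 r q :=
    h.defining.contDiffAt (h.isOpen_ambient.mem_nhds (h.closure_subset hqc))
  have hr1 : Tendsto (fderiv ℝ r) (𝓝 q) (𝓝 (fderiv ℝ r q)) :=
    (hr2.fderiv_right (m := 1) (by norm_num)).continuousAt
  have hrq : r q = 0 := h.defining_eq_zero hq
  obtain ⟨hstr, hder⟩ := h.tendsto_structure hqc hy hyq
  have hsq := h.structure_structure hqc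
  obtain ⟨A, B, A₀, B₀, hA, hB, hinv, hinv₀, hst, hst₀, hre, hre₀⟩ :=
    exists_complex_frame (hr1.comp hyq) (h.fderiv_ne_zero q hq) hstr
      (fun n => h.sq_structure n _ (hy n)) hsq
  have hpos : ∀ n, 0 < -r (y n) := fun n => by linarith [h.neg_of_mem (hy n)]
  have hs : Tendsto (fun n => √(-r (y n))) atTop (𝓝 0) := by
    have := ((hr2.continuousAt.tendsto.comp hyq).neg).sqrt
    rw [hrq, neg_zero, Real.sqrt_zero] at this
    exact this
  exact ⟨fun n => √(-r (y n)), A, B, A₀, B₀, hy, fun n => Real.sqrt_pos.2 (hpos n),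
    fun n => Real.sq_sqrt (hpos n).le, hs, hyq, hA, hB, hinv, hinv₀, hst, hst₀, hre, hre₀, hstr,
    hder⟩

end UniformizingSequence

theorem tendsto_clm_comp {𝕜 X Y Z ι : Type*} [NontriviallyNormedField 𝕜] [NormedAddCommGroup X]
    [NormedSpace 𝕜 X] [NormedAddCommGroup Y] [NormedSpace 𝕜 Y] [NormedAddCommGroup Z]
    [NormedSpace 𝕜 Z] {l : Filter ι} {a : ι → Y →L[𝕜] Z} {b : ι → X →L[𝕜] Y} {a₀ : Y →L[𝕜] Z}
    {b₀ : X →L[𝕜] Y} (ha : Tendsto a l (𝓝 a₀)) (hb : Tendsto b l (𝓝 b₀)) :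
    Tendsto (fun i => (a i).comp (b i)) l (𝓝 (a₀.comp b₀)) := by
  have h := (isBoundedBilinearMap_comp (𝕜 := 𝕜) (E := X) (F := Y) (G := Z)).continuous.tendsto
    (a₀, b₀)
  exact h.comp (ha.prodMk_nhds hb)

/-- The limit structure, of the form `Jst + S ∘ Θ(T x) ∘ T`. -/
def limitStructure (S T : E2 →L[ℝ] E2) (Θ : E2 →L[ℝ] E2 →L[ℝ] E2) (x : E2) : E2 →L[ℝ] E2 :=
  Jst E2 + sandwich S T (Θ (T x))

theorem sandwich_dil {s : ℝ} (hs : s ≠ 0) (A B : E2 →L[ℝ] E2) (Θ : E2 →L[ℝ] E2 →L[ℝ] E2) (x : E2) :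
    sandwich ((dil s⁻¹).comp B) (A.comp (dil s)) (Θ (A.comp (dil s) x)) =
      sandwich ((axisProj 0 + s • axisProj 1).comp B) (A.comp (axisProj 1 + s • axisProj 0))
        (Θ (A.comp (axisProj 1 + s • axisProj 0) x)) := by
  rw [← dil_inv_smul hs, dil_eq_smul s]
  ext1 u
  simp only [sandwich_apply, comp_apply, smul_apply, map_smul, smul_smul, sq]

namespace ScalingFrame

theorem exists_norm_le (F : ScalingFrame G J r Jν q y s A B A₀ B₀) :
    ∃ C, 1 ≤ C ∧ ∀ᶠ n in atTop, s n ≤ 1 ∧ ‖A n‖ ≤ C ∧ ‖B n‖ ≤ C ∧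
      ‖(A n).comp (dil (s n))‖ ≤ C * s n ∧ ‖(dil (s n)⁻¹).comp (B n)‖ ≤ C * (s n ^ 2)⁻¹ := by
  refine ⟨max (‖A₀‖ + 1) (‖B₀‖ + 1), le_max_of_le_left (by linarith [norm_nonneg A₀]), ?_⟩
  filter_upwards [F.tendsto_scale.eventually_le_const one_pos,
    F.tendsto_frame.norm.eventually_le_const (lt_add_one ‖A₀‖),
    F.tendsto_coframe.norm.eventually_le_const (lt_add_one ‖B₀‖)] with n h1 h2 h3
  have hA := h2.trans (le_max_left (‖A₀‖ + 1) (‖B₀‖ + 1))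
  have hB := h3.trans (le_max_right (‖A₀‖ + 1) (‖B₀‖ + 1))
  have hs := F.pos n
  refine ⟨h1, hA, hB, ((A n).opNorm_comp_le _).trans ?_,
    (opNorm_comp_le _ _).trans ?_⟩
  · gcongr
    exact norm_dil_le hs.le h1
  · rw [mul_comm]
    gcongr
    exact norm_dil_inv_le hs h1

theorem eventually_mem_ball (F : ScalingFrame G J r Jν q y s A B A₀ B₀) {t : ℝ} (ht : 0 < t)
    (R : ℝ) : ∀ᶠ n in atTop, y n ∈ ball q t ∧
      ∀ x, ‖x‖ ≤ R → y n + (A n).comp (dil (s n)) x ∈ ball q t := by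
  obtain ⟨C, hC1, hC⟩ := F.exists_norm_le
  have h0 : Tendsto (fun n => C * s n * R) atTop (𝓝 0) := by
    simpa using (F.tendsto_scale.const_mul C).mul_const R
  filter_upwards [hC, h0.eventually_lt_const (half_pos ht),
    Metric.tendsto_nhds.1 F.tendsto_point (t / 2) (half_pos ht)] with n h1 h2 h3
  refine ⟨mem_ball.2 (h3.trans (by linarith)), fun x hx => ?_⟩
  rw [dist_eq_norm] at h3
  rw [mem_ball_iff_norm, add_sub_right_comm]
  have h4 := ((A n).comp (dil (s n))).le_of_opNorm_le_of_le h1.2.2.2.1 hx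
  exact (norm_add_le _ _).trans_lt (by linarith)

theorem rescaled_structure (F : ScalingFrame G J r Jν q y s A B A₀ B₀) {n : ℕ}
    (hinv : ∀ x, B n (A n x) = x) :
    sandwich ((dil (s n)⁻¹).comp (B n)) ((A n).comp (dil (s n))) (Jν n (y n)) = Jst E2 := by
  ext1 x
  rw [sandwich_apply, comp_apply, comp_apply,
    F.structure_eq, hinv, dil_Jst, dil_inv_dil (F.pos n).ne']

theorem tendsto_frames (F : ScalingFrame G J r Jν q y s A B A₀ B₀) :
    Tendsto (fun n => (axisProj 0 + s n • axisProj 1).comp (B n)) atTop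
        (𝓝 ((axisProj 0).comp B₀)) ∧
      Tendsto (fun n => (A n).comp (axisProj 1 + s n • axisProj 0)) atTop
        (𝓝 (A₀.comp (axisProj 1))) := by
  constructor
  · refine tendsto_clm_comp ?_ F.tendsto_coframe
    simpa using (F.tendsto_scale.smul_const (axisProj 1)).const_add (axisProj 0)
  · refine tendsto_clm_comp F.tendsto_frame ?_
    simpa using (F.tendsto_scale.smul_const (axisProj 0)).const_add (axisProj 1)

theorem tendsto_sandwich (F : ScalingFrame G J r Jν q y s A B A₀ B₀) :
    Tendsto (fun n => (sandwich ((axisProj 0 + s n • axisProj 1).comp (B n))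
        ((A n).comp (axisProj 1 + s n • axisProj 0))).comp
        ((fderiv ℝ (Jν n) (y n)).comp ((A n).comp (axisProj 1 + s n • axisProj 0)))) atTop
      (𝓝 ((sandwich ((axisProj 0).comp B₀) (A₀.comp (axisProj 1))).comp
        ((fderiv ℝ J q).comp (A₀.comp (axisProj 1))))) := by
  obtain ⟨h1, h2⟩ := F.tendsto_frames
  refine tendsto_clm_comp (tendsto_clm_comp ?_ ?_) (tendsto_clm_comp F.tendsto_fderiv h2)
  · exact ((compL ℝ E2 E2 E2).continuous.tendsto _).comp h1
  · exact ((compL ℝ E2 E2 E2).flip.continuous.tendsto _).comp h2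

end ScalingFrame

namespace UniformizingSequence

theorem rescaled_close (h : UniformizingSequence Ω G D J r f g Jν K c) (hq : q ∈ frontier G)
    (F : ScalingFrame G J r Jν q y s A B A₀ B₀) (R : ℝ) {ε : ℝ} (hε : 0 < ε) :
    ∀ᶠ n in atTop, ∀ x, ‖x‖ ≤ R → y n + (A n).comp (dil (s n)) x ∈ G →
      ‖rescaled (Jν n) (y n) ((dil (s n)⁻¹).comp (B n)) ((A n).comp (dil (s n))) x -
        limitStructure ((axisProj 0).comp B₀) (A₀.comp (axisProj 1)) (fderiv ℝ J q) x‖ ≤ ε := by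
  obtain ⟨t, ht, C₁, hC₁, htay⟩ := h.exists_taylor_bound hq
  obtain ⟨C, hC1, hC⟩ := F.exists_norm_le
  have hsm : Tendsto (fun n => C ^ 4 * C₁ * R ^ 2 * s n) atTop (𝓝 0) := by
    simpa using F.tendsto_scale.const_mul (C ^ 4 * C₁ * R ^ 2)
  have hlin := (tendsto_iff_norm_sub_tendsto_zero.1 F.tendsto_sandwich).mul_const R
  rw [zero_mul] at hlin
  filter_upwards [hC, F.inverse, F.eventually_mem_ball ht R,
    hsm.eventually_le_const (half_pos hε), hlin.eventually_le_const (half_pos hε)] with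
    n ⟨_, _, _, hT, hS⟩ ⟨_, hinv⟩ ⟨hyt, hball⟩ hs1 hs2 x hx hxG
  have hs := F.pos n
  have hR : 0 ≤ R := (norm_nonneg x).trans hx
  have hrem := (htay n (y n) ⟨F.mem n, hyt⟩ _ ⟨hxG, hball x hx⟩).2
  rw [add_sub_cancel_left] at hrem
  have hTx := ((A n).comp (dil (s n))).le_of_opNorm_le_of_le hT hx
  have hstr := F.rescaled_structure hinv
  have hdil := sandwich_dil hs.ne' (A n) (B n) (fderiv ℝ (Jν n) (y n)) x
  obtain ⟨T, hTeq⟩ : ∃ T, T = (A n).comp (dil (s n)) := ⟨_, rfl⟩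
  obtain ⟨S, hSeq⟩ : ∃ S, S = (dil (s n)⁻¹).comp (B n) := ⟨_, rfl⟩
  rw [← hTeq] at hrem hTx hT hstr hdil
  rw [← hSeq] at hS hstr hdil
  rw [← hTeq, ← hSeq]
  have h1 : ‖sandwich S T (Jν n (y n + T x) - Jν n (y n) - fderiv ℝ (Jν n) (y n) (T x))‖ ≤
      ε / 2 := by
    calc _ ≤ ‖S‖ * ‖Jν n (y n + T x) - Jν n (y n) - fderiv ℝ (Jν n) (y n) (T x)‖ * ‖T‖ :=
          norm_sandwich_apply_le _ _ _
      _ ≤ C * (s n ^ 2)⁻¹ * (C₁ * (C * s n * R) ^ 2) * (C * s n) := by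
        gcongr
        exact hrem.trans (by gcongr)
      _ = C ^ 4 * C₁ * R ^ 2 * s n := by field_simp
      _ ≤ ε / 2 := hs1
  have h2 := (le_of_opNorm_le_of_le _ le_rfl hx).trans hs2
  have e : rescaled (Jν n) (y n) S T x -
      limitStructure ((axisProj 0).comp B₀) (A₀.comp (axisProj 1)) (fderiv ℝ J q) x =
      sandwich S T (Jν n (y n + T x) - Jν n (y n) - fderiv ℝ (Jν n) (y n) (T x)) +
      ((sandwich ((axisProj 0 + s n • axisProj 1).comp (B n))
        ((A n).comp (axisProj 1 + s n • axisProj 0))).comp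
        ((fderiv ℝ (Jν n) (y n)).comp ((A n).comp (axisProj 1 + s n • axisProj 0))) -
      ((sandwich ((axisProj 0).comp B₀) (A₀.comp (axisProj 1))).comp
        ((fderiv ℝ J q).comp (A₀.comp (axisProj 1))))) x := by
    rw [rescaled, limitStructure, map_sub, map_sub, hstr, hdil, sub_apply]
    simp only [comp_apply]
    abel
  rw [e]
  exact (norm_add_le _ _).trans (by linarith)

theorem rescaled_bound (h : UniformizingSequence Ω G D J r f g Jν K c) (hq : q ∈ frontier G)
    (F : ScalingFrame G J r Jν q y s A B A₀ B₀) (R : ℝ) :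
    ∃ L, ∀ᶠ n in atTop, ∀ x, ‖x‖ ≤ R → y n + (A n).comp (dil (s n)) x ∈ G →
      ContDiffAt ℝ 2 (rescaled (Jν n) (y n) ((dil (s n)⁻¹).comp (B n))
        ((A n).comp (dil (s n)))) x ∧
      ‖rescaled (Jν n) (y n) ((dil (s n)⁻¹).comp (B n)) ((A n).comp (dil (s n))) x‖ ≤ L ∧
      ‖fderiv ℝ (rescaled (Jν n) (y n) ((dil (s n)⁻¹).comp (B n))
        ((A n).comp (dil (s n)))) x‖ ≤ L ∧
      ‖fderiv ℝ (fderiv ℝ (rescaled (Jν n) (y n) ((dil (s n)⁻¹).comp (B n))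
        ((A n).comp (dil (s n))))) x‖ ≤ L ∧
      ∀ v, rescaled (Jν n) (y n) ((dil (s n)⁻¹).comp (B n)) ((A n).comp (dil (s n))) x
        (rescaled (Jν n) (y n) ((dil (s n)⁻¹).comp (B n)) ((A n).comp (dil (s n))) x v) = -v := by
  obtain ⟨C, hC1, hC⟩ := F.exists_norm_le
  have hK := h.one_le
  obtain ⟨S₀, hS₀⟩ : ∃ S₀, S₀ = (axisProj 0).comp B₀ := ⟨_, rfl⟩
  obtain ⟨T₀, hT₀⟩ : ∃ T₀, T₀ = A₀.comp (axisProj 1) := ⟨_, rfl⟩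
  have hclose := h.rescaled_close hq F R one_pos
  rw [← hS₀, ← hT₀] at hclose
  refine ⟨max (1 + (‖Jst E2‖ + ‖S₀‖ * (‖fderiv ℝ J q‖ * (‖T₀‖ * R)) * ‖T₀‖)) (C ^ 4 * K), ?_⟩
  filter_upwards [hC, F.inverse, hclose] with n ⟨hs1, _, _, hT, hS⟩ ⟨hinv', hinv⟩ hcl x hx hxG
  have hs := F.pos n
  have hsne := hs.ne'
  have hmain := hcl x hx hxG
  have hTS : ∀ v, (A n).comp (dil (s n)) ((dil (s n)⁻¹).comp (B n) v) = v := fun v => by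
    rw [comp_apply, comp_apply, dil_dil_inv hsne, hinv']
  have hST : ∀ v, (dil (s n)⁻¹).comp (B n) ((A n).comp (dil (s n)) v) = v := fun v => by
    rw [comp_apply, comp_apply, hinv, dil_inv_dil hsne]
  obtain ⟨T, hTeq⟩ : ∃ T, T = (A n).comp (dil (s n)) := ⟨_, rfl⟩
  obtain ⟨S, hSeq⟩ : ∃ S, S = (dil (s n)⁻¹).comp (B n) := ⟨_, rfl⟩
  rw [← hTeq] at hT hmain hxG hTS hST
  rw [← hSeq] at hS hmain hTS hST
  rw [← hTeq, ← hSeq]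
  have hc2 := h.contDiffAt_structure n hxG
  obtain ⟨-, hb1, hb2⟩ := h.structure_le n _ hxG
  obtain ⟨hd1, hd2⟩ := norm_fderiv_rescaled_le (S := S) (T := T) hc2 hb1 hb2
  refine ⟨contDiffAt_rescaled hc2, ?_, ?_, ?_, fun v => ?_⟩
  · refine le_max_of_le_left ?_
    have h1 : ‖limitStructure S₀ T₀ (fderiv ℝ J q) x‖ ≤
        ‖Jst E2‖ + ‖S₀‖ * (‖fderiv ℝ J q‖ * (‖T₀‖ * R)) * ‖T₀‖ := by
      refine (norm_add_le _ _).trans (add_le_add le_rfl ((norm_sandwich_apply_le _ _ _).trans ?_))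
      gcongr
      exact le_of_opNorm_le_of_le _ le_rfl
        (le_of_opNorm_le_of_le _ le_rfl hx)
    have h2 := norm_sub_norm_le (rescaled (Jν n) (y n) S T x)
      (limitStructure S₀ T₀ (fderiv ℝ J q) x)
    linarith
  · refine le_max_of_le_right (hd1.trans ?_)
    calc ‖S‖ * ‖T‖ ^ 2 * K ≤ C * (s n ^ 2)⁻¹ * (C * s n) ^ 2 * K := by gcongr
      _ = C ^ 3 * K := by field_simp
      _ ≤ C ^ 4 * K := by gcongr; norm_num
  · refine le_max_of_le_right (hd2.trans ?_)
    calc ‖S‖ * ‖T‖ ^ 3 * K ≤ C * (s n ^ 2)⁻¹ * (C * s n) ^ 3 * K := by gcongr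
      _ = C ^ 4 * K * s n := by field_simp
      _ ≤ C ^ 4 * K := mul_le_of_le_one_right (by positivity) hs1
  · rw [rescaled, sandwich_apply, sandwich_apply, hTS, h.sq_structure n _ hxG, map_neg, hST]

end UniformizingSequence

/-- The defining function of the limit model. -/
def limitDefining (T : E2 →L[ℝ] E2) (b : E2 →L[ℝ] E2 →L[ℝ] ℝ) (x : E2) : ℝ :=
  -1 + (x 0).re + (1 / 2) * b (T x) (T x)

theorem continuous_limitDefining (T : E2 →L[ℝ] E2) (b : E2 →L[ℝ] E2 →L[ℝ] ℝ) :
    Continuous (limitDefining T b) := by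
  have h1 : Continuous fun x : E2 => (x 0).re := (Complex.reCLM.comp (crd 0)).continuous
  have h2 : Continuous fun x => b (T x) (T x) :=
    (b.continuous.comp T.continuous).clm_apply T.continuous
  exact (continuous_const.add h1).add (continuous_const.mul h2)

theorem abs_bilin_sub_le
    (b : V →L[ℝ] V →L[ℝ] ℝ) (u v : V) : |b u u - b v v| ≤ ‖b‖ * (‖u‖ + ‖v‖) * ‖u - v‖ := by
  have e : b u u - b v v = b u (u - v) + b (u - v) v := by
    simp only [map_sub, sub_apply]
    ring
  rw [e]
  refine (abs_add_le _ _).trans ?_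
  have h1 := b.le_opNorm₂ u (u - v)
  have h2 := b.le_opNorm₂ (u - v) v
  rw [Real.norm_eq_abs] at h1 h2
  linarith

theorem ScalingFrame.abs_defining_sub_le (F : ScalingFrame G J r Jν q y s A B A₀ B₀)
    (hr : ContDiffAt ℝ 2 r q) (R : ℝ) {ε : ℝ} (hε : 0 < ε) :
    ∀ᶠ n in atTop, ∀ x, ‖x‖ ≤ R → |r (y n + (A n).comp (dil (s n)) x) / s n ^ 2 -
      limitDefining (A₀.comp (axisProj 1)) (fderiv ℝ (fderiv ℝ r) q) x| ≤ ε := by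
  obtain ⟨T₀, hT₀⟩ : ∃ T₀, T₀ = A₀.comp (axisProj 1) := ⟨_, rfl⟩
  obtain ⟨C, hC1, hC⟩ := F.exists_norm_le
  have hR' : 0 ≤ max R 0 := le_max_right _ _
  obtain ⟨t, ht, htay⟩ := exists_taylor_two hr (ε := ε / (2 * (C ^ 2 * (max R 0) ^ 2 + 1)))
    (by positivity)
  have hT' := F.tendsto_frames.2
  rw [← hT₀] at hT' ⊢
  obtain ⟨b, hb⟩ : ∃ b, b = fderiv ℝ (fderiv ℝ r) q := ⟨_, rfl⟩
  rw [← hb] at htay ⊢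
  have hq0 : Tendsto (fun n => ‖b‖ * ((‖T₀‖ + 1 + ‖T₀‖) * max R 0) *
      (‖(A n).comp (axisProj 1 + s n • axisProj 0) - T₀‖ * max R 0)) atTop (𝓝 0) := by
    simpa using ((tendsto_iff_norm_sub_tendsto_zero.1 hT').mul_const (max R 0)).const_mul
      (‖b‖ * ((‖T₀‖ + 1 + ‖T₀‖) * max R 0))
  filter_upwards [hC, F.inverse, F.eventually_mem_ball ht R, hq0.eventually_le_const hε,
    hT'.norm.eventually_le_const (lt_add_one ‖T₀‖)] with
    n ⟨_, _, _, hT, _⟩ ⟨_, hinv⟩ ⟨hyt, hball⟩ hsm hT'n x hx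
  have hs := F.pos n
  have hxR : ‖x‖ ≤ max R 0 := hx.trans (le_max_left _ _)
  have hTx := ((A n).comp (dil (s n))).le_of_opNorm_le_of_le hT hxR
  have htx := htay _ (hball x hx) _ hyt
  rw [add_sub_cancel_left] at htx
  have hlin : fderiv ℝ r (y n) ((A n).comp (dil (s n)) x) = s n ^ 2 * (x 0).re := by
    rw [← F.re_eq, comp_apply, hinv, dil_apply_zero, Complex.re_ofReal_mul]
  have hsc : (A n).comp (dil (s n)) x = s n • (A n).comp (axisProj 1 + s n • axisProj 0) x := by
    rw [dil_eq_smul]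
    simp only [comp_apply, smul_apply, map_smul]
  have hquad : b ((A n).comp (dil (s n)) x) ((A n).comp (dil (s n)) x) =
      s n ^ 2 * b ((A n).comp (axisProj 1 + s n • axisProj 0) x)
        ((A n).comp (axisProj 1 + s n • axisProj 0) x) := by
    rw [hsc]
    simp only [map_smul, smul_apply, smul_eq_mul]
    ring
  rw [hlin, hquad] at htx
  have hry : r (y n) = -(s n ^ 2) := by rw [F.sq_eq]; ring
  obtain ⟨T, hTe⟩ : ∃ T, T = (A n).comp (dil (s n)) := ⟨_, rfl⟩
  obtain ⟨T', hTe'⟩ : ∃ T', T' = (A n).comp (axisProj 1 + s n • axisProj 0) := ⟨_, rfl⟩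
  rw [← hTe, ← hTe'] at htx
  rw [← hTe] at hTx ⊢
  rw [← hTe'] at hsm hT'n
  have h1 : |r (y n + T x) / s n ^ 2 - (-1 + (x 0).re + (1 / 2) * b (T' x) (T' x))| ≤ ε / 2 := by
    have e : r (y n + T x) / s n ^ 2 - (-1 + (x 0).re + (1 / 2) * b (T' x) (T' x)) =
        (r (y n + T x) - r (y n) - s n ^ 2 * (x 0).re -
          1 / 2 * (s n ^ 2 * b (T' x) (T' x))) / s n ^ 2 := by
      rw [hry]
      field_simp
      ring
    rw [e, abs_div, abs_of_pos (pow_pos hs 2), div_le_iff₀ (pow_pos hs 2)]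
    refine htx.trans ?_
    calc ε / (2 * (C ^ 2 * (max R 0) ^ 2 + 1)) * ‖T x‖ ^ 2
        ≤ ε / (2 * (C ^ 2 * (max R 0) ^ 2 + 1)) * (C * s n * max R 0) ^ 2 := by gcongr
      _ = (C ^ 2 * (max R 0) ^ 2) / (C ^ 2 * (max R 0) ^ 2 + 1) * (ε / 2 * s n ^ 2) := by
        field_simp
      _ ≤ 1 * (ε / 2 * s n ^ 2) := by
        gcongr
        exact (div_le_one (by positivity)).2 (by linarith)
      _ = _ := one_mul _
  have h2 : |b (T' x) (T' x) - b (T₀ x) (T₀ x)| ≤ ε := by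
    refine (abs_bilin_sub_le b _ _).trans (le_trans ?_ hsm)
    rw [add_mul]
    gcongr
    · exact T'.le_of_opNorm_le_of_le hT'n hxR
    · exact T₀.le_of_opNorm_le_of_le le_rfl hxR
    · exact (T' - T₀).le_of_opNorm_le_of_le le_rfl hxR
  rw [limitDefining]
  rw [abs_le] at h1 h2 ⊢
  constructor <;> linarith [h1.1, h1.2, h2.1, h2.2]

theorem UniformizingSequence.eventually_mem_iff (h : UniformizingSequence Ω G D J r f g Jν K c)
    (hq : q ∈ frontier G) (F : ScalingFrame G J r Jν q y s A B A₀ B₀) (R : ℝ) :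
    ∀ᶠ n in atTop, ∀ x, ‖x‖ ≤ R → (y n + (A n).comp (dil (s n)) x ∈ G ↔
      r (y n + (A n).comp (dil (s n)) x) < 0) := by
  obtain ⟨t, ht, hsub⟩ := Metric.isOpen_iff.1 h.isOpen_ambient q
    (h.closure_subset (frontier_subset_closure hq))
  filter_upwards [F.eventually_mem_ball ht R] with n hn x hx
  rw [h.mem_target_iff, and_iff_right (hsub (hn.2 x hx))]

theorem exists_subseq_of_local_bounds {V W : Type*} [NormedAddCommGroup V] [NormedSpace ℂ V]
    [ProperSpace V] [SecondCountableTopology V] [NormedAddCommGroup W] [NormedSpace ℝ W]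
    [ProperSpace W] {D : Set V} (hD : IsOpen D) {Φ : ℕ → V → W}
    (hb : ∀ x ∈ D, ∃ t > 0, ∃ L > 0, ∀ᶠ n in atTop, ∀ z ∈ ball x t, ContDiffAt ℝ 2 (Φ n) z ∧
      ‖Φ n z‖ ≤ L ∧ ‖fderiv ℝ (Φ n) z‖ ≤ L ∧ ∀ X, ‖X‖ = 1 → ‖lap2 (Φ n) z X‖ ≤ L) :
    ∃ φ : ℕ → ℕ, StrictMono φ ∧ ∃ F : V → W,
      TendstoLocallyUniformlyOn (fun k => Φ (φ k)) F atTop D ∧ (∀ x ∈ D, DifferentiableAt ℝ F x) ∧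
      TendstoLocallyUniformlyOn (fun k => fderiv ℝ (Φ (φ k))) (fderiv ℝ F) atTop D := by
  obtain ⟨φ, hφ, F, hF⟩ := exists_subseq_tendstoLocallyUniformlyOn (f := Φ) (U := D) (0 : W)
    (fun x hx => by
      obtain ⟨t, ht, L, hL, h⟩ := hb x hx
      refine ⟨L, h.mono fun n hn => ?_⟩
      rw [dist_zero_right]
      exact (hn x (mem_ball_self ht)).2.1)
    (fun x hx ε hε => by
      obtain ⟨t, ht, L, hL, h⟩ := hb x hx
      refine ⟨min t (ε / L), by positivity, h.mono fun n hn z hz => ?_⟩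
      have h1 := (convex_ball x t).norm_image_sub_le_of_norm_fderiv_le (𝕜 := ℝ)
        (fun w hw => (hn w hw).1.differentiableAt (by norm_num)) (fun w hw => (hn w hw).2.2.1)
        (mem_ball_self ht) (ball_subset_ball (min_le_left _ _) hz)
      have h2 : ‖z - x‖ ≤ ε / L := (mem_ball_iff_norm.1 hz).le.trans (min_le_right _ _)
      rw [dist_eq_norm]
      calc _ ≤ L * ‖z - x‖ := h1
        _ ≤ L * (ε / L) := by gcongr
        _ = ε := by field_simp)
  refine ⟨φ, hφ, F, hF, differentiableAt_of_equicontinuous_fderiv hD hF fun x hx ε hε => ?_⟩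
  have : ProperSpace V := inferInstance
  obtain ⟨t, ht, L, hL, h⟩ := hb x hx
  obtain ⟨B, hB⟩ : ∃ B, B = 16 * L / √t + L * √t := ⟨_, rfl⟩
  have hB0 : 0 < B := by rw [hB]; positivity
  refine ⟨min (t / 8) ((ε / B) ^ 2), by positivity,
    (hφ.tendsto_atTop.eventually h).mono fun n hn y hy => ?_⟩
  have hy8 : y ∈ ball x (t / 8) := ball_subset_ball (min_le_left _ _) hy
  refine ⟨(hn y (ball_subset_ball (by linarith) hy8)).1.differentiableAt (by norm_num), ?_⟩
  have h1 := norm_fderiv_sub_le_sqrt ht hL.le (fun z hz => (hn z hz).1) (fun z hz => (hn z hz).2.2.1)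
    (fun z hz => (hn z hz).2.2.2) (mem_ball_self (by positivity)) hy8
  rw [← hB] at h1
  refine h1.trans ?_
  have h2 : √‖y - x‖ ≤ ε / B := Real.sqrt_le_iff.2
    ⟨by positivity, (mem_ball_iff_norm.1 hy).le.trans (min_le_right _ _)⟩
  calc B * √‖y - x‖ ≤ B * (ε / B) := by gcongr
    _ = ε := by field_simp

theorem ScalingFrame.comp (F : ScalingFrame G J r Jν q y s A B A₀ B₀) {φ : ℕ → ℕ}
    (hφ : Tendsto φ atTop atTop) : ScalingFrame G J r (fun n => Jν (φ n)) q (fun n => y (φ n))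
      (fun n => s (φ n)) (fun n => A (φ n)) (fun n => B (φ n)) A₀ B₀ where
  mem _ := F.mem _
  pos _ := F.pos _
  sq_eq _ := F.sq_eq _
  tendsto_scale := F.tendsto_scale.comp hφ
  tendsto_point := F.tendsto_point.comp hφ
  tendsto_frame := F.tendsto_frame.comp hφ
  tendsto_coframe := F.tendsto_coframe.comp hφ
  inverse := hφ.eventually F.inverse
  inverse_limit := F.inverse_limit
  structure_eq _ := F.structure_eq _
  limit_structure_eq := F.limit_structure_eq
  re_eq _ := F.re_eq _
  limit_re_eq := F.limit_re_eq
  tendsto_structure := F.tendsto_structure.comp hφ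
  tendsto_fderiv := F.tendsto_fderiv.comp hφ

theorem ScalingFrame.norm_blowup_le (F : ScalingFrame G J r Jν q y s A B A₀ B₀) {n : ℕ} {C : ℝ}
    (hB : ‖B n‖ ≤ C) {v : E2} {M N : ℝ} (h1 : |fderiv ℝ r (y n) v| ≤ M * s n ^ 2)
    (h2 : |fderiv ℝ r (y n) (Jν n (y n) v)| ≤ M * s n ^ 2) (h3 : ‖v‖ ≤ N * s n) :
    ‖(dil (s n)⁻¹).comp (B n) v‖ ≤ 2 * M + C * N := by
  have hs := F.pos n
  have hre := F.re_eq n v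
  have him : (B n v 0).im = -fderiv ℝ r (y n) (Jν n (y n) v) := by
    rw [← F.re_eq, F.structure_eq]
    simp [Jst]
  refine (norm_le_coord_add _).trans (add_le_add ?_ ?_)
  · rw [comp_apply, dil_apply_zero, norm_mul, norm_real, inv_pow,
      Real.norm_of_nonneg (by positivity), inv_mul_le_iff₀ (by positivity)]
    have := Complex.norm_le_abs_re_add_abs_im (B n v 0)
    rw [hre, him, abs_neg] at this
    linarith
  · rw [comp_apply, dil_apply_one, norm_mul, norm_real,
      Real.norm_of_nonneg (by positivity), inv_mul_le_iff₀ hs]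
    calc ‖B n v 1‖ ≤ ‖B n v‖ := norm_coord_le _ _
      _ ≤ C * (N * s n) := (B n).le_of_opNorm_le_of_le hB h3
      _ = _ := by ring

namespace UniformizingSequence

theorem exists_blowup_bound (h : UniformizingSequence Ω G D J r f g Jν K c)
    (hF : TendstoLocallyUniformlyOn f (fun _ => q) atTop D) (hq : q ∈ frontier G) (hp : p ∈ D)
    (F : ScalingFrame G J r Jν q (fun n => f n p) s A B A₀ B₀) {x : E2} (hx : x ∈ D) :
    ∃ t > 0, ∃ L > 0, ball x t ⊆ D ∧ ∀ᶠ n in atTop, ∀ z ∈ ball x t,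
      ‖(dil (s n)⁻¹).comp (B n) (f n z - f n p)‖ ≤ L ∧
      ‖((dil (s n)⁻¹).comp (B n)).comp (fderiv ℝ (f n) z)‖ ≤ L := by
  obtain ⟨t, ht, C, hC, hsub, hbox⟩ := h.eventually_jetInBox hF (fun _ _ => rfl) hq hp x hx
  obtain ⟨C', hC1, hC'⟩ := F.exists_norm_le
  refine ⟨t, ht, 2 * C + C' * √C, by positivity, hsub, ?_⟩
  filter_upwards [hbox, hC'] with n hn ⟨_, _, hB, _⟩ z hz
  obtain ⟨⟨h1, -, h2⟩, h3, h4, h5, h6⟩ := hn z hz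
  rw [← F.sq_eq] at h1 h2 h3 h4 h5 h6
  have hs := (F.pos n).le
  have hsq : ∀ a : ℝ, a ^ 2 ≤ C * s n ^ 2 → a ≤ √C * s n := fun a ha => by
    refine le_of_sq_le_sq ?_ (by positivity)
    rwa [mul_pow, Real.sq_sqrt hC.le]
  refine ⟨F.norm_blowup_le hB h4 h2 (hsq _ h1),
    opNorm_le_bound _ (by positivity) fun a => ?_⟩
  have e1 := le_of_opNorm_le _ h5 a
  have e2 := le_of_opNorm_le _ h6 a
  have e3 := le_of_opNorm_le _ (hsq _ h3) a
  refine (F.norm_blowup_le (M := C * ‖a‖) (N := √C * ‖a‖) hB ?_ ?_ ?_).trans_eq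
    (by ring)
  · exact (e1.trans_eq (by ring))
  · exact (e2.trans_eq (by ring))
  · exact (e3.trans_eq (by ring))

theorem blowup_hol (h : UniformizingSequence Ω G D J r f g Jν K c) {n : ℕ} {S T : E2 →L[ℝ] E2}
    (hTS : ∀ v, T (S v) = v) (w : E2) {x : E2} (hx : x ∈ D) :
    ContDiffAt ℝ 2 (fun x => S (f n x - w)) x ∧
      fderiv ℝ (fun x => S (f n x - w)) x = S.comp (fderiv ℝ (f n) x) ∧
      (fderiv ℝ (fun x => S (f n x - w)) x).comp (Jst E2) =
        (rescaled (Jν n) w S T (S (f n x - w))).comp (fderiv ℝ (fun x => S (f n x - w)) x) := by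
  have hf := h.contDiffAt n hx
  have hd : fderiv ℝ (fun x => S (f n x - w)) x = S.comp (fderiv ℝ (f n) x) :=
    (S.hasFDerivAt.comp x ((hf.differentiableAt (by norm_num)).hasFDerivAt.sub_const w)).fderiv
  refine ⟨S.contDiff.contDiffAt.comp x (hf.sub contDiffAt_const), hd, ?_⟩
  rw [hd, rescaled, hTS, add_sub_cancel]
  ext1 v
  simp only [comp_apply, sandwich_apply, hTS]
  exact congrArg S (DFunLike.congr_fun (h.hol n x hx) v)

theorem exists_blowup_limit (h : UniformizingSequence Ω G D J r f g Jν K c)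
    (hF : TendstoLocallyUniformlyOn f (fun _ => q) atTop D) (hq : q ∈ frontier G) (hp : p ∈ D)
    (F : ScalingFrame G J r Jν q (fun n => f n p) s A B A₀ B₀) :
    ∃ φ : ℕ → ℕ, StrictMono φ ∧ ∃ Φ : E2 → E2,
      TendstoLocallyUniformlyOn
        (fun k x => (dil (s (φ k))⁻¹).comp (B (φ k)) (f (φ k) x - f (φ k) p)) Φ atTop D ∧
      ∀ x ∈ D, DifferentiableAt ℝ Φ x ∧ (fderiv ℝ Φ x).comp (Jst E2) =
        (limitStructure ((axisProj 0).comp B₀) (A₀.comp (axisProj 1)) (fderiv ℝ J q) (Φ x)).comp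
          (fderiv ℝ Φ x) := by
  have hTS : ∀ᶠ n in atTop, ∀ v,
      (A n).comp (dil (s n)) ((dil (s n)⁻¹).comp (B n) v) = v := by
    filter_upwards [F.inverse] with n hn v
    rw [comp_apply, comp_apply,
      dil_dil_inv (F.pos n).ne', hn.1]
  obtain ⟨φ, hφ, Φ, hΦ, hdiff, hder⟩ := exists_subseq_of_local_bounds h.isOpen_source
    (Φ := fun n x => (dil (s n)⁻¹).comp (B n) (f n x - f n p)) (fun x hx => by
      obtain ⟨t, ht, L, hL, hsub, hb⟩ := h.exists_blowup_bound hF hq hp F hx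
      obtain ⟨L', hL'⟩ := h.rescaled_bound hq F L
      refine ⟨t, ht, max L (2 * L' ^ 2 * L ^ 2), lt_max_of_lt_left hL, ?_⟩
      filter_upwards [hb, hL', hTS] with n hn hn' hinv z hz
      obtain ⟨hz1, hz2⟩ := hn z hz
      have hzD := hsub hz
      have heq : f n p + (A n).comp (dil (s n)) ((dil (s n)⁻¹).comp (B n) (f n z - f n p)) =
          f n z := by rw [hinv, add_sub_cancel]
      obtain ⟨hc, hb0, hb1, -, -⟩ := hn' _ hz1 (by rw [heq]; exact h.mapsTo n hzD)
      obtain ⟨e1, e2, e3⟩ := h.blowup_hol hinv (f n p) hzD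
      have hd : ‖fderiv ℝ (fun x => (dil (s n)⁻¹).comp (B n) (f n x - f n p)) z‖ ≤ L := by
        rw [e2]; exact hz2
      refine ⟨e1, hz1.trans (le_max_left _ _), hd.trans (le_max_left _ _), fun X hX =>
        le_max_of_le_right ?_⟩
      have hhol : ∀ᶠ w in 𝓝 z, (fderiv ℝ (fun x => (dil (s n)⁻¹).comp (B n) (f n x - f n p))
          w).comp (Jst E2) = (rescaled (Jν n) (f n p) ((dil (s n)⁻¹).comp (B n))
            ((A n).comp (dil (s n))) ((dil (s n)⁻¹).comp (B n) (f n w - f n p))).comp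
          (fderiv ℝ (fun x => (dil (s n)⁻¹).comp (B n) (f n x - f n p)) w) := by
        filter_upwards [h.isOpen_source.mem_nhds hzD] with w hw using
          (h.blowup_hol hinv (f n p) hw).2.2
      rw [lap2_of_holomorphic e1 (hc.differentiableAt (by norm_num)) hhol, norm_neg]
      refine (norm_levTorsion_le hb0 hb1 _).trans ?_
      have := le_of_opNorm_le _ hd X
      rw [hX, mul_one] at this
      gcongr)
  refine ⟨φ, hφ, Φ, hΦ, fun x hx => ⟨hdiff x hx, ?_⟩⟩
  have t1 := hder.tendsto_at hx
  have tΦ := hΦ.tendsto_at hx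
  obtain ⟨S₀, hS₀⟩ : ∃ S₀, S₀ = (axisProj 0).comp B₀ := ⟨_, rfl⟩
  obtain ⟨T₀, hT₀⟩ : ∃ T₀, T₀ = A₀.comp (axisProj 1) := ⟨_, rfl⟩
  have hclose := fun ε (hε : 0 < ε) => h.rescaled_close hq F (‖Φ x‖ + 1) hε
  rw [← hS₀, ← hT₀] at hclose ⊢
  have t2 : Tendsto (fun k => limitStructure S₀ T₀ (fderiv ℝ J q)
      ((dil (s (φ k))⁻¹).comp (B (φ k)) (f (φ k) x - f (φ k) p))) atTop
      (𝓝 (limitStructure S₀ T₀ (fderiv ℝ J q) (Φ x))) := by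
    have hc : Continuous (limitStructure S₀ T₀ (fderiv ℝ J q)) :=
      continuous_const.add ((sandwich S₀ T₀).continuous.comp
        ((fderiv ℝ J q).continuous.comp T₀.continuous))
    exact (hc.tendsto _).comp tΦ
  have t3 : Tendsto (fun k => rescaled (Jν (φ k)) (f (φ k) p) ((dil (s (φ k))⁻¹).comp (B (φ k)))
      ((A (φ k)).comp (dil (s (φ k))))
      ((dil (s (φ k))⁻¹).comp (B (φ k)) (f (φ k) x - f (φ k) p))) atTop
      (𝓝 (limitStructure S₀ T₀ (fderiv ℝ J q) (Φ x))) := by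
    refine tendsto_of_norm_sub_le t2 fun ε hε => ?_
    filter_upwards [hφ.tendsto_atTop.eventually (hclose ε hε), hφ.tendsto_atTop.eventually hTS,
      tΦ.norm.eventually_le_const (lt_add_one ‖Φ x‖)] with k hk hinv hle
    exact hk _ hle (by rw [hinv, add_sub_cancel]; exact h.mapsTo _ hx)
  refine tendsto_nhds_unique (tendsto_clm_comp t1 tendsto_const_nhds)
    ((tendsto_clm_comp t3 t1).congr' ?_)
  filter_upwards [hφ.tendsto_atTop.eventually hTS] with k hk
  exact (h.blowup_hol hk (f (φ k) p) hx).2.2.symm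

end UniformizingSequence

namespace UniformizingSequence

theorem mapsTo_blowup_limit (h : UniformizingSequence Ω G D J r f g Jν K c)
    (hq : q ∈ frontier G) (hp : p ∈ D) (F : ScalingFrame G J r Jν q (fun n => f n p) s A B A₀ B₀)
    (hinv : ∀ n v, (A n).comp (dil (s n)) ((dil (s n)⁻¹).comp (B n) v) = v) {Φ : E2 → E2}
    (hΦ : TendstoLocallyUniformlyOn (fun n x => (dil (s n)⁻¹).comp (B n) (f n x - f n p)) Φ atTop D)
    (hΦc : ContinuousOn Φ D) :
    MapsTo Φ D {x | limitDefining (A₀.comp (axisProj 1)) (fderiv ℝ (fderiv ℝ r) q) x < 0} := by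
  have hcont := continuous_limitDefining (A₀.comp (axisProj 1)) (fderiv ℝ (fderiv ℝ r) q)
  have happrox := F.abs_defining_sub_le
    (h.contDiffAt_defining (frontier_subset_closure hq))
  have h0 : limitDefining (A₀.comp (axisProj 1)) (fderiv ℝ (fderiv ℝ r) q) (Φ p) = -1 := by
    have : Φ p = 0 := tendsto_nhds_unique (hΦ.tendsto_at hp) (by simp)
    simp [this, limitDefining]
  obtain ⟨ρ, hρ⟩ : ∃ ρ, ρ = limitDefining (A₀.comp (axisProj 1)) (fderiv ℝ (fderiv ℝ r) q) :=
    ⟨_, rfl⟩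
  rw [← hρ] at hcont happrox h0 ⊢
  have hu : TendstoLocallyUniformlyOn (fun n x => (s n ^ 2)⁻¹ * r (f n x)) (fun x => ρ (Φ x))
      atTop D := by
    refine Metric.tendstoLocallyUniformlyOn_iff.2 fun ε hε x hx => ?_
    obtain ⟨δ, hδ, hδρ⟩ := Metric.continuousAt_iff.1 (hcont.continuousAt (x := Φ x)) (ε / 3)
      (by positivity)
    obtain ⟨t, ht, hsub, hball⟩ := eventually_mem_ball_of_tendstoLocallyUniformlyOn
      h.isOpen_source hΦ hΦc hx (lt_min hδ one_pos)
    refine ⟨ball x t, mem_nhdsWithin_of_mem_nhds (ball_mem_nhds _ ht), ?_⟩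
    filter_upwards [hball, happrox (‖Φ x‖ + 1) (show 0 < ε / 4 by positivity)] with n hn hn' z hz
    obtain ⟨h1, h2⟩ := hn z hz
    have h3 := hδρ ((mem_ball.1 h1).trans_le (min_le_left _ _))
    have h4 := hδρ ((mem_ball.1 h2).trans_le (min_le_left _ _))
    have h5 := hn' ((dil (s n)⁻¹).comp (B n) (f n z - f n p)) (by
      have := (mem_ball_iff_norm.1 h2).trans_le (min_le_right _ _)
      linarith [norm_sub_norm_le ((dil (s n)⁻¹).comp (B n) (f n z - f n p)) (Φ x)])
    rw [hinv, add_sub_cancel, div_eq_inv_mul] at h5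
    rw [Real.dist_eq, abs_lt] at *
    rw [abs_le] at h5
    constructor <;> linarith [h5.1, h5.2, h3.1, h3.2, h4.1, h4.2]
  have hρc : ContinuousOn (fun x => ρ (Φ x)) D := hcont.comp_continuousOn hΦc
  have hle : ∀ x ∈ D, ρ (Φ x) ≤ 0 := fun x hx =>
    le_of_tendsto (hu.tendsto_at hx) (Eventually.of_forall fun n =>
      mul_nonpos_of_nonneg_of_nonpos (by positivity) (h.neg_of_mem (h.mapsTo n hx)).le)
  intro x hx
  refine lt_of_le_of_ne (hle x hx) fun h1 => ?_
  have := eq_zero_of_limit_subsolution (J := fun _ _ => Jst E2) h.isOpen_source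
    h.isConnected_source.isPreconnected (fun x hx => ?_) hu hρc hle hx h1 p hp
  · rw [h0] at this
    norm_num at this
  · obtain ⟨t, ht, hsub⟩ := Metric.isOpen_iff.1 h.isOpen_source x hx
    refine ⟨t, ht, ‖Jst E2‖, Eventually.of_forall fun n y hy => ⟨le_rfl, by simp,
      contDiffAt_const.mul (h.contDiffAt_comp_defining n (hsub hy)), fun X => ?_⟩⟩
    rw [lev_Jst, lap2_const_mul _ (h.contDiffAt_comp_defining n (hsub hy)),
      h.lap2_defining_eq n (hsub hy)]
    exact mul_nonneg (by positivity) ((mul_nonneg h.pos.le (sq_nonneg _)).trans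
      (h.le_lev n _ (h.mapsTo n (hsub hy)) _))

theorem exists_inverse_blowup_limit (h : UniformizingSequence Ω G D J r f g Jν K c)
    (hq : q ∈ frontier G) (hp : p ∈ D) (F : ScalingFrame G J r Jν q (fun n => f n p) s A B A₀ B₀)
    (hinv : ∀ n, (∀ v, (A n).comp (dil (s n)) ((dil (s n)⁻¹).comp (B n) v) = v) ∧
      ∀ v, (dil (s n)⁻¹).comp (B n) ((A n).comp (dil (s n)) v) = v) {Φ : E2 → E2}
    (hΦ : TendstoLocallyUniformlyOn (fun n x => (dil (s n)⁻¹).comp (B n) (f n x - f n p)) Φ atTop D)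
    (hΦc : ContinuousOn Φ D) {U : Set E2} (hUc : IsPreconnected U)
    (hU : U = {x | limitDefining (A₀.comp (axisProj 1)) (fderiv ℝ (fderiv ℝ r) q) x < 0}) :
    MapsTo Φ D U ∧ ∃ Ψ : E2 → E2, MapsTo Ψ U D ∧ (∀ x ∈ D, Ψ (Φ x) = x) ∧
      (∀ y ∈ U, Φ (Ψ y) = y) ∧
      ∀ y ∈ U, ∃ t > 0, ∃ C, ∀ a ∈ ball y t, ∀ b ∈ ball y t, ‖Ψ a - Ψ b‖ ≤ C * ‖a - b‖ := by
  have hmaps := h.mapsTo_blowup_limit hq hp F (fun n => (hinv n).1) hΦ hΦc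
  rw [← hU] at hmaps
  refine ⟨hmaps, ?_⟩
  obtain ⟨η, hη1, hη2, hη3, hη4, hη5⟩ := h.exhaustion
  have hcont := continuous_limitDefining (A₀.comp (axisProj 1)) (fderiv ℝ (fderiv ℝ r) q)
  have happrox := F.abs_defining_sub_le
    (h.contDiffAt_defining (frontier_subset_closure hq))
  obtain ⟨ρ, hρ⟩ : ∃ ρ, ρ = limitDefining (A₀.comp (axisProj 1)) (fderiv ℝ (fderiv ℝ r) q) :=
    ⟨_, rfl⟩
  rw [← hρ] at hcont happrox hU
  have hbound := fun R => h.rescaled_bound hq F R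
  have hmem := fun R => h.eventually_mem_iff hq F R
  have hpos := F.pos
  generalize hS : (fun n => (dil (s n)⁻¹).comp (B n)) = S at *
  generalize hT : (fun n => (A n).comp (dil (s n))) = T at *
  simp only [funext_iff] at hS hT
  simp only [hS, hT] at *
  refine limit_inverse_of_holomorphic (Uν := fun n => {x | f n p + T n x ∈ G})
    (Φ := fun n x => S n (f n x - f n p)) (Ψ := fun n x => g n (f n p + T n x))
    (J := fun n => rescaled (Jν n) (f n p) (S n) (T n)) h.isOpen_source h.isBounded_source
    ⟨p, hp⟩ (hU ▸ isOpen_lt hcont continuous_const) hUc (fun n x hx => h.mapsTo_symm n hx)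
    (fun n x hx => ?_) (fun n x hx => ?_) (fun x hx => ?_) hΦ hmaps hΦc hη1 hη2 hη3 hη4 hη5
  · rw [(hinv n).1, add_sub_cancel]
    exact (h.diffeo n).2.2.2.2.1 x hx
  · rw [(h.diffeo n).2.2.2.2.2 _ hx, add_sub_cancel_left, (hinv n).2]
  · have hx0 : ρ x < 0 := by rw [hU] at hx; exact hx
    obtain ⟨t, ht, htρ⟩ := Metric.continuousAt_iff.1 (hcont.continuousAt (x := x)) (-ρ x / 2)
      (by linarith)
    obtain ⟨L, hL⟩ := hbound (‖x‖ + 1)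
    refine ⟨min t 1, by positivity, L, ?_⟩
    filter_upwards [hL, hmem (‖x‖ + 1), happrox (‖x‖ + 1) (show 0 < -ρ x / 4 by linarith)]
      with n hn hiff hle
    have hxG : ∀ z ∈ ball x (min t 1), ‖z‖ ≤ ‖x‖ + 1 ∧ f n p + T n z ∈ G := fun z hz => by
      have hz' := mem_ball.1 hz
      have hnorm : ‖z‖ ≤ ‖x‖ + 1 := by
        rw [dist_eq_norm] at hz'
        linarith [norm_sub_norm_le z x, min_le_right t 1]
      refine ⟨hnorm, (hiff z hnorm).2 ?_⟩
      have h1 := hle z hnorm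
      have h2 := htρ (hz'.trans_le (min_le_left _ _))
      rw [Real.dist_eq, abs_lt] at h2
      rw [abs_le] at h1
      by_contra hr
      linarith [div_nonneg (not_lt.1 hr) (sq_nonneg (s n))]
    refine ⟨fun z hz => (hxG z hz).2, fun z hz => ?_⟩
    obtain ⟨hz, hzG⟩ := hxG z hz
    obtain ⟨e1, e2, e3, e4, e5⟩ := hn z hz hzG
    have hg : ContDiffAt ℝ 3 (g n) (f n p + T n z) := by
      have := (h.diffeo n).2.1.contDiffAt (h.isOpen_target.mem_nhds hzG)
      exact contDiffAt_infty.1 this 3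
    refine ⟨e1, e2, e3, e4, e5, hg.comp z (contDiffAt_const.add (T n).contDiff.contDiffAt), ?_⟩
    rw [fderiv_comp_affine _ _ (hg.differentiableAt (by norm_num))]
    ext1 v
    simp only [comp_apply, rescaled, sandwich_apply, (hinv n).1]
    exact DFunLike.congr_fun (h.hol_symm n _ hzG) (T n v)

end UniformizingSequence

theorem differentiableAt_complex_of_comm_I {V W : Type*} [NormedAddCommGroup V] [NormedSpace ℂ V]
    [NormedAddCommGroup W] [NormedSpace ℂ W] {f : V → W} {x : V} (hf : DifferentiableAt ℝ f x)
    (hI : ∀ v, fderiv ℝ f x (I • v) = I • fderiv ℝ f x v) :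
    DifferentiableAt ℂ f x := by
  have hsmul : ∀ (z : ℂ) v, fderiv ℝ f x (z • v) = z • fderiv ℝ f x v := fun z v => by
    rw [← re_add_im z, mul_comm, add_smul, mul_smul, add_smul, mul_smul, map_add, hI,
      coe_smul, coe_smul, map_smul, map_smul, coe_smul, coe_smul,
      smul_comm]
  let L : V →L[ℂ] W := ⟨⟨⟨fderiv ℝ f x, map_add _⟩, hsmul⟩, (fderiv ℝ f x).continuous⟩
  exact (hasFDerivAt_of_restrictScalars ℝ hf.hasFDerivAt
    (show L.restrictScalars ℝ = fderiv ℝ f x from rfl)).differentiableAt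

/-- The Cayley transform between the Siegel domain and the ball. -/
theorem exists_cayley : ∃ C C' : E2 → E2,
    (∀ w : E2, -1 + (w 0).re + ‖w 1‖ ^ 2 < 0 →
      C w ∈ ball (0 : E2) 1 ∧ C' (C w) = w ∧ DifferentiableAt ℂ C w) ∧
    ∀ w ∈ ball (0 : E2) 1, -1 + (C' w 0).re + ‖C' w 1‖ ^ 2 < 0 ∧ C (C' w) = w ∧
      DifferentiableAt ℂ C' w := by
  have hproj : ∀ (k : Fin 2) (w : E2), DifferentiableAt ℂ (fun w : E2 => w k) w := fun k w =>
    (EuclideanSpace.proj k : E2 →L[ℂ] ℂ).differentiableAt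
  have hpair : ∀ a b : ℂ, (inc 0 a + inc 1 b : E2) 0 = a ∧ (inc 0 a + inc 1 b : E2) 1 = b :=
    fun a b => by simp
  have hdiff : ∀ (u v : E2 → ℂ) (w : E2), DifferentiableAt ℂ u w → DifferentiableAt ℂ v w →
      DifferentiableAt ℂ (fun w => inc 0 (u w) + inc 1 (v w)) w := fun u v w hu hv =>
    (hu.smul_const (EuclideanSpace.single 0 1)).add (hv.smul_const (EuclideanSpace.single 1 1))
  have hball : ∀ w : E2, w ∈ ball (0 : E2) 1 ↔ ‖w 0‖ ^ 2 + ‖w 1‖ ^ 2 < 1 := fun w => by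
    rw [mem_ball_zero_iff, ← norm_sq_eq_two, sq_lt_one_iff₀ (norm_nonneg _)]
  have hsub : ∀ z : ℂ, ∀ t : ℝ, ‖z - t‖ ^ 2 = ‖z‖ ^ 2 - 2 * t * z.re + t ^ 2 := fun z t => by
    rw [Complex.sq_norm, Complex.sq_norm, normSq_apply, normSq_apply]
    simp
    ring
  have h2 := fun z => hsub z 2
  have h1 := fun z => hsub z 1
  push_cast at h1 h2
  refine ⟨fun w => inc 0 (w 0 / (w 0 - 2)) + inc 1 (2 * w 1 / (w 0 - 2)),
    fun w => inc 0 (2 * w 0 / (w 0 - 1)) + inc 1 (w 1 / (w 0 - 1)), fun w hw => ?_, fun w hw => ?_⟩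
  · have hne : w 0 - 2 ≠ 0 := fun h0 => by
      have := congrArg Complex.re (sub_eq_zero.1 h0)
      simp at this
      nlinarith [sq_nonneg ‖w 1‖]
    have hpos : 0 < ‖w 0 - 2‖ ^ 2 := by positivity
    refine ⟨?_, ?_, hdiff _ _ _ (by fun_prop (disch := exact hne))
      (by fun_prop (disch := exact hne))⟩
    · rw [hball, (hpair _ _).1, (hpair _ _).2, norm_div, norm_div, norm_mul, div_pow, div_pow,
        ← add_div, div_lt_one hpos, h2, Complex.norm_two]
      linarith
    · beta_reduce
      rw [(hpair _ _).1, (hpair _ _).2]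
      have e : w 0 / (w 0 - 2) - 1 = 2 / (w 0 - 2) := by field_simp; ring
      rw [e]
      refine Eq.trans ?_ (inc_add_inc w)
      congr 2 <;> field_simp
  · have hw' := (hball w).1 hw
    have hne : w 0 - 1 ≠ 0 := fun h0 => by
      rw [sub_eq_zero.1 h0, norm_one] at hw'
      linarith [sq_nonneg ‖w 1‖]
    have hpos : 0 < ‖w 0 - 1‖ ^ 2 := by positivity
    refine ⟨?_, ?_, hdiff _ _ _ (by fun_prop (disch := exact hne))
      (by fun_prop (disch := exact hne))⟩
    · have e : (2 * w 0 / (w 0 - 1)).re = (2 * ‖w 0‖ ^ 2 - 2 * (w 0).re) / ‖w 0 - 1‖ ^ 2 := by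
        rw [Complex.div_re, Complex.sq_norm, Complex.sq_norm, normSq_apply (w 0)]
        simp
        ring
      rw [(hpair _ _).1, (hpair _ _).2, e, norm_div, div_pow, add_assoc, ← add_div, neg_add_lt_iff_lt_add,
        add_zero, div_lt_one hpos, h1]
      linarith
    · beta_reduce
      rw [(hpair _ _).1, (hpair _ _).2]
      have e : 2 * w 0 / (w 0 - 1) - 2 = 2 / (w 0 - 1) := by field_simp; ring
      rw [e]
      refine Eq.trans ?_ (inc_add_inc w)
      congr 2 <;> field_simp

theorem exists_quadratic_normalization {c : ℂ →L[ℝ] ℂ →L[ℝ] ℂ} {b : ℂ →L[ℝ] ℂ →L[ℝ] ℝ}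
    (hc : ∀ z u, c z (I * u) = -(I * c z u))
    (hb : b 1 I = b I 1)
    (hpos : 0 < b 1 1 + b I I - (c 1 I - c I 1).re) :
    ∃ a > 0, ∃ (Q : ℂ → ℂ) (Q' : ℂ → ℂ →L[ℝ] ℂ), (∀ z, HasFDerivAt Q (Q' z) z) ∧
      (∀ z u, Q' z (I * u) - I * Q' z u = c z u) ∧
      ∀ z, (Q z).re + (1 / 2) * b z z = a * ‖z‖ ^ 2 := by
  have hdec : ∀ z : ℂ, z = z.re • (1 : ℂ) + z.im • I := fun z => by
    rw [real_smul, real_smul, mul_one, re_add_im]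
  obtain ⟨α, hα⟩ : ∃ α, α = (c 1 1 - I * c I 1) / 2 := ⟨_, rfl⟩
  obtain ⟨β, hβ⟩ : ∃ β, β = (c 1 1 + I * c I 1) / 2 := ⟨_, rfl⟩
  have hc1 : ∀ z, c z 1 = z.re • c 1 1 + z.im • c I 1 := fun z => by
    conv_lhs => rw [hdec z]
    rw [map_add, map_smul, map_smul]
    rfl
  have hcI : ∀ z, c z I = -(I * c z 1) := fun z => by rw [← hc, mul_one]
  have hcz : ∀ z u, c z u = (u.re • (1 : ℂ) - u.im • I) * c z 1 := fun z u => by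
    conv_lhs => rw [hdec u]
    rw [map_add, map_smul, map_smul, hcI]
    simp only [real_smul]
    ring
  have hbz : ∀ z, b z z = z.re ^ 2 * b 1 1 + 2 * (z.re * z.im) * b 1 I +
      z.im ^ 2 * b I I := fun z => by
    conv_lhs => rw [hdec z]
    simp only [map_add, map_smul, add_apply, smul_apply,
      smul_eq_mul, ← hb]
    ring
  have hα' : α.im = ((c 1 1).im - (c I 1).re) / 2 := by
    rw [hα, ← Complex.ofReal_ofNat, Complex.div_ofReal_im]; simp
  obtain ⟨γ, hγ⟩ : ∃ γ : ℂ, γ = ⟨(b I I - b 1 1 + β.im) / 4,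
    (2 * b 1 I + β.re) / 4⟩ := ⟨_, rfl⟩
  have hconj : ∀ z, HasFDerivAt (starRingEnd ℂ : ℂ → ℂ) (conjCLE : ℂ →L[ℝ] ℂ) z :=
    fun z => Complex.conjCLE.hasFDerivAt
  refine ⟨(b 1 1 + b I I) / 4 - α.im / 2, ?_,
    fun z => I / 2 * (α * (z * (starRingEnd ℂ) z) +
      β / 2 * ((starRingEnd ℂ) z * (starRingEnd ℂ) z)) + γ * (z * z), _, fun z =>
      (((((hasFDerivAt_id z).mul (hconj z)).const_mul α).add
        (((hconj z).mul (hconj z)).const_mul (β / 2))).const_mul (I / 2)).add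
        (((hasFDerivAt_id z).mul (hasFDerivAt_id z)).const_mul γ), fun z u => ?_, fun z => ?_⟩
  · rw [hcI] at hpos
    simp at hpos
    rw [hα']
    linarith
  · rw [hcz, hc1]
    have e1 : c 1 1 = α + β := by rw [hα, hβ]; ring
    have e2 : c I 1 = I * (α - β) := by
      rw [hα, hβ]; linear_combination (c I 1) * Complex.I_sq
    rw [e1, e2]
    simp only [real_smul]
    have hu : (u.re : ℂ) * 1 - u.im * I = (starRingEnd ℂ) u := by
      apply Complex.ext <;> simp
    have hz : (z.re : ℂ) * (α + β) + z.im * (I * (α - β)) =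
        α * z + β * (starRingEnd ℂ) z := by
      apply Complex.ext <;> simp <;> ring
    rw [hu, hz]
    simp only [add_apply, smul_apply, smul_eq_mul, ContinuousLinearMap.coe_id', id,
      ContinuousLinearEquiv.coe_coe, Complex.conjCLE_apply, map_mul, Complex.conj_I]
    linear_combination (-(α * z + β * (starRingEnd ℂ) z) * (starRingEnd ℂ) u) * Complex.I_sq
  · rw [hbz, hγ, Complex.sq_norm, normSq_apply]
    simp
    ring

theorem exists_ball_chart {c : ℂ →L[ℝ] ℂ →L[ℝ] ℂ} {b : ℂ →L[ℝ] ℂ →L[ℝ] ℝ}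
    (hc : ∀ z u, c z (I * u) = -(I * c z u))
    (hb : b 1 I = b I 1)
    (hpos : 0 < b 1 1 + b I I - (c 1 I - c I 1).re)
    {U : Set E2} (hU : ∀ x, x ∈ U ↔ -1 + (x 0).re + (1 / 2) * b (x 1) (x 1) < 0)
    {j : E2 → E2 →L[ℝ] E2} (hj : ∀ x u, j x u = Jst E2 u + inc 0 (c (x 1) (u 1))) :
    ∃ Λ Λ' : E2 → E2, (∀ x ∈ U, Λ x ∈ ball (0 : E2) 1 ∧ Λ' (Λ x) = x ∧ DifferentiableAt ℝ Λ x ∧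
        (fderiv ℝ Λ x).comp (j x) = (Jst E2).comp (fderiv ℝ Λ x)) ∧
      ∀ y ∈ ball (0 : E2) 1, Λ' y ∈ U ∧ Λ (Λ' y) = y ∧ DifferentiableAt ℝ Λ' y := by
  obtain ⟨a, ha, Q, Q', hQ, hQc, hQb⟩ := exists_quadratic_normalization hc hb hpos
  obtain ⟨C, C', hC, hC'⟩ := exists_cayley
  obtain ⟨m, hm, hma⟩ : ∃ m : ℝ, m ≠ 0 ∧ a = m ^ 2 :=
    ⟨√a, (Real.sqrt_pos.2 ha).ne', (Real.sq_sqrt ha.le).symm⟩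
  have hm' : (m : ℂ) ≠ 0 := Complex.ofReal_ne_zero.2 hm
  have hpair : ∀ a b : ℂ, (inc 0 a + inc 1 b : E2) 0 = a ∧ (inc 0 a + inc 1 b : E2) 1 = b :=
    fun a b => by simp
  obtain ⟨Ξ, hΞ⟩ : ∃ Ξ : E2 → E2, Ξ = fun x => inc 0 (x 0 - Q (x 1)) + inc 1 (m * x 1) := ⟨_, rfl⟩
  obtain ⟨Ξ', hΞ'⟩ : ∃ Ξ' : E2 → E2,
      Ξ' = fun w => inc 0 (w 0 + Q (w 1 / m)) + inc 1 (w 1 / m) := ⟨_, rfl⟩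
  have hd : ∀ x, HasFDerivAt Ξ ((inc 0).comp (crd 0 - (Q' (x 1)).comp (crd 1)) +
      (inc 1).comp ((m : ℂ) • crd 1)) x := fun x => by
    rw [hΞ]
    exact ((inc 0).hasFDerivAt.comp x ((crd 0).hasFDerivAt.sub
      ((hQ (x 1)).comp x (crd 1).hasFDerivAt))).add
      ((inc 1).hasFDerivAt.comp x ((crd 1).hasFDerivAt.const_mul (m : ℂ)))
  have hd' : ∀ w, DifferentiableAt ℝ Ξ' w := fun w => by
    rw [hΞ']
    have h1 : DifferentiableAt ℝ (fun w : E2 => w 1 / (m : ℂ)) w :=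
      ((crd 1).differentiableAt (x := w)).mul_const ((m : ℂ)⁻¹)
    exact ((inc 0).differentiableAt.comp w ((crd 0).differentiableAt.add
      ((hQ _).differentiableAt.comp w h1))).add ((inc 1).differentiableAt.comp w h1)
  have hleft : ∀ x, Ξ' (Ξ x) = x := fun x => by
    rw [hΞ', hΞ]
    beta_reduce
    rw [(hpair _ _).1, (hpair _ _).2, mul_div_cancel_left₀ _ hm', sub_add_cancel, inc_add_inc]
  have hright : ∀ w, Ξ (Ξ' w) = w := fun w => by
    rw [hΞ', hΞ]
    beta_reduce
    rw [(hpair _ _).1, (hpair _ _).2, mul_div_cancel₀ _ hm', add_sub_cancel_right, inc_add_inc]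
  have hmem : ∀ x, x ∈ U ↔ -1 + (Ξ x 0).re + ‖Ξ x 1‖ ^ 2 < 0 := fun x => by
    rw [hU, hΞ, (hpair _ _).1, (hpair _ _).2, norm_mul, norm_real, mul_pow,
      Real.norm_eq_abs, sq_abs, ← hma, ← hQb, Complex.sub_re]
    ring_nf
  refine ⟨fun x => C (Ξ x), fun y => Ξ' (C' y), fun x hx => ?_, fun y hy => ?_⟩
  · obtain ⟨h1, h2, h3⟩ := hC _ ((hmem x).1 hx)
    have h4 := h3.hasFDerivAt.restrictScalars ℝ
    have h5 := h4.comp x (hd x)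
    refine ⟨h1, by beta_reduce; rw [h2, hleft], h5.differentiableAt, ?_⟩
    rw [show fderiv ℝ (fun x => C (Ξ x)) x = _ from h5.fderiv]
    ext1 u
    simp only [comp_apply, hj]
    have e : ∀ v, fderiv ℂ C (Ξ x) (Jst E2 v) = Jst E2 (fderiv ℂ C (Ξ x) v) := fun v => by
      simp [Jst]
    rw [ContinuousLinearMap.coe_restrictScalars', ← e]
    congr 1
    simp only [add_apply, comp_apply, sub_apply, smul_apply, crd_apply]
    rw [← hQc]
    ext k
    fin_cases k <;> simp [Jst] <;> ring
  · obtain ⟨h1, h2, h3⟩ := hC' y hy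
    exact ⟨by rwa [hmem, hright], by beta_reduce; rw [hright, h2], (hd' _).comp y (h3.restrictScalars ℝ)⟩

theorem exists_biholomorphic_ball {D U : Set E2} (hD : IsOpen D) (hU : IsOpen U)
    {j : E2 → E2 →L[ℝ] E2} {Φ Ψ Λ Λ' : E2 → E2}
    (hΛ : ∀ x ∈ U, Λ x ∈ ball (0 : E2) 1 ∧ Λ' (Λ x) = x ∧ DifferentiableAt ℝ Λ x ∧
      (fderiv ℝ Λ x).comp (j x) = (Jst E2).comp (fderiv ℝ Λ x))
    (hΛ' : ∀ y ∈ ball (0 : E2) 1, Λ' y ∈ U ∧ Λ (Λ' y) = y ∧ DifferentiableAt ℝ Λ' y)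
    (hΦ : ∀ x ∈ D, DifferentiableAt ℝ Φ x ∧
      (fderiv ℝ Φ x).comp (Jst E2) = (j (Φ x)).comp (fderiv ℝ Φ x))
    (hΦU : MapsTo Φ D U) (hΨD : MapsTo Ψ U D) (hleft : ∀ x ∈ D, Ψ (Φ x) = x)
    (hright : ∀ y ∈ U, Φ (Ψ y) = y)
    (hlip : ∀ y ∈ U, ∃ t > 0, ∃ C, ∀ a ∈ ball y t, ∀ b ∈ ball y t, ‖Ψ a - Ψ b‖ ≤ C * ‖a - b‖) :
    ∃ P P' : E2 → E2, DifferentiableOn ℂ P D ∧ DifferentiableOn ℂ P' (ball 0 1) ∧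
      MapsTo P D (ball 0 1) ∧ MapsTo P' (ball 0 1) D ∧ (∀ x ∈ D, P' (P x) = x) ∧
      ∀ y ∈ ball 0 1, P (P' y) = y := by
  have hJst : ∀ v : E2, Jst E2 v = I • v := fun v => by simp [Jst]
  have hΨd : ∀ y ∈ U, DifferentiableAt ℝ Ψ y := fun y hy => by
    obtain ⟨t, ht, C, hC⟩ := hlip y hy
    obtain ⟨L, hL⟩ := exists_equiv_of_lipschitz_left_inverse (hΦ _ (hΨD hy)).1.hasFDerivAt ht
      (by filter_upwards [hD.mem_nhds (hΨD hy)] with x hx using hleft x hx)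
      (by rwa [hright y hy])
    have hc : ContinuousAt Ψ y := by
      refine tendsto_iff_norm_sub_tendsto_zero.2 (squeeze_zero' (Eventually.of_forall fun _ =>
        norm_nonneg _) (g := fun a => C * ‖a - y‖) ?_ ?_)
      · filter_upwards [ball_mem_nhds y ht] with a ha using hC a ha y (mem_ball_self ht)
      · have : Continuous fun a : E2 => C * ‖a - y‖ := by fun_prop
        simpa using this.tendsto y
    exact (hL.of_local_left_inverse hc (by
      filter_upwards [hU.mem_nhds hy] with a ha using hright a ha)).differentiableAt
  have hP : ∀ x ∈ D, DifferentiableAt ℝ (fun x => Λ (Φ x)) x ∧ ∀ v,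
      fderiv ℝ (fun x => Λ (Φ x)) x (I • v) =
        I • fderiv ℝ (fun x => Λ (Φ x)) x v := fun x hx => by
    obtain ⟨-, -, h1, h2⟩ := hΛ _ (hΦU hx)
    obtain ⟨h3, h4⟩ := hΦ x hx
    refine ⟨h1.comp x h3, fun v => ?_⟩
    rw [fderiv_fun_comp x h1 h3, ← hJst, ← hJst]
    have e1 := DFunLike.congr_fun h4 v
    have e2 := DFunLike.congr_fun h2 (fderiv ℝ Φ x v)
    simp only [comp_apply] at e1 e2 ⊢
    rw [e1, e2]
  have hPl : ∀ x ∈ D, Ψ (Λ' (Λ (Φ x))) = x := fun x hx => by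
    rw [(hΛ _ (hΦU hx)).2.1, hleft x hx]
  have hPr : ∀ y ∈ ball (0 : E2) 1, Λ (Φ (Ψ (Λ' y))) = y := fun y hy => by
    rw [hright _ (hΛ' y hy).1, (hΛ' y hy).2.1]
  refine ⟨fun x => Λ (Φ x), fun y => Ψ (Λ' y), fun x hx =>
    (differentiableAt_complex_of_comm_I (hP x hx).1 (hP x hx).2).differentiableWithinAt,
    fun y hy => (differentiableAt_complex_of_comm_I ((hΨd _ (hΛ' y hy).1).comp y (hΛ' y hy).2.2)
      fun v => ?_).differentiableWithinAt, fun x hx => (hΛ _ (hΦU hx)).1,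
    fun y hy => hΨD (hΛ' y hy).1, hPl, hPr⟩
  have hx := hΨD (hΛ' y hy).1
  obtain ⟨hd, hI⟩ := hP _ hx
  have hd' : DifferentiableAt ℝ (fun y => Ψ (Λ' y)) y :=
    (hΨd _ (hΛ' y hy).1).comp y (hΛ' y hy).2.2
  have e1 : ∀ v, fderiv ℝ (fun x => Λ (Φ x)) (Ψ (Λ' y)) (fderiv ℝ (fun y => Ψ (Λ' y)) y v) = v :=
    fun v => by
      have h1 := (hd.hasFDerivAt.comp y hd'.hasFDerivAt).congr_of_eventuallyEq (f₁ := id) (by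
        filter_upwards [isOpen_ball.mem_nhds hy] with z hz using (hPr z hz).symm)
      exact (DFunLike.congr_fun (h1.unique (hasFDerivAt_id y)) v :)
  have e2 : ∀ v, fderiv ℝ (fun y => Ψ (Λ' y)) y (fderiv ℝ (fun x => Λ (Φ x)) (Ψ (Λ' y)) v) = v :=
    fun v => by
      have hd'' := hd'.hasFDerivAt
      nth_rw 2 [← hPr y hy] at hd''
      have h1 := (hd''.comp (Ψ (Λ' y)) hd.hasFDerivAt).congr_of_eventuallyEq (f₁ := id) (by
        filter_upwards [hD.mem_nhds hx] with z hz using (hPl z hz).symm)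
      exact (DFunLike.congr_fun (h1.unique (hasFDerivAt_id _)) v :)
  change fderiv ℝ (fun y => Ψ (Λ' y)) y _ = I • fderiv ℝ (fun y => Ψ (Λ' y)) y v
  conv_lhs => rw [← e1 v, ← hI, e2]

namespace ScalingFrame

theorem le_lev_limit (F : ScalingFrame G J r Jν q y s A B A₀ B₀)
    (h : UniformizingSequence Ω G D J r f g Jν K c) (hq : q ∈ frontier G) (X : E2) :
    c * ‖X‖ ^ 2 ≤ lev J r q X := by
  have hr := h.contDiffAt_defining (frontier_subset_closure hq)
  have hr1 : ContDiffAt ℝ 1 (fderiv ℝ r) q := hr.fderiv_right (by norm_num)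
  have h1 : Tendsto (fun n => fderiv ℝ r (y n)) atTop (𝓝 (fderiv ℝ r q)) :=
    hr1.continuousAt.tendsto.comp F.tendsto_point
  have h2 : Tendsto (fun n => fderiv ℝ (fderiv ℝ r) (y n)) atTop (𝓝 (fderiv ℝ (fderiv ℝ r) q)) :=
    (hr1.fderiv_right (m := 0) (by norm_num)).continuousAt.tendsto.comp F.tendsto_point
  have hX : Tendsto (fun _ : ℕ => X) atTop (𝓝 X) := tendsto_const_nhds
  have hJ := F.tendsto_structure.clm_apply' hX
  have hD := F.tendsto_fderiv
  refine ge_of_tendsto' (x := atTop) (f := fun n => lev (Jν n) r (y n) X) ?_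
    fun n => h.le_lev n _ (F.mem n) X
  exact (((h2.clm_apply' hX).clm_apply' hX).add ((h2.clm_apply' hJ).clm_apply' hJ)).sub
    (h1.clm_apply' (((hD.clm_apply' hX).clm_apply' hJ).sub ((hD.clm_apply' hJ).clm_apply' hX)))

theorem fderiv_structure_anticomm (F : ScalingFrame G J r Jν q y s A B A₀ B₀)
    (h : UniformizingSequence Ω G D J r f g Jν K c) (u v : E2) :
    fderiv ℝ J q u (J q v) = -J q (fderiv ℝ J q u v) := by
  have hu : Tendsto (fun _ : ℕ => u) atTop (𝓝 u) := tendsto_const_nhds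
  have hv : Tendsto (fun _ : ℕ => v) atTop (𝓝 v) := tendsto_const_nhds
  have hD := F.tendsto_fderiv.clm_apply' hu
  have hJ := F.tendsto_structure
  have h1 := (hD.clm_apply' (hJ.clm_apply' hv)).add (hJ.clm_apply' (hD.clm_apply' hv))
  rw [← add_eq_zero_iff_eq_neg]
  refine tendsto_nhds_unique (h1.congr fun n => ?_) (tendsto_const_nhds (f := (atTop : Filter ℕ)))
  have hd := ((h.contDiffAt_structure n (F.mem n)).differentiableAt (by simp)).hasFDerivAt
  have hdv := hd.clm_apply (hd.clm_apply (hasFDerivAt_const v (y n)))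
  have hc : (fun z => Jν n z (Jν n z v)) =ᶠ[𝓝 (y n)] fun _ => -v := by
    filter_upwards [h.isOpen_target.mem_nhds (F.mem n)] with z hz using h.sq_structure n z hz v
  have := DFunLike.congr_fun
    (hdv.unique ((hasFDerivAt_const (-v) (y n)).congr_of_eventuallyEq hc)) u
  simpa [add_comm] using this

theorem exists_limit_chart (F : ScalingFrame G J r Jν q y s A B A₀ B₀)
    (h : UniformizingSequence Ω G D J r f g Jν K c) (hq : q ∈ frontier G) {U : Set E2}
    (hU : U = {x | limitDefining (A₀.comp (axisProj 1)) (fderiv ℝ (fderiv ℝ r) q) x < 0})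
    {j : E2 → E2 →L[ℝ] E2}
    (hj : j = limitStructure ((axisProj 0).comp B₀) (A₀.comp (axisProj 1)) (fderiv ℝ J q)) :
    ∃ Λ Λ' : E2 → E2, (∀ x ∈ U, Λ x ∈ ball (0 : E2) 1 ∧ Λ' (Λ x) = x ∧ DifferentiableAt ℝ Λ x ∧
        (fderiv ℝ Λ x).comp (j x) = (Jst E2).comp (fderiv ℝ Λ x)) ∧
      ∀ y ∈ ball (0 : E2) 1, Λ' y ∈ U ∧ Λ (Λ' y) = y ∧ DifferentiableAt ℝ Λ' y := by
  obtain ⟨T, hT⟩ : ∃ T, T = A₀.comp (inc 1) := ⟨_, rfl⟩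
  have hTapp : ∀ z, T z = A₀ (inc 1 z) := fun z => by rw [hT]; rfl
  have hTI : ∀ z, T (I * z) = J q (T z) := fun z => by
    have h1 : J q (T z) = A₀ (Jst E2 (inc 1 z)) := by
      rw [← F.inverse_limit.2 (inc 1 z), ← hTapp, ← F.limit_structure_eq, F.inverse_limit.1]
    rw [h1, hTapp]
    congr 1
    ext k
    by_cases hk : k = 1 <;> simp [Jst, hk]
  have hBJ : ∀ w, B₀ (J q w) 0 = I * B₀ w 0 := fun w => by
    rw [F.limit_structure_eq]; simp [Jst]
  have hlev := F.le_lev_limit h hq (T 1)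
  have hT1 : T 1 ≠ 0 := fun h0 => by
    have := F.inverse_limit.2 (inc 1 1)
    rw [← hTapp, h0, map_zero] at this
    simpa using congrArg (fun x : E2 => x 1) this
  have hpos : 0 < lev J r q (T 1) := lt_of_lt_of_le (by have := h.pos; positivity) hlev
  have hr := h.contDiffAt_defining (frontier_subset_closure hq)
  refine exists_ball_chart
    (c := (compL ℝ ℂ E2 ℂ ((crd 0).comp B₀)).comp
      (((compL ℝ ℂ E2 E2).flip T).comp ((fderiv ℝ J q).comp T)))
    (b := ((compL ℝ ℂ E2 ℝ).flip T).comp ((fderiv ℝ (fderiv ℝ r) q).comp T))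
    (fun z u => ?_) ?_ ?_ (fun x => ?_) (fun x u => ?_)
  · change B₀ (fderiv ℝ J q (T z) (T (I * u))) 0 =
      -(I * B₀ (fderiv ℝ J q (T z) (T u)) 0)
    rw [hTI, F.fderiv_structure_anticomm h, map_neg, ← hBJ]
    rfl
  · exact hr.isSymmSndFDerivAt (by simp) _ _
  · change 0 < fderiv ℝ (fderiv ℝ r) q (T 1) (T 1) +
      fderiv ℝ (fderiv ℝ r) q (T I) (T I) -
      (B₀ (fderiv ℝ J q (T 1) (T I)) 0 - B₀ (fderiv ℝ J q (T I) (T 1)) 0).re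
    have hTi : T I = J q (T 1) := by rw [← hTI, mul_one]
    rw [Complex.sub_re, F.limit_re_eq, F.limit_re_eq, ← map_sub, hTi]
    exact hpos
  · rw [hU, hT]; rfl
  · rw [hj, hT]; rfl

end ScalingFrame

theorem UniformizingSequence.not_tendsto_const
    (h : UniformizingSequence Ω G D J r f g Jν K c) (hq : q ∈ frontier G)
    (hnoball : ¬ ∃ P P' : E2 → E2, DifferentiableOn ℂ P D ∧ DifferentiableOn ℂ P' (ball 0 1) ∧
      MapsTo P D (ball 0 1) ∧ MapsTo P' (ball 0 1) D ∧ (∀ x ∈ D, P' (P x) = x) ∧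
      ∀ y ∈ ball 0 1, P (P' y) = y) :
    ¬ TendstoLocallyUniformlyOn f (fun _ => q) atTop D := fun hF => by
  obtain ⟨p, hp⟩ := h.isConnected_source.nonempty
  obtain ⟨s, A, B, A₀, B₀, S⟩ := h.exists_scalingFrame hq (fun n => h.mapsTo n hp)
    (hF.tendsto_at hp)
  obtain ⟨φ, hφ, Φ, hΦ, hΦ'⟩ := h.exists_blowup_limit hF hq hp S
  obtain ⟨N, hN⟩ := eventually_atTop.1 S.inverse
  have hθ : Tendsto (fun k => φ (k + N)) atTop atTop :=
    hφ.tendsto_atTop.comp (tendsto_add_atTop_nat N)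
  obtain ⟨Λ, Λ', hΛ, hΛ'⟩ := S.exists_limit_chart h hq rfl rfl
  have hUo := isOpen_lt (continuous_limitDefining (A₀.comp (axisProj 1))
    (fderiv ℝ (fderiv ℝ r) q)) (continuous_const (y := (0 : ℝ)))
  have hUc : IsPreconnected
      {x | limitDefining (A₀.comp (axisProj 1)) (fderiv ℝ (fderiv ℝ r) q) x < 0} := by
    have := (convex_ball (0 : E2) 1).isPreconnected.image Λ'
      fun y hy => (hΛ' y hy).2.2.continuousAt.continuousWithinAt
    convert this using 1
    refine Subset.antisymm (fun x hx => ⟨Λ x, (hΛ x hx).1, (hΛ x hx).2.1⟩) ?_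
    rintro _ ⟨y, hy, rfl⟩
    exact (hΛ' y hy).1
  obtain ⟨hmaps, Ψ, h1, h2, h3, h4⟩ := (h.comp_strictMono hθ).exists_inverse_blowup_limit hq hp
    (S.comp hθ) (fun n => by
      have hn := hN (φ (n + N)) ((Nat.le_add_left N n).trans (hφ.id_le _))
      have hs := (S.pos (φ (n + N))).ne'
      constructor <;> intro v <;> simp only [comp_apply]
      · rw [dil_dil_inv hs, hn.1]
      · rw [hn.2, dil_inv_dil hs])
    (fun u hu x hx => by
      obtain ⟨t, ht, H⟩ := hΦ u hu x hx
      exact ⟨t, ht, (tendsto_add_atTop_nat N).eventually H⟩)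
    (fun x hx => (hΦ' x hx).1.continuousAt.continuousWithinAt) hUc rfl
  exact hnoball (exists_biholomorphic_ball h.isOpen_source hUo hΛ hΛ' hΦ' hmaps h1 h2 h3 h4)

end

/-- **Compactness corollary.** If `D ⊆ ℂ²` is a bounded domain not biholomorphic to the
unit ball, `G = {r < 0}` is a relatively compact strictly `J`-pseudoconvex domain, and
`f^ν : D → G` are diffeomorphisms (defined on a neighborhood of `D̄`) whose pushforward
structures `J_ν` converge to `J` in `C²(Ḡ)`, then `(f^ν)` is relatively compact:
every subsequence has a further subsequence converging uniformly on compact subsets of `D`,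
and every such limit is a `(J_st, J)`-holomorphic diffeomorphism from `D` onto `G`. -/
theorem statement1
    (Ω : Set E2) (hΩ : IsOpen Ω) (J : E2 → E2 →L[ℝ] E2) (hJ : IsACS Ω J)
    (r : E2 → ℝ) (hr : ContDiffOn ℝ 2 r Ω) (hrpsh : StrictPSHOn J r Ω)
    (G : Set E2) (hGdef : G = {x ∈ Ω | r x < 0})
    (hGcomp : IsCompact (closure G)) (hGΩ : closure G ⊆ Ω)
    (hdr : ∀ x ∈ frontier G, fderiv ℝ r x ≠ 0)
    (D : Set E2) (hDopen : IsOpen D) (hDconn : IsConnected D)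
    (hDbdd : Bornology.IsBounded D)
    (hnoball : ¬ ∃ Φ Ψ : E2 → E2, DifferentiableOn ℂ Φ D ∧
      DifferentiableOn ℂ Ψ (ball 0 1) ∧
      MapsTo Φ D (ball (0 : E2) 1) ∧ MapsTo Ψ (ball (0 : E2) 1) D ∧
      (∀ x ∈ D, Ψ (Φ x) = x) ∧ (∀ y ∈ ball (0 : E2) 1, Φ (Ψ y) = y))
    (f g : ℕ → E2 → E2)
    (hdiffeo : ∀ ν, IsDiffeoOn (f ν) (g ν) D G)
    (hnbhd : ∀ ν, ∃ D' G' : Set E2, IsOpen D' ∧ closure D ⊆ D' ∧ IsOpen G' ∧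
      IsDiffeoOn (f ν) (g ν) D' G')
    (Jν : ℕ → E2 → E2 →L[ℝ] E2)
    (hJν : ∀ ν y, Jν ν y = (fderiv ℝ (f ν) (g ν y)).comp
      ((Jst E2).comp (fderiv ℝ (g ν) y)))
    (hJνconv : Tendsto (fun ν => c2Dist (Jν ν) J (closure G)) atTop (𝓝 0)) :
    (∀ φ : ℕ → ℕ, StrictMono φ → ∃ ψ : ℕ → ℕ, StrictMono ψ ∧ ∃ F : E2 → E2,
      TendstoLocallyUniformlyOn (fun k => f (φ (ψ k))) F atTop D) ∧
    (∀ (φ : ℕ → ℕ) (F : E2 → E2), StrictMono φ →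
      TendstoLocallyUniformlyOn (fun k => f (φ k)) F atTop D →
      IsHolomorphicMapOn (fun _ => Jst E2) J F D ∧
      ∃ F' : E2 → E2, IsDiffeoOn F F' D G) := by
  obtain ⟨N, K, c, h⟩ := exists_uniformizingSequence hΩ hJ hr hrpsh hGdef hGcomp hGΩ hdr hDopen
    hDconn hDbdd hdiffeo hnbhd hJν hJνconv
  have hθ : ∀ φ : ℕ → ℕ, StrictMono φ → Tendsto (fun k => φ (k + N) - N) atTop atTop ∧
      (fun k x => f (φ (k + N) - N + N) x) = fun k => f (φ (k + N)) := fun φ hφ => by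
    have hle : ∀ k, k ≤ φ (k + N) - N := fun k => Nat.le_sub_of_add_le (hφ.id_le (k + N))
    refine ⟨tendsto_atTop_mono hle tendsto_id, funext fun k => ?_⟩
    rw [Nat.sub_add_cancel ((Nat.le_add_left N k).trans (hφ.id_le (k + N)))]
  refine ⟨fun φ hφ => ?_, fun φ F hφ hF => ?_⟩
  · obtain ⟨hθ1, hθ2⟩ := hθ φ hφ
    obtain ⟨ψ, hψ, F, hF⟩ := (h.comp_strictMono hθ1).exists_subseq
    refine ⟨fun k => ψ k + N, fun a b hab => Nat.add_lt_add_right (hψ hab) N, F, ?_⟩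
    have h2 : (fun k => f (φ (ψ k + N) - N + N)) = fun k => f (φ (ψ k + N)) :=
      funext fun k => congrFun hθ2 (ψ k)
    rwa [h2] at hF
  · obtain ⟨hθ1, hθ2⟩ := hθ φ hφ
    have h' := h.comp_strictMono hθ1
    have hF' : TendstoLocallyUniformlyOn (fun k x => f (φ (k + N) - N + N) x) F atTop D := by
      rw [hθ2]
      intro u hu x hx
      obtain ⟨t, ht, H⟩ := hF u hu x hx
      exact ⟨t, ht, (tendsto_add_atTop_nat N).eventually H⟩
    refine ⟨(h'.hol_of_tendsto hF').2.1, ?_⟩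
    rcases h'.mapsTo_or_const hF' with hFG | ⟨q, hq, hconst⟩
    · exact h'.exists_isDiffeoOn hF' hFG
    · exact absurd (hF'.congr_right hconst) (h'.not_tendsto_const hq hnoball)


end
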